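/- Let R_k → ∞ and let u_k be classical solutions of the one-phase free boundary problem in B_{R_k} ⊆ ℝ² with 0 ∈ F(u_k) and no connected component of F(u_k) compact, and suppose u_k → U uniformly on compact subsets of ℝ². Let R_j → ∞ and suppose V(x) = lim_j R_j^{-1} U(R_j x) uniformly on compact sets. Then, after rigid motion, one of the following holds: (a) V = P and U = P; (b) V = W_s for some 0 < s ≤ 1 and U is a two-plane solution TP_a for some a > 0 or the wedge W₁; (c) V = W_s for some 0 < s ≤ 1 and U is a double hairpin solution H_a for some a > 0. -/

import Mathlib

open Complex Metric Set Filter MeasureTheory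
open scoped Topology Classical NNReal

noncomputable section

/-- The positive phase of `u` in `Ω`. -/
def posSet (Ω : Set ℂ) (u : ℂ → ℝ) : Set ℂ := {z ∈ Ω | 0 < u z}

/-- The free boundary of `u` in `Ω`. -/
def FB (Ω : Set ℂ) (u : ℂ → ℝ) : Set ℂ := Ω ∩ frontier (posSet Ω u)

/-- The gradient of `u : ℂ → ℝ`, viewed as a complex number `∂ₓu + i ∂ᵧu`. -/
def grad2 (u : ℂ → ℝ) (z : ℂ) : ℂ :=
  ((fderiv ℝ u z 1 : ℝ) : ℂ) + ((fderiv ℝ u z Complex.I : ℝ) : ℂ) * Complex.I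

/-- Second derivative (Hessian) of `u : ℂ → ℝ` at `z` in directions `v, w`. -/
def hess (u : ℂ → ℝ) (z v w : ℂ) : ℝ := fderiv ℝ (fun x => fderiv ℝ u x v) z w

/-- `u` is harmonic on `s`: twice continuously differentiable with vanishing Laplacian. -/
def HarmonicOn2 (u : ℂ → ℝ) (s : Set ℂ) : Prop :=
  ContDiffOn ℝ 2 u s ∧ ∀ z ∈ s, hess u z 1 1 + hess u z Complex.I Complex.I = 0

/-- A classical solution of the one-phase free boundary problem `Δu = 0` in `{u>0}`,
`|∇u| = 1` on the free boundary, in the open set `Ω ⊆ ℝ² ≅ ℂ`. -/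
structure IsClassicalSolution (Ω : Set ℂ) (u : ℂ → ℝ) : Prop where
  contOn : ContinuousOn u Ω
  nonneg : ∀ z ∈ Ω, 0 ≤ u z
  harm : HarmonicOn2 u (posSet Ω u)
  smooth_ext : ∃ v : ℂ → ℝ, ContDiffOn ℝ (⊤ : ℕ∞) v (Ω ∩ closure (posSet Ω u)) ∧
    Set.EqOn u v (Ω ∩ closure (posSet Ω u))
  fb_manifold : ∀ z ∈ FB Ω u, ∃ V : Set ℂ, IsOpen V ∧ z ∈ V ∧ V ⊆ Ω ∧
    ∃ φ : ℂ → ℝ, ContDiffOn ℝ (⊤ : ℕ∞) φ V ∧ (∀ w ∈ V, fderiv ℝ φ w ≠ 0) ∧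
      V ∩ posSet Ω u = {w ∈ V | 0 < φ w} ∧
      V ∩ {w | u w = 0} = {w ∈ V | φ w ≤ 0} ∧
      V ∩ FB Ω u = {w ∈ V | φ w = 0}
  grad_one : ∀ z ∈ FB Ω u,
    Filter.Tendsto (fun w => ‖grad2 u w‖) (nhdsWithin z (posSet Ω u)) (nhds 1)

/-- One-plane solution `P(z) = max (Re z) 0`. -/
def Pfun (z : ℂ) : ℝ := max z.re 0

/-- Wedge solution `W_s(z) = s |Re z|`. -/
def Wfun (s : ℝ) (z : ℂ) : ℝ := s * |z.re|

/-- Two-plane solution `TP_a`. -/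
def TPfun (a : ℝ) (z : ℂ) : ℝ := max z.re 0 + max (-z.re - a) 0

/-- Rotation of the plane by angle `θ`. -/
def rot (θ : ℝ) (z : ℂ) : ℂ := Complex.exp (θ * Complex.I) * z

/-- The strip `S = {|Im ζ| < π/2}`. -/
def Sstrip : Set ℂ := {ζ : ℂ | |ζ.im| < Real.pi / 2}

/-- The hairpin domain `Ω₁ = {|x₂| < π/2 + cosh x₁}`. -/
def Omega1 : Set ℂ := {z : ℂ | |z.im| < Real.pi / 2 + Real.cosh z.re}

/-- Dilated hairpin domain `Ω_a = aΩ₁`. -/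
def OmegaA (a : ℝ) : Set ℂ := {z : ℂ | z / (a : ℂ) ∈ Omega1}

/-- The Hauswirth–Hélein–Pacard double hairpin solution `H = H₁`:
`H(z) = Re (cosh w)` where `w` is the unique point of the strip `S` with `w + sinh w = z`,
and `H(z) = 0` if there is no such point. -/
def hairpinH (z : ℂ) : ℝ :=
  if h : ∃ w : ℂ, w ∈ Sstrip ∧ w + Complex.sinh w = z then (Complex.cosh h.choose).re else 0

/-- The double hairpin solution `H_a(z) = a H(z/a)`. -/
def hairpin (a : ℝ) (z : ℂ) : ℝ := a * hairpinH (z / (a : ℂ))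

/-- Euclidean dot product of two complex numbers viewed as vectors in ℝ². -/
def dot2 (a b : ℂ) : ℝ := a.re * b.re + a.im * b.im

/-- Divergence of a vector field `ψ : ℂ → ℂ` on ℝ². -/
def div2 (ψ : ℂ → ℂ) (z : ℂ) : ℝ := (fderiv ℝ ψ z 1).re + (fderiv ℝ ψ z Complex.I).im

/-- A variational (weak) solution of the one-phase free boundary problem in `Ω`:
`u ∈ H¹_loc(Ω) ∩ C(Ω)`, `u ≥ 0`, `u ∈ C²({u>0})`, and the domain-variation
Euler–Lagrange identity holds for all compactly supported smooth vector fields. -/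
def VariationalSolution (Ω : Set ℂ) (u : ℂ → ℝ) : Prop :=
  ContinuousOn u Ω ∧ (∀ z ∈ Ω, 0 ≤ u z) ∧
  (∀ K : Set ℂ, K ⊆ Ω → IsCompact K →
    MeasureTheory.IntegrableOn (fun z => (u z) ^ 2 + ‖grad2 u z‖ ^ 2) K) ∧
  ContDiffOn ℝ 2 u (posSet Ω u) ∧
  ∀ ψ : ℂ → ℂ, ContDiff ℝ (⊤ : ℕ∞) ψ → HasCompactSupport ψ → tsupport ψ ⊆ Ω →
    ∫ z in Ω, ((‖grad2 u z‖ ^ 2 + Set.indicator {w | 0 < u w} (fun _ => (1 : ℝ)) z) * div2 ψ z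
      - 2 * dot2 (grad2 u z) (fderiv ℝ ψ z (grad2 u z))) = 0

/-- Average of `w` over the circle of radius `r` around `z`. -/
def circleAvg (w : ℂ → ℝ) (z : ℂ) (r : ℝ) : ℝ :=
  (1 / (2 * Real.pi)) * ∫ θ in (0 : ℝ)..(2 * Real.pi), w (z + r * Complex.exp (θ * Complex.I))

/-- Superharmonicity on `s` via the super-mean-value property. -/
def SuperharmonicOn2 (w : ℂ → ℝ) (s : Set ℂ) : Prop :=
  ∀ z ∈ s, ∀ r : ℝ, 0 < r → Metric.closedBall z r ⊆ s → circleAvg w z r ≤ w z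

/-- Subharmonicity on `s` via the sub-mean-value property. -/
def SubharmonicOn2 (w : ℂ → ℝ) (s : Set ℂ) : Prop :=
  ∀ z ∈ s, ∀ r : ℝ, 0 < r → Metric.closedBall z r ⊆ s → w z ≤ circleAvg w z r

/-- Non-tangential approach region in `B` at `x₀` with aperture `C`. -/
def NontangentialIn (B : Set ℂ) (x₀ : ℂ) (C : ℝ) : Set ℂ :=
  {x ∈ B | ‖x - x₀‖ ≤ C * Metric.infDist x Bᶜ}

/-- `w(x) = α ⟨x − x₀, ν⟩⁺ + o(|x − x₀|)` as `x → x₀` within the region `R`. -/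
def HasSlopeAt (w : ℂ → ℝ) (x₀ ν : ℂ) (α : ℝ) (R : Set ℂ) : Prop :=
  Filter.Tendsto (fun x => (w x - α * max (dot2 (x - x₀) ν) 0) / ‖x - x₀‖)
    (nhdsWithin x₀ R) (nhds 0)

/-- Viscosity supersolution of the one-phase free boundary problem in `Ω`. -/
structure ViscositySupersolution (Ω : Set ℂ) (w : ℂ → ℝ) : Prop where
  contOn : ContinuousOn w Ω
  nonneg : ∀ z ∈ Ω, 0 ≤ w z
  superharm : SuperharmonicOn2 w (posSet Ω w)
  slope : ∀ x₀ ∈ FB Ω w, ∀ (y : ℂ) (ρ : ℝ), 0 < ρ → Metric.ball y ρ ⊆ posSet Ω w →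
    dist x₀ y = ρ → ∃ α : ℝ, α ≤ 1 ∧ ∀ C : ℝ, 1 < C →
      HasSlopeAt w x₀ ((y - x₀) / (ρ : ℂ)) α (NontangentialIn (Metric.ball y ρ) x₀ C)

/-- Viscosity subsolution of the one-phase free boundary problem in `Ω`. -/
structure ViscositySubsolution (Ω : Set ℂ) (w : ℂ → ℝ) : Prop where
  contOn : ContinuousOn w Ω
  nonneg : ∀ z ∈ Ω, 0 ≤ w z
  subharm : SubharmonicOn2 w (posSet Ω w)
  slope : ∀ x₀ ∈ FB Ω w, ∀ (y : ℂ) (ρ : ℝ), 0 < ρ →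
    Metric.ball y ρ ⊆ {z ∈ Ω | w z = 0} → dist x₀ y = ρ →
    ∃ α : ℝ, 1 ≤ α ∧ ∀ C : ℝ, 1 < C →
      HasSlopeAt w x₀ ((x₀ - y) / (ρ : ℂ)) α
        (NontangentialIn (closure (Metric.ball y ρ))ᶜ x₀ C)

/-- Viscosity solution: both a supersolution and a subsolution. -/
def ViscositySolution (Ω : Set ℂ) (w : ℂ → ℝ) : Prop :=
  ViscositySupersolution Ω w ∧ ViscositySubsolution Ω w

/-- Non-degeneracy with constant `c`: linear growth away from the free boundary. -/
def Nondegenerate (Ω : Set ℂ) (w : ℂ → ℝ) (c : ℝ) : Prop :=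
  ∀ x ∈ FB Ω w, ∀ r : ℝ, 0 < r → Metric.ball x r ⊆ Ω → c * r ≤ sSup (w '' Metric.ball x r)

/-- The open annulus `{δ < |z| < R}`. -/
def ann (δ R : ℝ) : Set ℂ := {z : ℂ | δ < ‖z‖ ∧ ‖z‖ < R}

/-- Condition (A): the free boundary of `u` in the annulus `{δ < |z| < R}` consists of
exactly two connected components, each non-compact with closure meeting both boundary
circles. -/
def ConditionA (δ R : ℝ) (u : ℂ → ℝ) : Prop :=
  ∃ F₁ F₂ : Set ℂ,
    F₁.Nonempty ∧ F₂.Nonempty ∧ Disjoint F₁ F₂ ∧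
    F₁ ∪ F₂ = FB (ann δ R) u ∧
    (∀ z ∈ F₁, connectedComponentIn (FB (ann δ R) u) z = F₁) ∧
    (∀ z ∈ F₂, connectedComponentIn (FB (ann δ R) u) z = F₂) ∧
    ¬ IsCompact F₁ ∧ ¬ IsCompact F₂ ∧
    (closure F₁ ∩ Metric.sphere 0 δ).Nonempty ∧
    (closure F₁ ∩ Metric.sphere 0 R).Nonempty ∧
    (closure F₂ ∩ Metric.sphere 0 δ).Nonempty ∧
    (closure F₂ ∩ Metric.sphere 0 R).Nonempty

/-- `k` is the curvature of the set `S` at the point `p`, computed via an arc-length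
parametrization. -/
def IsCurvatureAt (S : Set ℂ) (p : ℂ) (k : ℝ) : Prop :=
  ∃ γ : ℝ → ℂ, ContDiff ℝ 2 γ ∧ γ 0 = p ∧ (∀ s : ℝ, ‖deriv γ s‖ = 1) ∧
    (∃ ε > 0, ∀ s ∈ Set.Ioo (-ε) ε, γ s ∈ S) ∧ ‖deriv (deriv γ) 0‖ = k

/-- A set has exactly two connected components. -/
def HasExactlyTwoComponents (S : Set ℂ) : Prop :=
  ∃ z₁ ∈ S, ∃ z₂ ∈ S, connectedComponentIn S z₁ ≠ connectedComponentIn S z₂ ∧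
    ∀ z ∈ S, connectedComponentIn S z = connectedComponentIn S z₁ ∨
      connectedComponentIn S z = connectedComponentIn S z₂

end

noncomputable section

open InnerProductSpace (HarmonicAt HarmonicOnNhd)
open scoped ComplexConjugate

/-- The complex gradient `∂ₓU - i ∂ᵧU`, holomorphic wherever `U` is harmonic. -/
def cgrad (U : ℂ → ℝ) (z : ℂ) : ℂ := fderiv ℝ U z 1 - I * fderiv ℝ U z I

lemma fderiv_eq_re_cgrad_mul (U : ℂ → ℝ) (z v : ℂ) : fderiv ℝ U z v = (cgrad U z * v).re := by
  have hv : v = v.re • (1 : ℂ) + v.im • I := by simp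
  conv_lhs => rw [hv]
  rw [map_add, map_smul, map_smul]
  simp [cgrad]
  ring

lemma norm_grad2_eq (U : ℂ → ℝ) (z : ℂ) : ‖grad2 U z‖ = ‖cgrad U z‖ := by
  have : cgrad U z = conj (grad2 U z) := by
    simp [cgrad, grad2]; ring
  rw [this, RCLike.norm_conj]

lemma cgrad_eq_of_hasDerivAt {U : ℂ → ℝ} {f : ℂ → ℂ} {z f' : ℂ} (hf : HasDerivAt f f' z)
    (h : U =ᶠ[𝓝 z] fun w => (f w).re) : cgrad U z = f' := by
  have h0 : HasFDerivAt f ((ContinuousLinearMap.toSpanSingleton ℂ f').restrictScalars ℝ) z :=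
    hf.hasFDerivAt.restrictScalars ℝ
  have h1 := reCLM.hasFDerivAt.comp z h0
  have h2 := h1.congr_of_eventuallyEq (f₁ := U) h
  rw [cgrad, h2.fderiv]
  apply Complex.ext <;> simp

lemma cgrad_congr {U V : ℂ → ℝ} {z : ℂ} (h : U =ᶠ[𝓝 z] V) : cgrad U z = cgrad V z := by
  simp [cgrad, h.fderiv_eq]

lemma norm_cgrad_le_of_lipschitz {U : ℂ → ℝ} {z : ℂ} {M : ℝ} (hM : 0 ≤ M)
    (h : ∀ᶠ w in 𝓝 z, |U w - U z| ≤ M * ‖w - z‖) : ‖cgrad U z‖ ≤ M := by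
  by_cases hd : DifferentiableAt ℝ U z
  · have h1 : ‖fderiv ℝ U z‖ ≤ M := hd.hasFDerivAt.le_of_lip' hM h
    have h2 := fderiv_eq_re_cgrad_mul U z (conj (cgrad U z))
    rw [mul_conj, ofReal_re, normSq_eq_norm_sq] at h2
    have h3 : ‖fderiv ℝ U z (conj (cgrad U z))‖ ≤ M * ‖conj (cgrad U z)‖ :=
      (fderiv ℝ U z).le_of_opNorm_le h1 _
    rw [h2, RCLike.norm_conj, Real.norm_of_nonneg (by positivity)] at h3
    by_contra hcon
    push Not at hcon
    have : 0 < ‖cgrad U z‖ := lt_of_le_of_lt hM hcon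
    nlinarith
  · simp [cgrad, fderiv_zero_of_not_differentiableAt hd, hM]

lemma HarmonicOnNhd.exists_hasDerivAt_ball {U : ℂ → ℝ} {z : ℂ} {r : ℝ}
    (hU : HarmonicOnNhd U (ball z r)) :
    ∃ f : ℂ → ℂ, (∀ w ∈ ball z r, HasDerivAt f (cgrad U w) w) ∧
      (∀ w ∈ ball z r, U w = (f w).re) ∧ (0 < r → f z = U z) := by
  obtain ⟨F, hF, hFU⟩ := hU.exists_analyticOnNhd_ball_re_eq
  refine ⟨fun w => F w - (F z).im * I, fun w hw => ?_, fun w hw => ?_, fun hr => ?_⟩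
  · have h1 := (hF w hw).differentiableAt.hasDerivAt
    have h2 : U =ᶠ[𝓝 w] fun w => (F w).re := by
      filter_upwards [isOpen_ball.mem_nhds hw] with x hx using (hFU hx).symm
    rw [cgrad_eq_of_hasDerivAt h1 h2]
    exact h1.sub_const _
  · simp [(hFU hw).symm]
  · have := hFU (mem_ball_self hr)
    simp only at this
    apply Complex.ext <;> simp [this]

lemma HarmonicAt.hasFDerivAt {U : ℂ → ℝ} {z : ℂ} (hU : HarmonicAt U z) :
    DifferentiableAt ℝ U z := hU.1.differentiableAt (by norm_num)

lemma HarmonicAt.differentiableAt_cgrad {U : ℂ → ℝ} {z : ℂ} (hU : HarmonicAt U z) :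
    DifferentiableAt ℂ (cgrad U) z := HarmonicAt.differentiableAt_complex_partial hU

lemma harmonicAt_re_of_differentiableOn {f : ℂ → ℂ} {s : Set ℂ} (hs : IsOpen s)
    (hf : DifferentiableOn ℂ f s) {z : ℂ} (hz : z ∈ s) : HarmonicAt (fun w => (f w).re) z :=
  (hf.analyticAt (hs.mem_nhds hz)).harmonicAt_re

lemma harmonicAt_im_of_differentiableOn {f : ℂ → ℂ} {s : Set ℂ} (hs : IsOpen s)
    (hf : DifferentiableOn ℂ f s) {z : ℂ} (hz : z ∈ s) : HarmonicAt (fun w => (f w).im) z :=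
  (hf.analyticAt (hs.mem_nhds hz)).harmonicAt_im

/-- A function with positive real part: Schwarz estimate for its Cayley transform. -/
lemma norm_cayley_le {f : ℂ → ℂ} {p : ℂ} {ρ a : ℝ} (ha : 0 < a)
    (hf : DifferentiableOn ℂ f (ball p ρ)) (hpos : ∀ w ∈ ball p ρ, 0 < (f w).re)
    (hfp : f p = a) {z : ℂ} (hz : z ∈ ball p ρ) :
    ‖(f z - a) / (f z + a)‖ ≤ ‖z - p‖ / ρ := by
  have hne : ∀ w ∈ ball p ρ, f w + a ≠ 0 := fun w hw h => by
    have := congrArg re h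
    simp at this
    linarith [hpos w hw]
  have hd : DifferentiableOn ℂ (fun w => (f w - a) / (f w + a)) (ball p ρ) :=
    (hf.sub_const _).div (hf.add_const _) hne
  have hmaps : MapsTo (fun w => (f w - a) / (f w + a)) (ball p ρ)
      (closedBall ((f p - a) / (f p + a)) 1) := by
    intro w hw
    rw [hfp]
    simp only [sub_self, zero_div, mem_closedBall, dist_zero_right, norm_div]
    apply div_le_one_of_le₀ _ (norm_nonneg _)
    rw [← sq_le_sq₀ (norm_nonneg _) (norm_nonneg _), ← normSq_eq_norm_sq, ← normSq_eq_norm_sq,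
      normSq_apply, normSq_apply]
    have := hpos w hw
    simp
    nlinarith
  have h1 := Complex.dist_le_div_mul_dist_of_mapsTo_ball hd hmaps hz
  rw [hfp] at h1
  simp only [sub_self, zero_div, dist_zero_right] at h1
  rw [dist_eq_norm] at h1
  calc _ ≤ _ := h1
    _ = _ := by ring

lemma HarmonicOnNhd.harnack {U : ℂ → ℝ} {p : ℂ} {ρ : ℝ} (hU : HarmonicOnNhd U (ball p ρ))
    (h0 : ∀ w ∈ ball p ρ, 0 ≤ U w) {z : ℂ} (hz : ‖z - p‖ ≤ ρ / 2) (hρ : 0 < ρ) :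
    U p / 3 ≤ U z := by
  obtain ⟨f, hf, hfU, hfp⟩ := HarmonicOnNhd.exists_hasDerivAt_ball hU
  have hzb : z ∈ ball p ρ := by rw [mem_ball, dist_eq_norm]; linarith
  refine le_of_forall_pos_le_add fun ε hε => ?_
  set a := U p + ε with ha
  have ha0 : 0 < a := by linarith [h0 p (mem_ball_self hρ)]
  have key := norm_cayley_le (f := fun w => f w + ε) (a := a) ha0
    (fun w hw => ((hf w hw).differentiableAt.add_const _).differentiableWithinAt)
    (fun w hw => by simp [← hfU w hw]; linarith [h0 w hw]) (by simp [hfp hρ, ha]) hzb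
  have ht : ‖(f z + ε - a) / (f z + ε + a)‖ ≤ 1 / 2 := key.trans (by
    rw [div_le_iff₀ hρ]; linarith)
  have hden : 0 < ‖f z + ε + a‖ := by
    rw [norm_pos_iff]
    intro h
    have := congrArg re h
    simp [← hfU z hzb] at this
    linarith [h0 z hzb]
  rw [norm_div, div_le_iff₀ hden, ← sq_le_sq₀ (norm_nonneg _) (by positivity), mul_pow,
    ← normSq_eq_norm_sq, ← normSq_eq_norm_sq, normSq_apply, normSq_apply] at ht
  simp [← hfU z hzb] at ht
  have hz0 := h0 z hzb
  by_contra hcon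
  push Not at hcon
  have h3 : U z + ε < a / 3 + ε := by rw [ha]; linarith
  nlinarith [mul_self_nonneg (f z).im, mul_pos ha0 hε, mul_nonneg hz0 hε.le]

lemma HarmonicOnNhd.norm_cgrad_le {U : ℂ → ℝ} {p : ℂ} {ρ : ℝ}
    (hU : HarmonicOnNhd U (ball p ρ)) (h0 : ∀ w ∈ ball p ρ, 0 ≤ U w) (hρ : 0 < ρ) :
    ‖cgrad U p‖ ≤ 2 * U p / ρ := by
  obtain ⟨f, hf, hfU, hfp⟩ := HarmonicOnNhd.exists_hasDerivAt_ball hU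
  rw [le_div_iff₀ hρ]
  refine le_of_forall_pos_le_add fun ε hε => ?_
  set a := U p + ε / 2 with ha
  have ha0 : 0 < a := by linarith [h0 p (mem_ball_self hρ)]
  have key := fun z hz => norm_cayley_le (f := fun w => f w + (ε / 2 : ℝ)) (a := a) (z := z) ha0
    (fun w hw => ((hf w hw).differentiableAt.add_const _).differentiableWithinAt)
    (fun w hw => by
      have := h0 w hw
      rw [hfU w hw] at this
      rw [add_re, ofReal_re]; linarith) (by simp [hfp hρ, ha]) hz
  have hfp2 : f p + (ε / 2 : ℝ) = a := by simp [hfp hρ, ha]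
  have hane : (a : ℂ) + a ≠ 0 := by
    norm_cast; linarith
  have hd : HasDerivAt (fun w => (f w + (ε / 2 : ℝ) - a) / (f w + (ε / 2 : ℝ) + a))
      (cgrad U p / (2 * a)) p := by
    have h1 := hf p (mem_ball_self hρ)
    have h2 := ((h1.add_const ((ε / 2 : ℝ) : ℂ)).sub_const (a : ℂ)).fun_div
      ((h1.add_const ((ε / 2 : ℝ) : ℂ)).add_const (a : ℂ)) (by rw [hfp2]; exact hane)
    have h3 : (cgrad U p * (f p + (ε / 2 : ℝ) + a) - (f p + (ε / 2 : ℝ) - a) * cgrad U p) /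
        (f p + (ε / 2 : ℝ) + a) ^ 2 = cgrad U p / (2 * a) := by
      rw [hfp2]
      have : (a : ℂ) ≠ 0 := by norm_cast; exact ha0.ne'
      field_simp
      ring
    rwa [h3] at h2
  have hle : ‖cgrad U p / (2 * a)‖ ≤ 1 / ρ := by
    have := hd.hasFDerivAt.le_of_lip' (C := 1 / ρ) (by positivity) (by
      filter_upwards [ball_mem_nhds p hρ] with z hz
      have h2 : f p + (ε / 2 : ℝ) - a = 0 := by rw [hfp2]; ring
      rw [h2]
      simpa [div_eq_inv_mul] using key z hz)
    simpa using this
  rw [norm_div] at hle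
  have h2a : ‖(2 * a : ℂ)‖ = 2 * a := by
    rw [norm_mul, norm_real, Real.norm_of_nonneg ha0.le]; simp
  rw [h2a, div_le_div_iff₀ (by positivity) hρ] at hle
  rw [ha] at hle
  linarith

/-- Weak maximum principle for continuous functions that are locally constant near interior
local maxima. -/
lemma le_of_forall_frontier_le {W : Set ℂ} (hWo : IsOpen W) (hWb : Bornology.IsBounded W)
    {h : ℂ → ℝ} (hc : ContinuousOn h (closure W))
    (hloc : ∀ z ∈ W, IsLocalMax h z → ∀ᶠ w in 𝓝 z, h w = h z) {m : ℝ}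
    (hm : ∀ z ∈ frontier W, h z ≤ m) {z : ℂ} (hz : z ∈ W) : h z ≤ m := by
  have hK : IsCompact (closure W) := hWb.isCompact_closure
  obtain ⟨z0, hz0, hmax⟩ := hK.exists_isMaxOn ⟨z, subset_closure hz⟩ hc
  refine (hmax (subset_closure hz)).trans ?_
  by_contra hcon
  push Not at hcon
  set A := closure W ∩ h ⁻¹' {h z0}
  have hAc : IsCompact A :=
    hK.of_isClosed_subset (hc.preimage_isClosed_of_isClosed isClosed_closure isClosed_singleton)
      inter_subset_left
  obtain ⟨z1, hz1, hre⟩ := hAc.exists_isMaxOn ⟨z0, hz0, rfl⟩ continuous_re.continuousOn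
  have hz1W : z1 ∈ W := by
    by_contra hn
    have : z1 ∈ frontier W := ⟨hz1.1, fun hi => hn (interior_subset hi)⟩
    have h2 := hm z1 this
    rw [show h z1 = h z0 from hz1.2] at h2
    linarith
  have hlm : IsLocalMax h z1 := by
    filter_upwards [hWo.mem_nhds hz1W] with w hw
    rw [show h z1 = h z0 from hz1.2]
    exact hmax (subset_closure hw)
  have hev := (hloc z1 hz1W hlm).and (hWo.mem_nhds hz1W)
  obtain ⟨ε, hε, hb⟩ := Metric.eventually_nhds_iff.1 hev
  have hd : dist (z1 + (ε / 2 : ℝ)) z1 < ε := by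
    simp [dist_eq_norm, abs_of_pos hε]; linarith
  have h3 := hb hd
  have h4 : z1 + (ε / 2 : ℝ) ∈ A := ⟨subset_closure h3.2, h3.1.trans hz1.2⟩
  have h5 := hre h4
  simp at h5
  linarith

lemma HarmonicAt.eventually_eq_of_isLocalMax {h : ℂ → ℝ} {z : ℂ} (hh : HarmonicAt h z)
    (hm : IsLocalMax h z) : ∀ᶠ w in 𝓝 z, h w = h z := by
  obtain ⟨r, hr, hball⟩ := Metric.eventually_nhds_iff_ball.1 hh.eventually
  obtain ⟨f, hf, hfU, -⟩ := HarmonicOnNhd.exists_hasDerivAt_ball hball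
  have hb : ∀ᶠ w in 𝓝 z, w ∈ ball z r := isOpen_ball.mem_nhds (mem_ball_self hr)
  have h1 : ∀ᶠ w in 𝓝 z, cexp (f w) = cexp (f z) := by
    apply Complex.eventually_eq_of_isLocalMax_norm
    · filter_upwards [hb] with w hw using (hf w hw).differentiableAt.cexp
    · filter_upwards [hm, hb] with w hw hwb
      simp only [Function.comp, norm_exp]
      rw [← hfU w hwb, ← hfU z (mem_ball_self hr)]
      exact Real.exp_le_exp.2 hw
  filter_upwards [h1, hb] with w hw hwb
  have := congrArg norm hw
  rw [norm_exp, norm_exp] at this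
  rw [hfU w hwb, hfU z (mem_ball_self hr)]
  exact Real.exp_injective this

lemma le_of_forall_frontier_le_of_harmonic {W : Set ℂ} (hWo : IsOpen W)
    (hWb : Bornology.IsBounded W) {h : ℂ → ℝ} (hc : ContinuousOn h (closure W))
    (hh : ∀ z ∈ W, HarmonicAt h z) {m : ℝ}
    (hm : ∀ z ∈ frontier W, h z ≤ m) {z : ℂ} (hz : z ∈ W) : h z ≤ m :=
  le_of_forall_frontier_le hWo hWb hc
    (fun z hz hl => HarmonicAt.eventually_eq_of_isLocalMax (hh z hz) hl) hm hz

/-- A continuous function vanishing on a diameter and holomorphic on one side of it vanishes on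
that side. -/
lemma eq_zero_of_eq_zero_on_diameter {h : ℂ → ℂ} {p e : ℂ} (he : ‖e‖ = 1) {r : ℝ}
    (hc : ContinuousOn h (ball p r))
    (hd : ∀ z ∈ ball p r, 0 < ((z - p) * conj e).im → DifferentiableAt ℂ h z)
    (h0 : ∀ z ∈ ball p r, ((z - p) * conj e).im = 0 → h z = 0)
    {z : ℂ} (hz : z ∈ ball p (r / 4)) (hzp : 0 < ((z - p) * conj e).im) : h z = 0 := by
  set s := ((z - p) * conj e).im with hs
  have hr : 0 < r := by
    have := dist_nonneg.trans_lt (mem_ball.1 hz)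
    linarith
  have hzr : ‖z - p‖ < r / 4 := by rwa [mem_ball, dist_eq_norm] at hz
  have hsr : s < r / 4 := by
    calc s ≤ |((z - p) * conj e).im| := le_abs_self _
      _ ≤ ‖(z - p) * conj e‖ := abs_im_le_norm _
      _ = ‖z - p‖ := by rw [norm_mul, RCLike.norm_conj, he, mul_one]
      _ < r / 4 := hzr
  have hee : e * conj e = 1 := by rw [mul_conj, normSq_eq_norm_sq, he]; simp
  set Q : Set ℂ := Ioo (-s) s ×ℂ Ioo (-s) s with hQ
  have hQo : IsOpen Q := isOpen_Ioo.reProdIm isOpen_Ioo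
  have hQcl : closure Q = Icc (-s) s ×ℂ Icc (-s) s := by
    rw [hQ, closure_reProdIm, closure_Ioo (by linarith)]
  have hpt : ∀ k : ℕ, ∀ ξ ∈ closure Q, z + e * (I ^ k * ξ) ∈ ball p r := by
    intro k ξ hξ
    rw [hQcl] at hξ
    have h1 : ‖ξ‖ ≤ s + s := by
      refine (norm_le_abs_re_add_abs_im ξ).trans (add_le_add ?_ ?_)
      · exact abs_le.2 hξ.1
      · exact abs_le.2 hξ.2
    rw [mem_ball, dist_eq_norm]
    calc ‖z + e * (I ^ k * ξ) - p‖ = ‖(z - p) + e * (I ^ k * ξ)‖ := by ring_nf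
      _ ≤ ‖z - p‖ + ‖e * (I ^ k * ξ)‖ := norm_add_le _ _
      _ = ‖z - p‖ + ‖ξ‖ := by simp [he]
      _ < r := by linarith
  have hht : ∀ k : ℕ, ∀ ξ : ℂ, ((z + e * (I ^ k * ξ) - p) * conj e).im = s + (I ^ k * ξ).im := by
    intro k ξ
    have : (z + e * (I ^ k * ξ) - p) * conj e = (z - p) * conj e + (e * conj e) * (I ^ k * ξ) := by
      ring
    rw [this, hee, one_mul, add_im]
  have hI : ∀ ξ : ℂ, (I ^ 0 * ξ).im = ξ.im ∧ (I ^ 1 * ξ).im = ξ.re ∧ (I ^ 2 * ξ).im = -ξ.im ∧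
      (I ^ 3 * ξ).im = -ξ.re := by
    intro ξ
    have h3 : I ^ 3 = -I := by rw [pow_succ, I_sq]; ring
    simp [h3, I_sq]
  set H : ℂ → ℂ := fun ξ => ∏ k ∈ Finset.range 4, h (z + e * (I ^ k * ξ)) with hH
  have hHc : DiffContOnCl ℂ H Q := by
    constructor
    · intro ξ hξ
      apply DifferentiableAt.differentiableWithinAt
      apply DifferentiableAt.fun_finsetProd
      intro k hk
      have hdiff : DifferentiableAt ℂ h (z + e * (I ^ k * ξ)) := by
        apply hd _ (hpt k ξ (subset_closure hξ))
        rw [hht]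
        have := hI ξ
        obtain ⟨⟨a1, a2⟩, a3, a4⟩ := hξ
        simp only [Finset.mem_range] at hk
        interval_cases k <;> simp only [this] <;> linarith
      exact DifferentiableAt.fun_comp' (f := fun ξ : ℂ => z + e * (I ^ k * ξ)) (g := h) ξ hdiff
        (by fun_prop)
    · apply continuousOn_finsetProd
      intro k _
      exact hc.comp (by fun_prop) (fun ξ hξ => hpt k ξ hξ)
  have hfr : ∀ ξ ∈ frontier Q, ‖H ξ‖ ≤ 0 := by
    intro ξ hξ
    have hξc := frontier_subset_closure hξ
    have hξn : ξ ∉ Q := by rw [hQo.frontier_eq] at hξ; exact hξ.2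
    have hξ2 := hξc
    rw [hQcl] at hξ2
    obtain ⟨⟨a1, a2⟩, a3, a4⟩ := hξ2
    have : ∃ k ∈ Finset.range 4, s + (I ^ k * ξ).im = 0 := by
      have h4 := hI ξ
      by_contra hcon
      push Not at hcon
      have b0 := hcon 0 (by simp)
      have b1 := hcon 1 (by simp)
      have b2 := hcon 2 (by simp)
      have b3 := hcon 3 (by simp)
      simp only [h4] at b0 b1 b2 b3
      apply hξn
      refine ⟨⟨lt_of_le_of_ne a1 ?_, lt_of_le_of_ne a2 ?_⟩,
        ⟨lt_of_le_of_ne a3 ?_, lt_of_le_of_ne a4 ?_⟩⟩ <;> intro h5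
      · exact b1 (by linarith)
      · exact b3 (by linarith)
      · exact b0 (by linarith)
      · exact b2 (by linarith)
    obtain ⟨k, hk, hk0⟩ := this
    rw [hH]
    simp only
    rw [Finset.prod_eq_zero hk (h0 _ (hpt k ξ hξc) (by rw [hht, hk0]))]
    simp
  have hQb : Bornology.IsBounded Q := by
    have : IsCompact (closure Q) := by
      rw [hQcl]; exact isCompact_Icc.reProdIm isCompact_Icc
    exact this.isBounded.subset subset_closure
  have h0Q : (0 : ℂ) ∈ closure Q := subset_closure ⟨by simp [hzp], by simp [hzp]⟩
  have := Complex.norm_le_of_forall_mem_frontier_norm_le hQb hHc hfr h0Q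
  have h5 : H 0 = h z ^ 4 := by simp [hH]
  rw [h5] at this
  have h6 := norm_le_zero_iff.1 this
  exact pow_eq_zero_iff (by norm_num) |>.1 h6

end

noncomputable section
open InnerProductSpace (HarmonicAt HarmonicOnNhd)
open scoped ComplexConjugate

/-- Lipschitz nonnegative functions on the disk of radius `R`, vanishing on the closed set `K`,
harmonic off `K`, with slope at most one at points of `K` touched by a disk from outside `K`. -/
structure Base (R : ℝ) (U : ℂ → ℝ) (K : Set ℂ) : Prop where
  closed : IsClosed K
  nonneg : ∀ z, ‖z‖ < R → 0 ≤ U z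
  zero : ∀ z ∈ K, ‖z‖ < R → U z = 0
  lip : ∀ x y, ‖x‖ < R → ‖y‖ < R → |U x - U y| ≤ 5 * ‖x - y‖
  harm : ∀ z, ‖z‖ < R → z ∉ K → HarmonicAt U z
  visc : ∀ (p : ℂ) (ρ' ρ t : ℝ), 0 < ρ' → ρ' < ρ → ρ < t → ‖p‖ + ρ < R →
    (∀ z ∈ K, ρ ≤ ‖z - p‖) → (∀ z, ‖z - p‖ = ρ' → t * Real.log (ρ / ρ') ≤ U z) →
    ∀ y ∈ K, ‖y - p‖ ≠ ρ

/-- A `Base` pair together with a primitive `S` of `-(∂ₓU - i ∂ᵧU)²` that equals `z̄ + const` on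
unbounded pieces of `K`, and linear growth of `U` away from `∂K`. -/
structure Full (R c L : ℝ) (U : ℂ → ℝ) (S : ℂ → ℂ) (K : Set ℂ) : Prop extends Base R U K where
  slip : ∀ x y, ‖x‖ < R → ‖y‖ < R → ‖S x - S y‖ ≤ L * ‖x - y‖
  sder : ∀ z, ‖z‖ < R → z ∉ K → HasDerivAt S (-(cgrad U z) ^ 2) z
  reach : ∀ x ∈ K, ∀ ρ, 0 < ρ → ‖x‖ + ρ < R →
    ∃ y ∈ K, ‖y - x‖ = ρ ∧ S y - conj y = S x - conj x
  nd : ∀ x ∈ frontier K, ∀ r, 0 < r → ‖x‖ + r < R → ∃ y, ‖y - x‖ ≤ r ∧ c * r ≤ U y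
  loc : ∀ z ∈ interior K, ‖z‖ < R → ∀ᶠ w in 𝓝 z, S w - conj w = S z - conj z

/-- The global class. -/
def Glob (c : ℝ) (U : ℂ → ℝ) (S : ℂ → ℂ) (K : Set ℂ) : Prop := ∀ R, Full R c 1 U S K

lemma Base.mono {R R' : ℝ} {U : ℂ → ℝ} {K : Set ℂ} (h : Base R U K) (hR : R' ≤ R) :
    Base R' U K where
  closed := h.closed
  nonneg z hz := h.nonneg z (hz.trans_le hR)
  zero z hz hz' := h.zero z hz (hz'.trans_le hR)
  lip x y hx hy := h.lip x y (hx.trans_le hR) (hy.trans_le hR)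
  harm z hz := h.harm z (hz.trans_le hR)
  visc p ρ' ρ t h1 h2 h3 h4 := h.visc p ρ' ρ t h1 h2 h3 (h4.trans_le hR)

section Affine

/-- Rescaling of `U` along `z ↦ z₀ + m z`. -/
def affU (z₀ m : ℂ) (U : ℂ → ℝ) : ℂ → ℝ := fun z => U (z₀ + m * z) / ‖m‖
/-- Rescaling of `S` along `z ↦ z₀ + m z`. -/
def affS (z₀ m : ℂ) (S : ℂ → ℂ) : ℂ → ℂ := fun z => (S (z₀ + m * z) - S z₀) / conj m
/-- Rescaling of `K` along `z ↦ z₀ + m z`. -/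
def affK (z₀ m : ℂ) (K : Set ℂ) : Set ℂ := {z | z₀ + m * z ∈ K}

variable {z₀ m : ℂ} {R R' : ℝ} {U : ℂ → ℝ} {S : ℂ → ℂ} {K : Set ℂ} {c L : ℝ}

lemma norm_aff_lt (hm : m ≠ 0) (hR : ‖z₀‖ + ‖m‖ * R' ≤ R) {z : ℂ} (hz : ‖z‖ < R') :
    ‖z₀ + m * z‖ < R := by
  have hm' : 0 < ‖m‖ := norm_pos_iff.2 hm
  calc ‖z₀ + m * z‖ ≤ ‖z₀‖ + ‖m‖ * ‖z‖ := (norm_add_le _ _).trans (by rw [norm_mul])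
    _ < ‖z₀‖ + ‖m‖ * R' := by gcongr
    _ ≤ R := hR

lemma harmonicAt_aff {z : ℂ} (h : HarmonicAt U (z₀ + m * z)) :
    HarmonicAt (affU z₀ m U) z ∧
      cgrad (affU z₀ m U) z = cgrad U (z₀ + m * z) * (m / ‖m‖) := by
  obtain ⟨r, hr, hball⟩ := Metric.eventually_nhds_iff_ball.1 h.eventually
  obtain ⟨f, hf, hfU, -⟩ := HarmonicOnNhd.exists_hasDerivAt_ball hball
  have hcont : Continuous fun w : ℂ => z₀ + m * w := by fun_prop
  set s : Set ℂ := (fun w : ℂ => z₀ + m * w) ⁻¹' ball (z₀ + m * z) r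
  have hs : IsOpen s := isOpen_ball.preimage hcont
  have hzs : z ∈ s := mem_ball_self hr
  have hder : ∀ w ∈ s, HasDerivAt (fun w => f (z₀ + m * w) / ‖m‖)
      (cgrad U (z₀ + m * w) * (m / ‖m‖)) w := by
    intro w hw
    have h1 : HasDerivAt (fun w : ℂ => z₀ + m * w) m w := by
      simpa using ((hasDerivAt_id w).const_mul m).const_add z₀
    have h2 := (HasDerivAt.comp w (hf _ hw) h1).div_const (‖m‖ : ℂ)
    have h3 : cgrad U (z₀ + m * w) * m / ‖m‖ = cgrad U (z₀ + m * w) * (m / ‖m‖) := by ring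
    rw [← h3]
    exact h2
  have heq : ∀ w ∈ s, affU z₀ m U w = (f (z₀ + m * w) / ‖m‖).re := by
    intro w hw
    rw [affU, hfU _ hw, div_ofReal_re]
  have hev : affU z₀ m U =ᶠ[𝓝 z] fun w => (f (z₀ + m * w) / ‖m‖).re := by
    filter_upwards [hs.mem_nhds hzs] with w hw using heq w hw
  constructor
  · rw [InnerProductSpace.harmonicAt_congr_nhds hev]
    exact harmonicAt_re_of_differentiableOn hs
      (fun w hw => (hder w hw).differentiableAt.differentiableWithinAt) hzs
  · exact cgrad_eq_of_hasDerivAt (hder z hzs) hev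

/-- The map `z ↦ z₀ + m z` as a homeomorphism. -/
def affHomeo (z₀ : ℂ) (hm : m ≠ 0) : ℂ ≃ₜ ℂ :=
  (Homeomorph.mulLeft₀ m hm).trans (Homeomorph.addLeft z₀)

lemma affHomeo_apply (hm : m ≠ 0) (z : ℂ) : affHomeo z₀ hm z = z₀ + m * z := rfl

lemma affK_eq (hm : m ≠ 0) : affK z₀ m K = affHomeo z₀ hm ⁻¹' K := rfl

lemma exists_aff_eq (z₀ : ℂ) (hm : m ≠ 0) (y : ℂ) : ∃ ζ, y = z₀ + m * ζ :=
  ⟨(y - z₀) / m, by field_simp; ring⟩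

lemma norm_aff_sub (z₀ m a b : ℂ) : ‖z₀ + m * a - (z₀ + m * b)‖ = ‖m‖ * ‖a - b‖ := by
  rw [← norm_mul]; congr 1; ring

lemma Base.aff (h : Base R U K) (hm : m ≠ 0) (hR : ‖z₀‖ + ‖m‖ * R' ≤ R) :
    Base R' (affU z₀ m U) (affK z₀ m K) := by
  have hm' : 0 < ‖m‖ := norm_pos_iff.2 hm
  have hin := fun z => norm_aff_lt (z := z) hm hR
  refine ⟨?_, ?_, ?_, ?_, ?_, ?_⟩
  · rw [affK_eq hm]; exact h.closed.preimage (affHomeo z₀ hm).continuous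
  · intro z hz; exact div_nonneg (h.nonneg _ (hin z hz)) hm'.le
  · intro z hz hz'; simp [affU, h.zero _ hz (hin z hz')]
  · intro x y hx hy
    rw [affU, affU, ← sub_div, abs_div, abs_of_pos hm', div_le_iff₀ hm']
    calc _ ≤ _ := h.lip _ _ (hin x hx) (hin y hy)
      _ = _ := by rw [norm_aff_sub]; ring
  · intro z hz hzK; exact (harmonicAt_aff (h.harm _ (hin z hz) hzK)).1
  · intro p ρ' ρ t h1 h2 h3 h4 h5 h6 y hy hyp
    refine h.visc (z₀ + m * p) (‖m‖ * ρ') (‖m‖ * ρ) (‖m‖ * t) (by positivity) (by gcongr)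
      (by gcongr) ?_ ?_ ?_ (z₀ + m * y) hy ?_
    · calc ‖z₀ + m * p‖ + ‖m‖ * ρ ≤ ‖z₀‖ + ‖m‖ * ‖p‖ + ‖m‖ * ρ := by
            gcongr; exact (norm_add_le _ _).trans (by rw [norm_mul])
        _ = ‖z₀‖ + ‖m‖ * (‖p‖ + ρ) := by ring
        _ < ‖z₀‖ + ‖m‖ * R' := by gcongr
        _ ≤ R := hR
    · intro z hz
      obtain ⟨ζ, rfl⟩ := exists_aff_eq z₀ hm z
      rw [norm_aff_sub]
      gcongr
      exact h5 ζ hz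
    · intro z hz
      obtain ⟨ζ, rfl⟩ := exists_aff_eq z₀ hm z
      rw [norm_aff_sub] at hz
      have h7 := h6 ζ (mul_left_cancel₀ hm'.ne' hz)
      rw [affU, le_div_iff₀ hm'] at h7
      rw [mul_div_mul_left _ _ hm'.ne']
      linarith
    · rw [norm_aff_sub, hyp]

lemma affS_sub_conj (hm : m ≠ 0) (z : ℂ) : affS z₀ m S z - conj z =
    ((S (z₀ + m * z) - conj (z₀ + m * z)) - (S z₀ - conj z₀)) / conj m := by
  have : conj m ≠ 0 := by simpa using hm
  simp only [affS, map_add, map_mul]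
  field_simp
  ring

lemma Full.aff (h : Full R c L U S K) (hm : m ≠ 0) (hR : ‖z₀‖ + ‖m‖ * R' ≤ R) :
    Full R' c L (affU z₀ m U) (affS z₀ m S) (affK z₀ m K) := by
  have hm' : 0 < ‖m‖ := norm_pos_iff.2 hm
  have hcm : conj m ≠ 0 := by simpa using hm
  have hin := fun z => norm_aff_lt (z := z) hm hR
  have hin2 : ∀ x ρ, ‖x‖ + ρ < R' → ‖z₀ + m * x‖ + ‖m‖ * ρ < R := by
    intro x ρ hx
    calc ‖z₀ + m * x‖ + ‖m‖ * ρ ≤ ‖z₀‖ + ‖m‖ * ‖x‖ + ‖m‖ * ρ := by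
          gcongr; exact (norm_add_le _ _).trans (by rw [norm_mul])
      _ = ‖z₀‖ + ‖m‖ * (‖x‖ + ρ) := by ring
      _ < ‖z₀‖ + ‖m‖ * R' := by gcongr
      _ ≤ R := hR
  refine { h.toBase.aff hm hR with slip := ?_, sder := ?_, reach := ?_, nd := ?_, loc := ?_ }
  · intro x y hx hy
    have : affS z₀ m S x - affS z₀ m S y = (S (z₀ + m * x) - S (z₀ + m * y)) / conj m := by
      simp only [affS]; field_simp; ring
    rw [this, norm_div, RCLike.norm_conj, div_le_iff₀ hm']
    calc _ ≤ _ := h.slip _ _ (hin x hx) (hin y hy)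
      _ = _ := by rw [norm_aff_sub]; ring
  · intro z hz hzK
    rw [(harmonicAt_aff (h.harm _ (hin z hz) hzK)).2]
    have h1 : HasDerivAt (fun w : ℂ => z₀ + m * w) m z := by
      simpa using ((hasDerivAt_id z).const_mul m).const_add z₀
    have h2 := ((HasDerivAt.comp z (h.sder _ (hin z hz) hzK) h1).sub_const (S z₀)).div_const (conj m)
    have h3 : (‖m‖ : ℂ) ^ 2 = m * conj m := by rw [mul_conj, normSq_eq_norm_sq]; simp
    have h4 : -(cgrad U (z₀ + m * z)) ^ 2 * m / conj m =
        -(cgrad U (z₀ + m * z) * (m / ‖m‖)) ^ 2 := by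
      rw [mul_pow, div_pow, h3]
      field_simp
    rw [← h4]
    exact h2
  · intro x hx ρ hρ hxR
    obtain ⟨y, hy, hy1, hy2⟩ := h.reach _ hx (‖m‖ * ρ) (by positivity) (hin2 x ρ hxR)
    obtain ⟨ζ, rfl⟩ := exists_aff_eq z₀ hm y
    refine ⟨ζ, hy, ?_, ?_⟩
    · rw [norm_aff_sub] at hy1; exact mul_left_cancel₀ hm'.ne' hy1
    · rw [affS_sub_conj hm, affS_sub_conj hm, hy2]
  · intro x hx r hr hxR
    rw [affK_eq hm, ← Homeomorph.preimage_frontier] at hx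
    obtain ⟨y, hy1, hy2⟩ := h.nd _ hx (‖m‖ * r) (by positivity) (hin2 x r hxR)
    obtain ⟨ζ, rfl⟩ := exists_aff_eq z₀ hm y
    rw [affHomeo_apply, norm_aff_sub] at hy1
    refine ⟨ζ, le_of_mul_le_mul_left hy1 hm', ?_⟩
    rw [affU, le_div_iff₀ hm']
    linarith
  · intro z hz hzR
    rw [affK_eq hm, ← Homeomorph.preimage_interior] at hz
    have h1 := h.loc _ hz (hin z hzR)
    have h2 := ((affHomeo z₀ hm).continuous.tendsto z).eventually h1
    filter_upwards [h2] with w hw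
    rw [affS_sub_conj hm, affS_sub_conj hm, ← affHomeo_apply hm, ← affHomeo_apply hm, hw]

lemma Glob.aff (h : Glob c U S K) (z₀ : ℂ) (hm : m ≠ 0) :
    Glob c (affU z₀ m U) (affS z₀ m S) (affK z₀ m K) :=
  fun R => (h (‖z₀‖ + ‖m‖ * R)).aff hm le_rfl

end Affine

section Limit

variable {ι : Type*} {l : Ultrafilter ι}

/-- Limit of a family of sets along an ultrafilter. -/
def limK (l : Ultrafilter ι) (K : ι → Set ℂ) : Set ℂ :=
  {x | ∀ ε > 0, ∀ᶠ n in (l : Filter ι), ∃ y ∈ K n, ‖y - x‖ < ε}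

lemma exists_tendsto_of_bounded {E : Type*} [NormedAddCommGroup E] [ProperSpace E] {x : ι → E}
    {C : ℝ} (h : ∀ᶠ n in (l : Filter ι), ‖x n‖ ≤ C) :
    ∃ a, ‖a‖ ≤ C ∧ Tendsto x l (𝓝 a) := by
  have hK : IsCompact (closedBall (0 : E) C) := isCompact_closedBall _ _
  obtain ⟨a, ha, hl⟩ := hK.ultrafilter_le_nhds (l.map x) (by
    rw [Ultrafilter.coe_map, le_principal_iff, mem_map]
    filter_upwards [h] with n hn
    simpa using hn)
  exact ⟨a, by simpa using ha, hl⟩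

lemma mem_limK_of_tendsto {K : ι → Set ℂ} {x : ι → ℂ} {a : ℂ}
    (hx : ∀ᶠ n in (l : Filter ι), x n ∈ K n) (ha : Tendsto x l (𝓝 a)) : a ∈ limK l K := by
  intro ε hε
  filter_upwards [hx, ha.eventually (ball_mem_nhds a hε)] with n h1 h2
  exact ⟨x n, h1, by simpa [dist_eq_norm] using h2⟩

lemma exists_of_notMem_limK {K : ι → Set ℂ} {x : ℂ} (hx : x ∉ limK l K) :
    ∃ ε > 0, ∀ᶠ n in (l : Filter ι), ∀ y ∈ K n, ε ≤ ‖y - x‖ := by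
  simp only [limK, mem_ofPred_eq, not_forall] at hx
  obtain ⟨ε, hε, h⟩ := hx
  refine ⟨ε, hε, ?_⟩
  rw [← Ultrafilter.eventually_not] at h
  filter_upwards [h] with n hn y hy
  by_contra hlt
  exact hn ⟨y, hy, not_le.1 hlt⟩

lemma exists_seq_of_mem_limK {K : ι → Set ℂ} {a : ℂ} (hK : ∀ᶠ n in (l : Filter ι), IsClosed (K n))
    (ha : a ∈ limK l K) :
    ∃ x : ι → ℂ, (∀ᶠ n in (l : Filter ι), x n ∈ K n) ∧ Tendsto x l (𝓝 a) := by
  have h1 : ∀ᶠ n in (l : Filter ι), ∃ y, y ∈ K n ∧ ∀ z ∈ K n, dist a y ≤ dist a z := by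
    filter_upwards [ha 1 one_pos, hK] with n hn hcl
    obtain ⟨y, hy, -⟩ := hn
    obtain ⟨w, hw, hw2⟩ := hcl.exists_infDist_eq_dist ⟨y, hy⟩ a
    exact ⟨w, hw, fun z hz => hw2 ▸ infDist_le_dist_of_mem hz⟩
  obtain ⟨x, hx⟩ := h1.choice
  refine ⟨x, hx.mono fun n hn => hn.1, ?_⟩
  rw [Metric.tendsto_nhds]
  intro ε hε
  filter_upwards [hx, ha ε hε] with n hn hy
  obtain ⟨y, hy, hy2⟩ := hy
  rw [dist_comm]
  refine (hn.2 y hy).trans_lt ?_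
  rwa [dist_comm, dist_eq_norm]

lemma isClosed_limK (K : ι → Set ℂ) : IsClosed (limK l K) := by
  rw [← isOpen_compl_iff, Metric.isOpen_iff]
  intro x hx
  obtain ⟨ε, hε, h⟩ := exists_of_notMem_limK hx
  refine ⟨ε / 2, by positivity, fun y hy hy2 => ?_⟩
  obtain ⟨n, hn1, k, hk, hk2⟩ := (h.and (hy2 (ε / 2) (by positivity))).exists
  have h3 := hn1 k hk
  rw [mem_ball, dist_eq_norm] at hy
  have : ‖k - x‖ ≤ ‖k - y‖ + ‖y - x‖ := by
    calc _ = ‖(k - y) + (y - x)‖ := by ring_nf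
      _ ≤ _ := norm_add_le _ _
  linarith

lemma tendstoLocallyUniformlyOn_of_lipschitz {F : ι → ℂ → ℂ} {G : ℂ → ℂ} {B : Set ℂ} {C : ℝ}
    (hC : 0 < C)
    (hL : ∀ᶠ n in (l : Filter ι), ∀ x ∈ B, ∀ y ∈ B, ‖F n x - F n y‖ ≤ C * ‖x - y‖)
    (hp : ∀ x ∈ B, Tendsto (fun n => F n x) l (𝓝 (G x))) :
    TendstoLocallyUniformlyOn F G l B := by
  have hG : ∀ x ∈ B, ∀ y ∈ B, ‖G x - G y‖ ≤ C * ‖x - y‖ := by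
    intro x hx y hy
    refine le_of_tendsto ((hp x hx).sub (hp y hy)).norm ?_
    filter_upwards [hL] with n hn using hn x hx y hy
  rw [Metric.tendstoLocallyUniformlyOn_iff]
  intro ε hε x hx
  refine ⟨ball x (ε / (3 * C)) ∩ B, inter_mem (mem_nhdsWithin_of_mem_nhds
    (ball_mem_nhds x (by positivity))) self_mem_nhdsWithin, ?_⟩
  filter_upwards [hL, (hp x hx).eventually (ball_mem_nhds (G x) (show 0 < ε / 3 by positivity))]
    with n hn hn2 y hy
  have hyx : ‖y - x‖ < ε / (3 * C) := by simpa [dist_eq_norm] using hy.1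
  have h1 : C * ‖y - x‖ < ε / 3 := by
    rw [lt_div_iff₀ (by positivity)] at hyx
    linarith
  have a1 := hG y hy.2 x hx
  have a2 := hn x hx y hy.2
  rw [norm_sub_rev x y] at a2
  have a3 : ‖F n x - G x‖ < ε / 3 := by simpa [dist_eq_norm] using hn2
  rw [dist_eq_norm]
  calc ‖G y - F n y‖ = ‖(G y - G x) - (F n x - G x) + (F n x - F n y)‖ := by ring_nf
    _ ≤ ‖G y - G x‖ + ‖F n x - G x‖ + ‖F n x - F n y‖ :=
      (norm_add_le _ _).trans (by gcongr; exact norm_sub_le _ _)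
    _ < ε := by linarith

variable {U : ι → ℂ → ℝ} {K : ι → Set ℂ} {U' : ℂ → ℝ}

lemma Base.tendsto_diag (hB : ∀ ρ, ∀ᶠ n in (l : Filter ι), Base ρ (U n) (K n))
    (hU : ∀ x, Tendsto (fun n => U n x) l (𝓝 (U' x))) {x : ι → ℂ} {a : ℂ}
    (hx : Tendsto x l (𝓝 a)) : Tendsto (fun n => U n (x n)) l (𝓝 (U' a)) := by
  have h1 : Tendsto (fun n => U n (x n) - U n a) l (𝓝 0) := by
    have h2 : Tendsto (fun n => 5 * ‖x n - a‖) l (𝓝 0) := by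
      have := (tendsto_iff_norm_sub_tendsto_zero.1 hx).const_mul 5
      simpa using this
    refine squeeze_zero_norm' ?_ h2
    filter_upwards [hB (‖a‖ + 1), hx.eventually (ball_mem_nhds a one_pos)] with n hn hxn
    have hxn' : ‖x n - a‖ < 1 := by simpa [dist_eq_norm] using hxn
    refine hn.lip _ _ ?_ (by linarith)
    calc ‖x n‖ = ‖(x n - a) + a‖ := by ring_nf
      _ ≤ ‖x n - a‖ + ‖a‖ := norm_add_le _ _
      _ < ‖a‖ + 1 := by linarith
  simpa using h1.add (hU a)

lemma Base.lim_harmonic (hB : ∀ ρ, ∀ᶠ n in (l : Filter ι), Base ρ (U n) (K n))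
    (hU : ∀ x, Tendsto (fun n => U n x) l (𝓝 (U' x))) {z : ℂ} (hz : z ∉ limK l K) :
    HarmonicAt U' z ∧ Tendsto (fun n => cgrad (U n) z) l (𝓝 (cgrad U' z)) := by
  obtain ⟨ε, hε, hev⟩ := exists_of_notMem_limK hz
  have hball : ∀ w ∈ ball z ε, ‖w‖ < ‖z‖ + ε := by
    intro w hw
    rw [mem_ball, dist_eq_norm] at hw
    calc ‖w‖ = ‖(w - z) + z‖ := by ring_nf
      _ ≤ ‖w - z‖ + ‖z‖ := norm_add_le _ _
      _ < ‖z‖ + ε := by linarith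
  have h1 : ∀ᶠ n in (l : Filter ι), ∃ f : ℂ → ℂ,
      (∀ w ∈ ball z ε, HasDerivAt f (cgrad (U n) w) w) ∧
      (∀ w ∈ ball z ε, U n w = (f w).re) ∧ (0 < ε → f z = U n z) ∧
      (∀ w ∈ ball z ε, ‖cgrad (U n) w‖ ≤ 5) := by
    filter_upwards [hev, hB (‖z‖ + ε)] with n hn hb
    have hharm : HarmonicOnNhd (U n) (ball z ε) := by
      intro w hw
      refine hb.harm w (hball w hw) fun hwK => ?_
      have := hn w hwK
      rw [mem_ball, dist_eq_norm] at hw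
      linarith
    obtain ⟨f, hf1, hf2, hf3⟩ := HarmonicOnNhd.exists_hasDerivAt_ball hharm
    refine ⟨f, hf1, hf2, hf3, fun w hw => ?_⟩
    apply norm_cgrad_le_of_lipschitz (by norm_num)
    filter_upwards [isOpen_ball.mem_nhds hw] with x hx
    exact hb.lip x w (hball x hx) (hball w hw)
  obtain ⟨f, hf⟩ := h1.choice
  have hlip : ∀ᶠ n in (l : Filter ι), ∀ x ∈ ball z ε, ∀ y ∈ ball z ε,
      ‖f n x - f n y‖ ≤ 5 * ‖x - y‖ := by
    filter_upwards [hf] with n hn x hx y hy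
    exact (convex_ball z ε).norm_image_sub_le_of_norm_hasDerivWithin_le
      (fun w hw => (hn.1 w hw).hasDerivWithinAt) hn.2.2.2 hy hx
  have hlim : ∀ x : ℂ, ∃ a, x ∈ ball z ε → Tendsto (fun n => f n x) l (𝓝 a) := by
    intro x
    by_cases hx : x ∈ ball z ε
    · obtain ⟨a, -, ha⟩ := exists_tendsto_of_bounded (l := l) (x := fun n => f n x)
        (C := |U' z| + 1 + 5 * ε) (by
          filter_upwards [hf, hlip, (hU z).abs.eventually (gt_mem_nhds (lt_add_one |U' z|))]
            with n hn hn2 hn3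
          have h4 := hn2 x hx z (mem_ball_self hε)
          have hxz : ‖x - z‖ < ε := by simpa [dist_eq_norm] using hx
          have h5 : ‖f n z‖ = |U n z| := by rw [hn.2.2.1 hε]; simp
          calc ‖f n x‖ = ‖f n z + (f n x - f n z)‖ := by ring_nf
            _ ≤ ‖f n z‖ + ‖f n x - f n z‖ := norm_add_le _ _
            _ ≤ |U' z| + 1 + 5 * ε := by
              rw [h5]
              have : 5 * ‖x - z‖ ≤ 5 * ε := by linarith
              linarith)
      exact ⟨a, fun _ => ha⟩
    · exact ⟨0, fun h => absurd h hx⟩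
  choose F hF using hlim
  have hloc : TendstoLocallyUniformlyOn f F l (ball z ε) :=
    tendstoLocallyUniformlyOn_of_lipschitz (by norm_num) hlip hF
  have hdf : ∀ᶠ n in (l : Filter ι), DifferentiableOn ℂ (f n) (ball z ε) := by
    filter_upwards [hf] with n hn w hw
    exact (hn.1 w hw).differentiableAt.differentiableWithinAt
  have hdF : DifferentiableOn ℂ F (ball z ε) := hloc.differentiableOn hdf isOpen_ball
  have hre : ∀ w ∈ ball z ε, U' w = (F w).re := by
    intro w hw
    refine tendsto_nhds_unique (hU w) ?_
    have h2 := (continuous_re.tendsto _).comp (hF w hw)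
    refine h2.congr' ?_
    filter_upwards [hf] with n hn
    simp [hn.2.1 w hw]
  have hevz : U' =ᶠ[𝓝 z] fun w => (F w).re := by
    filter_upwards [ball_mem_nhds z hε] with w hw using hre w hw
  refine ⟨?_, ?_⟩
  · rw [InnerProductSpace.harmonicAt_congr_nhds hevz]
    exact harmonicAt_re_of_differentiableOn isOpen_ball hdF (mem_ball_self hε)
  · have hd := (hdF.differentiableAt (ball_mem_nhds z hε)).hasDerivAt
    rw [cgrad_eq_of_hasDerivAt hd hevz]
    have h3 := (hloc.deriv hdf isOpen_ball).tendsto_at (mem_ball_self hε)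
    refine h3.congr' ?_
    filter_upwards [hf] with n hn
    exact (hn.1 z (mem_ball_self hε)).deriv

lemma norm_le_of_norm_sub_le {x a : ℂ} {r : ℝ} (h : ‖x - a‖ ≤ r) : ‖x‖ ≤ ‖a‖ + r := by
  calc ‖x‖ = ‖(x - a) + a‖ := by ring_nf
    _ ≤ ‖x - a‖ + ‖a‖ := norm_add_le _ _
    _ ≤ _ := by linarith

lemma Base.lim (hB : ∀ ρ, ∀ᶠ n in (l : Filter ι), Base ρ (U n) (K n))
    (hU : ∀ x, Tendsto (fun n => U n x) l (𝓝 (U' x))) (R : ℝ) : Base R U' (limK l K) := by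
  have hcl : ∀ᶠ n in (l : Filter ι), IsClosed (K n) := (hB 0).mono fun n hn => hn.closed
  refine ⟨isClosed_limK K, ?_, ?_, ?_, ?_, ?_⟩
  · intro z hz
    refine ge_of_tendsto (hU z) ?_
    filter_upwards [hB R] with n hn using hn.nonneg z hz
  · intro z hz hzR
    obtain ⟨x, hx, hxz⟩ := exists_seq_of_mem_limK hcl hz
    refine tendsto_nhds_unique (Base.tendsto_diag hB hU hxz) ?_
    refine tendsto_const_nhds.congr' ?_
    have h2 : ∀ᶠ n in (l : Filter ι), ‖x n‖ < R := hxz.norm.eventually (gt_mem_nhds hzR)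
    filter_upwards [hB R, hx, h2] with n hn h1 h2 using (hn.zero _ h1 h2).symm
  · intro x y hx hy
    refine le_of_tendsto ((hU x).sub (hU y)).abs ?_
    filter_upwards [hB R] with n hn using hn.lip x y hx hy
  · intro z _ hz
    exact (Base.lim_harmonic hB hU hz).1
  · intro p ρ' ρ t h1 h2 h3 h4 h5 h6 y hy hyp
    have hρ : 0 < ρ := h1.trans h2
    -- nearest points of `K n` to `p`
    obtain ⟨x, hx, hxy⟩ := exists_seq_of_mem_limK hcl hy
    have h7 : ∀ᶠ n in (l : Filter ι), ∃ k, k ∈ K n ∧ ∀ z ∈ K n, ‖k - p‖ ≤ ‖z - p‖ := by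
      filter_upwards [hx, hcl] with n hn hc
      obtain ⟨k, hk, hk2⟩ := hc.exists_infDist_eq_dist ⟨_, hn⟩ p
      refine ⟨k, hk, fun z hz => ?_⟩
      have := infDist_le_dist_of_mem (x := p) hz
      rwa [hk2, dist_comm, dist_eq_norm, dist_comm, dist_eq_norm] at this
    obtain ⟨k, hk⟩ := h7.choice
    have hxp : Tendsto (fun n => ‖x n - p‖) l (𝓝 ρ) := hyp ▸ (hxy.sub_const p).norm
    have hkb : ∀ᶠ n in (l : Filter ι), ‖k n‖ ≤ ‖p‖ + (ρ + 1) := by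
      filter_upwards [hk, hx, hxp.eventually (gt_mem_nhds (lt_add_one ρ))] with n hn hxn hn2
      exact norm_le_of_norm_sub_le ((hn.2 _ hxn).trans hn2.le)
    obtain ⟨a, -, ha⟩ := exists_tendsto_of_bounded hkb
    have haK : a ∈ limK l K := mem_limK_of_tendsto (hk.mono fun n hn => hn.1) ha
    have hkp : Tendsto (fun n => ‖k n - p‖) l (𝓝 ‖a - p‖) := (ha.sub_const p).norm
    have haρ : ‖a - p‖ = ρ := by
      refine le_antisymm (le_of_tendsto_of_tendsto hkp hxp ?_) (h5 a haK)
      filter_upwards [hk, hx] with n hn hxn using hn.2 _ hxn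
    rw [haρ] at hkp
    obtain ⟨t', ht1, ht2⟩ := exists_between h3
    have hlog : 0 < Real.log (ρ / ρ') := Real.log_pos (by rwa [one_lt_div h1])
    have hL : Tendsto (fun n => t' * Real.log (‖k n - p‖ / ρ')) l (𝓝 (t' * Real.log (ρ / ρ'))) := by
      apply Tendsto.const_mul
      exact (Real.continuousAt_log (by positivity)).tendsto.comp (hkp.div_const ρ')
    have h8 : ∀ᶠ n in (l : Filter ι), ∀ z, ‖z - p‖ = ρ' → t' * Real.log (‖k n - p‖ / ρ') ≤ U n z := by
      by_contra hcon
      rw [← Ultrafilter.eventually_not] at hcon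
      have h9 : ∀ᶠ n in (l : Filter ι), ∃ z, ‖z - p‖ = ρ' ∧ U n z < t' * Real.log (‖k n - p‖ / ρ') := by
        filter_upwards [hcon] with n hn
        push Not at hn
        exact hn
      obtain ⟨z, hz⟩ := h9.choice
      obtain ⟨b, -, hb⟩ := exists_tendsto_of_bounded (l := l) (x := z) (C := ‖p‖ + ρ')
        (hz.mono fun n hn => norm_le_of_norm_sub_le hn.1.le)
      have hbp : ‖b - p‖ = ρ' := by
        refine tendsto_nhds_unique (hb.sub_const p).norm ?_
        refine tendsto_const_nhds.congr' ?_
        filter_upwards [hz] with n hn using hn.1.symm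
      have h10 : U' b ≤ t' * Real.log (ρ / ρ') :=
        le_of_tendsto_of_tendsto (Base.tendsto_diag hB hU hb) hL (hz.mono fun n hn => hn.2.le)
      have h11 := h6 b hbp
      nlinarith
    obtain ⟨n, hn, hkn, h8n, h12, h13, h14⟩ := ((hB R).and (hk.and (h8.and
      ((hkp.eventually (lt_mem_nhds h2)).and ((hkp.eventually (gt_mem_nhds ht1)).and
      ((hkp.const_add ‖p‖).eventually (gt_mem_nhds h4))))))).exists
    exact hn.visc p ρ' ‖k n - p‖ t' h1 h12 h13 h14 hkn.2 h8n (k n) hkn.1 rfl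

variable {S : ι → ℂ → ℂ} {S' : ℂ → ℂ} {c : ℝ}

lemma IsPreconnected.eq_of_eventually_eq {α : Type*} {A : Set ℂ} (hA : IsPreconnected A) {F : ℂ → α}
    (hF : ∀ z ∈ A, ∀ᶠ w in 𝓝 z, F w = F z) {x y : ℂ} (hx : x ∈ A) (hy : y ∈ A) : F x = F y := by
  let _ : TopologicalSpace α := ⊥
  have : DiscreteTopology α := ⟨rfl⟩
  refine hA.constant (f := F) (fun z hz => ?_) hx hy
  exact (tendsto_nhds_of_eventually_eq (hF z hz)).mono_left nhdsWithin_le_nhds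

lemma IsPreconnected.exists_mem_frontier {A B : Set ℂ} (hB : IsPreconnected B) {a b : ℂ}
    (haB : a ∈ B) (hbB : b ∈ B) (ha : a ∈ A) (hb : b ∉ A) : ∃ x ∈ B, x ∈ frontier A := by
  by_contra! hcon
  have hcov : B ⊆ interior A ∪ (closure A)ᶜ := by
    intro x hx
    by_contra hxc
    rw [mem_union, not_or, mem_compl_iff, not_not] at hxc
    exact hcon x hx ⟨hxc.2, hxc.1⟩
  have hai : a ∈ interior A := (hcov haB).resolve_right fun h => h (subset_closure ha)
  have hbi : b ∈ (closure A)ᶜ := (hcov hbB).resolve_left fun h => hb (interior_subset h)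
  obtain ⟨x, -, hx1, hx2⟩ := hB _ _ isOpen_interior isClosed_closure.isOpen_compl hcov
    ⟨a, haB, hai⟩ ⟨b, hbB, hbi⟩
  exact hx2 (subset_closure (interior_subset hx1))

lemma exists_frontier_mem_segment {A : Set ℂ} {a b : ℂ} (ha : a ∈ A) (hb : b ∉ A) :
    ∃ x ∈ segment ℝ a b, x ∈ frontier A :=
  (convex_segment a b).isPreconnected.exists_mem_frontier (left_mem_segment ℝ a b)
    (right_mem_segment ℝ a b) ha hb

lemma Full.interior_stable (hc : 0 < c)
    (hF : ∀ ρ, ∀ ε > 0, ∀ᶠ n in (l : Filter ι), Full ρ c (1 + ε) (U n) (S n) (K n))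
    (hU : ∀ x, Tendsto (fun n => U n x) l (𝓝 (U' x))) {q : ℂ} {δ : ℝ} (hδ : 0 < δ)
    (hq : ball q (2 * δ) ⊆ limK l K) : ∀ᶠ n in (l : Filter ι), ball q δ ⊆ K n := by
  have hB : ∀ ρ, ∀ᶠ n in (l : Filter ι), Base ρ (U n) (K n) := fun ρ =>
    (hF ρ 1 one_pos).mono fun n hn => hn.toBase
  have hcl : ∀ᶠ n in (l : Filter ι), IsClosed (K n) := (hB 0).mono fun n hn => hn.closed
  by_contra hcon
  rw [← Ultrafilter.eventually_not] at hcon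
  obtain ⟨k, hk, hkq⟩ := exists_seq_of_mem_limK hcl (hq (mem_ball_self (by positivity)))
  have h1 : ∀ᶠ n in (l : Filter ι), ∃ y, ‖y - q‖ ≤ 3 / 2 * δ ∧ c * (δ / 2) ≤ U n y := by
    filter_upwards [hcon, hk, hkq.eventually (ball_mem_nhds q hδ), hF (‖q‖ + 2 * δ) 1 one_pos]
      with n hn hkn hkb hf
    rw [not_subset] at hn
    obtain ⟨w, hw, hwK⟩ := hn
    obtain ⟨x, hx, hxf⟩ := exists_frontier_mem_segment hkn hwK
    have hxb : x ∈ ball q δ := (convex_ball q δ).segment_subset hkb hw hx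
    rw [mem_ball, dist_eq_norm] at hxb
    obtain ⟨y, hy1, hy2⟩ := hf.nd x hxf (δ / 2) (by positivity)
      (by linarith [norm_le_of_norm_sub_le hxb.le])
    refine ⟨y, ?_, hy2⟩
    calc ‖y - q‖ = ‖(y - x) + (x - q)‖ := by ring_nf
      _ ≤ ‖y - x‖ + ‖x - q‖ := norm_add_le _ _
      _ ≤ _ := by linarith
  obtain ⟨y, hy⟩ := h1.choice
  obtain ⟨a, -, ha⟩ := exists_tendsto_of_bounded (l := l) (x := y) (C := ‖q‖ + 3 / 2 * δ)
    (hy.mono fun n hn => norm_le_of_norm_sub_le hn.1)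
  have haq : ‖a - q‖ ≤ 3 / 2 * δ :=
    le_of_tendsto (ha.sub_const q).norm (hy.mono fun n hn => hn.1)
  have haK : a ∈ limK l K := hq (by rw [mem_ball, dist_eq_norm]; linarith)
  have h0 : U' a = 0 := (Base.lim hB hU (‖a‖ + 1)).zero a haK (by linarith)
  have h2 : c * (δ / 2) ≤ U' a :=
    ge_of_tendsto (Base.tendsto_diag hB hU ha) (hy.mono fun n hn => hn.2)
  have : 0 < c * (δ / 2) := by positivity
  linarith

lemma Full.tendsto_diag_S
    (hF : ∀ ρ, ∀ ε > 0, ∀ᶠ n in (l : Filter ι), Full ρ c (1 + ε) (U n) (S n) (K n))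
    (hS : ∀ x, Tendsto (fun n => S n x) l (𝓝 (S' x))) {x : ι → ℂ} {a : ℂ}
    (hx : Tendsto x l (𝓝 a)) : Tendsto (fun n => S n (x n)) l (𝓝 (S' a)) := by
  have h1 : Tendsto (fun n => S n (x n) - S n a) l (𝓝 0) := by
    have h2 : Tendsto (fun n => (1 + 1) * ‖x n - a‖) l (𝓝 0) := by
      have := (tendsto_iff_norm_sub_tendsto_zero.1 hx).const_mul (1 + 1)
      simpa using this
    refine squeeze_zero_norm' ?_ h2
    filter_upwards [hF (‖a‖ + 1) 1 one_pos, hx.eventually (ball_mem_nhds a one_pos)] with n hn hxn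
    have hxn' : ‖x n - a‖ < 1 := by simpa [dist_eq_norm] using hxn
    refine hn.slip _ _ ?_ (by linarith)
    calc ‖x n‖ = ‖(x n - a) + a‖ := by ring_nf
      _ ≤ ‖x n - a‖ + ‖a‖ := norm_add_le _ _
      _ < ‖a‖ + 1 := by linarith
  simpa using h1.add (hS a)

theorem Full.lim (hc : 0 < c)
    (hF : ∀ ρ, ∀ ε > 0, ∀ᶠ n in (l : Filter ι), Full ρ c (1 + ε) (U n) (S n) (K n))
    (hU : ∀ x, Tendsto (fun n => U n x) l (𝓝 (U' x)))
    (hS : ∀ x, Tendsto (fun n => S n x) l (𝓝 (S' x))) : Glob c U' S' (limK l K) := by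
  intro R
  have hB : ∀ ρ, ∀ᶠ n in (l : Filter ι), Base ρ (U n) (K n) := fun ρ =>
    (hF ρ 1 one_pos).mono fun n hn => hn.toBase
  have hcl : ∀ᶠ n in (l : Filter ι), IsClosed (K n) := (hB 0).mono fun n hn => hn.closed
  have hlim := Base.lim hB hU
  refine { hlim R with slip := ?_, sder := ?_, reach := ?_, nd := ?_, loc := ?_ }
  · intro x y hx hy
    have h1 : ∀ ε > 0, ‖S' x - S' y‖ ≤ (1 + ε) * ‖x - y‖ := by
      intro ε hε
      refine le_of_tendsto ((hS x).sub (hS y)).norm ?_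
      filter_upwards [hF R ε hε] with n hn using hn.slip x y hx hy
    refine le_of_forall_pos_le_add fun δ hδ => ?_
    have h2 := h1 (δ / (‖x - y‖ + 1)) (by positivity)
    have h3 : δ / (‖x - y‖ + 1) * ‖x - y‖ ≤ δ := by
      rw [div_mul_eq_mul_div, div_le_iff₀ (by positivity)]
      nlinarith [norm_nonneg (x - y)]
    nlinarith
  · intro z _ hz
    obtain ⟨ε, hε, hev⟩ := exists_of_notMem_limK hz
    have hball : ∀ w ∈ ball z ε, ‖w‖ < ‖z‖ + ε := by
      intro w hw
      rw [mem_ball, dist_eq_norm] at hw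
      calc ‖w‖ = ‖(w - z) + z‖ := by ring_nf
        _ ≤ ‖w - z‖ + ‖z‖ := norm_add_le _ _
        _ < ‖z‖ + ε := by linarith
    have hder : ∀ᶠ n in (l : Filter ι), ∀ w ∈ ball z ε,
        HasDerivAt (S n) (-(cgrad (U n) w) ^ 2) w := by
      filter_upwards [hev, hF (‖z‖ + ε) 1 one_pos] with n hn hf w hw
      refine hf.sder w (hball w hw) fun hwK => ?_
      have := hn w hwK
      rw [mem_ball, dist_eq_norm] at hw
      linarith
    have hdf : ∀ᶠ n in (l : Filter ι), DifferentiableOn ℂ (S n) (ball z ε) := by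
      filter_upwards [hder] with n hn w hw
      exact (hn w hw).differentiableAt.differentiableWithinAt
    have hloc : TendstoLocallyUniformlyOn S S' l (ball z ε) := by
      refine tendstoLocallyUniformlyOn_of_lipschitz (C := 1 + 1) (by norm_num) ?_ fun x _ => hS x
      filter_upwards [hF (‖z‖ + ε) 1 one_pos] with n hf x hx y hy
      exact hf.slip x y (hball x hx) (hball y hy)
    have hdF : DifferentiableOn ℂ S' (ball z ε) := hloc.differentiableOn hdf isOpen_ball
    have hd := (hdF.differentiableAt (ball_mem_nhds z hε)).hasDerivAt
    have h3 := (hloc.deriv hdf isOpen_ball).tendsto_at (mem_ball_self hε)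
    have h4 : Tendsto (fun n => -(cgrad (U n) z) ^ 2) l (𝓝 (-(cgrad U' z) ^ 2)) :=
      ((Base.lim_harmonic hB hU hz).2.pow 2).neg
    have h5 : deriv S' z = -(cgrad U' z) ^ 2 := by
      refine tendsto_nhds_unique h3 (h4.congr' ?_)
      filter_upwards [hder] with n hn
      exact (hn z (mem_ball_self hε)).deriv.symm
    rwa [h5] at hd
  · intro x hx ρ hρ _
    obtain ⟨k, hk, hkx⟩ := exists_seq_of_mem_limK hcl hx
    have h1 : ∀ᶠ n in (l : Filter ι), ∃ y, y ∈ K n ∧ ‖y - k n‖ = ρ ∧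
        S n y - conj y = S n (k n) - conj (k n) := by
      filter_upwards [hk, hF (‖x‖ + ρ + 1) 1 one_pos,
        hkx.norm.eventually (gt_mem_nhds (lt_add_one ‖x‖))] with n hn hf hn2
      exact hf.reach (k n) hn ρ hρ (by linarith)
    obtain ⟨y, hy⟩ := h1.choice
    obtain ⟨a, -, ha⟩ := exists_tendsto_of_bounded (l := l) (x := y) (C := ‖x‖ + 1 + ρ) (by
      filter_upwards [hy, hkx.norm.eventually (gt_mem_nhds (lt_add_one ‖x‖))] with n hn hn2
      linarith [norm_le_of_norm_sub_le hn.2.1.le])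
    refine ⟨a, mem_limK_of_tendsto (hy.mono fun n hn => hn.1) ha, ?_, ?_⟩
    · refine tendsto_nhds_unique (ha.sub hkx).norm (tendsto_const_nhds.congr' ?_)
      filter_upwards [hy] with n hn using hn.2.1.symm
    · have h2 := (Full.tendsto_diag_S hF hS ha).sub ((continuous_conj.tendsto a).comp ha)
      have h3 := (Full.tendsto_diag_S hF hS hkx).sub ((continuous_conj.tendsto x).comp hkx)
      refine tendsto_nhds_unique h2 (h3.congr' ?_)
      filter_upwards [hy] with n hn using hn.2.2.symm
  · intro x hx r hr _
    have hxK : x ∈ limK l K := (isClosed_limK K).frontier_subset hx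
    have hU'c : Continuous U' := by
      refine (LipschitzWith.of_dist_le_mul (K := 5) fun a b => ?_).continuous
      rw [Real.dist_eq, dist_eq_norm]
      exact (hlim (max ‖a‖ ‖b‖ + 1)).lip a b (by linarith [le_max_left ‖a‖ ‖b‖])
        (by linarith [le_max_right ‖a‖ ‖b‖])
    obtain ⟨m, hm, hmax⟩ := (isCompact_closedBall x r).exists_isMaxOn
      ⟨x, mem_closedBall_self hr.le⟩ hU'c.continuousOn
    refine ⟨m, by simpa [dist_eq_norm] using hm, ?_⟩
    obtain ⟨k, hk, hkx⟩ := exists_seq_of_mem_limK hcl hxK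
    have key : ∀ δ, 0 < δ → δ < r → c * (r - δ) ≤ U' m := by
      intro δ hδ hδr
      have hx2 : x ∈ closure (limK l K)ᶜ := by
        rw [frontier_eq_closure_inter_closure] at hx; exact hx.2
      obtain ⟨w, hw, hwx⟩ := Metric.mem_closure_iff.1 hx2 δ hδ
      obtain ⟨ε, hε, hev⟩ := exists_of_notMem_limK hw
      have h1 : ∀ᶠ n in (l : Filter ι), ∃ y, ‖y - x‖ ≤ r ∧ c * (r - δ) ≤ U n y := by
        filter_upwards [hk, hkx.eventually (ball_mem_nhds x hδ), hev,
          hF (‖x‖ + r + 1) 1 one_pos] with n hn hn2 hn3 hf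
        have hwK : w ∉ K n := fun h => by
          have := hn3 w h
          simp at this
          linarith
        obtain ⟨y, hy, hyf⟩ := exists_frontier_mem_segment hn hwK
        have hyb : y ∈ ball x δ := (convex_ball x δ).segment_subset hn2
          (by rwa [mem_ball, dist_comm]) hy
        rw [mem_ball, dist_eq_norm] at hyb
        obtain ⟨v, hv1, hv2⟩ := hf.nd y hyf (r - δ) (by linarith)
          (by linarith [norm_le_of_norm_sub_le hyb.le])
        refine ⟨v, ?_, hv2⟩
        calc ‖v - x‖ = ‖(v - y) + (y - x)‖ := by ring_nf
          _ ≤ ‖v - y‖ + ‖y - x‖ := norm_add_le _ _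
          _ ≤ r := by linarith
      obtain ⟨y, hy⟩ := h1.choice
      obtain ⟨a, -, ha⟩ := exists_tendsto_of_bounded (l := l) (x := y) (C := ‖x‖ + r)
        (hy.mono fun n hn => norm_le_of_norm_sub_le hn.1)
      have haq : ‖a - x‖ ≤ r :=
        le_of_tendsto (ha.sub_const x).norm (hy.mono fun n hn => hn.1)
      have h2 : c * (r - δ) ≤ U' a :=
        ge_of_tendsto (Base.tendsto_diag hB hU ha) (hy.mono fun n hn => hn.2)
      exact h2.trans (hmax (by rwa [mem_closedBall, dist_eq_norm]))
    refine le_of_forall_pos_le_add fun η hη => ?_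
    have h3 := key (min (r / 2) (η / c)) (by positivity)
      ((min_le_left _ _).trans_lt (by linarith))
    have h4 : c * min (r / 2) (η / c) ≤ η := by
      calc _ ≤ c * (η / c) := by gcongr; exact min_le_right _ _
        _ = η := by field_simp
    linarith
  · intro z hz _
    obtain ⟨ε, hε, hb⟩ := Metric.isOpen_iff.1 isOpen_interior z hz
    have hb2 : ball z (2 * (ε / 2)) ⊆ limK l K := by
      rw [mul_div_cancel₀ _ (by norm_num : (2 : ℝ) ≠ 0)]
      exact hb.trans interior_subset
    have hst := Full.interior_stable hc hF hU (by positivity : 0 < ε / 2) hb2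
    have hconst : ∀ᶠ n in (l : Filter ι), ∀ w ∈ ball z (ε / 2),
        S n w - conj w = S n z - conj z := by
      filter_upwards [hst, hF (‖z‖ + ε) 1 one_pos] with n hn hf w hw
      have h_int : ball z (ε / 2) ⊆ interior (K n) := interior_maximal hn isOpen_ball
      refine (convex_ball z (ε / 2)).isPreconnected.eq_of_eventually_eq
        (F := fun w => S n w - conj w) (fun x hx => ?_) hw (mem_ball_self (by positivity))
      refine hf.loc x (h_int hx) ?_
      rw [mem_ball, dist_eq_norm] at hx
      linarith [norm_le_of_norm_sub_le hx.le]
    filter_upwards [ball_mem_nhds z (by positivity : 0 < ε / 2)] with w hw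
    have h2 := (hS w).sub_const (conj w)
    have h3 := (hS z).sub_const (conj z)
    refine tendsto_nhds_unique h2 (h3.congr' ?_)
    filter_upwards [hconst] with n hn using (hn w hw).symm

end Limit
end

noncomputable section
open InnerProductSpace (HarmonicAt HarmonicOnNhd)
open scoped ComplexConjugate

/-- `Base` on every disk. -/
def GBase (U : ℂ → ℝ) (K : Set ℂ) : Prop := ∀ R, Base R U K

namespace GBase

variable {U : ℂ → ℝ} {K : Set ℂ}

lemma closed (h : GBase U K) : IsClosed K := (h 0).closed
lemma nonneg (h : GBase U K) (z : ℂ) : 0 ≤ U z := (h (‖z‖ + 1)).nonneg z (by linarith)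
lemma zero (h : GBase U K) {z : ℂ} (hz : z ∈ K) : U z = 0 :=
  (h (‖z‖ + 1)).zero z hz (by linarith)
lemma lip (h : GBase U K) (x y : ℂ) : |U x - U y| ≤ 5 * ‖x - y‖ :=
  (h (max ‖x‖ ‖y‖ + 1)).lip x y (by linarith [le_max_left ‖x‖ ‖y‖])
    (by linarith [le_max_right ‖x‖ ‖y‖])
lemma harm (h : GBase U K) {z : ℂ} (hz : z ∉ K) : HarmonicAt U z :=
  (h (‖z‖ + 1)).harm z (by linarith) hz
lemma continuous (h : GBase U K) : Continuous U := by
  refine (LipschitzWith.of_dist_le_mul (K := 5) fun a b => ?_).continuous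
  rw [Real.dist_eq, dist_eq_norm]
  exact h.lip a b
lemma norm_cgrad_le_five (h : GBase U K) (z : ℂ) : ‖cgrad U z‖ ≤ 5 :=
  norm_cgrad_le_of_lipschitz (by norm_num) (Eventually.of_forall fun w => h.lip w z)

lemma eventually_notMem (h : GBase U K) {z : ℂ} (hz : z ∉ K) : ∀ᶠ w in 𝓝 z, w ∉ K :=
  h.closed.isOpen_compl.mem_nhds hz

lemma cgrad_eq_zero_of_zero (h : GBase U K) {z : ℂ} (h0 : U z = 0) : cgrad U z = 0 := by
  have : IsLocalMin U z := Eventually.of_forall fun w => h0 ▸ h.nonneg w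
  simp [cgrad, this.fderiv_eq_zero]

end GBase

lemma harmonicAt_re_mul_add (a : ℂ) (b : ℝ) (z : ℂ) : HarmonicAt (fun w => (a * w).re + b) z := by
  have : DifferentiableOn ℂ (fun w : ℂ => a * w + b) univ := by fun_prop
  have h := harmonicAt_re_of_differentiableOn isOpen_univ this (mem_univ z)
  simpa using h

lemma cgrad_re_mul_add (a : ℂ) (b : ℝ) (z : ℂ) : cgrad (fun w => (a * w).re + b) z = a := by
  have h : HasDerivAt (fun w : ℂ => a * w + b) a z := by
    simpa using ((hasDerivAt_id z).const_mul a).add_const (b : ℂ)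
  exact cgrad_eq_of_hasDerivAt h (Eventually.of_forall fun w => by simp)

lemma continuous_re_mul_add (a : ℂ) (b : ℝ) : Continuous fun w : ℂ => (a * w).re + b := by
  fun_prop

/-- Harmonic functions whose complex gradients agree near a point differ by a constant. -/
lemma HarmonicAt.eventually_eq_affine {U : ℂ → ℝ} {z a : ℂ} (hU : HarmonicAt U z)
    (ha : ∀ᶠ w in 𝓝 z, cgrad U w = a) :
    ∀ᶠ w in 𝓝 z, U w = (a * w).re + (U z - (a * z).re) := by
  obtain ⟨r, hr, hball⟩ := Metric.eventually_nhds_iff_ball.1 (hU.eventually.and ha)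
  obtain ⟨f, hf, hfU, hfz⟩ := HarmonicOnNhd.exists_hasDerivAt_ball (r := r)
    fun w hw => (hball w hw).1
  have key : ∀ w ∈ ball z r, f w - a * w = f z - a * z := by
    intro w hw
    refine isOpen_ball.is_const_of_deriv_eq_zero (f := fun w => f w - a * w)
      (convex_ball z r).isPreconnected ?_ ?_ hw (mem_ball_self hr)
    · intro x hx
      exact ((hf x hx).differentiableAt.sub (by fun_prop)).differentiableWithinAt
    · intro x hx
      have h1 : HasDerivAt (fun w => f w - a * w) (cgrad U x - a) x := by
        have h2 : HasDerivAt (fun w : ℂ => a * w) a x := by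
          simpa using (hasDerivAt_id x).const_mul a
        exact (hf x hx).sub h2
      rw [h1.deriv, (hball x hx).2]; simp
  filter_upwards [ball_mem_nhds z hr] with w hw
  have h1 : f w = a * w + (f z - a * z) := by linear_combination key w hw
  rw [hfU w hw, h1, add_re, sub_re, ← hfU z (mem_ball_self hr)]

/-- If the gradient attains its maximal modulus, the component is a half-plane on which the
function is affine. -/
theorem GBase.halfplane {U : ℂ → ℝ} {K : Set ℂ} (h : GBase U K) {m : ℝ} (hm : 0 < m)
    (hg : ∀ z, z ∉ K → ‖cgrad U z‖ ≤ m) {z₀ : ℂ} (hz₀ : z₀ ∉ K) (ha : ‖cgrad U z₀‖ = m) :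
    ∃ b : ℝ, 0 < (cgrad U z₀ * z₀).re + b ∧
      (∀ z, 0 < (cgrad U z₀ * z).re + b → z ∉ K ∧ U z = (cgrad U z₀ * z).re + b) ∧
      ∀ z, (cgrad U z₀ * z).re + b = 0 → z ∈ K := by
  set a := cgrad U z₀ with ha'
  have ha0 : a ≠ 0 := by rw [← norm_pos_iff, ha]; exact hm
  have hev : ∀ᶠ w in 𝓝 z₀, cgrad U w = a := by
    refine Complex.eventually_eq_of_isLocalMax_norm ?_ ?_
    · filter_upwards [h.eventually_notMem hz₀] with w hw
      exact HarmonicAt.differentiableAt_cgrad (h.harm hw)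
    · filter_upwards [h.eventually_notMem hz₀] with w hw
      simp only [Function.comp]
      rw [← ha', ha]
      exact hg w hw
  have haff := HarmonicAt.eventually_eq_affine (h.harm hz₀) hev
  set b := U z₀ - (a * z₀).re with hb
  have hbz : (a * z₀).re + b = U z₀ := by rw [hb]; ring
  have hUz : 0 < U z₀ := by
    refine lt_of_le_of_ne (h.nonneg z₀) fun h0 => ha0 ?_
    rw [ha', h.cgrad_eq_zero_of_zero h0.symm]
  have hcontl := continuous_re_mul_add a b
  set H : Set ℂ := {z | 0 < (a * z).re + b}
  have hHc : Convex ℝ H := by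
    have : H = {z | -b < (Complex.reCLM.comp ((ContinuousLinearMap.mul ℝ ℂ a))) z} := by
      ext z
      simp only [H, mem_ofPred_eq, ContinuousLinearMap.comp_apply, ContinuousLinearMap.mul_apply',
        reCLM_apply]
      constructor <;> intro h <;> linarith
    rw [this]
    exact convex_halfSpace_gt (LinearMap.isLinear _) _
  set W : Set ℂ := {z | z ∉ K ∧ U =ᶠ[𝓝 z] fun w => (a * w).re + b}
  have hWo : IsOpen W := h.closed.isOpen_compl.inter isOpen_setOfPred_eventually_nhds
  have hsub : H ⊆ W := by
    refine hHc.isPreconnected.subset_of_closure_inter_subset hWo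
      ⟨z₀, show 0 < (a * z₀).re + b by rw [hbz]; exact hUz, hz₀, haff⟩ ?_
    rintro z ⟨hzc, hzH⟩
    have hzeq : U z = (a * z).re + b := by
      have hcl : IsClosed {z | U z = (a * z).re + b} := isClosed_eq h.continuous hcontl
      exact closure_minimal (fun w hw => hw.2.self_of_nhds) hcl hzc
    have hzK : z ∉ K := fun hzK => by
      have := h.zero hzK
      have h2 : 0 < (a * z).re + b := hzH
      linarith
    refine ⟨hzK, ?_⟩
    obtain ⟨r, hr, hball⟩ := Metric.eventually_nhds_iff_ball.1 (h.eventually_notMem hzK)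
    obtain ⟨w, hw, hwr⟩ := Metric.mem_closure_iff.1 hzc r hr
    have heq := AnalyticOnNhd.eqOn_of_preconnected_of_eventuallyEq (𝕜 := ℝ) (f := U)
      (g := fun w => (a * w).re + b) (U := ball z r)
      (fun x hx => HarmonicAt.analyticAt (h.harm (hball x hx)))
      (fun x _ => HarmonicAt.analyticAt (harmonicAt_re_mul_add a b x))
      (convex_ball z r).isPreconnected (z₀ := w) (by rwa [mem_ball, dist_comm]) hw.2
    filter_upwards [ball_mem_nhds z hr] with x hx using heq hx
  refine ⟨b, by rw [hbz]; exact hUz, fun z hz => ⟨(hsub hz).1, (hsub hz).2.self_of_nhds⟩, ?_⟩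
  intro z hz
  by_contra hzK
  have hzH : z ∈ closure H := by
    rw [Metric.mem_closure_iff]
    intro ε hε
    refine ⟨z + (ε / (2 * m) : ℝ) * conj a, ?_, ?_⟩
    · have : (a * (z + (ε / (2 * m) : ℝ) * conj a)).re = (a * z).re + ε / (2 * m) * m ^ 2 := by
        rw [mul_add, add_re, mul_left_comm, mul_conj, normSq_eq_norm_sq, ha, ← ofReal_mul,
          ofReal_re]
      simp only [H, mem_ofPred_eq]
      rw [this]
      have : 0 < ε / (2 * m) * m ^ 2 := by positivity
      linarith
    · rw [dist_eq_norm]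
      simp only [sub_add_cancel_left, norm_neg, norm_mul, RCLike.norm_conj, ha, norm_real,
        Real.norm_eq_abs]
      rw [abs_of_pos (by positivity), div_mul_eq_mul_div, div_lt_iff₀ (by positivity)]
      nlinarith
  have hcont : ContinuousAt (cgrad U) z :=
    (HarmonicAt.differentiableAt_cgrad (h.harm hzK)).continuousAt
  have h1 : cgrad U z = a := by
    have : (𝓝[H] z).NeBot := mem_closure_iff_nhdsWithin_neBot.1 hzH
    refine tendsto_nhds_unique (l := 𝓝[H] z) (hcont.mono_left nhdsWithin_le_nhds)
      (tendsto_const_nhds.congr' ?_)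
    filter_upwards [self_mem_nhdsWithin] with w hw
    rw [cgrad_congr (hsub hw).2, cgrad_re_mul_add]
  have h2 : U z = 0 := by
    have hcl : IsClosed {z | U z = (a * z).re + b} := isClosed_eq h.continuous hcontl
    rw [← hz]
    exact closure_minimal (fun w hw => (hsub hw).2.self_of_nhds) hcl hzH
  exact ha0 (h1 ▸ h.cgrad_eq_zero_of_zero h2)

lemma GBase.cgrad_eq_zero_of_empty {U : ℂ → ℝ} (h : GBase U ∅) (z : ℂ) : cgrad U z = 0 := by
  rw [← norm_le_zero_iff]
  have key : ∀ ρ : ℝ, 0 < ρ → ‖cgrad U z‖ ≤ 2 * U z / ρ := fun ρ hρ =>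
    HarmonicOnNhd.norm_cgrad_le (fun w _ => h.harm (notMem_empty w)) (fun w _ => h.nonneg w) hρ
  refine ge_of_tendsto (x := atTop) (f := fun ρ : ℝ => 2 * U z / ρ) ?_ ?_
  · exact tendsto_const_nhds.div_atTop tendsto_id
  · filter_upwards [eventually_gt_atTop 0] with ρ hρ using key ρ hρ

lemma GBase.aff {U : ℂ → ℝ} {K : Set ℂ} (h : GBase U K) (z₀ : ℂ) {m : ℂ} (hm : m ≠ 0) :
    GBase (affU z₀ m U) (affK z₀ m K) :=
  fun R => (h (‖z₀‖ + ‖m‖ * R)).aff hm le_rfl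

lemma exists_norm_eq_infDist {K : Set ℂ} (hK : IsClosed K) (hne : K.Nonempty) (z : ℂ) :
    ∃ k ∈ K, ‖k - z‖ = infDist z K ∧ ∀ y ∈ K, infDist z K ≤ ‖y - z‖ := by
  obtain ⟨k, hk, hk2⟩ := hK.exists_infDist_eq_dist hne z
  refine ⟨k, hk, by rw [hk2, dist_comm, dist_eq_norm], fun y hy => ?_⟩
  rw [← dist_eq_norm, dist_comm]
  exact infDist_le_dist_of_mem hy

/-- A function affine of slope larger than one on a half-plane violates the viscosity
condition. -/
lemma GBase.slope_le_one {U : ℂ → ℝ} {K : Set ℂ} (h : GBase U K) {a : ℂ} {b : ℝ} (ha : 1 < ‖a‖)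
    (h1 : ∀ z, 0 < (a * z).re + b → z ∉ K ∧ U z = (a * z).re + b)
    (h2 : ∀ z, (a * z).re + b = 0 → z ∈ K) : False := by
  set m := ‖a‖ with hm
  have hm0 : (0 : ℝ) < m := by linarith
  have hm0' : (m : ℂ) ≠ 0 := by exact_mod_cast hm0.ne'
  have haa : a * conj a = (m : ℂ) ^ 2 := by rw [mul_conj, normSq_eq_norm_sq]; simp [hm]
  set y : ℂ := ((-b / m ^ 2 : ℝ) : ℂ) * conj a with hy
  set p : ℂ := y + ((1 / m : ℝ) : ℂ) * conj a with hp
  have hre : ∀ s : ℝ, (a * ((s : ℂ) * conj a)).re = s * m ^ 2 := by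
    intro s
    rw [mul_left_comm, haa, ← ofReal_pow, ← ofReal_mul, ofReal_re]
  have hly : (a * y).re + b = 0 := by rw [hy, hre]; field_simp; ring
  have hlp : (a * p).re + b = m := by
    rw [hp, mul_add, add_re, hre (1 / m)]
    have : 1 / m * m ^ 2 = m := by field_simp
    linarith
  have hlz : ∀ z, m - m * ‖z - p‖ ≤ (a * z).re + b := by
    intro z
    have h3 : (a * z).re = (a * p).re + (a * (z - p)).re := by rw [← add_re]; ring_nf
    have h4 : |(a * (z - p)).re| ≤ m * ‖z - p‖ := by
      rw [hm, ← norm_mul]; exact abs_re_le_norm _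
    have := (abs_le.1 h4).1
    linarith
  have hyp : ‖y - p‖ = 1 := by
    rw [hp, sub_add_cancel_left, norm_neg, norm_mul, RCLike.norm_conj, norm_real, ← hm,
      Real.norm_of_nonneg (by positivity)]
    field_simp
  set t := (1 + m) / 2 with ht
  have ht1 : 1 < t := by linarith
  have htm : t < m := by linarith
  refine (h (‖p‖ + 2)).visc p (t / m) 1 t (by positivity) ((div_lt_one hm0).2 htm) ht1
    (by linarith) ?_ ?_ y (h2 y hly) hyp
  · intro z hz
    by_contra hlt
    push Not at hlt
    refine (h1 z ?_).1 hz
    nlinarith [hlz z]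
  · intro z hz
    have h3 := hlz z
    rw [hz, mul_div_cancel₀ _ hm0.ne'] at h3
    rw [(h1 z (by linarith)).2]
    refine le_trans ?_ h3
    have h5 : Real.log (1 / (t / m)) ≤ 1 / (t / m) - 1 :=
      Real.log_le_sub_one_of_pos (by positivity)
    calc t * Real.log (1 / (t / m)) ≤ t * (1 / (t / m) - 1) := by gcongr
      _ = m - t := by field_simp

/-- The gradient bound. -/
theorem GBase.norm_cgrad_le_one {U : ℂ → ℝ} {K : Set ℂ} (h : GBase U K) {z : ℂ} (hz : z ∉ K) :
    ‖cgrad U z‖ ≤ 1 := by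
  set A : Set ℝ := {x | ∃ (U : ℂ → ℝ) (K : Set ℂ) (z : ℂ), GBase U K ∧ z ∉ K ∧
    ‖cgrad U z‖ = x}
  have hAb : BddAbove A := ⟨5, by rintro x ⟨U, K, z, h, -, rfl⟩; exact h.norm_cgrad_le_five z⟩
  have hAne : A.Nonempty := ⟨_, U, K, z, h, hz, rfl⟩
  set M := sSup A with hM
  have hle : ∀ (U : ℂ → ℝ) (K : Set ℂ) (z : ℂ), GBase U K → z ∉ K → ‖cgrad U z‖ ≤ M :=
    fun U K z h hz => le_csSup hAb ⟨U, K, z, h, hz, rfl⟩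
  refine (hle U K z h hz).trans ?_
  by_contra! hM1
  have hex : ∀ n : ℕ, ∃ (U : ℂ → ℝ) (K : Set ℂ), GBase U K ∧
      max (M - 1 / (n + 1)) 0 < ‖cgrad U 0‖ ∧ (∀ y ∈ K, 1 ≤ ‖y‖) ∧ ∃ k ∈ K, ‖k‖ = 1 := by
    intro n
    have hlt : max (M - 1 / ((n : ℝ) + 1)) 0 < M := by
      have : (0 : ℝ) < 1 / ((n : ℝ) + 1) := by positivity
      exact max_lt (by linarith) (by linarith)
    obtain ⟨x, ⟨U, K, z, hB, hzK, rfl⟩, hx⟩ := exists_lt_of_lt_csSup hAne hlt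
    have hKne : K.Nonempty := by
      rw [nonempty_iff_ne_empty]
      rintro rfl
      rw [hB.cgrad_eq_zero_of_empty, norm_zero] at hx
      exact (le_max_right _ _).not_gt hx
    obtain ⟨k, hk, hk1, hk2⟩ := exists_norm_eq_infDist hB.closed hKne z
    set d := infDist z K with hd
    have hd0 : 0 < d := (hB.closed.notMem_iff_infDist_pos hKne).1 hzK
    have hdne : (d : ℂ) ≠ 0 := by exact_mod_cast hd0.ne'
    refine ⟨affU z d U, affK z d K, hB.aff z hdne, ?_, ?_, (k - z) / d, ?_, ?_⟩
    · have := (harmonicAt_aff (z₀ := z) (m := d) (z := 0) (by simpa using hB.harm hzK)).2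
      rw [this, norm_mul]
      simpa [abs_of_pos hd0, hd0.ne'] using hx
    · intro y hy
      have := hk2 _ hy
      rw [add_sub_cancel_left, norm_mul, norm_real, Real.norm_of_nonneg hd0.le] at this
      nlinarith
    · change z + d * ((k - z) / d) ∈ K
      rwa [mul_div_cancel₀ _ hdne, add_sub_cancel]
    · rw [norm_div, hk1, norm_real, Real.norm_of_nonneg hd0.le, div_self hd0.ne']
  choose Un Kn hB hg hK1 k hk hk1 using hex
  set l : Ultrafilter ℕ := hyperfilter ℕ
  have hbd : ∀ x n, ‖Un n x‖ ≤ 5 * (‖x‖ + 1) := by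
    intro x n
    have := (hB n).lip x (k n)
    rw [(hB n).zero (hk n), sub_zero] at this
    refine this.trans ?_
    gcongr
    rw [← hk1 n]
    exact norm_sub_le _ _
  choose U' _ hU' using fun x => exists_tendsto_of_bounded (l := l) (Eventually.of_forall (hbd x))
  have hBl : ∀ ρ, ∀ᶠ n in (l : Filter ℕ), Base ρ (Un n) (Kn n) :=
    fun ρ => Eventually.of_forall fun n => hB n ρ
  have hlim : GBase U' (limK l Kn) := Base.lim hBl hU'
  have h0 : (0 : ℂ) ∉ limK l Kn := by
    intro h0
    obtain ⟨n, y, hy, hy2⟩ := (h0 1 one_pos).exists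
    rw [sub_zero] at hy2
    exact (hK1 n y hy).not_gt hy2
  have hgl : ‖cgrad U' 0‖ = M := by
    refine tendsto_nhds_unique (Base.lim_harmonic hBl hU' h0).2.norm ?_
    have h1 : Tendsto (fun n : ℕ => M - 1 / ((n : ℝ) + 1)) l (𝓝 (M - 0)) :=
      (tendsto_one_div_add_atTop_nhds_zero_nat.const_sub M).mono_left Nat.hyperfilter_le_atTop
    rw [sub_zero] at h1
    refine tendsto_of_tendsto_of_tendsto_of_le_of_le h1 tendsto_const_nhds ?_ ?_
    · intro n; exact (le_max_left _ _).trans (hg n).le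
    · intro n
      exact hle _ _ _ (hB n) fun h0 => by simpa using (hK1 n 0 h0).trans_lt' (by simp : (0:ℝ) < 1)
  obtain ⟨b, -, h1, h2⟩ := hlim.halfplane (by linarith) (fun z hz => hle _ _ _ hlim hz) h0 hgl
  exact hlim.slope_le_one (by rw [hgl]; exact hM1) h1 h2

end

noncomputable section
open InnerProductSpace (HarmonicAt HarmonicOnNhd)
open scoped ComplexConjugate

lemma Complex.eq_ofReal_of_norm_le_re {w : ℂ} {t : ℝ} (h1 : ‖w‖ ≤ t) (h2 : t ≤ w.re) : w = t := by
  have h3 : w.re = t := le_antisymm ((re_le_norm w).trans h1) h2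
  have h4 : w.im ^ 2 ≤ 0 := by
    have h5 : ‖w‖ ^ 2 = w.re ^ 2 + w.im ^ 2 := by
      rw [← normSq_eq_norm_sq, normSq_apply]; ring
    have h6 : ‖w‖ ^ 2 ≤ t ^ 2 := pow_le_pow_left₀ (norm_nonneg _) h1 2
    rw [h3] at h5
    linarith
  apply Complex.ext
  · simpa using h3
  · simpa using pow_eq_zero_iff (two_ne_zero) |>.1 (le_antisymm h4 (sq_nonneg _))

lemma Complex.mul_conj_eq_one {e : ℂ} (he : ‖e‖ = 1) : e * conj e = 1 := by
  rw [mul_conj, normSq_eq_norm_sq, he]; simp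

lemma Complex.exists_real_mul_of_perp {v a b : ℂ} (hv : v ≠ 0) (ha : a ≠ 0)
    (h1 : (conj v * a).re = 0) (h2 : (conj v * b).re = 0) : ∃ t : ℝ, b = t * a := by
  have hcv : conj v ≠ 0 := by simpa using hv
  have e1 : conj v * a = (conj v * a).im * I := by
    conv_lhs => rw [← re_add_im (conj v * a), h1]
    simp
  have e2 : conj v * b = (conj v * b).im * I := by
    conv_lhs => rw [← re_add_im (conj v * b), h2]
    simp
  have hx : (conj v * a).im ≠ 0 := by
    intro h0
    rw [h0] at e1
    simp [hv, ha] at e1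
  refine ⟨(conj v * b).im / (conj v * a).im, ?_⟩
  apply mul_left_cancel₀ hcv
  have hx' : ((conj v * a).im : ℂ) ≠ 0 := by exact_mod_cast hx
  calc conj v * b = (conj v * b).im * I := e2
    _ = ((conj v * b).im / (conj v * a).im : ℂ) * ((conj v * a).im * I) := by field_simp
    _ = _ := by rw [← e1]; push_cast; ring

/-- A point of a closed convex set plus an asymptotic direction of the set. -/
lemma Convex.add_mem_of_tendsto {ι : Type*} {l : Filter ι} [l.NeBot] {A : Set ℂ} (hA : Convex ℝ A)
    (hcl : IsClosed A) {y v : ℂ} (hy : y ∈ A) {k : ι → ℂ} {s : ι → ℝ}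
    (hk : ∀ᶠ n in l, k n ∈ A) (hs0 : ∀ᶠ n in l, 0 ≤ s n) (hs : Tendsto s l (𝓝 0))
    (hv : Tendsto (fun n => (s n : ℂ) * k n) l (𝓝 v)) : y + v ∈ A := by
  have hs' : Tendsto (fun n => (s n : ℂ)) l (𝓝 0) := by
    have := (continuous_ofReal.tendsto 0).comp hs
    rwa [ofReal_zero] at this
  have h1 : Tendsto (fun n => (1 - (s n : ℂ)) * y + s n * k n) l (𝓝 ((1 - 0) * y + v)) :=
    ((hs'.const_sub 1).mul_const y).add hv
  rw [sub_zero, one_mul] at h1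
  refine hcl.mem_of_tendsto h1 ?_
  filter_upwards [hk, hs0, hs.eventually (gt_mem_nhds (one_pos))] with n h2 h3 h4
  have := hA hy h2 (sub_nonneg.2 h4.le) h3 (by ring)
  simpa [real_smul] using this

lemma Convex.re_conj_mul_le_zero_of_nearest {A : Set ℂ} (hA : Convex ℝ A) {z p k : ℂ} (hp : p ∈ A)
    (hn : ∀ k ∈ A, ‖p - z‖ ≤ ‖k - z‖) (hk : k ∈ A) : (conj (z - p) * (k - p)).re ≤ 0 := by
  have key : ∀ t : ℝ, 0 < t → t ≤ 1 → 2 * (conj (z - p) * (k - p)).re ≤ t * ‖k - p‖ ^ 2 := by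
    intro t ht ht1
    have hmem : (1 - t) • p + t • k ∈ A := hA hp hk (sub_nonneg.2 ht1) ht.le (by ring)
    have h1 := pow_le_pow_left₀ (norm_nonneg _) (hn _ hmem) 2
    have h2 : (1 - t) • p + t • k - z = (p - z) + t * (k - p) := by
      simp only [real_smul]; push_cast; ring
    rw [h2, ← normSq_eq_norm_sq, ← normSq_eq_norm_sq, normSq_add] at h1
    have h3 : ((p - z) * conj ((t : ℂ) * (k - p))).re = - t * (conj (z - p) * (k - p)).re := by
      rw [map_mul, conj_ofReal, mul_left_comm, re_ofReal_mul]
      simp [mul_re]; ring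
    have h4 : normSq ((t : ℂ) * (k - p)) = t ^ 2 * ‖k - p‖ ^ 2 := by
      rw [normSq_mul, normSq_ofReal, normSq_eq_norm_sq]; ring
    rw [h3, h4] at h1
    have h5 : t * (2 * (conj (z - p) * (k - p)).re) ≤ t * (t * ‖k - p‖ ^ 2) := by nlinarith
    exact le_of_mul_le_mul_left h5 ht
  have h1 : Tendsto (fun t : ℝ => t * ‖k - p‖ ^ 2) (𝓝[>] 0) (𝓝 (0 * ‖k - p‖ ^ 2)) :=
    (tendsto_id.mono_left nhdsWithin_le_nhds).mul_const _
  rw [zero_mul] at h1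
  have h2 : 2 * (conj (z - p) * (k - p)).re ≤ 0 := by
    refine ge_of_tendsto h1 ?_
    filter_upwards [Ioo_mem_nhdsGT (one_pos : (0 : ℝ) < 1)] with t ht
    exact key t ht.1 ht.2.le
  linarith

/-- The deviation of `S` from complex conjugation. -/
def cst (S : ℂ → ℂ) (z : ℂ) : ℂ := S z - conj z

namespace Glob

variable {c : ℝ} {U : ℂ → ℝ} {S : ℂ → ℂ} {K : Set ℂ}

lemma gbase (h : Glob c U S K) : GBase U K := fun R => (h R).toBase
lemma slip (h : Glob c U S K) (x y : ℂ) : ‖S x - S y‖ ≤ ‖x - y‖ := by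
  simpa using (h (max ‖x‖ ‖y‖ + 1)).slip x y (by linarith [le_max_left ‖x‖ ‖y‖])
    (by linarith [le_max_right ‖x‖ ‖y‖])
lemma sder (h : Glob c U S K) {z : ℂ} (hz : z ∉ K) : HasDerivAt S (-(cgrad U z) ^ 2) z :=
  (h (‖z‖ + 1)).sder z (by linarith) hz
lemma loc (h : Glob c U S K) {z : ℂ} (hz : z ∈ interior K) : ∀ᶠ w in 𝓝 z, cst S w = cst S z :=
  (h (‖z‖ + 1)).loc z hz (by linarith)
lemma reach (h : Glob c U S K) {x : ℂ} (hx : x ∈ K) {ρ : ℝ} (hρ : 0 < ρ) :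
    ∃ y ∈ K, ‖y - x‖ = ρ ∧ cst S y = cst S x :=
  (h (‖x‖ + ρ + 1)).reach x hx ρ hρ (by linarith)
lemma norm_cgrad_le (h : Glob c U S K) {z : ℂ} (hz : z ∉ K) : ‖cgrad U z‖ ≤ 1 :=
  h.gbase.norm_cgrad_le_one hz
lemma continuous_S (h : Glob c U S K) : Continuous S := by
  refine (LipschitzWith.of_dist_le_mul (K := 1) fun a b => ?_).continuous
  simpa [dist_eq_norm] using h.slip a b
lemma continuous_cst (h : Glob c U S K) : Continuous (cst S) :=
  h.continuous_S.sub continuous_conj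

/-- Points where `S` moves isometrically along a line lie in a half-plane component. -/
lemma halfplane_of_deriv (h : Glob c U S K) {z e : ℂ} (hz : z ∉ K) (he : ‖e‖ = 1)
    (hd : -(cgrad U z) ^ 2 * e = conj e) :
    ∃ σ b : ℝ, (σ = 1 ∨ σ = -1) ∧ 0 < σ * (z * conj e).im + b ∧
      (∀ w, 0 < σ * (w * conj e).im + b → w ∉ K ∧ U w = σ * (w * conj e).im + b) ∧
      ∀ w, σ * (w * conj e).im + b = 0 → w ∈ K := by
  have hee := mul_conj_eq_one he
  have h1 : (cgrad U z * e) ^ 2 = -1 := by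
    calc (cgrad U z * e) ^ 2 = -(-(cgrad U z) ^ 2 * e) * e := by ring
      _ = -(conj e * e) := by rw [hd]; ring
      _ = -1 := by rw [mul_comm, hee]
  have h2 : ∃ σ : ℝ, (σ = 1 ∨ σ = -1) ∧ cgrad U z = -σ * I * conj e := by
    have h3 : (cgrad U z * e - I) * (cgrad U z * e + I) = 0 := by
      linear_combination h1 - I_sq
    have h4 : ∀ x : ℂ, cgrad U z * e = x → cgrad U z = x * conj e := by
      intro x hx
      rw [← hx, mul_assoc, hee, mul_one]
    rcases mul_eq_zero.1 h3 with h5 | h5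
    · exact ⟨-1, Or.inr rfl, by rw [h4 I (by linear_combination h5)]; simp⟩
    · exact ⟨1, Or.inl rfl, by rw [h4 (-I) (by linear_combination h5)]; simp⟩
  obtain ⟨σ, hσ, hg⟩ := h2
  have hn : ‖cgrad U z‖ = 1 := by
    rw [hg]
    rcases hσ with rfl | rfl <;> simp [he]
  obtain ⟨b, hb1, hb2, hb3⟩ := h.gbase.halfplane one_pos (fun w hw => h.norm_cgrad_le hw) hz hn
  have hre : ∀ w, (cgrad U z * w).re = σ * (w * conj e).im := by
    intro w
    have : cgrad U z * w = -(σ * (I * (w * conj e))) := by rw [hg]; ring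
    rw [this, neg_re, re_ofReal_mul, I_mul_re]; ring
  simp only [hre] at hb1 hb2 hb3
  exact ⟨σ, b, hσ, hb1, hb2, hb3⟩

lemma deriv_of_line (h : Glob c U S K) {z e : ℂ} (hz : z ∉ K)
    (hS : ∀ᶠ s : ℝ in 𝓝 0, S (z + s * e) = S z + s * conj e) :
    -(cgrad U z) ^ 2 * e = conj e := by
  have h0 : HasDerivAt (fun s : ℝ => z + s * e) e 0 := by
    simpa using ((hasDerivAt_id (0 : ℝ)).ofReal_comp.mul_const e).const_add z
  have h1 : HasDerivAt (fun s : ℝ => S (z + s * e)) (-(cgrad U z) ^ 2 * e) 0 := by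
    have h2 : HasDerivAt S (-(cgrad U z) ^ 2) (z + ((0 : ℝ) : ℂ) * e) := by simpa using h.sder hz
    exact h2.comp 0 h0
  have h3 : HasDerivAt (fun s : ℝ => S z + s * conj e) (conj e) 0 := by
    simpa using ((hasDerivAt_id (0 : ℝ)).ofReal_comp.mul_const (conj e)).const_add (S z)
  exact h1.unique (h3.congr_of_eventuallyEq hS)

lemma isometric_between (h : Glob c U S K) {x e : ℂ} (he : ‖e‖ = 1) {T : ℝ}
    (hT : S (x + T * e) = S x + T * conj e) {t : ℝ} (h0 : 0 ≤ t) (h1 : t ≤ T) :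
    S (x + t * e) = S x + t * conj e := by
  have hee := mul_conj_eq_one he
  have a1 : ‖e * (S (x + t * e) - S x)‖ ≤ t := by
    rw [norm_mul, he, one_mul]
    refine (h.slip _ _).trans ?_
    simp [he, abs_of_nonneg h0]
  have a2 : ‖e * (S (x + T * e) - S (x + t * e))‖ ≤ T - t := by
    rw [norm_mul, he, one_mul]
    refine (h.slip _ _).trans ?_
    have : x + T * e - (x + t * e) = ((T - t : ℝ) : ℂ) * e := by push_cast; ring
    rw [this, norm_mul, he, norm_real, Real.norm_of_nonneg (by linarith), mul_one]
  have a3 : e * (S (x + t * e) - S x) + e * (S (x + T * e) - S (x + t * e)) = T := by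
    rw [hT]; linear_combination T * hee
  have a4 := congrArg re a3
  rw [add_re, ofReal_re] at a4
  have a5 := (re_le_norm _).trans a2
  have a6 := eq_ofReal_of_norm_le_re a1 (by linarith)
  linear_combination conj e * a6 - (S (x + t * e) - S x) * hee

/-- Level sets of `cst S` in `K` are convex. -/
lemma mem_between (h : Glob c U S K) {x e : ℂ} (he : ‖e‖ = 1) (hx : x ∈ K) {T : ℝ}
    (hy : x + T * e ∈ K) (hc : cst S (x + T * e) = cst S x) {t : ℝ} (h0 : 0 ≤ t) (h1 : t ≤ T) :
    x + t * e ∈ K ∧ cst S (x + t * e) = cst S x := by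
  have hT : S (x + T * e) = S x + T * conj e := by
    simp only [cst, map_add, map_mul, conj_ofReal] at hc
    linear_combination hc
  have hS : ∀ t : ℝ, 0 ≤ t → t ≤ T → S (x + t * e) = S x + t * conj e :=
    fun t h0 h1 => h.isometric_between he hT h0 h1
  refine ⟨?_, ?_⟩
  · by_contra hz
    have ht0 : 0 < t := lt_of_le_of_ne h0 fun h => hz (by simpa [← h] using hx)
    have htT : t < T := lt_of_le_of_ne h1 fun h => hz (by rwa [h])
    have hd := h.deriv_of_line (e := e) hz (by
      filter_upwards [Ioo_mem_nhds (show -t < 0 by linarith) (show 0 < T - t by linarith)]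
        with s hs
      have e1 : x + t * e + s * e = x + ((t + s : ℝ) : ℂ) * e := by push_cast; ring
      rw [e1, hS _ (by linarith [hs.1]) (by linarith [hs.2]), hS t h0 h1]
      push_cast; ring)
    obtain ⟨σ, b, -, hb1, hb2, -⟩ := h.halfplane_of_deriv hz he hd
    refine (hb2 x ?_).1 hx
    have : ((x + t * e) * conj e).im = (x * conj e).im := by
      rw [add_mul, mul_assoc, mul_conj_eq_one he]; simp
    rwa [this] at hb1
  · simp only [cst, hS t h0 h1, map_add, map_mul, conj_ofReal]
    ring

lemma exists_unit {x y : ℂ} (hxy : x ≠ y) : ∃ e : ℂ, ‖e‖ = 1 ∧ y = x + ‖y - x‖ * e := by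
  have h0 : y - x ≠ 0 := sub_ne_zero.2 hxy.symm
  have hn : (‖y - x‖ : ℂ) ≠ 0 := by exact_mod_cast (norm_ne_zero_iff.2 h0)
  refine ⟨(y - x) / ‖y - x‖, by simp [h0], ?_⟩
  field_simp
  ring

lemma convex_class (h : Glob c U S K) (κ : ℂ) : Convex ℝ {z | z ∈ K ∧ cst S z = κ} := by
  rw [convex_iff_segment_subset]
  rintro x ⟨hx, hxc⟩ y ⟨hy, hyc⟩ z hz
  by_cases hxy : x = y
  · subst hxy
    rw [segment_same, mem_singleton_iff] at hz
    rw [hz]; exact ⟨hx, hxc⟩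
  obtain ⟨e, he, hye⟩ := exists_unit hxy
  rw [segment_eq_image'] at hz
  obtain ⟨θ, hθ, rfl⟩ := hz
  have e1 : x + θ • (y - x) = x + ((θ * ‖y - x‖ : ℝ) : ℂ) * e := by
    conv_lhs => rw [hye]
    simp only [real_smul]; push_cast; ring
  have := h.mem_between he hx (T := ‖y - x‖) (by rwa [← hye]) (by rw [← hye, hxc, hyc])
    (t := θ * ‖y - x‖) (by have := hθ.1; positivity)
    (by nlinarith [hθ.2, norm_nonneg (y - x)])
  simp only [e1]
  exact ⟨this.1, this.2.trans hxc⟩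

lemma isClosed_class (h : Glob c U S K) (κ : ℂ) : IsClosed {z | z ∈ K ∧ cst S z = κ} :=
  h.gbase.closed.inter (isClosed_eq h.continuous_cst continuous_const)

end Glob

/-- The half-line from `x` in direction `e` stays in one level of `cst S` in `K`. -/
def Ray (S : ℂ → ℂ) (K : Set ℂ) (x e : ℂ) : Prop :=
  ∀ t : ℝ, 0 ≤ t → x + t * e ∈ K ∧ cst S (x + t * e) = cst S x

namespace Glob

variable {c : ℝ} {U : ℂ → ℝ} {S : ℂ → ℂ} {K : Set ℂ}

lemma exists_ray (h : Glob c U S K) {x : ℂ} (hx : x ∈ K) : ∃ e, ‖e‖ = 1 ∧ Ray S K x e := by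
  have h1 : ∀ n : ℕ, ∃ e : ℂ, ‖e‖ = 1 ∧ x + ((n + 1 : ℝ) : ℂ) * e ∈ K ∧
      cst S (x + ((n + 1 : ℝ) : ℂ) * e) = cst S x := by
    intro n
    obtain ⟨y, hy, hyx, hyc⟩ := h.reach hx (show (0 : ℝ) < n + 1 by positivity)
    have hne : x ≠ y := by
      rintro rfl
      rw [sub_self, norm_zero] at hyx
      have : (0 : ℝ) < n + 1 := by positivity
      linarith
    obtain ⟨e, he, hye⟩ := exists_unit hne
    rw [hyx] at hye
    exact ⟨e, he, hye ▸ hy, hye ▸ hyc⟩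
  choose e he heK hec using h1
  obtain ⟨a, -, ha⟩ := exists_tendsto_of_bounded (l := hyperfilter ℕ) (x := e) (C := 1)
    (Eventually.of_forall fun n => (he n).le)
  refine ⟨a, tendsto_nhds_unique ha.norm (by simp [he]), fun t ht => ?_⟩
  have h3 : Tendsto (fun n => x + (t : ℂ) * e n) (hyperfilter ℕ) (𝓝 (x + t * a)) :=
    (ha.const_mul _).const_add _
  have h4 : x + t * a ∈ {z | z ∈ K ∧ cst S z = cst S x} := by
    refine (h.isClosed_class (cst S x)).mem_of_tendsto h3 ?_
    have h2 : ∀ᶠ n : ℕ in (hyperfilter ℕ : Filter ℕ), t ≤ n :=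
      (tendsto_natCast_atTop_atTop.eventually (eventually_ge_atTop t)).filter_mono
        Nat.hyperfilter_le_atTop
    filter_upwards [h2] with n hn
    exact h.mem_between (he n) hx (heK n) (hec n) ht (by linarith)
  exact h4

/-- A flat piece of the boundary of one level extends to a half-plane solution. -/
lemma flat (h : Glob c U S K) {e p κ : ℂ} {r : ℝ} (he : ‖e‖ = 1) (hr : 0 < r)
    (hline : ∀ z ∈ ball p r, ((z - p) * conj e).im = 0 → z ∈ K ∧ cst S z = κ)
    (hup : ∀ z ∈ ball p r, 0 < ((z - p) * conj e).im → z ∉ K) (z : ℂ) :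
    (0 < ((z - p) * conj e).im → z ∉ K ∧ U z = ((z - p) * conj e).im) ∧
      (((z - p) * conj e).im = 0 → z ∈ K) := by
  have hee := mul_conj_eq_one he
  set F : ℂ → ℂ := fun z => S z - (conj p + (z - p) * conj e ^ 2 + κ) with hF
  have hzero : ∀ z ∈ ball p (r / 4), 0 < ((z - p) * conj e).im → F z = 0 := by
    intro z hz hz2
    refine eq_zero_of_eq_zero_on_diameter he (r := r) ?_ ?_ ?_ hz hz2
    · exact (h.continuous_S.sub (by fun_prop)).continuousOn
    · intro w hw hw2
      exact (h.sder (hup w hw hw2)).differentiableAt.sub (by fun_prop)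
    · intro w hw hw2
      have h1 := (hline w hw hw2).2
      have h2 : (w - p) * conj e = conj ((w - p) * conj e) := (conj_eq_iff_im.2 hw2).symm
      simp only [map_mul, map_sub, conj_conj] at h2
      simp only [cst] at h1
      simp only [F]
      linear_combination h1 - conj e * h2 + (conj p - conj w) * hee
  set z₁ : ℂ := p + ((r / 8 : ℝ) : ℂ) * I * e with hz₁
  have him : ∀ t : ℝ, ((p + (t : ℂ) * I * e - p) * conj e).im = t := by
    intro t
    rw [add_sub_cancel_left, mul_assoc, hee]; simp
  have hball : ∀ t R : ℝ, 0 ≤ t → t < R → p + (t : ℂ) * I * e ∈ ball p R := by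
    intro t R h0 h1
    rw [mem_ball, dist_eq_norm, add_sub_cancel_left]
    simpa [he, abs_of_nonneg h0] using h1
  have hz₁K : z₁ ∉ K := hup _ (hball _ _ (by positivity) (by linarith)) (by rw [him]; positivity)
  have hd : -(cgrad U z₁) ^ 2 = conj e ^ 2 := by
    have h1 : HasDerivAt (fun z => conj p + (z - p) * conj e ^ 2 + κ) (conj e ^ 2) z₁ := by
      simpa using ((((hasDerivAt_id z₁).sub_const p).mul_const (conj e ^ 2)).const_add
        (conj p)).add_const κ
    refine (h.sder hz₁K).unique (h1.congr_of_eventuallyEq ?_)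
    have hcont : Continuous fun z : ℂ => ((z - p) * conj e).im := by fun_prop
    filter_upwards [isOpen_ball.mem_nhds (hball (r / 8) (r / 4) (by positivity) (by linarith)),
      hcont.continuousAt.eventually (lt_mem_nhds (show 0 < ((z₁ - p) * conj e).im by
        rw [hz₁, him]; positivity))] with w hw1 hw2
    have := hzero w hw1 hw2
    simp only [F] at this
    linear_combination this
  obtain ⟨σ, b, hσ, hb1, hb2, hb3⟩ := h.halfplane_of_deriv hz₁K he (by
    rw [hd]; linear_combination conj e * hee)
  have hsplit : ∀ w, (w * conj e).im = ((w - p) * conj e).im + (p * conj e).im := by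
    intro w; rw [← add_im]; ring_nf
  set b' := σ * (p * conj e).im + b with hb'
  have hl : ∀ w, σ * (w * conj e).im + b = σ * ((w - p) * conj e).im + b' := by
    intro w; rw [hsplit, hb']; ring
  simp only [hl] at hb1 hb2 hb3
  rw [hz₁, him] at hb1
  have hpK : p ∈ K := (hline p (mem_ball_self hr) (by simp)).1
  have hb'0 : b' ≤ 0 := by
    by_contra! hlt
    exact (hb2 p (by simpa using hlt)).1 hpK
  have hσ1 : σ = 1 := by
    rcases hσ with h | h
    · exact h
    · rw [h] at hb1; linarith
  subst hσ1
  have hb'1 : b' = 0 := by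
    by_contra hne
    have hlt : b' < 0 := lt_of_le_of_ne hb'0 hne
    have h1 := hb3 (p + ((-b' : ℝ) : ℂ) * I * e) (by rw [him]; ring)
    exact hup _ (hball _ _ (by linarith) (by linarith)) (by rw [him]; linarith) h1
  rw [hb'1] at hb2 hb3
  simp only [one_mul, add_zero] at hb2 hb3
  exact ⟨hb2 z, hb3 z⟩

end Glob
end

noncomputable section
open InnerProductSpace (HarmonicAt HarmonicOnNhd)
open scoped ComplexConjugate

namespace Glob

variable {c : ℝ} {U : ℂ → ℝ} {S : ℂ → ℂ} {K : Set ℂ} {ι : Type*} {l : Ultrafilter ι}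

/-- Limits of rescalings exist when the rescaled sets do not escape. -/
lemma exists_lim (h : Glob c U S K) (hc : 0 < c) {z m : ι → ℂ} (hm : ∀ n, m n ≠ 0) {k : ι → ℂ}
    {C : ℝ} (hk : ∀ᶠ n in (l : Filter ι), k n ∈ affK (z n) (m n) K)
    (hkC : ∀ᶠ n in (l : Filter ι), ‖k n‖ ≤ C) :
    ∃ (U' : ℂ → ℝ) (S' : ℂ → ℂ), Glob c U' S' (limK l fun n => affK (z n) (m n) K) ∧
      (∀ x, Tendsto (fun n => affU (z n) (m n) U x) l (𝓝 (U' x))) ∧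
      (∀ x, Tendsto (fun n => affS (z n) (m n) S x) l (𝓝 (S' x))) := by
  have h1 : ∀ x, ∀ᶠ n in (l : Filter ι), ‖affU (z n) (m n) U x‖ ≤ 5 * (‖x‖ + C) := by
    intro x
    filter_upwards [hk, hkC] with n hn hn2
    have h2 := (h.aff (z n) (hm n)).gbase
    have h3 := h2.lip x (k n)
    rw [h2.zero hn, sub_zero] at h3
    refine h3.trans ?_
    gcongr
    exact (norm_sub_le _ _).trans (by gcongr)
  have h2 : ∀ x, ∀ᶠ n in (l : Filter ι), ‖affS (z n) (m n) S x‖ ≤ ‖x‖ := by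
    intro x
    refine Eventually.of_forall fun n => ?_
    have := (h.aff (z n) (hm n)).slip x 0
    simpa [affS] using this
  choose U' _ hU' using fun x => exists_tendsto_of_bounded (h1 x)
  choose S' _ hS' using fun x => exists_tendsto_of_bounded (h2 x)
  refine ⟨U', S', Full.lim hc (fun ρ ε hε => Eventually.of_forall fun n => ?_) hU' hS', hU', hS'⟩
  have h3 := (h.aff (z n) (hm n)) ρ
  refine { h3 with slip := fun x y hx hy => (h3.slip x y hx hy).trans ?_ }
  gcongr
  linarith

lemma cst_lim (h : Glob c U S K) {z m : ι → ℂ} (hm : ∀ n, m n ≠ 0)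
    {S' : ℂ → ℂ} (hS : ∀ x, Tendsto (fun n => affS (z n) (m n) S x) l (𝓝 (S' x)))
    {k : ι → ℂ} {a : ℂ} (hk : Tendsto k l (𝓝 a)) :
    Tendsto (fun n => (cst S (z n + m n * k n) - cst S (z n)) / conj (m n)) l (𝓝 (cst S' a)) := by
  have h1 : Tendsto (fun n => affS (z n) (m n) S (k n)) l (𝓝 (S' a)) :=
    Full.tendsto_diag_S (U := fun n => affU (z n) (m n) U) (K := fun n => affK (z n) (m n) K)
      (c := c) (fun ρ ε hε => Eventually.of_forall fun n => by
        have h3 := (h.aff (z n) (hm n)) ρ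
        refine { h3 with slip := fun x y hx hy => (h3.slip x y hx hy).trans ?_ }
        gcongr
        linarith) hS hk
  refine (h1.sub ((continuous_conj.tendsto a).comp hk)).congr fun n => ?_
  exact affS_sub_conj (hm n) (k n)

/-- Levels sharing a direction at infinity coincide. -/
theorem cst_eq_of_same_direction (h : Glob c U S K) (hc : 0 < c) {x y e : ℂ} (he : ‖e‖ = 1)
    (hx : Ray S K x e) (hy : Ray S K y e) : cst S x = cst S y := by
  have hee := mul_conj_eq_one he
  set l : Ultrafilter ℕ := hyperfilter ℕ
  have hl : (l : Filter ℕ) ≤ atTop := Nat.hyperfilter_le_atTop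
  have hm : ∀ n : ℕ, (1 : ℂ) ≠ 0 := fun _ => one_ne_zero
  have htop : ∀ s : ℝ, ∀ᶠ n : ℕ in (l : Filter ℕ), s ≤ n := fun s =>
    (tendsto_natCast_atTop_atTop.eventually (eventually_ge_atTop s)).filter_mono hl
  obtain ⟨U', S', hG, hU', hS'⟩ := h.exists_lim (l := l) hc (z := fun n : ℕ => (n : ℂ) * e)
    (m := fun _ => 1) hm (k := fun _ => x) (C := ‖x‖) (Eventually.of_forall fun n => by
      have := (hx n (by positivity)).1
      change (n : ℂ) * e + 1 * x ∈ K
      rw [one_mul, add_comm]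
      simpa using this) (Eventually.of_forall fun n => le_rfl)
  set K' := limK l fun n : ℕ => affK ((n : ℂ) * e) 1 K
  have hS1 : ∀ ζ, Tendsto (fun n : ℕ => S (ζ + (n : ℝ) * e) - S ((n : ℝ) * e)) l (𝓝 (S' ζ)) := by
    intro ζ
    refine (hS' ζ).congr fun n => ?_
    simp [affS, add_comm]
  -- the directional increments converge
  have hmono : ∀ ζ, ∃ L, Tendsto (fun t : ℝ => t - (e * S (ζ + t * e)).re) atTop (𝓝 L) := by
    intro ζ
    have hmon : Monotone fun t : ℝ => t - (e * S (ζ + t * e)).re := by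
      intro s t hst
      have h1 : ‖e * S (ζ + t * e) - e * S (ζ + s * e)‖ ≤ t - s := by
        rw [← mul_sub, norm_mul, he, one_mul]
        refine (h.slip _ _).trans ?_
        have : ζ + t * e - (ζ + s * e) = ((t - s : ℝ) : ℂ) * e := by push_cast; ring
        rw [this, norm_mul, he, norm_real, Real.norm_of_nonneg (by linarith), mul_one]
      have h2 := (re_le_norm _).trans h1
      rw [sub_re] at h2
      simp only
      linarith
    have hbdd : BddAbove (range fun t : ℝ => t - (e * S (ζ + t * e)).re) := by
      refine ⟨‖ζ - x‖ + ‖S x‖, ?_⟩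
      rintro _ ⟨t, rfl⟩
      have hmx : (t - (e * S (ζ + t * e)).re) ≤
          (max t 0 - (e * S (ζ + ((max t 0 : ℝ) : ℂ) * e)).re) := hmon (le_max_left t 0)
      refine hmx.trans ?_
      set s := max t 0
      have hs : 0 ≤ s := le_max_right _ _
      have h1 : S (x + s * e) = S x + s * conj e := by
        have := (hx s hs).2
        simp only [cst, map_add, map_mul, conj_ofReal] at this
        linear_combination this
      have h2 : ‖e * S (x + s * e) - e * S (ζ + s * e)‖ ≤ ‖ζ - x‖ := by
        rw [← mul_sub, norm_mul, he, one_mul]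
        refine (h.slip _ _).trans ?_
        rw [add_sub_add_right_eq_sub, norm_sub_rev]
      have h3 := (re_le_norm _).trans h2
      have h4 : e * S (x + s * e) = e * S x + s := by rw [h1]; linear_combination s * hee
      rw [sub_re, h4, add_re, ofReal_re] at h3
      have h5 : |(e * S x).re| ≤ ‖S x‖ := by
        refine (abs_re_le_norm _).trans ?_
        rw [norm_mul, he, one_mul]
      linarith [(abs_le.1 h5).1]
    exact ⟨_, tendsto_atTop_ciSup hmon hbdd⟩
  have hline : ∀ ζ (s : ℝ), 0 ≤ s → S' (ζ + s * e) = S' ζ + s * conj e := by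
    intro ζ s hs
    have h1 : ‖e * (S' (ζ + s * e) - S' ζ)‖ ≤ s := by
      rw [norm_mul, he, one_mul]
      refine (hG.slip _ _).trans ?_
      simp [he, abs_of_nonneg hs]
    have h2 : (e * (S' (ζ + s * e) - S' ζ)).re = s := by
      obtain ⟨L, hL⟩ := hmono ζ
      have ht : Tendsto (fun n : ℕ => ((n : ℝ))) l atTop := tendsto_natCast_atTop_atTop.mono_left hl
      have a1 := hL.comp ht
      have a2 := hL.comp (tendsto_atTop_add_const_right _ s ht)
      have a3 : Tendsto (fun n : ℕ => (e * ((S (ζ + s * e + (n : ℝ) * e) - S ((n : ℝ) * e)) -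
          (S (ζ + (n : ℝ) * e) - S ((n : ℝ) * e)))).re) l
          (𝓝 ((e * (S' (ζ + s * e) - S' ζ)).re)) :=
        (continuous_re.tendsto _).comp (((hS1 _).sub (hS1 ζ)).const_mul e)
      refine tendsto_nhds_unique a3 ?_
      have a4 := (a1.sub a2).add_const s
      rw [sub_self, zero_add] at a4
      refine a4.congr fun n => ?_
      simp only [Function.comp]
      have : ζ + ((n + s : ℝ) : ℂ) * e = ζ + s * e + (n : ℝ) * e := by push_cast; ring
      rw [this]
      simp only [mul_sub, sub_re]
      ring
    have h3 := eq_ofReal_of_norm_le_re h1 h2.ge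
    linear_combination conj e * h3 - (S' (ζ + s * e) - S' ζ) * hee
  have hline' : ∀ ζ (s : ℝ), S' (ζ + s * e) = S' ζ + s * conj e := by
    intro ζ s
    rcases le_total 0 s with hs | hs
    · exact hline ζ s hs
    · have h1 := hline (ζ + s * e) (-s) (by linarith)
      have h2 : ζ + s * e + ((-s : ℝ) : ℂ) * e = ζ := by push_cast; ring
      rw [h2] at h1
      push_cast at h1
      linear_combination -h1
  -- full lines in the limit set
  have hmem : ∀ w, Ray S K w e → w ∈ K' := by
    intro w hw
    refine mem_limK_of_tendsto (x := fun _ => w) (Eventually.of_forall fun n => ?_)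
      tendsto_const_nhds
    change (n : ℂ) * e + 1 * w ∈ K
    rw [one_mul, add_comm]
    simpa using (hw n (by positivity)).1
  have hcst : ∀ w, Ray S K w e → Tendsto (fun n : ℕ => cst S w - cst S ((n : ℂ) * e)) l
      (𝓝 (cst S' w)) := by
    intro w hw
    have := h.cst_lim (l := l) (z := fun n : ℕ => (n : ℂ) * e) (m := fun _ => 1) hm hS'
      (k := fun _ => w) (a := w) tendsto_const_nhds
    refine this.congr fun n => ?_
    have h2 := (hw n (by positivity)).2
    rw [one_mul, add_comm, map_one, div_one]
    rw [ofReal_natCast] at h2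
    rw [h2]
  have hdiff : cst S' x - cst S' y = cst S x - cst S y := by
    refine tendsto_nhds_unique ((hcst x hx).sub (hcst y hy)) ?_
    refine tendsto_const_nhds.congr fun n => ?_
    ring
  suffices cst S' x = cst S' y by
    rw [this, sub_self] at hdiff
    exact (sub_eq_zero.1 hdiff.symm)
  have him : ∀ a b : ℂ, (a * conj e).im < (b * conj e).im → a ∈ K' → b ∈ K' →
      cst S' a = cst S' b := by
    intro a b hab haK hbK
    set A : Set ℂ := {w | (a * conj e).im < (w * conj e).im} ∩
      {w | (w * conj e).im < (b * conj e).im}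
    have hcont : Continuous fun w : ℂ => (w * conj e).im := by fun_prop
    have hAo : IsOpen A := (isOpen_lt continuous_const hcont).inter
      (isOpen_lt hcont continuous_const)
    have hlin : IsLinearMap ℝ fun w : ℂ => (w * conj e).im :=
      ⟨fun u v => by rw [add_mul, add_im], fun r v => by
        rw [real_smul, mul_assoc, im_ofReal_mul, smul_eq_mul]⟩
    have hAc : Convex ℝ A := (convex_halfSpace_gt hlin _).inter (convex_halfSpace_lt hlin _)
    have hAK : A ⊆ K' := by
      rintro w ⟨hw1, hw2⟩
      simp only [mem_ofPred_eq] at hw1 hw2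
      by_contra hwK
      have hd := hG.deriv_of_line (e := e) hwK (Eventually.of_forall fun s => hline' w s)
      obtain ⟨σ, β, hσ, hb1, hb2, -⟩ := hG.halfplane_of_deriv hwK he hd
      rcases hσ with rfl | rfl
      · exact (hb2 b (by linarith)).1 hbK
      · exact (hb2 a (by linarith)).1 haK
    have hAi : A ⊆ interior K' := interior_maximal hAK hAo
    have hconst : ∀ u ∈ A, ∀ v ∈ A, cst S' u = cst S' v := fun u hu v hv =>
      hAc.isPreconnected.eq_of_eventually_eq (fun w hw => hG.loc (hAi hw)) hu hv
    set γ : ℝ → ℂ := fun t => a + t * (b - a) with hγ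
    have hγc : Continuous γ := by fun_prop
    have hγA : ∀ t ∈ Ioo (0 : ℝ) 1, γ t ∈ A := by
      intro t ht
      have : (γ t * conj e).im = (a * conj e).im + t * ((b * conj e).im - (a * conj e).im) := by
        have : γ t * conj e = a * conj e + t * (b * conj e - a * conj e) := by
          simp only [γ]; ring
        rw [this, add_im, im_ofReal_mul, sub_im]
      constructor <;> simp only [mem_ofPred_eq, this] <;> nlinarith [ht.1, ht.2]
    have hcl : Icc (0 : ℝ) 1 ⊆ {t | cst S' (γ t) = cst S' (γ (1 / 2))} := by
      rw [← closure_Ioo (zero_ne_one)]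
      refine closure_minimal (fun t ht => hconst _ (hγA t ht) _ (hγA _ (by norm_num))) ?_
      exact isClosed_eq (hG.continuous_cst.comp hγc) continuous_const
    have h0 : cst S' (γ 0) = cst S' (γ (1 / 2)) := hcl ⟨le_rfl, zero_le_one⟩
    have h1 : cst S' (γ 1) = cst S' (γ (1 / 2)) := hcl ⟨zero_le_one, le_rfl⟩
    have e0 : γ 0 = a := by simp [γ]
    have e1 : γ 1 = b := by simp [γ]
    rw [e0] at h0
    rw [e1] at h1
    rw [h0, h1]
  rcases lt_trichotomy (x * conj e).im (y * conj e).im with hlt | heq | hlt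
  · exact him x y hlt (hmem x hx) (hmem y hy)
  · have h1 : (y - x) * conj e = (((y - x) * conj e).re : ℂ) := by
      refine (conj_eq_iff_re.1 (conj_eq_iff_im.2 ?_)).symm
      rw [sub_mul, sub_im]; linarith
    have h2 : y = x + (((y - x) * conj e).re : ℂ) * e := by
      rw [← h1]; linear_combination (x - y) * hee
    rw [h2]
    simp only [cst, hline', map_add, map_mul, conj_ofReal]
    ring
  · exact (him y x hlt (hmem y hy) (hmem x hx)).symm

lemma tendsto_div_natCast_succ (x : ℂ) :
    Tendsto (fun n : ℕ => x / ((n : ℂ) + 1)) (hyperfilter ℕ) (𝓝 0) := by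
  have h1 : Tendsto (fun n : ℕ => ((1 / ((n : ℝ) + 1) : ℝ) : ℂ)) atTop (𝓝 ((0 : ℝ) : ℂ)) :=
    (continuous_ofReal.tendsto 0).comp tendsto_one_div_add_atTop_nhds_zero_nat
  have h2 := (h1.const_mul x).mono_left Nat.hyperfilter_le_atTop
  rw [ofReal_zero, mul_zero] at h2
  refine h2.congr fun n => ?_
  push_cast
  rw [mul_one_div]

/-- Rescaled limits at infinity. -/
lemma exists_blowdown (h : Glob c U S K) (hc : 0 < c) (hne : K.Nonempty) {r : ι → ℝ}
    (hr : ∀ n, 1 ≤ r n) (hrt : Tendsto r l atTop) :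
    ∃ (U' : ℂ → ℝ) (S' : ℂ → ℂ), Glob c U' S' (limK l fun n => affK 0 (r n : ℂ) K) ∧
      (∀ x, Tendsto (fun n => affU 0 (r n : ℂ) U x) l (𝓝 (U' x))) ∧
      ∀ (k : ι → ℂ) (a κ : ℂ), Tendsto (fun n => k n / (r n : ℂ)) l (𝓝 a) →
        (∀ᶠ n in (l : Filter ι), k n ∈ K) → (∀ᶠ n in (l : Filter ι), cst S (k n) = κ) →
        a ∈ limK l (fun n => affK 0 (r n : ℂ) K) ∧ cst S' a = 0 := by
  have hr0 : ∀ n, (r n : ℂ) ≠ 0 := fun n => by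
    have := hr n
    exact_mod_cast (by linarith : r n ≠ 0)
  obtain ⟨x, hx⟩ := hne
  obtain ⟨U', S', hG, hU', hS'⟩ := h.exists_lim (l := l) hc (z := fun _ : ι => 0)
    (m := fun n => (r n : ℂ)) hr0 (k := fun n => x / r n) (C := ‖x‖)
    (Eventually.of_forall fun n => by
      change 0 + (r n : ℂ) * (x / r n) ∈ K
      rwa [mul_div_cancel₀ _ (hr0 n), zero_add])
    (Eventually.of_forall fun n => by
      rw [norm_div, norm_real, Real.norm_of_nonneg (by linarith [hr n])]
      exact div_le_self (norm_nonneg _) (hr n))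
  refine ⟨U', S', hG, hU', fun k a κ hka hkK hkκ => ⟨?_, ?_⟩⟩
  · refine mem_limK_of_tendsto ?_ hka
    filter_upwards [hkK] with n hn
    change 0 + (r n : ℂ) * (k n / r n) ∈ K
    rwa [mul_div_cancel₀ _ (hr0 n), zero_add]
  · have h1 := h.cst_lim (l := l) hr0 hS' hka
    refine tendsto_nhds_unique h1 ?_
    have h2 : Tendsto (fun n => (κ - cst S 0) / (r n : ℂ)) l (𝓝 0) := by
      rw [tendsto_zero_iff_norm_tendsto_zero]
      have : Tendsto (fun n => ‖κ - cst S 0‖ / r n) l (𝓝 0) := tendsto_const_nhds.div_atTop hrt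
      refine this.congr fun n => ?_
      rw [norm_div, norm_real, Real.norm_of_nonneg (by linarith [hr n])]
    refine h2.congr' ?_
    filter_upwards [hkκ] with n hn
    rw [mul_div_cancel₀ _ (hr0 n), zero_add, hn, conj_ofReal]

end Glob
end

noncomputable section
open InnerProductSpace (HarmonicAt HarmonicOnNhd)
open scoped ComplexConjugate

namespace Glob

variable {c : ℝ} {U : ℂ → ℝ} {S : ℂ → ℂ} {K : Set ℂ}

lemma cst_eq_of_ball (h : Glob c U S K) {q x y : ℂ} {r : ℝ} (hq : ball q r ⊆ K)
    (hx : x ∈ ball q r) (hy : y ∈ ball q r) : cst S x = cst S y :=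
  (convex_ball q r).isPreconnected.eq_of_eventually_eq
    (fun _ hw => h.loc (interior_maximal hq isOpen_ball hw)) hx hy

/-- The open cone spanned by the directions of two levels is eventually inside `K`. -/
lemma eventually_ball_subset (h : Glob c U S K) (hc : 0 < c) {x y e e' : ℂ} {ω : ℝ}
    (hω : (e' * conj e).im = ω) (hω0 : ω ≠ 0) (hx : Ray S K x e) (hy : Ray S K y e') {q : ℂ}
    (hq1 : 0 < (q * conj e).im / ω) (hq2 : 0 < -(q * conj e').im / ω) :
    ∃ δ > 0, ∀ᶠ R : ℝ in atTop, ball ((R : ℂ) * q) (R * δ) ⊆ K := by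
  have hspan : ∀ q : ℂ, q = ((-(q * conj e').im / ω : ℝ) : ℂ) * e +
      (((q * conj e).im / ω : ℝ) : ℂ) * e' := by
    intro q
    have hω' : (ω : ℂ) ≠ 0 := by exact_mod_cast hω0
    have : (ω : ℂ) * q = ((-(q * conj e').im : ℝ) : ℂ) * e + (((q * conj e).im : ℝ) : ℂ) * e' := by
      rw [← hω]
      apply Complex.ext <;> simp <;> ring
    push_cast at this ⊢
    field_simp
    linear_combination this
  set A : Set ℂ := {w | 0 < (w * conj e).im / ω} ∩ {w | 0 < -(w * conj e').im / ω}
  have hAo : IsOpen A :=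
    (isOpen_lt continuous_const (by fun_prop)).inter (isOpen_lt continuous_const (by fun_prop))
  obtain ⟨ε, hε, hεA⟩ := Metric.isOpen_iff.1 hAo q ⟨hq1, hq2⟩
  refine ⟨ε / 2, by positivity, ?_⟩
  refine mem_iff_ultrafilter.2 fun l hl => ?_
  have hrt : Tendsto (fun R : ℝ => max R 1) l atTop :=
    (tendsto_atTop_mono (fun R => le_max_left R 1) tendsto_id).mono_left hl
  have hr1 : ∀ R : ℝ, 1 ≤ max R 1 := fun R => le_max_right R 1
  have hr0 : ∀ R : ℝ, ((max R 1 : ℝ) : ℂ) ≠ 0 := fun R => by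
    exact_mod_cast (zero_lt_one.trans_le (hr1 R)).ne'
  have hxK : x ∈ K := by simpa using (hx 0 le_rfl).1
  obtain ⟨U', S', hG, hU', hcl⟩ := h.exists_blowdown (l := l) hc ⟨x, hxK⟩ hr1 hrt
  have hray : ∀ w v : ℂ, Ray S K w v → ∀ t : ℝ, 0 ≤ t →
      (t : ℂ) * v ∈ limK l (fun R : ℝ => affK 0 ((max R 1 : ℝ) : ℂ) K) ∧ cst S' (t * v) = 0 := by
    intro w v hw t ht
    refine hcl (fun R => w + ((max R 1 * t : ℝ) : ℂ) * v) (t * v) (cst S w) ?_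
      (Eventually.of_forall fun R => (hw _ (by have := hr1 R; positivity)).1)
      (Eventually.of_forall fun R => (hw _ (by have := hr1 R; positivity)).2)
    have h1 : Tendsto (fun R : ℝ => w / ((max R 1 : ℝ) : ℂ)) l (𝓝 0) := by
      rw [tendsto_zero_iff_norm_tendsto_zero]
      have : Tendsto (fun R : ℝ => ‖w‖ / max R 1) l (𝓝 0) := tendsto_const_nhds.div_atTop hrt
      refine this.congr fun R => ?_
      rw [norm_div, norm_real, Real.norm_of_nonneg (by linarith [hr1 R])]
    have h2 := h1.add_const ((t : ℂ) * v)
    rw [zero_add] at h2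
    refine h2.congr fun R => ?_
    have := hr0 R
    push_cast at this ⊢
    field_simp
  have hAK : A ⊆ limK l (fun R : ℝ => affK 0 ((max R 1 : ℝ) : ℂ) K) := by
    rintro w ⟨hw1, hw2⟩
    simp only [mem_ofPred_eq] at hw1 hw2
    have h1 := hray x e hx (2 * (-(w * conj e').im / ω)) (by linarith)
    have h2 := hray y e' hy (2 * ((w * conj e).im / ω)) (by linarith)
    have h3 := hG.convex_class 0 h1 h2 (by norm_num : (0 : ℝ) ≤ 1 / 2)
      (by norm_num : (0 : ℝ) ≤ 1 / 2) (by norm_num)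
    have h4 := h3.1
    have h5 : w = (1 / 2 : ℝ) • (((2 * (-(w * conj e').im / ω) : ℝ) : ℂ) * e) +
        (1 / 2 : ℝ) • (((2 * ((w * conj e).im / ω) : ℝ) : ℂ) * e') := by
      conv_lhs => rw [hspan w]
      simp only [real_smul]
      push_cast
      ring
    rwa [← h5] at h4
  have hst := Full.interior_stable (l := l) (c := c) hc (U := fun R : ℝ => affU 0 ((max R 1 : ℝ) : ℂ) U)
    (S := fun R : ℝ => affS 0 ((max R 1 : ℝ) : ℂ) S) (K := fun R : ℝ => affK 0 ((max R 1 : ℝ) : ℂ) K)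
    (fun ρ ε hε => Eventually.of_forall fun R => by
      have h3 := (h.aff 0 (hr0 R)) ρ
      refine { h3 with slip := fun x y hx hy => (h3.slip x y hx hy).trans ?_ }
      gcongr
      linarith) hU' (q := q) (δ := ε / 2) (by positivity)
    (by rw [mul_div_cancel₀ _ (by norm_num : (2 : ℝ) ≠ 0)]; exact hεA.trans hAK)
  have hge : ∀ᶠ R : ℝ in (l : Filter ℝ), 1 ≤ R := hl (eventually_ge_atTop 1)
  filter_upwards [hst, hge] with R hR hR1 w hw
  have hR0 : (R : ℂ) ≠ 0 := by exact_mod_cast (by linarith : R ≠ 0)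
  rw [max_eq_left hR1] at hR
  have h1 : w / R ∈ ball q (ε / 2) := by
    rw [mem_ball, dist_eq_norm] at hw ⊢
    have : w / R - q = (w - R * q) / R := by field_simp
    rw [this, norm_div, norm_real, Real.norm_of_nonneg (by linarith), div_lt_iff₀ (by linarith)]
    linarith
  have h2 : (0 : ℂ) + R * (w / R) ∈ K := hR h1
  rwa [mul_div_cancel₀ _ hR0, zero_add] at h2

/-- Distinct levels have opposite directions at infinity. -/
theorem opposite_direction (h : Glob c U S K) (hc : 0 < c) {x y e e' : ℂ} (he : ‖e‖ = 1)
    (he' : ‖e'‖ = 1) (hx : Ray S K x e) (hy : Ray S K y e') (hne : cst S x ≠ cst S y) :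
    e' = -e := by
  have hee := mul_conj_eq_one he
  by_contra hopp
  set ω := (e' * conj e).im with hω
  have hω0 : ω ≠ 0 := by
    intro h0
    have h1 : e' * conj e = ((e' * conj e).re : ℂ) :=
      (conj_eq_iff_re.1 (conj_eq_iff_im.2 h0)).symm
    set s := (e' * conj e).re
    have h2 : e' = s * e := by rw [← h1]; linear_combination -e' * hee
    have h3 : |s| = 1 := by
      have := congrArg norm h2
      rw [he', norm_mul, he, norm_real, mul_one] at this
      exact this.symm
    rcases (abs_eq zero_le_one).1 h3 with h4 | h4
    · rw [h4, ofReal_one, one_mul] at h2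
      subst h2
      exact hne (h.cst_eq_of_same_direction hc he hx hy)
    · rw [h4] at h2
      exact hopp (by rw [h2]; simp)
  set A : Set ℂ := {w | 0 < (w * conj e).im / ω} ∩ {w | 0 < -(w * conj e').im / ω}
  have hAo : IsOpen A :=
    (isOpen_lt continuous_const (by fun_prop)).inter (isOpen_lt continuous_const (by fun_prop))
  have hlin : ∀ (a : ℂ) (s : ℝ), IsLinearMap ℝ fun w : ℂ => s * (w * a).im / ω := fun a s =>
    ⟨fun u v => by rw [add_mul, add_im]; ring, fun r v => by
      rw [real_smul, mul_assoc, im_ofReal_mul, smul_eq_mul]; ring⟩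
  have hAc : Convex ℝ A := by
    have h1 := convex_halfSpace_gt (hlin (conj e) 1) 0
    have h2 := convex_halfSpace_gt (hlin (conj e') (-1)) 0
    simp only [one_mul, neg_one_mul] at h1 h2
    exact h1.inter h2
  have hball : ∀ q ∈ A, ∃ δ > 0, ∀ᶠ R : ℝ in atTop, ball ((R : ℂ) * q) (R * δ) ⊆ K :=
    fun q hq => h.eventually_ball_subset hc hω.symm hω0 hx hy hq.1 hq.2
  have hκ : ∀ q, ∃ κ, q ∈ A → ∀ᶠ R : ℝ in atTop, (R : ℂ) * q ∈ K ∧ cst S (R * q) = κ := by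
    intro q
    by_cases hq : q ∈ A
    swap
    · exact ⟨0, fun h => absurd h hq⟩
    obtain ⟨δ, hδ, hev⟩ := hball q hq
    obtain ⟨R₀, hR₀⟩ := eventually_atTop.1 (hev.and (eventually_gt_atTop 0))
    have hmem : ∀ R, R₀ ≤ R → (R : ℂ) * q ∈ interior K := fun R hR =>
      interior_maximal (hR₀ R hR).1 isOpen_ball
        (mem_ball_self (mul_pos (hR₀ R hR).2 hδ))
    refine ⟨cst S (R₀ * q), fun _ => ?_⟩
    filter_upwards [eventually_ge_atTop R₀] with R hR
    refine ⟨interior_subset (hmem R hR), ?_⟩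
    have hpre : IsPreconnected ((fun R : ℝ => (R : ℂ) * q) '' Ici R₀) :=
      isPreconnected_Ici.image _ (by fun_prop)
    refine hpre.eq_of_eventually_eq (F := cst S) ?_ ⟨R, hR, rfl⟩ ⟨R₀, self_mem_Ici, rfl⟩
    rintro _ ⟨R, hR, rfl⟩
    exact h.loc (hmem R hR)
  choose κ hκ using hκ
  have hκc : ∀ q ∈ A, ∀ q' ∈ A, κ q = κ q' := by
    intro q hq q' hq'
    refine hAc.isPreconnected.eq_of_eventually_eq (fun z hz => ?_) hq hq'
    obtain ⟨δ, hδ, hev⟩ := hball z hz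
    filter_upwards [hAo.mem_nhds hz, ball_mem_nhds z hδ] with w hw hwz
    obtain ⟨R, h1, h2, h3, hR⟩ := (hev.and ((hκ z hz).and ((hκ w hw).and
      (eventually_gt_atTop 0)))).exists
    rw [← h2.2, ← h3.2]
    refine h.cst_eq_of_ball h1 ?_ (mem_ball_self (by positivity))
    rw [mem_ball, dist_eq_norm] at hwz ⊢
    rw [← mul_sub, norm_mul, norm_real, Real.norm_of_nonneg hR.le]
    gcongr
  have hcomb : ∀ a b : ℝ, 0 < a → 0 < b → (a : ℂ) * e + b * e' ∈ A := by
    intro a b ha hb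
    have hee' := mul_conj_eq_one he'
    have e1 : ((a * e + b * e') * conj e).im = b * ω := by
      rw [add_mul, mul_assoc, hee, mul_assoc, add_im, im_ofReal_mul]; simp [hω]
    have e2 : ((a * e + b * e') * conj e').im = -(a * ω) := by
      rw [add_mul, mul_assoc, mul_assoc, hee', add_im, im_ofReal_mul]
      have : (e * conj e').im = -ω := by rw [hω]; simp; ring
      rw [this]; simp
    constructor
    · simp only [mem_ofPred_eq]; rw [e1, mul_div_cancel_right₀ _ hω0]; exact hb
    · simp only [mem_ofPred_eq]; rw [e2, neg_neg, mul_div_cancel_right₀ _ hω0]; exact ha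
  set q₀ : ℂ := ((1 : ℝ) : ℂ) * e + ((1 : ℝ) : ℂ) * e'
  have hq₀ : q₀ ∈ A := hcomb 1 1 one_pos one_pos
  obtain ⟨R₀, hR₀⟩ := (hκ q₀ hq₀).exists
  set b₀ : ℂ := R₀ * q₀
  have hadd : ∀ q ∈ A, b₀ + q ∈ {z | z ∈ K ∧ cst S z = κ q₀} := by
    intro q hq
    refine (h.convex_class (κ q₀)).add_mem_of_tendsto (l := atTop) (h.isClosed_class _) hR₀
      (k := fun R : ℝ => R * q) (s := fun R : ℝ => R⁻¹) ?_ ?_ tendsto_inv_atTop_zero ?_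
    · rw [hκc q₀ hq₀ q hq]; exact hκ q hq
    · filter_upwards [eventually_gt_atTop 0] with R hR using (inv_pos.2 hR).le
    · refine tendsto_const_nhds.congr' ?_
      filter_upwards [eventually_gt_atTop 0] with R hR
      have : (R : ℂ) ≠ 0 := by exact_mod_cast hR.ne'
      push_cast
      field_simp
  have hrays : ∀ a b : ℝ, 0 ≤ a → 0 ≤ b →
      b₀ + ((a : ℂ) * e + b * e') ∈ {z | z ∈ K ∧ cst S z = κ q₀} := by
    intro a b ha hb
    have ht : Tendsto (fun ε : ℝ => b₀ + (((a + ε : ℝ) : ℂ) * e + ((b + ε : ℝ) : ℂ) * e'))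
        (𝓝[>] 0) (𝓝 (b₀ + (((a + 0 : ℝ) : ℂ) * e + ((b + 0 : ℝ) : ℂ) * e'))) := by
      refine Tendsto.mono_left ?_ nhdsWithin_le_nhds
      exact Continuous.tendsto (by fun_prop) 0
    rw [add_zero, add_zero] at ht
    refine (h.isClosed_class _).mem_of_tendsto ht ?_
    filter_upwards [self_mem_nhdsWithin] with ε hε
    have hε' : 0 < ε := hε
    exact hadd _ (hcomb _ _ (by linarith) (by linarith))
  have hb0 : cst S b₀ = κ q₀ := hR₀.2
  have r1 : Ray S K b₀ e := fun t ht => by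
    have := hrays t 0 ht le_rfl
    rw [hb0]
    simpa using this
  have r2 : Ray S K b₀ e' := fun t ht => by
    have := hrays 0 t le_rfl ht
    rw [hb0]
    simpa using this
  exact hne ((h.cst_eq_of_same_direction hc he hx r1).trans
    (h.cst_eq_of_same_direction hc he' hy r2).symm)

lemma convex_of_single (h : Glob c U S K) (hs : ∀ x ∈ K, ∀ y ∈ K, cst S x = cst S y) :
    Convex ℝ K := by
  rcases K.eq_empty_or_nonempty with rfl | ⟨x, hx⟩
  · exact convex_empty
  have : K = {z | z ∈ K ∧ cst S z = cst S x} := by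
    ext z; exact ⟨fun hz => ⟨hz, hs z hz x hx⟩, fun hz => hz.1⟩
  rw [this]
  exact h.convex_class _

/-- A half-plane component from a supporting line contained in `K`. -/
lemma flat_of_support (h : Glob c U S K) (hs : ∀ x ∈ K, ∀ y ∈ K, cst S x = cst S y) {p v : ℂ}
    {r : ℝ} (hr : 0 < r) (hv : v ≠ 0) (hp : p ∈ K)
    (hline : ∀ z ∈ ball p r, (conj v * (z - p)).re = 0 → z ∈ K)
    (hup : ∀ z ∈ K, (conj v * (z - p)).re ≤ 0) :
    ∃ e, ‖e‖ = 1 ∧ v = ‖v‖ * (I * e) ∧ ∀ w, (0 < ((w - p) * conj e).im →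
      w ∉ K ∧ U w = ((w - p) * conj e).im) ∧ (((w - p) * conj e).im = 0 → w ∈ K) := by
  have hv0 : 0 < ‖v‖ := norm_pos_iff.2 hv
  have hvc : (‖v‖ : ℂ) ≠ 0 := by exact_mod_cast hv0.ne'
  have he : ‖-I * v / (‖v‖ : ℂ)‖ = 1 := by simp [hv]
  have him : ∀ w, ((w - p) * conj (-I * v / (‖v‖ : ℂ))).im = (conj v * (w - p)).re / ‖v‖ := by
    intro w
    have : (w - p) * conj (-I * v / (‖v‖ : ℂ)) = I * (conj v * (w - p)) / ‖v‖ := by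
      simp only [map_div₀, map_mul, map_neg, conj_I, conj_ofReal]; ring
    rw [this, div_ofReal_im, I_mul_im]
  refine ⟨-I * v / ‖v‖, he, ?_, ?_⟩
  · field_simp
    linear_combination I_sq
  refine h.flat (κ := cst S p) he hr (fun z hz hz2 => ?_) (fun z _ hz2 hzK => ?_)
  · rw [him, div_eq_zero_iff, or_iff_left hv0.ne'] at hz2
    exact ⟨hline z hz hz2, hs _ (hline z hz hz2) _ hp⟩
  · rw [him] at hz2
    have := hup z hzK
    exact absurd hz2 (not_lt.2 (div_nonpos_of_nonpos_of_nonneg this hv0.le))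

/-- If `cst S` is constant on `K`, components of the complement of `K` are half-planes. -/
theorem halfplane_of_single (h : Glob c U S K) (hc : 0 < c)
    (hs : ∀ x ∈ K, ∀ y ∈ K, cst S x = cst S y) (hne : K.Nonempty) {z : ℂ} (hz : z ∉ K) :
    ∃ e p, ‖e‖ = 1 ∧ 0 < ((z - p) * conj e).im ∧ ∀ w, (0 < ((w - p) * conj e).im →
      w ∉ K ∧ U w = ((w - p) * conj e).im) ∧ (((w - p) * conj e).im = 0 → w ∈ K) := by
  obtain ⟨x, hx⟩ := hne
  have hcl := h.gbase.closed
  have hconv := h.convex_of_single hs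
  set l : Ultrafilter ℕ := hyperfilter ℕ
  have hl : (l : Filter ℕ) ≤ atTop := Nat.hyperfilter_le_atTop
  have hr1 : ∀ n : ℕ, (1 : ℝ) ≤ n + 1 := fun n => by linarith [(n.cast_nonneg : (0 : ℝ) ≤ n)]
  have hr0 : ∀ n : ℕ, (((n : ℝ) + 1 : ℝ) : ℂ) ≠ 0 := fun n => by
    exact_mod_cast (by linarith [hr1 n] : (n : ℝ) + 1 ≠ 0)
  have hrt : Tendsto (fun n : ℕ => (n : ℝ) + 1) l atTop :=
    (tendsto_atTop_add_const_right _ 1 tendsto_natCast_atTop_atTop).mono_left hl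
  obtain ⟨U', S', hG, hU', hcst⟩ := h.exists_blowdown (l := l) hc ⟨x, hx⟩ hr1 hrt
  set K' := limK l fun n : ℕ => affK 0 (((n : ℝ) + 1 : ℝ) : ℂ) K
  have hdiv : Tendsto (fun n : ℕ => x / (((n : ℝ) + 1 : ℝ) : ℂ)) l (𝓝 0) := by
    refine (tendsto_div_natCast_succ x).congr fun n => by push_cast; rfl
  have hseq : ∀ v ∈ K', ∃ k : ℕ → ℂ, (∀ᶠ n in (l : Filter ℕ), k n ∈ K) ∧
      Tendsto (fun n => k n / (((n : ℝ) + 1 : ℝ) : ℂ)) l (𝓝 v) := by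
    intro v hv
    obtain ⟨k, hk, hkv⟩ := exists_seq_of_mem_limK
      (Eventually.of_forall fun n => (h.aff 0 (hr0 n)).gbase.closed) hv
    refine ⟨fun n => (((n : ℝ) + 1 : ℝ) : ℂ) * k n, ?_, ?_⟩
    · filter_upwards [hk] with n hn
      have : (0 : ℂ) + (((n : ℝ) + 1 : ℝ) : ℂ) * k n ∈ K := hn
      rwa [zero_add] at this
    · refine hkv.congr fun n => ?_
      rw [mul_div_cancel_left₀ _ (hr0 n)]
  have hrec : ∀ v ∈ K', ∀ y ∈ K, y + v ∈ K := by
    intro v hv y hy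
    obtain ⟨k, hk, hkv⟩ := hseq v hv
    refine hconv.add_mem_of_tendsto hcl hy hk (s := fun n : ℕ => ((n : ℝ) + 1)⁻¹)
      (Eventually.of_forall fun n => by positivity) (tendsto_inv_atTop_zero.comp hrt) ?_
    refine hkv.congr fun n => ?_
    push_cast
    rw [div_eq_inv_mul]
  have hmem : ∀ v, (∀ t : ℝ, 0 ≤ t → x + t * v ∈ K) → v ∈ K' := by
    intro v hv
    refine (hcst (fun n => x + (((n : ℝ) + 1 : ℝ) : ℂ) * v) v (cst S x) ?_
      (Eventually.of_forall fun n => hv _ (by positivity))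
      (Eventually.of_forall fun n => hs _ (hv _ (by positivity)) _ hx)).1
    have := hdiv.add_const v
    rw [zero_add] at this
    refine this.congr fun n => ?_
    rw [add_div, mul_div_cancel_left₀ _ (hr0 n)]
  have hray : ∀ v ∈ K', ∀ y ∈ K, ∀ t : ℝ, 0 ≤ t → y + t * v ∈ K := by
    intro v hv y hy t ht
    have hn : ∀ n : ℕ, y + n * v ∈ K := by
      intro n
      induction n with
      | zero => simpa using hy
      | succ n ih =>
        have := hrec v hv _ ih
        rw [add_assoc] at this
        have e1 : (n : ℂ) * v + v = ((n + 1 : ℕ) : ℂ) * v := by push_cast; ring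
        rwa [e1] at this
    obtain ⟨n, hnt⟩ := exists_nat_gt t
    have hn0 : (0 : ℝ) < n := by linarith
    have h1 := hconv hy (hn n) (sub_nonneg.2 ((div_le_one hn0).2 hnt.le))
      (div_nonneg ht hn0.le) (by ring)
    have hn0' : (n : ℂ) ≠ 0 := by exact_mod_cast hn0.ne'
    have e1 : (1 - t / n) • y + (t / n) • (y + (n : ℂ) * v) = y + t * v := by
      simp only [real_smul]; push_cast; field_simp; ring
    rwa [e1] at h1
  have hcone : ∀ v ∈ K', ∀ t : ℝ, 0 ≤ t → (t : ℂ) * v ∈ K' := by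
    intro v hv t ht
    refine hmem _ fun s hs' => ?_
    have := hray v hv x hx (s * t) (by positivity)
    push_cast at this
    rwa [mul_assoc] at this
  have hs' : ∀ a ∈ K', ∀ b ∈ K', cst S' a = cst S' b := by
    have : ∀ a ∈ K', cst S' a = 0 := by
      intro a ha
      obtain ⟨k, hk, hka⟩ := hseq a ha
      refine (hcst k a (cst S x) hka hk ?_).2
      filter_upwards [hk] with n hn using hs _ hn _ hx
    intro a ha b hb
    rw [this a ha, this b hb]
  have hconv' := hG.convex_of_single hs'
  have hline : ∃ v, v ≠ 0 ∧ v ∈ K' ∧ -v ∈ K' := by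
    by_contra! hpt
    obtain ⟨e, he, hre⟩ := h.exists_ray hx
    have heK : e ∈ K' := hmem e fun t ht => (hre t ht).1
    have he0 : e ≠ 0 := by rw [← norm_pos_iff, he]; exact one_pos
    have h0K : (0 : ℂ) ∈ K' := by simpa using hcone e heK 0 le_rfl
    have hq : ∃ q, 0 < (conj q * e).re ∧ q ∉ K' := by
      by_contra! hall
      have key : ∀ σ : ℂ, (conj σ * e).re = 0 → σ ∈ K' := by
        intro σ hσ
        have ht : Tendsto (fun ε : ℝ => σ + ε * e) (𝓝[>] 0) (𝓝 (σ + (0 : ℝ) * e)) :=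
          Tendsto.mono_left (Continuous.tendsto (by fun_prop) 0) nhdsWithin_le_nhds
        simp only [ofReal_zero, zero_mul, add_zero] at ht
        refine hG.gbase.closed.mem_of_tendsto ht ?_
        filter_upwards [self_mem_nhdsWithin] with ε hε
        apply hall
        have e1 : conj (σ + ε * e) * e = conj σ * e + ((ε : ℝ) : ℂ) * (e * conj e) := by
          simp only [map_add, map_mul, conj_ofReal]; ring
        rw [e1, mul_conj_eq_one he, add_re, hσ]
        simpa using hε
      have hI : (conj (I * e) * e).re = 0 := by
        rw [map_mul, conj_I, mul_assoc, mul_comm (conj e), mul_conj_eq_one he]; simp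
      refine hpt (I * e) (by simp [he0]) (key _ hI) (key _ ?_)
      rw [map_neg, neg_mul, neg_re, hI, neg_zero]
    obtain ⟨q, hq1, hqK⟩ := hq
    obtain ⟨π, hπ, hπ1, hπ2⟩ := exists_norm_eq_infDist hG.gbase.closed ⟨0, h0K⟩ q
    have hnear : ∀ k ∈ K', (conj (q - π) * (k - π)).re ≤ 0 := fun k hk =>
      hconv'.re_conj_mul_le_zero_of_nearest hπ (fun k hk => hπ1 ▸ hπ2 k hk) hk
    have hπ0 : π ≠ 0 := by
      rintro rfl
      have := hnear e heK
      rw [sub_zero, sub_zero] at this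
      linarith
    have hv : q - π ≠ 0 := sub_ne_zero.2 fun h => hqK (h ▸ hπ)
    have hperp : (conj (q - π) * π).re = 0 := by
      have h1 := hnear 0 h0K
      have h2 := hnear _ (hcone π hπ 2 (by norm_num))
      have e2 : ((2 : ℝ) : ℂ) * π - π = π := by push_cast; ring
      rw [e2] at h2
      rw [zero_sub, mul_neg, neg_re] at h1
      linarith
    obtain ⟨e', he', -, hall⟩ := hG.flat_of_support hs' (norm_pos_iff.2 hπ0) hv hπ (by
      intro w hw hw2
      obtain ⟨t, ht⟩ := exists_real_mul_of_perp hv hπ0 hperp hw2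
      have hw3 : w = ((1 + t : ℝ) : ℂ) * π := by push_cast; linear_combination ht
      rw [hw3]
      refine hcone π hπ _ ?_
      rw [mem_ball, dist_eq_norm, ht, norm_mul, norm_real, Real.norm_eq_abs] at hw
      have : |t| < 1 := by
        by_contra! h1
        nlinarith [norm_nonneg π]
      linarith [(abs_lt.1 this).1]) hnear
    refine hpt π hπ0 hπ ((hall (-π)).2 ?_)
    -- `π` is parallel to the supporting line
    have h3 := hall 0
    have h4 : ¬ 0 < ((0 - π) * conj e').im := fun h5 => (h3.1 h5).1 h0K
    have h5 := (hall (((2 : ℝ) : ℂ) * π)).1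
    have h6 : ¬ 0 < (((2 : ℝ) * π - π) * conj e').im := fun h7 =>
      (h5 h7).1 (hcone π hπ 2 (by norm_num))
    have e3 : ((2 : ℝ) : ℂ) * π - π = π := by push_cast; ring
    rw [e3] at h6
    rw [zero_sub, neg_mul, neg_im] at h4
    have e4 : (-π - π) * conj e' = ((-2 : ℝ) : ℂ) * (π * conj e') := by push_cast; ring
    rw [e4, im_ofReal_mul]
    have : (π * conj e').im = 0 := by linarith
    rw [this, mul_zero]
  obtain ⟨v, hv0, hv1, hv2⟩ := hline
  obtain ⟨p, hp, hp1, hp2⟩ := exists_norm_eq_infDist hcl ⟨x, hx⟩ z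
  have hnear : ∀ k ∈ K, (conj (z - p) * (k - p)).re ≤ 0 := fun k hk =>
    hconv.re_conj_mul_le_zero_of_nearest hp (fun k hk => hp1 ▸ hp2 k hk) hk
  have hzp : z - p ≠ 0 := sub_ne_zero.2 fun h => hz (h ▸ hp)
  have hperp : (conj (z - p) * v).re = 0 := by
    have h1 := hnear _ (hrec v hv1 p hp)
    have h2 := hnear _ (hrec _ hv2 p hp)
    rw [add_sub_cancel_left] at h1 h2
    rw [mul_neg, neg_re] at h2
    linarith
  obtain ⟨e, he, hze, hall⟩ := h.flat_of_support hs one_pos hzp hp (by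
    intro w _ hw2
    obtain ⟨t, ht⟩ := exists_real_mul_of_perp hzp hv0 hperp hw2
    have hw3 : w = p + t * v := by linear_combination ht
    rw [hw3]
    rcases le_total 0 t with h1 | h1
    · exact hray v hv1 p hp t h1
    · have := hray (-v) hv2 p hp (-t) (by linarith)
      push_cast at this
      rwa [neg_mul_neg] at this) hnear
  refine ⟨e, p, he, ?_, hall⟩
  rw [hze, mul_assoc, mul_assoc, mul_conj_eq_one he]
  simpa using hzp

end Glob
end

noncomputable section
open InnerProductSpace (HarmonicAt HarmonicOnNhd)
open scoped ComplexConjugate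

lemma parallel_of_line_not_meet {K : Set ℂ} {e p e' p' : ℂ} (he : ‖e‖ = 1) (he' : ‖e'‖ = 1)
    (h1 : ∀ w, ((w - p) * conj e).im = 0 → w ∈ K)
    (h2 : ∀ w, 0 < ((w - p') * conj e').im → w ∉ K) : e' = e ∨ e' = -e := by
  have hee := mul_conj_eq_one he
  have hee' := mul_conj_eq_one he'
  have h3 : ∀ t : ℝ, ((p - p') * conj e').im + t * (e * conj e').im ≤ 0 := by
    intro t
    by_contra! h4
    refine h2 (p + t * e) ?_ (h1 _ ?_)
    · have : (p + t * e - p') * conj e' = (p - p') * conj e' + t * (e * conj e') := by ring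
      rw [this, add_im, im_ofReal_mul]; exact h4
    · rw [add_sub_cancel_left, mul_assoc, hee]; simp
  have h4 : (e * conj e').im = 0 := by
    by_contra hne
    have := h3 ((1 - ((p - p') * conj e').im) / (e * conj e').im)
    rw [div_mul_cancel₀ _ hne] at this
    linarith
  have h5 : e * conj e' = ((e * conj e').re : ℂ) := (conj_eq_iff_re.1 (conj_eq_iff_im.2 h4)).symm
  set s := (e * conj e').re
  have h6 : e = s * e' := by rw [← h5]; linear_combination -e * hee'
  have h7 : |s| = 1 := by
    have := congrArg norm h6
    rw [he, norm_mul, he', norm_real, mul_one] at this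
    exact this.symm
  rcases (abs_eq zero_le_one).1 h7 with h8 | h8
  · left; rw [h6, h8]; simp
  · right; rw [h6, h8]; simp

namespace Glob

variable {c : ℝ} {U : ℂ → ℝ} {S : ℂ → ℂ} {K : Set ℂ}

/-- The solutions with a single level. -/
theorem planes_of_single (h : Glob c U S K) (hc : 0 < c)
    (hs : ∀ x ∈ K, ∀ y ∈ K, cst S x = cst S y) (hne : K.Nonempty) (hK : K ≠ univ) :
    ∃ z₀ m : ℂ, ‖m‖ = 1 ∧ ((∀ z, U (z₀ + m * z) = Pfun z) ∨
      (∃ a : ℝ, 0 < a ∧ ∀ z, U (z₀ + m * z) = TPfun a z) ∨ ∀ z, U (z₀ + m * z) = Wfun 1 z) := by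
  obtain ⟨z, hz⟩ := (ne_univ_iff_exists_notMem K).1 hK
  obtain ⟨e, p, he, -, hall⟩ := h.halfplane_of_single hc hs hne hz
  have hee := mul_conj_eq_one he
  refine ⟨p, I * e, by simp [he], ?_⟩
  have him : ∀ w, ((p + I * e * w - p) * conj e).im = w.re := by
    intro w
    have : (p + I * e * w - p) * conj e = I * w := by linear_combination I * w * hee
    rw [this, I_mul_im]
  have hpK : p ∈ K := (hall p).2 (by simp)
  by_cases hA : ∀ w, ((w - p) * conj e).im < 0 → w ∈ K
  · left
    intro w
    rw [Pfun]
    rcases lt_or_ge 0 w.re with hw | hw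
    · rw [max_eq_left hw.le, ((hall _).1 (by rwa [him])).2, him]
    · rw [max_eq_right hw]
      refine h.gbase.zero ?_
      rcases hw.lt_or_eq with hw | hw
      · exact hA _ (by rwa [him])
      · exact (hall _).2 (by rwa [him])
  right
  push Not at hA
  obtain ⟨w₀, hw₀, hw₀K⟩ := hA
  obtain ⟨e', p', he', hw₀', hall'⟩ := h.halfplane_of_single hc hs hne hw₀K
  have hsub : ∀ u v, ((u - v) * conj e).im = ((u - p) * conj e).im - ((v - p) * conj e).im := by
    intro u v; rw [← sub_im]; ring_nf
  have hopp : e' = -e := by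
    rcases parallel_of_line_not_meet he he' (fun w => (hall w).2) (fun w hw => ((hall' w).1 hw).1)
      with h1 | h1
    · subst h1
      rw [hsub] at hw₀'
      refine absurd hpK ((hall' p).1 ?_).1
      rw [hsub, sub_self, zero_mul, zero_im]
      linarith
    · exact h1
  subst hopp
  set a := -((p' - p) * conj e).im with ha
  have him' : ∀ w, ((w - p') * conj (-e)).im = -((w - p) * conj e).im - a := by
    intro w; rw [map_neg, mul_neg, neg_im, hsub]; ring
  simp only [him'] at hall'
  have ha0 : 0 ≤ a := by
    by_contra! hlt
    exact ((hall' p).1 (by simpa using hlt)).1 hpK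
  have hp'K : p' ∈ K := (hall' p').2 (by rw [ha]; ring)
  have hmid : ∀ w, -a < ((w - p) * conj e).im → ((w - p) * conj e).im < 0 → w ∈ K := by
    intro w h1 h2
    by_contra hwK
    obtain ⟨e'', p'', he'', hw3, hall''⟩ := h.halfplane_of_single hc hs hne hwK
    rcases parallel_of_line_not_meet he he'' (fun w => (hall w).2)
      (fun w hw => ((hall'' w).1 hw).1) with h4 | h4
    · subst h4
      rw [hsub] at hw3
      refine absurd hpK ((hall'' p).1 ?_).1
      rw [hsub, sub_self, zero_mul, zero_im]
      linarith
    · subst h4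
      rw [map_neg, mul_neg, neg_im, hsub] at hw3
      refine absurd hp'K ((hall'' p').1 ?_).1
      rw [map_neg, mul_neg, neg_im, hsub]
      linarith
  have hU : ∀ w, U (p + I * e * w) = TPfun a w := by
    intro w
    rw [TPfun]
    rcases lt_or_ge 0 w.re with hw | hw
    · rw [max_eq_left hw.le, ((hall _).1 (by rwa [him])).2, him, max_eq_right (by linarith),
        add_zero]
    rcases lt_or_ge 0 (-w.re - a) with hw2 | hw2
    · rw [max_eq_right hw, max_eq_left hw2.le, ((hall' _).1 (by rwa [him])).2, him, zero_add]
    · rw [max_eq_right hw, max_eq_right hw2, add_zero]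
      refine h.gbase.zero ?_
      rcases hw.lt_or_eq with hw3 | hw3
      · rcases hw2.lt_or_eq with hw4 | hw4
        · exact hmid _ (by rw [him]; linarith) (by rwa [him])
        · exact (hall' _).2 (by rwa [him])
      · exact (hall _).2 (by rwa [him])
  rcases ha0.lt_or_eq with ha1 | ha1
  · exact Or.inl ⟨a, ha1, hU⟩
  · right
    intro w
    rw [hU, ← ha1, TPfun, Wfun, sub_zero, one_mul]
    rcases le_total 0 w.re with hw | hw
    · rw [max_eq_left hw, max_eq_right (by linarith), abs_of_nonneg hw, add_zero]
    · rw [max_eq_right hw, max_eq_left (by linarith), abs_of_nonpos hw, zero_add]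

end Glob

lemma ray_aff {z₀ m : ℂ} {S : ℂ → ℂ} {K : Set ℂ} (hm : m ≠ 0) {x e : ℂ} :
    Ray (affS z₀ m S) (affK z₀ m K) x e ↔ Ray S K (z₀ + m * x) (m * e) := by
  have hcm : conj m ≠ 0 := by simpa using hm
  have e1 : ∀ t : ℝ, z₀ + m * x + t * (m * e) = z₀ + m * (x + t * e) := fun t => by ring
  simp only [Ray, e1]
  refine forall_congr' fun t => imp_congr_right fun _ => and_congr_right fun _ => ?_
  simp only [cst, affS_sub_conj hm]
  rw [div_left_inj' hcm, sub_left_inj]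

/-- Two levels, with directions `i` and `-i`. -/
structure Two (c : ℝ) (κ₀ κ₁ : ℂ) (U : ℂ → ℝ) (S : ℂ → ℂ) (K : Set ℂ) : Prop where
  glob : Glob c U S K
  pos : 0 < c
  ne : κ₀ ≠ κ₁
  cases : ∀ x ∈ K, cst S x = κ₀ ∨ cst S x = κ₁
  nonempty₀ : ∃ x ∈ K, cst S x = κ₀
  nonempty₁ : ∃ x ∈ K, cst S x = κ₁
  dir₀ : ∀ x, cst S x = κ₀ → ∀ e, ‖e‖ = 1 → Ray S K x e → e = I
  dir₁ : ∀ x, cst S x = κ₁ → ∀ e, ‖e‖ = 1 → Ray S K x e → e = -I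

lemma Glob.exists_two {c : ℝ} {U : ℂ → ℝ} {S : ℂ → ℂ} {K : Set ℂ} (h : Glob c U S K) (hc : 0 < c)
    {x y : ℂ} (hx : x ∈ K) (hy : y ∈ K) (hxy : cst S x ≠ cst S y) :
    ∃ m : ℂ, ‖m‖ = 1 ∧ ∃ κ₀ κ₁, Two c κ₀ κ₁ (affU 0 m U) (affS 0 m S) (affK 0 m K) := by
  obtain ⟨e, he, hxe⟩ := h.exists_ray hx
  obtain ⟨e', he', hye⟩ := h.exists_ray hy
  have hopp := h.opposite_direction hc he he' hxe hye hxy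
  subst hopp
  have he0 : e ≠ 0 := by rw [← norm_pos_iff, he]; exact one_pos
  set m : ℂ := -I * e with hm
  have hm0 : m ≠ 0 := by simp [hm, he0]
  have hcm : conj m ≠ 0 := by simpa using hm0
  have hm1 : ‖m‖ = 1 := by simp [hm, he]
  have key : ∀ w ∈ K, cst S w = cst S x ∨ cst S w = cst S y := by
    intro w hw
    by_contra! hcon
    obtain ⟨d, hd, hwd⟩ := h.exists_ray hw
    have h1 := h.opposite_direction hc he hd hxe hwd hcon.1.symm
    have h2 := h.opposite_direction hc he' hd hye hwd hcon.2.symm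
    rw [h1, neg_neg] at h2
    exact he0 (self_eq_neg.1 h2.symm)
  have hcst : ∀ w, cst (affS 0 m S) w = (cst S (m * w) - cst S 0) / conj m := by
    intro w
    have := affS_sub_conj (z₀ := 0) (S := S) hm0 w
    simpa [cst] using this
  have hinj : ∀ w κ, cst (affS 0 m S) w = (κ - cst S 0) / conj m ↔ cst S (m * w) = κ := by
    intro w κ
    rw [hcst, div_left_inj' hcm, sub_left_inj]
  have hmem : ∀ w, w ∈ affK 0 m K ↔ m * w ∈ K := by intro w; simp [affK]
  have hnorm : ∀ d : ℂ, ‖d‖ = 1 → ‖m * d‖ = 1 := fun d hd => by rw [norm_mul, hm1, hd, one_mul]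
  refine ⟨m, hm1, (cst S x - cst S 0) / conj m, (cst S y - cst S 0) / conj m, h.aff 0 hm0, hc,
    ?_, ?_, ⟨x / m, ?_, ?_⟩, ⟨y / m, ?_, ?_⟩, ?_, ?_⟩
  · rw [ne_eq, div_left_inj' hcm, sub_left_inj]; exact hxy
  · intro w hw
    rw [hinj, hinj]
    exact key _ ((hmem w).1 hw)
  · rwa [hmem, mul_div_cancel₀ _ hm0]
  · rw [hinj, mul_div_cancel₀ _ hm0]
  · rwa [hmem, mul_div_cancel₀ _ hm0]
  · rw [hinj, mul_div_cancel₀ _ hm0]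
  · intro w hw d hd hray
    rw [hinj] at hw
    rw [ray_aff hm0, zero_add] at hray
    have := h.opposite_direction hc he' (hnorm d hd) hye hray (by rw [hw]; exact hxy.symm)
    rw [neg_neg] at this
    apply mul_left_cancel₀ he0
    rw [hm] at this
    linear_combination I * this + e * d * I_sq
  · intro w hw d hd hray
    rw [hinj] at hw
    rw [ray_aff hm0, zero_add] at hray
    have := h.opposite_direction hc he (hnorm d hd) hxe hray (by rw [hw]; exact hxy)
    apply mul_left_cancel₀ he0
    rw [hm] at this
    linear_combination I * this + e * d * I_sq

namespace Two

variable {c : ℝ} {κ₀ κ₁ : ℂ} {U : ℂ → ℝ} {S : ℂ → ℂ} {K : Set ℂ}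

lemma ray₀ (h : Two c κ₀ κ₁ U S K) {x : ℂ} (hx : x ∈ K) (hc : cst S x = κ₀) : Ray S K x I := by
  obtain ⟨e, he, hr⟩ := h.glob.exists_ray hx
  rwa [h.dir₀ x hc e he hr] at hr

lemma ray₁ (h : Two c κ₀ κ₁ U S K) {x : ℂ} (hx : x ∈ K) (hc : cst S x = κ₁) : Ray S K x (-I) := by
  obtain ⟨e, he, hr⟩ := h.glob.exists_ray hx
  rwa [h.dir₁ x hc e he hr] at hr

/-- Rotation by `π` exchanges the two levels. -/
lemma neg (h : Two c κ₀ κ₁ U S K) : Two c (cst S 0 - κ₁) (cst S 0 - κ₀)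
    (affU 0 (-1) U) (affS 0 (-1) S) (affK 0 (-1) K) := by
  have hm : (-1 : ℂ) ≠ 0 := by norm_num
  have hcst : ∀ w, cst (affS 0 (-1) S) w = cst S 0 - cst S (-w) := by
    intro w
    have := affS_sub_conj (z₀ := 0) (S := S) hm w
    simp only [cst] at this ⊢
    rw [this]; simp only [map_neg, map_one, zero_add, neg_mul, one_mul, map_zero]; ring
  have hmem : ∀ w, w ∈ affK 0 (-1) K ↔ -w ∈ K := by intro w; simp [affK]
  have hinj : ∀ w κ, cst (affS 0 (-1) S) w = cst S 0 - κ ↔ cst S (-w) = κ := by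
    intro w κ; rw [hcst, sub_right_inj]
  refine ⟨h.glob.aff 0 hm, h.pos, ?_, ?_, ?_, ?_, ?_, ?_⟩
  · rw [ne_eq, sub_right_inj]; exact h.ne.symm
  · intro x hx
    rw [hinj, hinj]
    exact (h.cases _ ((hmem x).1 hx)).symm
  · obtain ⟨x, hx, hx2⟩ := h.nonempty₁
    exact ⟨-x, by rwa [hmem, neg_neg], by rwa [hinj, neg_neg]⟩
  · obtain ⟨x, hx, hx2⟩ := h.nonempty₀
    exact ⟨-x, by rwa [hmem, neg_neg], by rwa [hinj, neg_neg]⟩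
  · intro x hx e he hr
    rw [hinj] at hx
    rw [ray_aff hm] at hr
    have := h.dir₁ (-x) hx (-e) (by rwa [norm_neg]) (by simpa using hr)
    exact neg_injective this
  · intro x hx e he hr
    rw [hinj] at hx
    rw [ray_aff hm] at hr
    have := h.dir₀ (-x) hx (-e) (by rwa [norm_neg]) (by simpa using hr)
    rw [← this, neg_neg]

lemma cst_eq_of_isPreconnected (h : Two c κ₀ κ₁ U S K) {B : Set ℂ} (hB : IsPreconnected B)
    (hBK : B ⊆ K) {x y : ℂ} (hx : x ∈ B) (hy : y ∈ B) : cst S x = cst S y := by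
  by_contra hne
  have hcl : ∀ κ, IsClosed {z | cst S z = κ} := fun κ =>
    isClosed_eq h.glob.continuous_cst continuous_const
  obtain ⟨z, -, hz1, hz2⟩ := isPreconnected_closed_iff.1 hB _ _ (hcl (cst S x)) (hcl (cst S y))
    (fun z hz => by
      simp only [mem_union, mem_ofPred_eq]
      rcases h.cases z (hBK hz) with h1 | h1 <;> rcases h.cases x (hBK hx) with h2 | h2 <;>
        rcases h.cases y (hBK hy) with h3 | h3 <;> rw [h1, h2, h3] <;> simp_all)
    ⟨x, hx, rfl⟩ ⟨y, hy, rfl⟩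
  exact hne (hz1.symm.trans hz2)

lemma ne_univ (h : Two c κ₀ κ₁ U S K) : K ≠ univ := by
  intro hK
  obtain ⟨x, -, hx⟩ := h.nonempty₀
  obtain ⟨y, -, hy⟩ := h.nonempty₁
  exact h.ne (hx.symm.trans ((h.cst_eq_of_isPreconnected isPreconnected_univ hK.ge (mem_univ x)
    (mem_univ y)).trans hy))

lemma norm_cgrad_lt (h : Two c κ₀ κ₁ U S K) {z : ℂ} (hz : z ∉ K) : ‖cgrad U z‖ < 1 := by
  refine lt_of_le_of_ne (h.glob.norm_cgrad_le hz) fun hg => ?_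
  obtain ⟨b, -, hb2, hb3⟩ := h.glob.gbase.halfplane one_pos
    (fun w hw => h.glob.norm_cgrad_le hw) hz hg
  set g := cgrad U z
  obtain ⟨x, hx, hxc⟩ := h.nonempty₀
  obtain ⟨y, hy, hyc⟩ := h.nonempty₁
  have hnon : ∀ w v, Ray S K w v → (g * v).re ≤ 0 := by
    intro w v hw
    by_contra! hlt
    have h1 : ∀ t : ℝ, 0 ≤ t → (g * w).re + b + t * (g * v).re ≤ 0 := by
      intro t ht
      by_contra! h2
      refine (hb2 (w + t * v) ?_).1 (hw t ht).1
      have : g * (w + t * v) = g * w + t * (g * v) := by ring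
      rw [this, add_re, re_ofReal_mul]; linarith
    have h2 := h1 ((|(g * w).re + b| + 1) / (g * v).re) (by positivity)
    rw [div_mul_cancel₀ _ hlt.ne'] at h2
    linarith [neg_abs_le ((g * w).re + b)]
  have h1 := hnon x I (h.ray₀ hx hxc)
  have h2 := hnon y (-I) (h.ray₁ hy hyc)
  have h3 : (g * I).re = 0 := by
    rw [mul_neg, neg_re] at h2; linarith
  have hgg : g * conj g = 1 := mul_conj_eq_one hg
  set p : ℂ := (-b : ℝ) * conj g
  have hline : ∀ t : ℝ, p + t * I ∈ K := by
    intro t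
    apply hb3
    have : g * (p + t * I) = ((-b : ℝ) : ℂ) * (g * conj g) + t * (g * I) := by
      simp only [p]; ring
    rw [this, hgg, add_re, re_ofReal_mul, re_ofReal_mul, h3]; simp
  have hcst : ∀ t : ℝ, cst S (p + t * I) = cst S p := by
    intro t
    have hpre : IsPreconnected (range fun t : ℝ => p + t * I) :=
      isPreconnected_range (by fun_prop)
    refine h.cst_eq_of_isPreconnected hpre ?_ ⟨t, rfl⟩ ⟨0, by simp⟩
    rintro _ ⟨t, rfl⟩
    exact hline t
  have hpK : p ∈ K := by simpa using hline 0
  have r1 : Ray S K p I := fun t _ => ⟨hline t, hcst t⟩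
  have r2 : Ray S K p (-I) := fun t _ => by
    have := hline (-t)
    have h4 := hcst (-t)
    push_cast at this h4
    rw [neg_mul, ← mul_neg] at this h4
    exact ⟨this, h4⟩
  have hII : (I : ℂ) ≠ -I := by
    intro h5
    have := congrArg im h5
    norm_num at this
  rcases h.cases p hpK with h5 | h5
  · exact hII (h.dir₀ p h5 _ (by simp) r2).symm
  · exact hII (h.dir₁ p h5 _ (by simp) r1)

lemma eventually_cst_eq (h : Two c κ₀ κ₁ U S K) {p : ℂ} (hc : cst S p = κ₀) :
    ∀ᶠ k in 𝓝 p, k ∈ K → cst S k = κ₀ := by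
  have : ∀ᶠ k in 𝓝 p, cst S k ≠ κ₁ :=
    h.glob.continuous_cst.continuousAt.eventually_ne (by rw [hc]; exact h.ne)
  filter_upwards [this] with k hk hkK
  exact (h.cases k hkK).resolve_right hk

lemma cgrad_im_mul (e p z : ℂ) : cgrad (fun w => ((w - p) * conj e).im) z = -I * conj e := by
  have : (fun w => ((w - p) * conj e).im) =
      fun w => (-I * conj e * w).re + -(p * conj e).im := by
    funext w
    have e1 : -I * conj e * w = -(I * (w * conj e)) := by ring
    rw [e1, neg_re, I_mul_re, sub_mul, sub_im]; ring
  rw [this, cgrad_re_mul_add]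

/-- Normals of the upper level point strictly downwards. -/
lemma im_normal_neg (h : Two c κ₀ κ₁ U S K) {p ν : ℂ} (hp : p ∈ K) (hc : cst S p = κ₀)
    (hν : ‖ν‖ = 1) (hn : ∀ k ∈ K, cst S k = κ₀ → (conj ν * (k - p)).re ≤ 0) : ν.im < 0 := by
  have hray := h.ray₀ hp hc
  have h1 : ν.im ≤ 0 := by
    have := hn _ (hray 1 zero_le_one).1 ((hray 1 zero_le_one).2.trans hc)
    rw [add_sub_cancel_left] at this
    simpa using this
  refine lt_of_le_of_ne h1 fun h0 => ?_
  set p' : ℂ := p + I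
  have hp' : p' ∈ K ∧ cst S p' = κ₀ := by
    have := hray 1 zero_le_one
    rw [hc] at this
    simpa using this
  have hνν := mul_conj_eq_one hν
  obtain ⟨r, hr, hball⟩ := Metric.eventually_nhds_iff_ball.1 (h.eventually_cst_eq hp'.2)
  have hconj : conj ν = ν := conj_eq_iff_im.2 h0
  have hνre : ν = (ν.re : ℂ) := (conj_eq_iff_re.1 hconj).symm
  have hν0 : ν.re ≠ 0 := by
    intro h2
    rw [h2, ofReal_zero] at hνre
    rw [hνre, norm_zero] at hν
    exact zero_ne_one hν
  have hIm : ∀ z, ((z - p') * conj (-I * ν)).im = (conj ν * (z - p)).re := by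
    intro z
    have e1 : (z - p') * conj (-I * ν) = I * (conj ν * (z - p)) + conj ν := by
      simp only [p', map_mul, map_neg, conj_I]; linear_combination -conj ν * I_sq
    rw [e1, add_im, I_mul_im, hconj, h0, add_zero]
  have he : ‖-I * ν‖ = 1 := by simp [hν]
  have hflat := h.glob.flat (e := -I * ν) (p := p') (κ := κ₀) (r := min r 1) he
    (lt_min hr one_pos) (fun z hz hz2 => by
      rw [hIm, hconj, hνre, re_ofReal_mul, mul_eq_zero, or_iff_right hν0, sub_re] at hz2
      have e1 : z = p + ((z - p).im : ℂ) * I := by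
        apply Complex.ext <;> simp
        linarith
      have h3 : 0 ≤ (z - p).im := by
        have h4 : |(z - p').im| < 1 :=
          (abs_im_le_norm _).trans_lt (by
            rw [← dist_eq_norm]; exact (mem_ball.1 hz).trans_le (min_le_right _ _))
        have h5 : (z - p).im = (z - p').im + 1 := by simp [p']; ring
        rw [h5]; linarith [(abs_lt.1 h4).1]
      have := hray _ h3
      rw [← e1, hc] at this
      exact this) (fun z hz hz2 hzK => by
      rw [hIm] at hz2
      exact absurd hz2 (not_lt.2 (hn z hzK
        (hball z (ball_subset_ball (min_le_left _ _) hz) hzK))))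
  set z₁ : ℂ := p + ν
  have hz₁ : 0 < ((z₁ - p') * conj (-I * ν)).im := by
    rw [hIm, add_sub_cancel_left, mul_comm, hνν]; simp
  have hlt := h.norm_cgrad_lt ((hflat z₁).1 hz₁).1
  have hev : U =ᶠ[𝓝 z₁] fun w => ((w - p') * conj (-I * ν)).im := by
    have hcont : Continuous fun w : ℂ => ((w - p') * conj (-I * ν)).im := by fun_prop
    filter_upwards [hcont.continuousAt.eventually (lt_mem_nhds hz₁)] with w hw
    exact ((hflat w).1 hw).2
  rw [cgrad_congr hev, cgrad_im_mul] at hlt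
  simp [hν] at hlt

lemma exists_ball_subset (h : Two c κ₀ κ₁ U S K) :
    ∃ q r, 0 < r ∧ ball q r ⊆ {z | z ∈ K ∧ cst S z = κ₀} := by
  obtain ⟨x, hx, hxc⟩ := h.nonempty₀
  have hex : ∀ ν : ℂ, ‖ν‖ = 1 → ν.im = 0 → ∃ k ∈ K, cst S k = κ₀ ∧ 0 < (conj ν * (k - x)).re := by
    intro ν hν h0
    by_contra! hcon
    have := h.im_normal_neg hx hxc hν hcon
    linarith
  obtain ⟨k, hk, hkc, hk2⟩ := hex 1 (by simp) (by simp)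
  obtain ⟨k', hk', hkc', hk2'⟩ := hex (-1) (by simp) (by simp)
  simp only [map_one, one_mul, sub_re, map_neg, neg_mul, neg_re] at hk2 hk2'
  set A : Set ℂ := {w | k'.re < w.re} ∩ {w | w.re < k.re} ∩ {w | max k.im k'.im < w.im}
  have hAo : IsOpen A := ((isOpen_lt continuous_const continuous_re).inter
    (isOpen_lt continuous_re continuous_const)).inter (isOpen_lt continuous_const continuous_im)
  have hA : A ⊆ {z | z ∈ K ∧ cst S z = κ₀} := by
    rintro w ⟨⟨h1, h2⟩, h3⟩
    simp only [mem_ofPred_eq] at h1 h2 h3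
    set s := (w.re - k'.re) / (k.re - k'.re) with hs
    have hd : 0 < k.re - k'.re := by linarith
    have hs0 : 0 ≤ s := div_nonneg (by linarith) hd.le
    have hs1 : s ≤ 1 := (div_le_one hd).2 (by linarith)
    have hmem := h.glob.convex_class κ₀ ⟨hk', hkc'⟩ ⟨hk, hkc⟩ (sub_nonneg.2 hs1) hs0 (by ring)
    set v := (1 - s) • k' + s • k with hv
    have hvre : v.re = w.re := by
      have : s * (k.re - k'.re) = w.re - k'.re := div_mul_cancel₀ _ hd.ne'
      simp [hv]; linarith
    have hvim : v.im ≤ w.im := by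
      have e1 : v.im = (1 - s) * k'.im + s * k.im := by simp [hv]
      rw [e1]
      have := le_max_left k.im k'.im
      have := le_max_right k.im k'.im
      nlinarith
    have := h.ray₀ hmem.1 hmem.2 (w.im - v.im) (by linarith)
    have e2 : v + ((w.im - v.im : ℝ) : ℂ) * I = w := by
      apply Complex.ext <;> simp [hvre]
    rw [e2] at this
    exact ⟨this.1, this.2.trans hmem.2⟩
  have hq : (⟨(k.re + k'.re) / 2, max k.im k'.im + 1⟩ : ℂ) ∈ A := by
    refine ⟨⟨?_, ?_⟩, ?_⟩ <;> simp only [mem_ofPred_eq] <;> linarith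
  obtain ⟨r, hr, hrA⟩ := Metric.isOpen_iff.1 hAo _ hq
  exact ⟨_, r, hr, hrA.trans hA⟩

end Two
end

noncomputable section
open InnerProductSpace (HarmonicAt HarmonicOnNhd)
open scoped ComplexConjugate

namespace Two

variable {c : ℝ} {κ₀ κ₁ : ℂ} {U : ℂ → ℝ} {S : ℂ → ℂ} {K : Set ℂ}

/-- Boundary behaviour of the gradient at the upper level. -/
theorem tendsto_cgrad (h : Two c κ₀ κ₁ U S K) {p : ℂ} (hp : p ∈ K) (hpc : cst S p = κ₀)
    {l : Ultrafilter ℂ} (hl : (l : Filter ℂ) ≤ 𝓝[Kᶜ] p) :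
    ∃ g, ‖g‖ = 1 ∧ 0 < g.im ∧ Tendsto (cgrad U) l (𝓝 g) := by
  have hcl := h.glob.gbase.closed
  have hKc : ∀ᶠ z in (l : Filter ℂ), z ∉ K := hl self_mem_nhdsWithin
  have hzp : Tendsto (fun z : ℂ => z) l (𝓝 p) := hl.trans nhdsWithin_le_nhds
  set d : ℂ → ℝ := fun z => if z ∈ K then 1 else infDist z K with hd
  have hd0 : ∀ z, 0 < d z := by
    intro z
    by_cases hz : z ∈ K
    · simp [hd, hz]
    · simp only [hd, hz, if_false]
      exact (hcl.notMem_iff_infDist_pos ⟨p, hp⟩).1 hz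
  have hd0' : ∀ z, ((d z : ℝ) : ℂ) ≠ 0 := fun z => by exact_mod_cast (hd0 z).ne'
  have hdeq : ∀ᶠ z in (l : Filter ℂ), d z = infDist z K := by
    filter_upwards [hKc] with z hz
    simp [hd, hz]
  have hdt : Tendsto d l (𝓝 0) := by
    have h1 : Tendsto (fun z => infDist z K) l (𝓝 (infDist p K)) :=
      (continuous_infDist_pt K).continuousAt.tendsto.comp hzp
    rw [infDist_zero_of_mem hp] at h1
    exact h1.congr' (hdeq.mono fun z hz => hz.symm)
  have hdt' : Tendsto (fun z => ((d z : ℝ) : ℂ)) l (𝓝 0) := by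
    have := (continuous_ofReal.tendsto 0).comp hdt
    rwa [ofReal_zero] at this
  choose n hnK hn1 hn2 using fun z => exists_norm_eq_infDist hcl ⟨p, hp⟩ z
  set k : ℂ → ℂ := fun z => (n z - z) / d z with hk
  have hkz : ∀ z, z + d z * k z = n z := by
    intro z
    simp only [hk]
    rw [mul_div_cancel₀ _ (hd0' z)]; ring
  have hkK : ∀ z, k z ∈ affK z (d z) K := fun z => by
    change z + d z * k z ∈ K
    rw [hkz]; exact hnK z
  have hk1 : ∀ᶠ z in (l : Filter ℂ), ‖k z‖ = 1 := by
    filter_upwards [hdeq] with z hz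
    simp only [hk]
    rw [norm_div, hn1, norm_real, Real.norm_of_nonneg (hd0 z).le, hz, div_self]
    rw [← hz]; exact (hd0 z).ne'
  obtain ⟨U', S', hG, hU', hS'⟩ := h.glob.exists_lim (l := l) h.pos (z := fun z => z)
    (m := fun z => ((d z : ℝ) : ℂ)) hd0' (k := k) (C := 1) (Eventually.of_forall hkK)
    (hk1.mono fun z hz => hz.le)
  set K' := limK l fun z => affK z (d z) K
  obtain ⟨k', -, hkk'⟩ := exists_tendsto_of_bounded (hk1.mono fun z hz => hz.le)
  have hk'K : k' ∈ K' := mem_limK_of_tendsto (Eventually.of_forall hkK) hkk'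
  have hk'1 : ‖k'‖ = 1 := by
    refine tendsto_nhds_unique hkk'.norm (tendsto_const_nhds.congr' ?_)
    filter_upwards [hk1] with z hz using hz.symm
  have hfar : ∀ x ∈ K', 1 ≤ ‖x‖ := by
    intro x hx
    obtain ⟨y, hy, hyx⟩ := exists_seq_of_mem_limK
      (Eventually.of_forall fun z => (h.glob.aff z (hd0' z)).gbase.closed) hx
    refine ge_of_tendsto hyx.norm ?_
    filter_upwards [hy, hdeq] with z hz hz2
    have h1 := hn2 z _ hz
    rw [add_sub_cancel_left, norm_mul, norm_real, Real.norm_of_nonneg (hd0 z).le, ← hz2] at h1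
    exact (le_mul_iff_one_le_right (hd0 z)).1 h1
  have hconv : ∀ x : ℂ, ∀ y : ℂ → ℂ, Tendsto y l (𝓝 x) →
      Tendsto (fun z => z + d z * y z) l (𝓝 p) := by
    intro x y hy
    have := hzp.add (hdt'.mul hy)
    rwa [zero_mul, add_zero] at this
  have hs : ∀ x ∈ K', ∀ y ∈ K', cst S' x = cst S' y := by
    have key : ∀ x ∈ K', Tendsto (fun z => (κ₀ - cst S z) / conj ((d z : ℝ) : ℂ)) l
        (𝓝 (cst S' x)) := by
      intro x hx
      obtain ⟨y, hy, hyx⟩ := exists_seq_of_mem_limK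
        (Eventually.of_forall fun z => (h.glob.aff z (hd0' z)).gbase.closed) hx
      have h1 := h.glob.cst_lim (l := l) hd0' hS' hyx
      refine h1.congr' ?_
      filter_upwards [hy, (hconv x y hyx).eventually (h.eventually_cst_eq hpc)] with z hz hz2
      rw [hz2 hz]
    intro x hx y hy
    exact tendsto_nhds_unique (key x hx) (key y hy)
  have h0 : (0 : ℂ) ∉ K' := fun h0 => by simpa using (hfar 0 h0).trans_lt' one_pos
  obtain ⟨e, q, he, hq0, hall⟩ := hG.halfplane_of_single h.pos hs ⟨k', hk'K⟩ h0
  have hee := mul_conj_eq_one he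
  have hg' : cgrad U' 0 = -I * conj e := by
    rw [← cgrad_im_mul e q 0]
    apply cgrad_congr
    have hcont : Continuous fun w : ℂ => ((w - q) * conj e).im := by fun_prop
    filter_upwards [hcont.continuousAt.eventually (lt_mem_nhds hq0)] with w hw
    exact ((hall w).1 hw).2
  have hgl : Tendsto (cgrad U) l (𝓝 (-I * conj e)) := by
    have h1 := (Base.lim_harmonic (l := l) (U := fun z => affU z (d z) U)
      (K := fun z => affK z (d z) K) (fun ρ => Eventually.of_forall fun z =>
        (h.glob.aff z (hd0' z)).gbase ρ) hU' h0).2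
    rw [hg'] at h1
    refine h1.congr' ?_
    filter_upwards [hKc] with z hz
    rw [(harmonicAt_aff (m := d z) (by simpa using h.glob.gbase.harm hz)).2, mul_zero, add_zero,
      norm_real, Real.norm_of_nonneg (hd0 z).le, div_self (hd0' z), mul_one]
  refine ⟨_, by simp [he], ?_, hgl⟩
  -- the nearest point determines the direction
  have hsplit : ∀ w, ((w - q) * conj e).im = (w * conj e).im + ((0 - q) * conj e).im := by
    intro w; rw [← add_im]; ring_nf
  set D := ((0 - q) * conj e).im with hD
  have hD1 : 1 ≤ D := by
    have h1 := hfar (-(D : ℂ) * (I * e)) ((hall _).2 (by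
      rw [hsplit]
      have : -(D : ℂ) * (I * e) * conj e = -(D * I) := by linear_combination -(D * I) * hee
      rw [this]; simp))
    simpa [he, abs_of_pos hq0] using h1
  have hk'2 : k' = -(I * e) := by
    have h1 : ((k' - q) * conj e).im ≤ 0 := by
      by_contra! h2
      exact ((hall k').1 h2).1 hk'K
    rw [hsplit] at h1
    have h2 : ‖I * (k' * conj e)‖ ≤ 1 := by simp [he, hk'1]
    have h3 := neg_le_of_abs_le ((abs_im_le_norm (k' * conj e)).trans
      (by rw [norm_mul, RCLike.norm_conj, he, hk'1, mul_one]))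
    have h4 : 1 ≤ (I * (k' * conj e)).re := by rw [I_mul_re]; linarith
    have h5 := eq_ofReal_of_norm_le_re h2 h4
    push_cast at h5
    linear_combination -I * e * h5 + (-k' * e * conj e) * (-I_sq) + (-k') * hee
  have hneg := h.im_normal_neg hp hpc (ν := I * e) (by simp [he]) (by
    intro w hw hwc
    have hnp : Tendsto n l (𝓝 p) := (hconv k' k hkk').congr hkz
    have h1 : Tendsto (fun z => (conj (-k z) * (w - n z)).re) l
        (𝓝 ((conj (-k') * (w - p)).re)) :=
      (continuous_re.tendsto _).comp (((continuous_conj.tendsto _).comp hkk'.neg).mul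
        (hnp.const_sub w))
    rw [hk'2, neg_neg] at h1
    refine le_of_tendsto h1 ?_
    filter_upwards [hnp.eventually (h.eventually_cst_eq hpc)] with z hz
    have h2 := (h.glob.convex_class κ₀).re_conj_mul_le_zero_of_nearest
      (z := z) (p := n z) (k := w) ⟨hnK z, hz (hnK z)⟩ (fun y hy => hn1 z ▸ hn2 z y hy.1) ⟨hw, hwc⟩
    have e1 : conj (-k z) * (w - n z) = conj (z - n z) * (w - n z) / (d z : ℝ) := by
      simp only [hk, map_neg, map_div₀, conj_ofReal, map_sub]; ring
    rw [e1, div_ofReal_re]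
    exact div_nonpos_of_nonpos_of_nonneg h2 (hd0 z).le)
  simp at hneg ⊢
  linarith

end Two
end

noncomputable section
open InnerProductSpace (HarmonicAt HarmonicOnNhd)
open scoped ComplexConjugate

lemma cayley_re (g : ℂ) : ((1 + g) / (1 - g)).re = (1 - ‖g‖ ^ 2) / ‖1 - g‖ ^ 2 := by
  rw [← normSq_eq_norm_sq, ← normSq_eq_norm_sq, div_re, ← add_div]
  congr 1
  simp [normSq_apply]; ring

lemma cayley_im (g : ℂ) : ((1 + g) / (1 - g)).im = 2 * g.im / ‖1 - g‖ ^ 2 := by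
  rw [← normSq_eq_norm_sq, div_im, ← sub_div]
  congr 1
  simp; ring

/-- The logarithm of the Cayley transform of the complex gradient. -/
def logCayley (U : ℂ → ℝ) (z : ℂ) : ℂ := Complex.log ((1 + cgrad U z) / (1 - cgrad U z))

/-- A bounded function, harmonic off `K` and vanishing on `K`, is zero when `K` contains a disk. -/
lemma eq_zero_of_bounded_of_ball {K : Set ℂ} (hK : IsClosed K) {q : ℂ} {r : ℝ} (hr : 0 < r)
    (hq : ball q r ⊆ K) {f : ℂ → ℝ} (hf : Continuous f) (h0 : ∀ z ∈ K, f z = 0)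
    (hh : ∀ z, z ∉ K → HarmonicAt f z) {B : ℝ} (hB : ∀ z, |f z| ≤ B) (z : ℂ) : f z = 0 := by
  have key : ∀ f : ℂ → ℝ, Continuous f → (∀ z ∈ K, f z = 0) →
      (∀ z, z ∉ K → HarmonicAt f z) → (∀ z, |f z| ≤ B) → ∀ z, f z ≤ 0 := by
    intro f hf h0 hh hB z
    by_cases hz : z ∈ K
    · exact (h0 z hz).le
    have hfar : ∀ w, w ∉ K → r ≤ ‖w - q‖ := by
      intro w hw
      by_contra! hlt
      exact hw (hq (by rwa [mem_ball, dist_eq_norm]))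
    have hB0 : 0 ≤ B := (abs_nonneg _).trans (hB 0)
    have hmain : ∀ ε > 0, f z ≤ ε * Real.log (‖z - q‖ / r) := by
      intro ε hε
      set R := max (‖z - q‖ + 1) (r * Real.exp (B / ε)) with hR
      have hRr : r * Real.exp (B / ε) ≤ R := le_max_right _ _
      have hR0 : 0 < R := lt_of_lt_of_le (by positivity) hRr
      set W : Set ℂ := Kᶜ ∩ ball q R
      have hcl : closure W ⊆ {w | r ≤ ‖w - q‖} :=
        closure_minimal (fun w hw => hfar w hw.1)
          (isClosed_le continuous_const (by fun_prop))
      have hlog : ∀ w, r ≤ ‖w - q‖ → ContinuousAt (fun w => Real.log (‖w - q‖ / r)) w := by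
        intro w hw
        have : 0 < ‖w - q‖ := hr.trans_le hw
        exact ContinuousAt.log (by fun_prop) (by positivity)
      have h1 : f z - ε * Real.log (‖z - q‖ / r) ≤ 0 := by
        refine le_of_forall_frontier_le_of_harmonic (W := W)
          (h := fun w => f w - ε * Real.log (‖w - q‖ / r))
          (hK.isOpen_compl.inter isOpen_ball) (isBounded_ball.subset inter_subset_right) ?_ ?_ ?_
          ⟨hz, ?_⟩
        · intro w hw
          exact (hf.continuousAt.sub ((hlog w (hcl hw)).const_mul ε)).continuousWithinAt
        · rintro w ⟨hw, -⟩
          have hw0 : w - q ≠ 0 := norm_pos_iff.1 (hr.trans_le (hfar w hw))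
          have h2 : HarmonicAt (fun w => Real.log ‖w - q‖) w :=
            AnalyticAt.harmonicAt_log_norm (f := fun w => w - q) (by fun_prop) hw0
          have h3 : HarmonicAt (fun w => f w - (ε • fun w => Real.log ‖w - q‖) w) w :=
            HarmonicAt.sub (hh w hw) (h2.const_smul (c := ε))
          have h4 : HarmonicAt (fun _ : ℂ => ε * Real.log r) w := by
            simp
          have h5 := HarmonicAt.add h3 h4
          refine (InnerProductSpace.harmonicAt_congr_nhds ?_).1 h5
          filter_upwards [(continuousAt_id.sub continuousAt_const).eventually_ne hw0] with x hx
          have hx' : ‖x - q‖ ≠ 0 := norm_ne_zero_iff.2 hx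
          simp only [Pi.add_apply, Pi.smul_apply, smul_eq_mul]
          rw [Real.log_div hx' hr.ne']
          ring
        · intro w hw
          have hwr : r ≤ ‖w - q‖ := hcl (frontier_subset_closure hw)
          have hl0 : 0 ≤ Real.log (‖w - q‖ / r) := Real.log_nonneg ((one_le_div hr).2 hwr)
          by_cases hwK : w ∈ K
          · simp only [h0 w hwK]
            have := mul_nonneg hε.le hl0
            linarith
          · have hwR : R ≤ ‖w - q‖ := by
              by_contra! hlt
              have hwW : w ∈ W := ⟨hwK, by rwa [mem_ball, dist_eq_norm]⟩
              have hWo : IsOpen W := hK.isOpen_compl.inter isOpen_ball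
              rw [hWo.frontier_eq] at hw
              exact hw.2 hwW
            have h2 : B / ε ≤ Real.log (‖w - q‖ / r) := by
              rw [Real.le_log_iff_exp_le (div_pos (hr.trans_le hwr) hr), le_div_iff₀ hr]
              linarith
            have h3 := (le_abs_self _).trans (hB w)
            have h4 : B ≤ ε * Real.log (‖w - q‖ / r) := by
              rw [div_le_iff₀ hε] at h2; linarith
            linarith
        · rw [mem_ball, dist_eq_norm]
          exact (lt_add_one _).trans_le (le_max_left _ _)
      linarith
    have ht : Tendsto (fun ε : ℝ => ε * Real.log (‖z - q‖ / r)) (𝓝[>] 0)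
        (𝓝 (0 * Real.log (‖z - q‖ / r))) :=
      (tendsto_id.mono_left nhdsWithin_le_nhds).mul_const _
    rw [zero_mul] at ht
    refine ge_of_tendsto ht ?_
    filter_upwards [self_mem_nhdsWithin] with ε hε using hmain ε hε
  refine le_antisymm (key f hf h0 hh hB z) ?_
  have := key (fun z => -f z) hf.neg (fun z hz => by simp [h0 z hz])
    (fun z hz => HarmonicAt.neg (hh z hz)) (fun z => by rw [abs_neg]; exact hB z) z
  linarith

namespace Two

variable {c : ℝ} {κ₀ κ₁ : ℂ} {U : ℂ → ℝ} {S : ℂ → ℂ} {K : Set ℂ}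

lemma one_sub_ne_zero (h : Two c κ₀ κ₁ U S K) {z : ℂ} (hz : z ∉ K) : 1 - cgrad U z ≠ 0 := by
  intro h0
  have := h.norm_cgrad_lt hz
  rw [← sub_eq_zero.1 h0] at this
  simp at this

lemma one_add_ne_zero (h : Two c κ₀ κ₁ U S K) {z : ℂ} (hz : z ∉ K) : 1 + cgrad U z ≠ 0 := by
  intro h0
  have := h.norm_cgrad_lt hz
  rw [← neg_eq_of_add_eq_zero_right h0] at this
  simp at this

lemma cayley_re_pos (h : Two c κ₀ κ₁ U S K) {z : ℂ} (hz : z ∉ K) :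
    0 < ((1 + cgrad U z) / (1 - cgrad U z)).re := by
  rw [cayley_re]
  have h1 := h.norm_cgrad_lt hz
  have h2 : 0 < ‖1 - cgrad U z‖ := norm_pos_iff.2 (h.one_sub_ne_zero hz)
  have h3 : ‖cgrad U z‖ ^ 2 < 1 := by nlinarith [norm_nonneg (cgrad U z)]
  exact div_pos (by linarith) (by positivity)

lemma abs_im_logCayley_lt (h : Two c κ₀ κ₁ U S K) {z : ℂ} (hz : z ∉ K) :
    |(logCayley U z).im| < Real.pi / 2 := by
  rw [logCayley, log_im, abs_arg_lt_pi_div_two_iff]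
  exact Or.inl (h.cayley_re_pos hz)

lemma exp_logCayley (h : Two c κ₀ κ₁ U S K) {z : ℂ} (hz : z ∉ K) :
    cexp (logCayley U z) = (1 + cgrad U z) / (1 - cgrad U z) :=
  exp_log (div_ne_zero (h.one_add_ne_zero hz) (h.one_sub_ne_zero hz))

lemma sq_ne_one (h : Two c κ₀ κ₁ U S K) {z : ℂ} (hz : z ∉ K) : 1 - cgrad U z ^ 2 ≠ 0 := by
  have : 1 - cgrad U z ^ 2 = (1 - cgrad U z) * (1 + cgrad U z) := by ring
  rw [this]
  exact mul_ne_zero (h.one_sub_ne_zero hz) (h.one_add_ne_zero hz)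

lemma cosh_logCayley (h : Two c κ₀ κ₁ U S K) {z : ℂ} (hz : z ∉ K) :
    Complex.cosh (logCayley U z) = (1 + cgrad U z ^ 2) / (1 - cgrad U z ^ 2) := by
  have h1 := h.one_sub_ne_zero hz
  have h2 := h.one_add_ne_zero hz
  have h3 := h.sq_ne_one hz
  rw [Complex.cosh, exp_neg, h.exp_logCayley hz]
  field_simp
  ring

lemma sinh_logCayley (h : Two c κ₀ κ₁ U S K) {z : ℂ} (hz : z ∉ K) :
    Complex.sinh (logCayley U z) = 2 * cgrad U z / (1 - cgrad U z ^ 2) := by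
  have h1 := h.one_sub_ne_zero hz
  have h2 := h.one_add_ne_zero hz
  have h3 := h.sq_ne_one hz
  rw [Complex.sinh, exp_neg, h.exp_logCayley hz]
  field_simp
  ring

lemma differentiableAt_logCayley (h : Two c κ₀ κ₁ U S K) {z : ℂ} (hz : z ∉ K) :
    DifferentiableAt ℂ (logCayley U) z := by
  have hg := HarmonicAt.differentiableAt_cgrad (h.glob.gbase.harm hz)
  have h1 : DifferentiableAt ℂ (fun w => (1 + cgrad U w) / (1 - cgrad U w)) z :=
    (hg.const_add 1).div (hg.const_sub 1) (h.one_sub_ne_zero hz)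
  exact h1.clog (Or.inl (h.cayley_re_pos hz))

/-- Boundary values of `logCayley` on the upper level. -/
lemma tendsto_logCayley₀ (h : Two c κ₀ κ₁ U S K) {p : ℂ} (hp : p ∈ K) (hpc : cst S p = κ₀)
    {l : Ultrafilter ℂ} (hl : (l : Filter ℂ) ≤ 𝓝[Kᶜ] p) :
    ∃ a, a.im = Real.pi / 2 ∧ Tendsto (logCayley U) l (𝓝 a) := by
  obtain ⟨g, hg1, hg2, hg⟩ := h.tendsto_cgrad hp hpc hl
  have hne : 1 - g ≠ 0 := by
    intro h0
    rw [← sub_eq_zero.1 h0] at hg2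
    simp at hg2
  have hn : 0 < ‖1 - g‖ := norm_pos_iff.2 hne
  have hre : ((1 + g) / (1 - g)).re = 0 := by rw [cayley_re, hg1]; simp
  have him : 0 < ((1 + g) / (1 - g)).im := by rw [cayley_im]; positivity
  have hsl : (1 + g) / (1 - g) ∈ slitPlane := Or.inr him.ne'
  refine ⟨Complex.log ((1 + g) / (1 - g)), ?_, ?_⟩
  · rw [log_im, arg_eq_pi_div_two_iff.2 ⟨hre, him⟩]
  · exact (continuousAt_clog hsl).tendsto.comp ((hg.const_add 1).div (hg.const_sub 1) hne)

lemma cgrad_aff_neg (h : Two c κ₀ κ₁ U S K) {z : ℂ} (hz : z ∉ K) :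
    cgrad (affU 0 (-1) U) (-z) = -cgrad U z := by
  have := (harmonicAt_aff (U := U) (z₀ := 0) (m := -1) (z := -z)
    (by simpa using h.glob.gbase.harm hz)).2
  simpa using this

/-- Boundary values of `logCayley` on the lower level. -/
lemma tendsto_logCayley₁ (h : Two c κ₀ κ₁ U S K) {p : ℂ} (hp : p ∈ K) (hpc : cst S p = κ₁)
    {l : Ultrafilter ℂ} (hl : (l : Filter ℂ) ≤ 𝓝[Kᶜ] p) :
    ∃ a, a.im = -(Real.pi / 2) ∧ Tendsto (logCayley U) l (𝓝 a) := by
  have hm : (-1 : ℂ) ≠ 0 := by norm_num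
  have hKc : ∀ᶠ z in (l : Filter ℂ), z ∉ K := hl self_mem_nhdsWithin
  have hcst : cst (affS 0 (-1) S) (-p) = cst S 0 - κ₁ := by
    have := affS_sub_conj (z₀ := 0) (S := S) hm (-p)
    simp only [cst] at this hpc ⊢
    rw [this, ← hpc]; simp only [map_neg, map_one, zero_add, neg_mul, one_mul, map_zero, neg_neg]
    ring
  have hl' : ((l.map Neg.neg : Ultrafilter ℂ) : Filter ℂ) ≤ 𝓝[(affK 0 (-1) K)ᶜ] (-p) := by
    refine tendsto_nhdsWithin_iff.2 ⟨?_, ?_⟩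
    · exact (continuous_neg.tendsto p).mono_left (hl.trans nhdsWithin_le_nhds)
    · filter_upwards [hKc] with z hz
      simpa [affK] using hz
  obtain ⟨a, ha, hat⟩ := h.neg.tendsto_logCayley₀ (p := -p) (by simpa [affK] using hp) hcst hl'
  have hat' : Tendsto (fun z => logCayley (affU 0 (-1) U) (-z)) l (𝓝 a) := hat
  refine ⟨-a, by rw [neg_im, ha], hat'.neg.congr' ?_⟩
  filter_upwards [hKc] with z hz
  have h1 : ((1 + cgrad U z) / (1 - cgrad U z)).arg ≠ Real.pi := by
    intro h2
    have := h.abs_im_logCayley_lt hz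
    rw [logCayley, log_im, h2, abs_of_pos Real.pi_pos] at this
    linarith [Real.pi_pos]
  rw [logCayley, h.cgrad_aff_neg hz, sub_neg_eq_add, ← sub_eq_add_neg, ← inv_div,
    Complex.log_inv _ h1, neg_neg, logCayley]

lemma im_le (h : Two c κ₀ κ₁ U S K) (z : ℂ) : (z + S z).im ≤ κ₀.im := by
  obtain ⟨x, hx, hxc⟩ := h.nonempty₀
  have hray := h.ray₀ hx hxc
  set d := z - x with hd
  set v := conj (S z - conj x - κ₀) with hv
  have key : ∀ t : ℝ, 0 ≤ t → normSq v - normSq d ≤ 2 * t * (v.im - d.im) := by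
    intro t ht
    have h1 : S (x + t * I) = conj x - t * I + κ₀ := by
      have := (hray t ht).2
      rw [hxc] at this
      simp only [cst, map_add, map_mul, conj_ofReal, conj_I] at this
      linear_combination this
    have h2 := pow_le_pow_left₀ (norm_nonneg _) (h.glob.slip z (x + t * I)) 2
    have e1 : S z - S (x + t * I) = conj (v - t * I) := by
      rw [h1, hv]; simp only [map_sub, conj_conj, map_mul, conj_ofReal, conj_I]; ring
    have e2 : z - (x + t * I) = d - t * I := by rw [hd]; ring
    rw [e1, e2, RCLike.norm_conj, ← normSq_eq_norm_sq, ← normSq_eq_norm_sq] at h2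
    simp only [normSq_apply, sub_re, sub_im, re_ofReal_mul, im_ofReal_mul, I_re, I_im] at h2 ⊢
    nlinarith
  have h3 : d.im ≤ v.im := by
    by_contra! hlt
    have h4 := key ((|normSq v - normSq d| + 1) / (2 * (d.im - v.im))) (by
      have : 0 < d.im - v.im := by linarith
      positivity)
    have h5 : 2 * ((|normSq v - normSq d| + 1) / (2 * (d.im - v.im))) * (v.im - d.im) =
        -(|normSq v - normSq d| + 1) := by
      have : d.im - v.im ≠ 0 := by linarith
      field_simp
      ring
    rw [h5] at h4
    linarith [neg_abs_le (normSq v - normSq d)]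
  rw [hd, hv] at h3
  simp only [sub_im, conj_im, map_sub, conj_conj] at h3
  rw [add_im]
  simp at h3
  linarith

lemma le_im (h : Two c κ₀ κ₁ U S K) (z : ℂ) : κ₁.im ≤ (z + S z).im := by
  have h1 := h.neg.im_le (-z)
  simp only [affS, cst, add_im, sub_im, neg_im, map_neg, map_one, map_zero, zero_add, neg_mul,
    one_mul, neg_neg, sub_zero, div_neg, div_one] at h1
  rw [add_im]
  linarith

end Two
end

noncomputable section
open InnerProductSpace (HarmonicAt HarmonicOnNhd)
open scoped ComplexConjugate

lemma continuousAt_of_ultrafilter {K : Set ℂ} {f : ℂ → ℝ} {p : ℂ} (h0 : ∀ z ∈ K, f z = 0)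
    (hp : p ∈ K) (h : ∀ l : Ultrafilter ℂ, (l : Filter ℂ) ≤ 𝓝[Kᶜ] p → Tendsto f l (𝓝 0)) :
    ContinuousAt f p := by
  rw [ContinuousAt, h0 p hp, tendsto_iff_ultrafilter]
  intro l hl
  rcases l.mem_or_compl_mem K with hK | hK
  · refine tendsto_const_nhds.congr' ?_
    filter_upwards [hK] with z hz using (h0 z hz).symm
  · exact h l (le_inf hl (le_principal_iff.2 hK))

/-- A function that is locally constant off `K`, continuous and zero on `K`, vanishes. -/
lemma eq_zero_of_locally_const {K : Set ℂ} (hne : K.Nonempty) {f : ℂ → ℝ}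
    (hf : Continuous f) (h0 : ∀ z ∈ K, f z = 0)
    (hloc : ∀ z, z ∉ K → ∀ᶠ w in 𝓝 z, f w = f z) (z : ℂ) : f z = 0 := by
  by_contra hz
  have hcl : IsClosed {w | f w = f z} := isClosed_eq hf continuous_const
  have hop : IsOpen {w | f w = f z} := by
    rw [isOpen_iff_mem_nhds]
    intro w hw
    have hwK : w ∉ K := fun hwK => hz (by rw [← (show f w = f z from hw), h0 w hwK])
    filter_upwards [hloc w hwK] with x hx
    exact hx.trans hw
  have huniv : {w | f w = f z} = univ := IsClopen.eq_univ ⟨hcl, hop⟩ ⟨z, rfl⟩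
  obtain ⟨k, hk⟩ := hne
  have : k ∈ {w | f w = f z} := huniv ▸ mem_univ k
  exact hz (by rw [← (show f k = f z from this), h0 k hk])

lemma re_cosh_pos {w : ℂ} (hw : |w.im| < Real.pi / 2) : 0 < (Complex.cosh w).re := by
  have h1 : (Complex.cosh w).re = Real.cosh w.re * Real.cos w.im := by
    rw [← re_add_im w, cosh_add, cosh_mul_I, sinh_mul_I]
    simp [← ofReal_cosh, ← ofReal_sinh, ← ofReal_cos, ← ofReal_sin]
  rw [h1]
  exact mul_pos (Real.cosh_pos _) (Real.cos_pos_of_mem_Ioo (abs_lt.1 hw))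

lemma re_cosh_eq_zero {w : ℂ} (hw : w.im = Real.pi / 2 ∨ w.im = -(Real.pi / 2)) :
    (Complex.cosh w).re = 0 := by
  have h1 : (Complex.cosh w).re = Real.cosh w.re * Real.cos w.im := by
    rw [← re_add_im w, cosh_add, cosh_mul_I, sinh_mul_I]
    simp [← ofReal_cosh, ← ofReal_sinh, ← ofReal_cos, ← ofReal_sin]
  rw [h1]
  rcases hw with h | h <;> simp [h]

lemma convex_Sstrip : Convex ℝ Sstrip := by
  have : Sstrip = {z : ℂ | -(Real.pi / 2) < z.im} ∩ {z : ℂ | z.im < Real.pi / 2} := by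
    ext z; simp [Sstrip, abs_lt]
  rw [this]
  exact (convex_halfSpace_im_gt _).inter (convex_halfSpace_im_lt _)

lemma isOpen_Sstrip : IsOpen Sstrip := isOpen_lt (by fun_prop) continuous_const

lemma hasDerivAt_add_sinh (w : ℂ) :
    HasDerivAt (fun w => w + Complex.sinh w) (1 + Complex.cosh w) w :=
  (hasDerivAt_id w).add (Complex.hasDerivAt_sinh w)

/-- The map `w + sinh w` is injective on the strip. -/
lemma injOn_add_sinh : InjOn (fun w => w + Complex.sinh w) Sstrip := by
  intro a ha b hb hab
  by_contra hne
  have hd : b - a ≠ 0 := sub_ne_zero.2 (Ne.symm hne)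
  set γ : ℝ → ℂ := fun t => a + t * (b - a)
  have hγ : ∀ t ∈ Icc (0 : ℝ) 1, γ t ∈ Sstrip := by
    intro t ht
    have := convex_Sstrip.segment_subset ha hb
    refine this ?_
    rw [segment_eq_image']
    exact ⟨t, ht, by simp [γ, real_smul]⟩
  set f : ℝ → ℝ := fun t => ((γ t + Complex.sinh (γ t)) / (b - a)).re
  have hf : ∀ t, HasDerivAt f ((1 + Complex.cosh (γ t)).re) t := by
    intro t
    have h1 : HasDerivAt γ (b - a) t := by
      have := ((hasDerivAt_id t).ofReal_comp.mul_const (b - a)).const_add a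
      rwa [ofReal_one, one_mul] at this
    have h2 := ((hasDerivAt_add_sinh (γ t)).comp t h1).div_const (b - a)
    rw [mul_div_cancel_right₀ _ hd] at h2
    exact reCLM.hasFDerivAt.comp_hasDerivAt t h2
  have hmono : StrictMonoOn f (Icc 0 1) := by
    refine strictMonoOn_of_deriv_pos (convex_Icc 0 1)
      (fun t _ => (hf t).continuousAt.continuousWithinAt) ?_
    intro t ht
    rw [interior_Icc] at ht
    rw [(hf t).deriv, add_re, one_re]
    linarith [re_cosh_pos (hγ t (Ioo_subset_Icc_self ht))]
  have h01 := hmono ⟨le_rfl, zero_le_one⟩ ⟨zero_le_one, le_rfl⟩ zero_lt_one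
  have e0 : γ 0 = a := by simp [γ]
  have e1 : γ 1 = b := by simp [γ]
  simp only [f, e0, e1] at h01
  simp only at hab
  rw [hab] at h01
  exact lt_irrefl _ h01

lemma hairpinH_eq {w z : ℂ} (hw : w ∈ Sstrip) (hz : w + Complex.sinh w = z) :
    hairpinH z = (Complex.cosh w).re := by
  have hex : ∃ w : ℂ, w ∈ Sstrip ∧ w + Complex.sinh w = z := ⟨w, hw, hz⟩
  rw [hairpinH, dif_pos hex]
  have h1 := hex.choose_spec
  rw [injOn_add_sinh h1.1 hw (h1.2.trans hz.symm)]

lemma exists_real_add_sinh (x : ℝ) : ∃ w : ℂ, w ∈ Sstrip ∧ w + Complex.sinh w = x := by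
  have hcont : Continuous fun t : ℝ => t + Real.sinh t := by fun_prop
  have h1 : Tendsto (fun t : ℝ => t + Real.sinh t) atTop atTop := by
    refine tendsto_atTop_mono' _ ?_ tendsto_id
    filter_upwards [eventually_ge_atTop 0] with t ht
    have := Real.sinh_nonneg_iff.2 ht
    simp only [id]; linarith
  have h2 : Tendsto (fun t : ℝ => t + Real.sinh t) atBot atBot := by
    refine tendsto_atBot_mono' _ ?_ tendsto_id
    filter_upwards [eventually_le_atBot 0] with t ht
    have := Real.sinh_nonpos_iff.2 ht
    simp only [id]; linarith
  obtain ⟨t, ht⟩ := hcont.surjective h1 h2 x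
  refine ⟨t, by simp [Sstrip, Real.pi_pos], ?_⟩
  rw [← ht]; push_cast; rfl

namespace Two

variable {c : ℝ} {κ₀ κ₁ : ℂ} {U : ℂ → ℝ} {S : ℂ → ℂ} {K : Set ℂ}

lemma tendsto_logCayley (h : Two c κ₀ κ₁ U S K) {p : ℂ} (hp : p ∈ K)
    {l : Ultrafilter ℂ} (hl : (l : Filter ℂ) ≤ 𝓝[Kᶜ] p) :
    ∃ a, ((cst S p = κ₀ ∧ a.im = Real.pi / 2) ∨ (cst S p = κ₁ ∧ a.im = -(Real.pi / 2))) ∧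
      Tendsto (logCayley U) l (𝓝 a) := by
  rcases h.cases p hp with hc | hc
  · obtain ⟨a, ha, hat⟩ := h.tendsto_logCayley₀ hp hc hl
    exact ⟨a, Or.inl ⟨hc, ha⟩, hat⟩
  · obtain ⟨a, ha, hat⟩ := h.tendsto_logCayley₁ hp hc hl
    exact ⟨a, Or.inr ⟨hc, ha⟩, hat⟩

/-- `Im (z + S z) / 2` is an affine function of `Im logCayley`. -/
lemma im_eq (h : Two c κ₀ κ₁ U S K) {z : ℂ} (hz : z ∉ K) :
    ((z + S z) / 2 - ((κ₀.im - κ₁.im) / (2 * Real.pi) : ℝ) * logCayley U z).im =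
      (κ₀.im + κ₁.im) / 4 := by
  have hcl := h.glob.gbase.closed
  set α := (κ₀.im - κ₁.im) / (2 * Real.pi) with hα
  set β := (κ₀.im + κ₁.im) / 4 with hβ
  have hαπ : α * (Real.pi / 2) = (κ₀.im - κ₁.im) / 4 := by
    rw [hα]; field_simp; ring
  set F : ℂ → ℂ := fun z => (z + S z) / 2 - α * logCayley U z
  set f : ℂ → ℝ := fun z => if z ∈ K then 0 else (F z).im - β with hf
  have hf0 : ∀ z ∈ K, f z = 0 := fun z hz => by simp [hf, hz]
  have hf1 : ∀ z, z ∉ K → f z = (F z).im - β := fun z hz => by simp [hf, hz]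
  have hFd : DifferentiableOn ℂ F Kᶜ := by
    intro z hz
    refine DifferentiableAt.differentiableWithinAt ?_
    exact ((differentiableAt_id.add (h.glob.sder hz).differentiableAt).div_const 2).sub
      ((h.differentiableAt_logCayley hz).const_mul _)
  have hev : ∀ z, z ∉ K → f =ᶠ[𝓝 z] fun w => (F w).im - β := by
    intro z hz
    filter_upwards [h.glob.gbase.eventually_notMem hz] with w hw using hf1 w hw
  have hharm : ∀ z, z ∉ K → HarmonicAt f z := by
    intro z hz
    rw [InnerProductSpace.harmonicAt_congr_nhds (hev z hz)]
    have h1 := harmonicAt_im_of_differentiableOn hcl.isOpen_compl hFd hz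
    have h2 : HarmonicAt (fun _ : ℂ => β) z := by simp
    exact HarmonicAt.sub h1 h2
  have hcont : Continuous f := by
    rw [continuous_iff_continuousAt]
    intro p
    by_cases hp : p ∈ K
    · refine continuousAt_of_ultrafilter hf0 hp fun l hl => ?_
      obtain ⟨a, ha, hat⟩ := h.tendsto_logCayley hp hl
      have hKc : ∀ᶠ z in (l : Filter ℂ), z ∉ K := hl self_mem_nhdsWithin
      have hzp : Tendsto (fun z : ℂ => z) l (𝓝 p) := hl.trans nhdsWithin_le_nhds
      have hS : Tendsto S l (𝓝 (S p)) := h.glob.continuous_S.continuousAt.tendsto.comp hzp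
      have h1 : Tendsto (fun z => (F z).im - β) l (𝓝 (((p + S p) / 2 - α * a).im - β)) :=
        ((continuous_im.tendsto _).comp (((hzp.add hS).div_const 2).sub
          (hat.const_mul _))).sub_const β
      have h2 : ((p + S p) / 2 - α * a).im - β = 0 := by
        have e1 : (p + S p) / 2 = ((p.re : ℝ) : ℂ) + cst S p / 2 := by
          rw [cst]
          have : p + conj p = 2 * p.re := by
            apply Complex.ext <;> simp; ring
          linear_combination this / 2
        have e2 : (cst S p / 2).im = (cst S p).im / 2 := by
          simp
        rw [e1, sub_im, add_im, ofReal_im, im_ofReal_mul, e2]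
        rcases ha with ⟨h3, h4⟩ | ⟨h3, h4⟩
        · rw [h3, h4, hαπ, hβ]; ring
        · rw [h3, h4, mul_neg, hαπ, hβ]; ring
      rw [h2] at h1
      refine h1.congr' ?_
      filter_upwards [hKc] with z hz using (hf1 z hz).symm
    · refine ContinuousAt.congr ?_ (hev p hp).symm
      exact (continuous_im.continuousAt.comp
        (hFd.differentiableAt (hcl.isOpen_compl.mem_nhds hp)).continuousAt).sub continuousAt_const
  obtain ⟨q, r, hr, hq⟩ := h.exists_ball_subset
  have hbd : ∀ z, |f z| ≤ |κ₀.im| + |κ₁.im| + |α| * (Real.pi / 2) + |β| := by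
    intro z
    by_cases hz : z ∈ K
    · rw [hf0 z hz, abs_zero]
      have := Real.pi_pos
      positivity
    · rw [hf1 z hz]
      have h1 := h.im_le z
      have h2 := h.le_im z
      have e1 : (F z).im = (z + S z).im / 2 - α * (logCayley U z).im := by
        simp only [F]
        rw [sub_im, im_ofReal_mul]
        simp
      have h3 : |α * (logCayley U z).im| ≤ |α| * (Real.pi / 2) := by
        rw [abs_mul]
        gcongr
        exact (h.abs_im_logCayley_lt hz).le
      have h4 : |(z + S z).im / 2| ≤ |κ₀.im| + |κ₁.im| := by
        rw [abs_le]
        constructor <;> linarith [abs_nonneg κ₀.im, abs_nonneg κ₁.im, le_abs_self κ₀.im,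
          neg_abs_le κ₁.im]
      rw [e1]
      calc _ ≤ |(z + S z).im / 2| + |α * (logCayley U z).im| + |β| :=
            (abs_sub _ _).trans (by gcongr; exact abs_sub _ _)
        _ ≤ _ := by gcongr
  have := eq_zero_of_bounded_of_ball hcl hr (fun w hw => (hq hw).1) hcont hf0 hharm hbd z
  rw [hf1 z hz] at this
  linarith

lemma mul_deriv_logCayley (h : Two c κ₀ κ₁ U S K) {z : ℂ} (hz : z ∉ K) :
    ((κ₀.im - κ₁.im) / (2 * Real.pi) : ℝ) * deriv (logCayley U) z = (1 - cgrad U z ^ 2) / 2 := by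
  set α := (κ₀.im - κ₁.im) / (2 * Real.pi)
  have h1 : HasDerivAt (fun z => -I * ((z + S z) / 2 - α * logCayley U z))
      (-I * ((1 + -(cgrad U z) ^ 2) / 2 - α * deriv (logCayley U) z)) z :=
    ((((hasDerivAt_id z).add (h.glob.sder hz)).div_const 2).sub
      ((h.differentiableAt_logCayley hz).hasDerivAt.const_mul _)).const_mul _
  have h2 := cgrad_eq_of_hasDerivAt (U := fun _ => (κ₀.im + κ₁.im) / 4) h1 (by
    filter_upwards [h.glob.gbase.eventually_notMem hz] with w hw
    rw [← h.im_eq hw]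
    simp only [neg_mul, neg_re, I_mul_re, neg_neg]
    rfl)
  have h3 : cgrad (fun _ : ℂ => (κ₀.im + κ₁.im) / 4) z = 0 := by simp [cgrad]
  rw [h3, zero_eq_mul] at h2
  have h4 := h2.resolve_left (by simp)
  linear_combination -h4

lemma alpha_pos (h : Two c κ₀ κ₁ U S K) : 0 < (κ₀.im - κ₁.im) / (2 * Real.pi) := by
  obtain ⟨z, hz⟩ := (ne_univ_iff_exists_notMem K).1 h.ne_univ
  have h1 := (h.le_im z).trans (h.im_le z)
  have h2 : 0 ≤ (κ₀.im - κ₁.im) / (2 * Real.pi) :=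
    div_nonneg (by linarith) (by linarith [Real.pi_pos])
  refine lt_of_le_of_ne h2 fun h0 => ?_
  have h3 := h.mul_deriv_logCayley hz
  rw [← h0, ofReal_zero, zero_mul] at h3
  exact h.sq_ne_one hz (by linear_combination -2 * h3)

/-- Two-level solutions are double hairpins. -/
theorem exists_hairpin (h : Two c κ₀ κ₁ U S K) :
    ∃ a : ℝ, 0 < a ∧ ∃ z₀ : ℂ, ∀ z, U z = hairpin a (z - z₀) := by
  have hcl := h.glob.gbase.closed
  have hKne : K.Nonempty := let ⟨x, hx, _⟩ := h.nonempty₀; ⟨x, hx⟩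
  set α := (κ₀.im - κ₁.im) / (2 * Real.pi) with hα
  have hα0 : 0 < α := h.alpha_pos
  have hαc : (α : ℂ) ≠ 0 := by exact_mod_cast hα0.ne'
  set L := logCayley U with hL
  have hLd : ∀ z, z ∉ K → HasDerivAt L (deriv L z) z := fun z hz =>
    (h.differentiableAt_logCayley hz).hasDerivAt
  have hLα : ∀ z, z ∉ K → (α : ℂ) * deriv L z = (1 - cgrad U z ^ 2) / 2 := fun z hz =>
    h.mul_deriv_logCayley hz
  -- the position as a function of `L`
  set F : ℂ → ℂ := fun z => z - α * (L z + Complex.sinh (L z)) with hF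
  have hFd : ∀ z, z ∉ K → HasDerivAt F 0 z := by
    intro z hz
    have h1 := (hasDerivAt_id z).sub
      (((hasDerivAt_add_sinh (L z)).comp z (hLd z hz)).const_mul (α : ℂ))
    have h2 : (1 : ℂ) - α * ((1 + Complex.cosh (L z)) * deriv L z) = 0 := by
      have h3 := h.sq_ne_one hz
      have e1 : (α : ℂ) * ((1 + Complex.cosh (L z)) * deriv L z) =
          (1 + Complex.cosh (L z)) * (α * deriv L z) := by ring
      rw [e1, hLα z hz, h.cosh_logCayley hz]
      field_simp
      ring
    rw [h2] at h1
    exact h1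
  have hFloc : ∀ z, z ∉ K → ∀ᶠ w in 𝓝 z, F w = F z := by
    intro z hz
    obtain ⟨r, hr, hball⟩ := Metric.eventually_nhds_iff_ball.1 (h.glob.gbase.eventually_notMem hz)
    filter_upwards [ball_mem_nhds z hr] with w hw
    refine isOpen_ball.is_const_of_deriv_eq_zero (convex_ball z r).isPreconnected ?_ ?_ hw
      (mem_ball_self hr)
    · exact fun x hx => (hFd x (hball x hx)).differentiableAt.differentiableWithinAt
    · exact fun x hx => (hFd x (hball x hx)).deriv
  -- the height as a function of `L`
  set G : ℂ → ℝ := fun z => if z ∈ K then 0 else U z - α * (Complex.cosh (L z)).re with hG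
  have hG0 : ∀ z ∈ K, G z = 0 := fun z hz => by simp [hG, hz]
  have hG1 : ∀ z, z ∉ K → G z = U z - α * (Complex.cosh (L z)).re := fun z hz => by simp [hG, hz]
  have hGloc : ∀ z, z ∉ K → ∀ᶠ w in 𝓝 z, G w = G z := by
    intro z hz
    obtain ⟨r, hr, hball⟩ := Metric.eventually_nhds_iff_ball.1 (h.glob.gbase.eventually_notMem hz)
    obtain ⟨f, hf, hfU, -⟩ := HarmonicOnNhd.exists_hasDerivAt_ball (U := U) (z := z) (r := r)
      fun w hw => h.glob.gbase.harm (hball w hw)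
    have hd : ∀ x ∈ ball z r, HasDerivAt (fun x => f x - α * Complex.cosh (L x)) 0 x := by
      intro x hx
      have h1 := (hf x hx).sub (((Complex.hasDerivAt_cosh (L x)).comp x
        (hLd x (hball x hx))).const_mul (α : ℂ))
      have h2 : cgrad U x - α * (Complex.sinh (L x) * deriv L x) = 0 := by
        have h3 := h.sq_ne_one (hball x hx)
        have e1 : (α : ℂ) * (Complex.sinh (L x) * deriv L x) =
            Complex.sinh (L x) * (α * deriv L x) := by ring
        rw [e1, hLα x (hball x hx), h.sinh_logCayley (hball x hx)]
        field_simp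
        ring
      rw [h2] at h1
      exact h1
    filter_upwards [ball_mem_nhds z hr] with w hw
    have h1 := isOpen_ball.is_const_of_deriv_eq_zero (convex_ball z r).isPreconnected
      (fun x hx => (hd x hx).differentiableAt.differentiableWithinAt)
      (fun x hx => (hd x hx).deriv) hw (mem_ball_self hr)
    have h2 := congrArg re h1
    simp only [sub_re, re_ofReal_mul] at h2
    rw [hG1 w (hball w hw), hG1 z hz, hfU w hw, hfU z (mem_ball_self hr)]
    exact h2
  have hGc : Continuous G := by
    rw [continuous_iff_continuousAt]
    intro p
    by_cases hp : p ∈ K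
    · refine continuousAt_of_ultrafilter hG0 hp fun l hl => ?_
      obtain ⟨a, ha, hat⟩ := h.tendsto_logCayley hp hl
      have hKc : ∀ᶠ z in (l : Filter ℂ), z ∉ K := hl self_mem_nhdsWithin
      have hzp : Tendsto (fun z : ℂ => z) l (𝓝 p) := hl.trans nhdsWithin_le_nhds
      have hU : Tendsto U l (𝓝 (U p)) := h.glob.gbase.continuous.continuousAt.tendsto.comp hzp
      have h1 : Tendsto (fun z => U z - α * (Complex.cosh (L z)).re) l
          (𝓝 (U p - α * (Complex.cosh a).re)) :=
        hU.sub (((continuous_re.tendsto _).comp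
          ((Complex.continuous_cosh.tendsto a).comp hat)).const_mul α)
      rw [h.glob.gbase.zero hp, re_cosh_eq_zero (ha.imp And.right And.right), mul_zero,
        sub_zero] at h1
      refine h1.congr' ?_
      filter_upwards [hKc] with z hz using (hG1 z hz).symm
    · exact tendsto_nhds_of_eventually_eq (hGloc p hp)
  have hU : ∀ z, z ∉ K → U z = α * (Complex.cosh (L z)).re := by
    intro z hz
    have := eq_zero_of_locally_const hKne hGc hG0 hGloc z
    rw [hG1 z hz] at this
    linarith
  have hLs : ∀ z, z ∉ K → L z ∈ Sstrip := fun z hz => h.abs_im_logCayley_lt hz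
  have hLF : ∀ z, L z + Complex.sinh (L z) = (z - F z) / α := by
    intro z
    simp only [hF]
    field_simp
    ring
  have hcont_φ : Continuous fun w => w + Complex.sinh w :=
    continuous_id.add Complex.continuous_sinh
  -- the image of the strip
  have himage : ∀ z₁, z₁ ∉ K → ∀ w ∈ Sstrip, F z₁ + α * (w + Complex.sinh w) ∉ K ∧
      F (F z₁ + α * (w + Complex.sinh w)) = F z₁ := by
    intro z₁ hz₁
    set ψ : ℂ → ℂ := fun w => F z₁ + α * (w + Complex.sinh w) with hψ
    have hψc : Continuous ψ := continuous_const.add (continuous_const.mul hcont_φ)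
    set A : Set ℂ := {w | w ∈ Sstrip ∧ ψ w ∉ K ∧ F (ψ w) = F z₁ ∧ L (ψ w) = w}
    have hAo : IsOpen A := by
      rw [isOpen_iff_mem_nhds]
      rintro w ⟨hw1, hw2, hw3, hw4⟩
      filter_upwards [isOpen_Sstrip.mem_nhds hw1,
        hψc.continuousAt.eventually (h.glob.gbase.eventually_notMem hw2),
        hψc.continuousAt.eventually (hFloc _ hw2)] with x hx1 hx2 hx3
      rw [hw3] at hx3
      refine ⟨hx1, hx2, hx3, injOn_add_sinh (hLs _ hx2) hx1 ?_⟩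
      simp only
      rw [hLF, hx3]
      simp only [hψ]
      field_simp
      ring
    have hsub : Sstrip ⊆ A := by
      refine convex_Sstrip.isPreconnected.subset_of_closure_inter_subset hAo
        ⟨L z₁, hLs z₁ hz₁, ?_⟩ ?_
      · have e1 : ψ (L z₁) = z₁ := by
          simp only [hψ, hLF]
          field_simp
          ring
        refine ⟨hLs z₁ hz₁, ?_, ?_, ?_⟩
        · rw [e1]; exact hz₁
        · rw [e1]
        · rw [e1]
      · rintro w ⟨hwc, hw⟩
        obtain ⟨l, hlA, hlw⟩ := mem_closure_iff_ultrafilter.1 hwc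
        have hA : ∀ᶠ x in (l : Filter ℂ), x ∈ A := hlA
        have hψl : Tendsto ψ l (𝓝 (ψ w)) := hψc.continuousAt.tendsto.comp hlw
        have hwK : ψ w ∉ K := by
          intro hwK
          have hl' : ((l.map ψ : Ultrafilter ℂ) : Filter ℂ) ≤ 𝓝[Kᶜ] (ψ w) :=
            tendsto_nhdsWithin_iff.2 ⟨hψl, hA.mono fun x hx => hx.2.1⟩
          obtain ⟨a, ha, hat⟩ := h.tendsto_logCayley hwK hl'
          have hat' : Tendsto (fun x => L (ψ x)) l (𝓝 a) := hat
          have h1 : a = w := by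
            refine tendsto_nhds_unique hat' ((show Tendsto (fun x : ℂ => x) l (𝓝 w) from
              hlw).congr' ?_)
            filter_upwards [hA] with x hx using hx.2.2.2.symm
          have hw' : |w.im| < Real.pi / 2 := hw
          rw [← h1] at hw'
          rcases ha with ⟨-, h2⟩ | ⟨-, h2⟩ <;> rw [h2] at hw'
          · rw [abs_of_pos (by linarith [Real.pi_pos])] at hw'
            exact lt_irrefl _ hw'
          · rw [abs_neg, abs_of_pos (by linarith [Real.pi_pos])] at hw'
            exact lt_irrefl _ hw'
        have hFw : F (ψ w) = F z₁ := by
          obtain ⟨x, hx1, hx2⟩ := (hA.and (hψl.eventually (hFloc _ hwK))).exists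
          rw [← hx2, hx1.2.2.1]
        refine ⟨hw, hwK, hFw, injOn_add_sinh (hLs _ hwK) hw ?_⟩
        simp only
        rw [hLF, hFw]
        simp only [hψ]
        field_simp
        ring
    intro w hw
    exact ⟨(hsub hw).2.1, (hsub hw).2.2.1⟩
  obtain ⟨z₁, hz₁⟩ := (ne_univ_iff_exists_notMem K).1 h.ne_univ
  -- horizontal lines avoid `K`
  have hhor : ∀ z, z ∉ K → ∀ x : ℝ, F z + x ∉ K := by
    intro z hz x
    obtain ⟨w, hw, hwx⟩ := exists_real_add_sinh (x / α)
    have := (himage z hz w hw).1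
    rw [hwx, ← ofReal_mul, mul_div_cancel₀ _ hα0.ne'] at this
    exact this
  have habove : ∀ z, z ∉ K → ∀ k ∈ K, cst S k = κ₀ → (F z).im < k.im := by
    intro z hz k hk hkc
    by_contra! hle
    have h1 := (h.ray₀ hk hkc ((F z).im - k.im) (by linarith)).1
    refine hhor z hz (k.re - (F z).re) ?_
    convert h1 using 1
    apply Complex.ext <;> simp
  have hbelow : ∀ z, z ∉ K → ∀ k ∈ K, cst S k = κ₁ → k.im < (F z).im := by
    intro z hz k hk hkc
    by_contra! hle
    have h1 := (h.ray₁ hk hkc (k.im - (F z).im) (by linarith)).1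
    refine hhor z hz (k.re - (F z).re) ?_
    convert h1 using 1
    apply Complex.ext <;> simp
  have hFconst : ∀ z, z ∉ K → F z = F z₁ := by
    intro z hz
    have hmem : ∀ u, u ∉ K → F u ∉ K := fun u hu => by simpa using hhor u hu 0
    have hFF : ∀ u, u ∉ K → F (F u) = F u := fun u hu => by
      have := (himage u hu 0 (by simp [Sstrip, Real.pi_pos])).2
      simpa using this
    have hseg : segment ℝ (F z) (F z₁) ⊆ Kᶜ := by
      intro w hw hwK
      have him : w.im ∈ segment ℝ (F z).im (F z₁).im := by
        obtain ⟨a, b, ha, hb, hab, rfl⟩ := hw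
        exact ⟨a, b, ha, hb, hab, by simp⟩
      rw [segment_eq_uIcc, mem_uIcc] at him
      rcases h.cases w hwK with h1 | h1
      · have h2 := habove z hz w hwK h1
        have h3 := habove z₁ hz₁ w hwK h1
        rcases him with h4 | h4 <;> linarith [h4.1, h4.2]
      · have h2 := hbelow z hz w hwK h1
        have h3 := hbelow z₁ hz₁ w hwK h1
        rcases him with h4 | h4 <;> linarith [h4.1, h4.2]
    have := (convex_segment (𝕜 := ℝ) (F z) (F z₁)).isPreconnected.eq_of_eventually_eq (F := F)
      (fun w hw => hFloc w (hseg hw)) (left_mem_segment ℝ _ _) (right_mem_segment ℝ _ _)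
    rwa [hFF z hz, hFF z₁ hz₁] at this
  refine ⟨α, hα0, F z₁, fun z => ?_⟩
  rw [hairpin]
  by_cases hz : z ∈ K
  · rw [h.glob.gbase.zero hz, hairpinH, dif_neg, mul_zero]
    rintro ⟨w, hw, hwz⟩
    refine (himage z₁ hz₁ w hw).1 ?_
    rw [hwz, mul_div_cancel₀ _ hαc, add_sub_cancel]
    exact hz
  · rw [hU z hz, hairpinH_eq (hLs z hz)]
    rw [hLF, hFconst z hz]

end Two
end

noncomputable section
open InnerProductSpace (HarmonicAt HarmonicOnNhd)
open scoped ComplexConjugate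

lemma isometry_add_mul (z₀ : ℂ) {m : ℂ} (hm : ‖m‖ = 1) : Isometry fun z : ℂ => z₀ + m * z := by
  refine Isometry.of_dist_eq fun x y => ?_
  rw [dist_eq_norm, dist_eq_norm, add_sub_add_left_eq_sub, ← mul_sub, norm_mul, hm, one_mul]

/-- Blow-downs of two-level solutions are wedges. -/
lemma Two.blowdown {c : ℝ} {κ₀ κ₁ : ℂ} {U : ℂ → ℝ} {S : ℂ → ℂ} {K : Set ℂ}
    (h : Two c κ₀ κ₁ U S K) {r : ℕ → ℝ} (hr : Tendsto r atTop atTop) {V : ℂ → ℝ}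
    (hV : ∀ z, Tendsto (fun j => (r j)⁻¹ * U ((r j : ℂ) * z)) atTop (𝓝 (V z))) :
    V = Wfun 1 := by
  obtain ⟨x, hx, hxc⟩ := h.nonempty₀
  obtain ⟨y, hy, hyc⟩ := h.nonempty₁
  set l : Ultrafilter ℕ := hyperfilter ℕ
  have hl : (l : Filter ℕ) ≤ atTop := Nat.hyperfilter_le_atTop
  set ρ : ℕ → ℝ := fun j => max (r j) 1
  have hρ1 : ∀ j, 1 ≤ ρ j := fun j => le_max_right _ _
  have hρt : Tendsto ρ l atTop := (tendsto_atTop_mono (fun j => le_max_left _ _) hr).mono_left hl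
  have hρ0 : ∀ j, (ρ j : ℂ) ≠ 0 := fun j => by
    exact_mod_cast (zero_lt_one.trans_le (hρ1 j)).ne'
  have hρi : Tendsto (fun j => (ρ j)⁻¹) l (𝓝 0) := tendsto_inv_atTop_zero.comp hρt
  have hρic : Tendsto (fun j => ((ρ j)⁻¹ : ℂ)) l (𝓝 0) := by
    have := (continuous_ofReal.tendsto 0).comp hρi
    rw [ofReal_zero] at this
    refine this.congr fun j => ?_
    simp
  obtain ⟨U', S', hG, hU', hcst⟩ := h.glob.exists_blowdown (l := l) h.pos ⟨x, hx⟩ hρ1 hρt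
  set K' := limK l fun j => affK 0 (ρ j : ℂ) K
  have hUV : U' = V := by
    funext z
    refine tendsto_nhds_unique (hU' z) (((hV z).mono_left hl).congr' ?_)
    filter_upwards [hl (hr.eventually_ge_atTop 1)] with j hj
    have e1 : ρ j = r j := max_eq_left hj
    rw [affU, e1, zero_add, norm_real, Real.norm_of_nonneg (by linarith), div_eq_inv_mul]
  have hray : ∀ w v : ℂ, Ray S K w v → ∀ t : ℝ, 0 ≤ t → (t : ℂ) * v ∈ K' := by
    intro w v hw t ht
    refine (hcst (fun j => w + ((ρ j * t : ℝ) : ℂ) * v) (t * v) (cst S w) ?_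
      (Eventually.of_forall fun j => (hw _ (by have := hρ1 j; positivity)).1)
      (Eventually.of_forall fun j => (hw _ (by have := hρ1 j; positivity)).2)).1
    have h2 := (hρic.const_mul w).add_const ((t : ℂ) * v)
    rw [mul_zero, zero_add] at h2
    refine h2.congr fun j => ?_
    have := hρ0 j
    push_cast
    field_simp
  have hK' : ∀ a ∈ K', cst S' a = 0 ∧ a.re = 0 := by
    intro a ha
    obtain ⟨k, hk, hka⟩ := exists_seq_of_mem_limK
      (Eventually.of_forall fun j => (h.glob.aff 0 (hρ0 j)).gbase.closed) ha
    have hk' : ∀ᶠ j in (l : Filter ℕ), (ρ j : ℂ) * k j ∈ K := by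
      filter_upwards [hk] with j hj
      have : (0 : ℂ) + ρ j * k j ∈ K := hj
      rwa [zero_add] at this
    have hka' : Tendsto (fun j => (ρ j : ℂ) * k j / ρ j) l (𝓝 a) := by
      refine hka.congr fun j => ?_
      rw [mul_div_cancel_left₀ _ (hρ0 j)]
    have key : ∀ κ w d, w ∈ K → cst S w = κ → d = I ∨ d = -I →
        (∀ e, ‖e‖ = 1 → Ray S K w e → e = d) →
        (∀ᶠ j in (l : Filter ℕ), cst S (ρ j * k j) = κ) → cst S' a = 0 ∧ a.re = 0 := by
      intro κ w d hw hwκ hd hdir hκ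
      refine ⟨(hcst _ a κ hka' hk' hκ).2, ?_⟩
      by_cases ha0 : a = 0
      · simp [ha0]
      have hadd : ∀ t : ℝ, 0 ≤ t → w + t * a ∈ {z | z ∈ K ∧ cst S z = κ} := by
        intro t ht
        refine (h.glob.convex_class κ).add_mem_of_tendsto (l := (l : Filter ℕ))
          (h.glob.isClosed_class κ) ⟨hw, hwκ⟩ (k := fun j => ρ j * k j)
          (s := fun j => t * (ρ j)⁻¹) (hk'.and hκ) (Eventually.of_forall fun j => ?_) ?_ ?_
        · have := hρ1 j; positivity
        · simpa using hρi.const_mul t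
        · refine (hka.const_mul (t : ℂ)).congr fun j => ?_
          have := hρ0 j
          push_cast
          field_simp
      have hn : (‖a‖ : ℂ) ≠ 0 := by exact_mod_cast norm_ne_zero_iff.2 ha0
      have := hdir (a / ‖a‖) (by simp [ha0]) fun t ht => by
        have := hadd (t / ‖a‖) (by positivity)
        rw [hwκ]
        have e1 : w + ((t / ‖a‖ : ℝ) : ℂ) * a = w + t * (a / ‖a‖) := by push_cast; ring
        rwa [e1] at this
      have e2 : a = ((‖a‖ : ℝ) : ℂ) * d := by rw [← this]; field_simp
      rw [e2, re_ofReal_mul]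
      rcases hd with rfl | rfl <;> simp
    rcases l.em fun j => cst S (ρ j * k j) = κ₀ with h1 | h1
    · exact key κ₀ x I hx hxc (Or.inl rfl) (h.dir₀ x hxc) h1
    · refine key κ₁ y (-I) hy hyc (Or.inr rfl) (h.dir₁ y hyc) ?_
      filter_upwards [h1, hk'] with j hj hj2
      exact (h.cases _ hj2).resolve_left hj
  have hIK : ∀ a : ℂ, a.re = 0 → a ∈ K' := by
    intro a ha
    have e1 : a = (a.im : ℂ) * I := by apply Complex.ext <;> simp [ha]
    rcases le_total 0 a.im with h1 | h1
    · rw [e1]; exact hray x I (h.ray₀ hx hxc) _ h1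
    · have := hray y (-I) (h.ray₁ hy hyc) (-a.im) (by linarith)
      push_cast at this
      rw [neg_mul_neg] at this
      rwa [e1]
  have hs : ∀ a ∈ K', ∀ b ∈ K', cst S' a = cst S' b := fun a ha b hb => by
    rw [(hK' a ha).1, (hK' b hb).1]
  rw [← hUV]
  funext z
  rw [Wfun, one_mul]
  by_cases hz : z ∈ K'
  · rw [hG.gbase.zero hz, (hK' z hz).2, abs_zero]
  obtain ⟨e, q, he, hq, hall⟩ := hG.halfplane_of_single h.pos hs ⟨0, hIK 0 rfl⟩ hz
  have hee := mul_conj_eq_one he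
  have hline : ∀ t : ℝ, (q + t * e).re = 0 := by
    intro t
    refine (hK' _ ((hall _).2 ?_)).2
    rw [add_sub_cancel_left, mul_assoc, hee]; simp
  have hq0 : q.re = 0 := by simpa using hline 0
  have he0 : e.re = 0 := by
    have := hline 1
    simpa [hq0] using this
  have him : e.im = 1 ∨ e.im = -1 := by
    have h1 : ‖e‖ ^ 2 = 1 := by rw [he]; norm_num
    rw [← normSq_eq_norm_sq, normSq_apply, he0] at h1
    have h2 : (e.im - 1) * (e.im + 1) = 0 := by linarith
    rcases mul_eq_zero.1 h2 with h3 | h3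
    · left; linarith
    · right; linarith
  have hval : ((z - q) * conj e).im = -(z.re * e.im) := by
    simp [mul_im, hq0, he0]
  rw [((hall z).1 hq).2]
  rw [hval] at hq ⊢
  rcases him with h1 | h1 <;> rw [h1] at hq ⊢
  · rw [abs_of_neg (by linarith)]; ring
  · rw [abs_of_pos (by linarith)]; ring

lemma blowdown_of_isometric {U V f f' : ℂ → ℝ} {z₀ m : ℂ} (hm : ‖m‖ = 1)
    (hU : ∀ z, U (z₀ + m * z) = f z) {r : ℕ → ℝ} (hr : Tendsto r atTop atTop)
    (hV : ∀ z, Tendsto (fun j => (r j)⁻¹ * U ((r j : ℂ) * z)) atTop (𝓝 (V z))) {C : ℝ}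
    (hC : ∀ w, |f w - f' w| ≤ C) (hlip : ∀ v w, |f' v - f' w| ≤ ‖v - w‖)
    (hhom : ∀ (R : ℝ) w, 0 < R → f' (R * w) = R * f' w) (z : ℂ) : V (m * z) = f' z := by
  have hm0 : m ≠ 0 := by rw [← norm_pos_iff, hm]; exact one_pos
  refine tendsto_nhds_unique (hV (m * z)) ?_
  rw [tendsto_iff_norm_sub_tendsto_zero]
  have h1 : Tendsto (fun j => (C + ‖z₀‖) / r j) atTop (𝓝 0) := tendsto_const_nhds.div_atTop hr
  refine squeeze_zero' (Eventually.of_forall fun j => norm_nonneg _) ?_ h1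
  filter_upwards [hr.eventually_gt_atTop 0] with j hj
  have e1 : (r j : ℂ) * (m * z) = z₀ + m * (r j * z - z₀ / m) := by field_simp; ring
  have e2 : (r j)⁻¹ * f (r j * z - z₀ / m) - f' z =
      ((f (r j * z - z₀ / m) - f' (r j * z - z₀ / m)) +
        (f' (r j * z - z₀ / m) - f' (r j * z))) / r j := by
    rw [hhom _ _ hj]; field_simp; ring
  rw [e1, hU, e2, norm_div, Real.norm_of_nonneg hj.le, Real.norm_eq_abs]
  gcongr
  refine (abs_add_le _ _).trans (add_le_add (hC _) ((hlip _ _).trans ?_))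
  rw [sub_sub_cancel_left, norm_neg, norm_div, hm, div_one]

lemma abs_max_zero_sub_le (x y : ℝ) : |max x 0 - max y 0| ≤ |x - y| := by
  simpa using abs_max_sub_max_le_abs x y 0

lemma wfun_lip (v w : ℂ) : |Wfun 1 v - Wfun 1 w| ≤ ‖v - w‖ := by
  rw [Wfun, Wfun, one_mul, one_mul]
  refine (abs_abs_sub_abs_le _ _).trans ?_
  rw [← sub_re]; exact abs_re_le_norm _

lemma wfun_hom (R : ℝ) (w : ℂ) (hR : 0 < R) : Wfun 1 (R * w) = R * Wfun 1 w := by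
  rw [Wfun, Wfun, re_ofReal_mul, abs_mul, abs_of_pos hR]; ring

/-- Classification of the global class and of its blow-downs. -/
theorem Glob.outcomes {c : ℝ} {U : ℂ → ℝ} {S : ℂ → ℂ} {K : Set ℂ} (h : Glob c U S K) (hc : 0 < c)
    (hne : K.Nonempty) (hK : K ≠ univ) {r : ℕ → ℝ} (hr : Tendsto r atTop atTop) {V : ℂ → ℝ}
    (hV : ∀ z, Tendsto (fun j => (r j)⁻¹ * U ((r j : ℂ) * z)) atTop (𝓝 (V z))) :
    ∃ T₁ T₂ : ℂ → ℂ, Isometry T₁ ∧ Isometry T₂ ∧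
      ((V ∘ T₁ = Pfun ∧ U ∘ T₂ = Pfun) ∨
       (∃ s : ℝ, 0 < s ∧ s ≤ 1 ∧ V ∘ T₁ = Wfun s ∧
         ((∃ a : ℝ, 0 < a ∧ U ∘ T₂ = TPfun a) ∨ U ∘ T₂ = Wfun 1)) ∨
       (∃ s : ℝ, 0 < s ∧ s ≤ 1 ∧ V ∘ T₁ = Wfun s ∧
         ∃ a : ℝ, 0 < a ∧ U ∘ T₂ = hairpin a)) := by
  by_cases hs : ∀ x ∈ K, ∀ y ∈ K, cst S x = cst S y
  · obtain ⟨z₀, m, hm, hcases⟩ := h.planes_of_single hc hs hne hK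
    refine ⟨fun z => 0 + m * z, fun z => z₀ + m * z, isometry_add_mul 0 hm,
      isometry_add_mul z₀ hm, ?_⟩
    rcases hcases with h1 | ⟨a, ha, h1⟩ | h1
    · left
      refine ⟨?_, funext h1⟩
      funext z
      simp only [Function.comp, zero_add]
      refine blowdown_of_isometric hm h1 hr hV (C := 0) (by simp) ?_ ?_ z
      · intro v w
        refine (abs_max_zero_sub_le _ _).trans ?_
        rw [← sub_re]; exact abs_re_le_norm _
      · intro R w hR
        rw [Pfun, Pfun, re_ofReal_mul, mul_max_of_nonneg _ _ hR.le, mul_zero]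
    · right; left
      refine ⟨1, one_pos, le_rfl, ?_, Or.inl ⟨a, ha, funext h1⟩⟩
      funext z
      simp only [Function.comp, zero_add]
      refine blowdown_of_isometric hm h1 hr hV (C := a) ?_ wfun_lip wfun_hom z
      intro w
      have e1 : Wfun 1 w = max w.re 0 + max (-w.re) 0 := by
        rw [Wfun, one_mul, ← posPart_add_negPart w.re, posPart_def, negPart_def]
      rw [e1, TPfun, add_sub_add_left_eq_sub]
      refine (abs_max_zero_sub_le _ _).trans ?_
      rw [sub_sub_cancel_left, abs_neg, abs_of_pos ha]
    · right; left
      refine ⟨1, one_pos, le_rfl, ?_, Or.inr (funext h1)⟩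
      funext z
      simp only [Function.comp, zero_add]
      exact blowdown_of_isometric hm h1 hr hV (C := 0) (by simp) wfun_lip wfun_hom z
  · push Not at hs
    obtain ⟨x, hx, y, hy, hxy⟩ := hs
    obtain ⟨m, hm, κ₀, κ₁, h2⟩ := h.exists_two hc hx hy hxy
    obtain ⟨a, ha, z₁, hU⟩ := h2.exists_hairpin
    refine ⟨fun z => 0 + m * z, fun z => m * z₁ + m * z, isometry_add_mul 0 hm,
      isometry_add_mul _ hm, Or.inr (Or.inr ⟨1, one_pos, le_rfl, ?_, a, ha, ?_⟩)⟩
    · refine h2.blowdown hr (V := V ∘ fun z => 0 + m * z) fun z => ?_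
      have := hV (m * z)
      simp only [Function.comp, zero_add]
      refine this.congr fun j => ?_
      rw [affU, hm, div_one, zero_add, mul_left_comm]
    · funext z
      have := hU (z₁ + z)
      rw [affU, hm, div_one, zero_add, add_sub_cancel_left] at this
      simp only [Function.comp]
      rw [← this, mul_add]

end

noncomputable section
open InnerProductSpace (HarmonicAt HarmonicOnNhd)
open scoped ComplexConjugate

/-- The zeros of `u` in the closed disk of radius `R / 2`. -/
def zeroSet (R : ℝ) (u : ℂ → ℝ) : Set ℂ := {z ∈ closedBall 0 (R / 2) | u z = 0}

namespace IsClassicalSolution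

variable {R : ℝ} {u : ℂ → ℝ}

lemma isOpen_posSet (hu : IsClassicalSolution (ball 0 R) u) : IsOpen (posSet (ball 0 R) u) :=
  hu.contOn.isOpen_inter_preimage isOpen_ball isOpen_Ioi

lemma harmonicAt (hu : IsClassicalSolution (ball 0 R) u) {z : ℂ} (hz : z ∈ posSet (ball 0 R) u) :
    HarmonicAt u z := by
  have ho := hu.isOpen_posSet
  refine ⟨hu.harm.1.contDiffAt (ho.mem_nhds hz), ?_⟩
  filter_upwards [ho.mem_nhds hz] with w hw
  have hd : DifferentiableAt ℝ (fderiv ℝ u) w :=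
    ((hu.harm.1.contDiffAt (ho.mem_nhds hw)).fderiv_right (m := 1) (by norm_num)).differentiableAt
      (by norm_num)
  have key : ∀ v, fderiv ℝ (fderiv ℝ u) w v v = hess u w v v := by
    intro v
    rw [hess, fderiv_clm_apply hd (by fun_prop)]
    simp
  rw [InnerProductSpace.laplacian_eq_iteratedFDeriv_complexPlane]
  simp only [iteratedFDeriv_two_apply]
  simpa [key] using hu.harm.2 w hw

lemma eq_zero_of_mem_FB (hu : IsClassicalSolution (ball 0 R) u) {z : ℂ}
    (hz : z ∈ FB (ball 0 R) u) : u z = 0 := by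
  by_contra h
  have : z ∈ posSet (ball 0 R) u := ⟨hz.1, lt_of_le_of_ne (hu.nonneg z hz.1) (Ne.symm h)⟩
  exact hz.2.2 (by rwa [hu.isOpen_posSet.interior_eq])

lemma mem_FB (hu : IsClassicalSolution (ball 0 R) u) {z : ℂ} (hz : z ∈ ball 0 R) (h0 : u z = 0)
    (hcl : z ∈ closure (posSet (ball 0 R) u)) : z ∈ FB (ball 0 R) u := by
  refine ⟨hz, hcl, fun h => ?_⟩
  rw [hu.isOpen_posSet.interior_eq] at h
  exact h.2.ne' h0

lemma eq_zero_of_notMem_posSet (hu : IsClassicalSolution (ball 0 R) u) {z : ℂ}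
    (hz : z ∈ ball 0 R) (h : z ∉ posSet (ball 0 R) u) : u z = 0 := by
  by_contra h0
  exact h ⟨hz, lt_of_le_of_ne (hu.nonneg z hz) (Ne.symm h0)⟩

lemma continuousAt (hu : IsClassicalSolution (ball 0 R) u) {z : ℂ} (hz : ‖z‖ < R) :
    ContinuousAt u z :=
  hu.contOn.continuousAt (isOpen_ball.mem_nhds (by simpa using hz))

lemma isClosed_zeroSet (hR : 0 < R) (hu : IsClassicalSolution (ball 0 R) u) :
    IsClosed (zeroSet R u) := by
  have h1 : ContinuousOn u (closedBall 0 (R / 2)) :=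
    hu.contOn.mono (closedBall_subset_ball (by linarith))
  exact h1.preimage_isClosed_of_isClosed isClosed_closedBall isClosed_singleton

lemma mem_posSet_of_notMem_zeroSet (hR : 0 < R) (hu : IsClassicalSolution (ball 0 R) u) {z : ℂ}
    (hz : ‖z‖ ≤ R / 2) (h : z ∉ zeroSet R u) : z ∈ posSet (ball 0 R) u := by
  by_contra hn
  have hzb : z ∈ ball (0 : ℂ) R := by simp; linarith
  exact h ⟨by simpa using hz, hu.eq_zero_of_notMem_posSet hzb hn⟩

lemma visc (hR : 0 < R) (hu : IsClassicalSolution (ball 0 R) u) {p : ℂ} {ρ' ρ t : ℝ} (h1 : 0 < ρ')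
    (h2 : ρ' < ρ) (h3 : ρ < t) (h4 : ‖p‖ + ρ < R / 2) (h5 : ∀ z ∈ zeroSet R u, ρ ≤ ‖z - p‖)
    (h6 : ∀ z, ‖z - p‖ = ρ' → t * Real.log (ρ / ρ') ≤ u z) {y : ℂ} (hy : y ∈ zeroSet R u) :
    ‖y - p‖ ≠ ρ := by
  intro hyp
  have hρ : 0 < ρ := h1.trans h2
  have ht : 0 < t := hρ.trans h3
  have hin : ∀ z, ‖z - p‖ ≤ ρ → ‖z‖ < R / 2 := fun z hz =>
    (norm_le_of_norm_sub_le hz).trans_lt h4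
  have hpos : ∀ z, ‖z - p‖ < ρ → z ∈ posSet (ball 0 R) u := fun z hz =>
    hu.mem_posSet_of_notMem_zeroSet hR (hin z hz.le).le fun h => (h5 z h).not_gt hz
  have hu0 : u y = 0 := hy.2
  set W : Set ℂ := {z | ρ' < ‖z - p‖ ∧ ‖z - p‖ < ρ} with hW
  have hcn : Continuous fun z : ℂ => ‖z - p‖ := by fun_prop
  have hWo : IsOpen W := (isOpen_lt continuous_const hcn).inter (isOpen_lt hcn continuous_const)
  have hWcl : closure W ⊆ {z | ρ' ≤ ‖z - p‖ ∧ ‖z - p‖ ≤ ρ} :=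
    closure_minimal (fun z hz => ⟨hz.1.le, hz.2.le⟩)
      ((isClosed_le continuous_const hcn).inter (isClosed_le hcn continuous_const))
  have hWb : Bornology.IsBounded W := by
    refine isBounded_closedBall (x := p) (r := ρ) |>.subset fun z hz => ?_
    rw [mem_closedBall, dist_eq_norm]; exact hz.2.le
  have hcmp : ∀ z ∈ W, t * Real.log ρ - t * Real.log ‖z - p‖ - u z ≤ 0 := by
    intro z hz
    refine le_of_forall_frontier_le_of_harmonic
      (h := fun z => t * Real.log ρ - t * Real.log ‖z - p‖ - u z) hWo hWb ?_ ?_ ?_ hz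
    · intro w hw
      have hw' := hWcl hw
      have hw0 : ‖w - p‖ ≠ 0 := (h1.trans_le hw'.1).ne'
      have huw : ContinuousAt u w := hu.continuousAt (by linarith [hin w hw'.2])
      refine ContinuousAt.continuousWithinAt ?_
      refine (continuousAt_const.sub (continuousAt_const.mul ?_)).sub huw
      exact ContinuousAt.comp (f := fun z : ℂ => ‖z - p‖) (Real.continuousAt_log hw0)
        hcn.continuousAt
    · intro w hw
      have hw0 : w - p ≠ 0 := norm_pos_iff.1 (h1.trans hw.1)
      have hl : HarmonicAt (fun w => Real.log ‖w - p‖) w :=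
        AnalyticAt.harmonicAt_log_norm (f := fun w => w - p) (by fun_prop) hw0
      have hlt : HarmonicAt (t • fun w => Real.log ‖w - p‖) w := hl.const_smul
      have hk : HarmonicAt (fun _ : ℂ => t * Real.log ρ) w := by simp
      exact (hk.sub hlt).sub (hu.harmonicAt (hpos w hw.2))
    · intro w hw
      have hw' := hWcl hw.1
      have hwn : w ∉ W := fun h => hw.2 (by rwa [hWo.interior_eq])
      rcases hw'.1.eq_or_lt with he | hlt
      · have h7 := h6 w he.symm
        rw [Real.log_div hρ.ne' h1.ne'] at h7
        rw [← he]
        linarith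
      · have he : ‖w - p‖ = ρ := le_antisymm hw'.2 (not_lt.1 fun h => hwn ⟨hlt, h⟩)
        rw [he]
        have := hu.nonneg w (by simp; linarith [hin w hw'.2])
        linarith
  -- the radial segment from `y` towards `p`
  set e : ℂ := (p - y) / ρ with he
  have hρ' : (ρ : ℂ) ≠ 0 := by exact_mod_cast hρ.ne'
  have hen : ‖e‖ = 1 := by
    rw [he, norm_div, norm_sub_rev, hyp, norm_real, Real.norm_of_nonneg hρ.le, div_self hρ.ne']
  have hseg : ∀ τ : ℝ, τ ≤ ρ → ‖y + τ * e - p‖ = ρ - τ := by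
    intro τ hτ
    have : y + τ * e - p = ((ρ - τ : ℝ) : ℂ) * (-e) := by
      have h7 : p - y = ρ * e := by rw [he]; field_simp
      push_cast
      linear_combination -h7
    rw [this, norm_mul, norm_neg, hen, mul_one, norm_real, Real.norm_of_nonneg (by linarith)]
  have hyF : y ∈ FB (ball 0 R) u := by
    refine hu.mem_FB (by simp; linarith [hin y hyp.le]) hu0 ?_
    have ht : Tendsto (fun τ : ℝ => y + τ * e) (𝓝[>] 0) (𝓝 y) := by
      have hc : Continuous fun τ : ℝ => y + τ * e := by fun_prop
      have := hc.tendsto 0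
      simp only [ofReal_zero, zero_mul, add_zero] at this
      exact this.mono_left nhdsWithin_le_nhds
    refine mem_closure_of_tendsto ht ?_
    filter_upwards [Ioo_mem_nhdsGT hρ] with τ hτ
    exact hpos _ (by rw [hseg τ hτ.2.le]; linarith [hτ.1])
  obtain ⟨q, hq1, hq2⟩ := exists_between ((one_lt_div hρ).2 h3)
  have hev := (hu.grad_one y hyF).eventually (gt_mem_nhds hq1)
  rw [eventually_nhdsWithin_iff, Metric.eventually_nhds_iff_ball] at hev
  obtain ⟨δ, hδ, hev⟩ := hev
  set τ := min (δ / 2) ((ρ - ρ') / 2) with hτ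
  have hτ0 : 0 < τ := lt_min (by positivity) (by linarith)
  have hτδ : τ < δ := (min_le_left _ _).trans_lt (by linarith)
  have hτρ : τ < ρ - ρ' := (min_le_right _ _).trans_lt (by linarith)
  have hder : ∀ s ∈ Ioo 0 τ, HasDerivAt (fun s : ℝ => u (y + s * e))
      (fderiv ℝ u (y + s * e) e) s := by
    intro s hs
    have hd : DifferentiableAt ℝ u (y + s * e) := HarmonicAt.hasFDerivAt (hu.harmonicAt
      (hpos _ (by rw [hseg s (by linarith [hs.2])]; linarith [hs.1])))
    have h8 : HasDerivAt (fun s : ℝ => y + s * e) e s := by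
      simpa using ((hasDerivAt_id s).ofReal_comp.mul_const e).const_add y
    exact hd.hasFDerivAt.comp_hasDerivAt s h8
  have hcont : ContinuousOn (fun s : ℝ => u (y + s * e)) (Icc 0 τ) := by
    intro s hs
    have h8 : ContinuousAt u (y + s * e) := hu.continuousAt (by
      have := hin (y + s * e) (by rw [hseg s (by linarith [hs.2])]; linarith [hs.1])
      linarith)
    exact (ContinuousAt.comp (f := fun s : ℝ => y + s * e) h8 (by fun_prop)).continuousWithinAt
  obtain ⟨s, hs, hslope⟩ := exists_hasDerivAt_eq_slope (fun s : ℝ => u (y + s * e)) _ hτ0 hcont hder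
  have hsD : y + s * e ∈ posSet (ball 0 R) u :=
    hpos _ (by rw [hseg s (by linarith [hs.2])]; linarith [hs.1])
  have hg := hev (y + s * e) (by
    rw [mem_ball, dist_eq_norm, add_sub_cancel_left, norm_mul, hen, mul_one, norm_real,
      Real.norm_of_nonneg hs.1.le]
    linarith [hs.2]) hsD
  rw [norm_grad2_eq] at hg
  have hle : fderiv ℝ u (y + s * e) e ≤ q := by
    rw [fderiv_eq_re_cgrad_mul]
    refine (re_le_norm _).trans ?_
    rw [norm_mul, hen, mul_one]
    exact hg.le
  rw [hslope] at hle
  simp only [ofReal_zero, zero_mul, add_zero, hu0, sub_zero] at hle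
  rw [div_le_iff₀ hτ0] at hle
  have hn : ‖y + τ * e - p‖ = ρ - τ := hseg τ (by linarith)
  have h9 := hcmp (y + τ * e) ⟨by rw [hn]; linarith, by rw [hn]; linarith⟩
  rw [hn] at h9
  have h10 : τ / ρ ≤ Real.log ρ - Real.log (ρ - τ) := by
    have h11 := Real.log_le_sub_one_of_pos (x := (ρ - τ) / ρ) (by apply div_pos <;> linarith)
    rw [Real.log_div (by linarith) hρ.ne', sub_div, div_self hρ.ne'] at h11
    linarith
  have h12 : t * (τ / ρ) ≤ t * (Real.log ρ - Real.log (ρ - τ)) := by gcongr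
  have h13 : q * τ < t / ρ * τ := by gcongr
  have h14 : t / ρ * τ = t * (τ / ρ) := by ring
  linarith

lemma le_mul_infDist (hR : 0 < R) (hu : IsClassicalSolution (ball 0 R) u)
    (h0 : (0 : ℂ) ∈ FB (ball 0 R) u) {z : ℂ} (hz : ‖z‖ < R / 4) (hzK : z ∉ zeroSet R u) :
    0 < infDist z (zeroSet R u) ∧ infDist z (zeroSet R u) ≤ ‖z‖ ∧
      (∀ w ∈ ball z (infDist z (zeroSet R u)), w ∈ posSet (ball 0 R) u) ∧
      u z ≤ 3 * Real.log 2 * infDist z (zeroSet R u) := by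
  have h0K : (0 : ℂ) ∈ zeroSet R u :=
    ⟨by simp; linarith, hu.eq_zero_of_mem_FB h0⟩
  have hcl := hu.isClosed_zeroSet hR
  obtain ⟨k, hk, hk1, hk2⟩ := exists_norm_eq_infDist hcl ⟨0, h0K⟩ z
  set d := infDist z (zeroSet R u) with hd
  have hd0 : 0 < d := (hcl.notMem_iff_infDist_pos ⟨0, h0K⟩).1 hzK
  have hdz : d ≤ ‖z‖ := by simpa using hk2 0 h0K
  have hball : ∀ w ∈ ball z d, w ∈ posSet (ball 0 R) u := by
    intro w hw
    rw [mem_ball, dist_eq_norm] at hw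
    refine hu.mem_posSet_of_notMem_zeroSet hR ?_ fun h => (hk2 w h).not_gt hw
    linarith [norm_le_of_norm_sub_le hw.le]
  refine ⟨hd0, hdz, hball, ?_⟩
  by_contra hcon
  push Not at hcon
  have hl2 : 0 < Real.log 2 := Real.log_pos (by norm_num)
  refine hu.visc hR (p := z) (ρ' := d / 2) (ρ := d) (t := u z / (3 * Real.log 2)) (by positivity)
    (by linarith) ?_ (by linarith) hk2 ?_ hk hk1
  · rw [lt_div_iff₀ (by positivity)]; linarith
  · intro w hw
    have h7 : d / (d / 2) = 2 := by field_simp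
    have h8 := HarmonicOnNhd.harnack (fun w hw => hu.harmonicAt (hball w hw))
      (fun w hw => (hball w hw).2.le) hw.le hd0
    rw [h7]
    have : u z / (3 * Real.log 2) * Real.log 2 = u z / 3 := by field_simp
    linarith

lemma norm_cgrad_le_five (hR : 0 < R) (hu : IsClassicalSolution (ball 0 R) u)
    (h0 : (0 : ℂ) ∈ FB (ball 0 R) u) {z : ℂ} (hz : ‖z‖ < R / 4) (hzK : z ∉ zeroSet R u) :
    ‖cgrad u z‖ ≤ 5 := by
  obtain ⟨hd0, -, hball, hle⟩ := hu.le_mul_infDist hR h0 hz hzK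
  set d := infDist z (zeroSet R u)
  have h1 := HarmonicOnNhd.norm_cgrad_le (fun w hw => hu.harmonicAt (hball w hw))
      (fun w hw => (hball w hw).2.le) hd0
  refine h1.trans ?_
  rw [div_le_iff₀ hd0]
  nlinarith [Real.log_two_lt_d9]

lemma base (hR : 0 < R) (hu : IsClassicalSolution (ball 0 R) u) (h0 : (0 : ℂ) ∈ FB (ball 0 R) u) :
    Base (R / 4) u (zeroSet R u) where
  closed := hu.isClosed_zeroSet hR
  nonneg z hz := hu.nonneg z (by simp; linarith)
  zero z hz _ := hz.2
  harm z hz hzK := hu.harmonicAt (hu.mem_posSet_of_notMem_zeroSet hR (by linarith) hzK)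
  visc p ρ' ρ t h1 h2 h3 h4 h5 h6 y hy := hu.visc hR h1 h2 h3 (by linarith) h5 h6 hy
  lip := by
    have key : ∀ x y : ℂ, ‖x‖ < R / 4 → ‖y‖ < R / 4 → u x - u y ≤ 5 * ‖x - y‖ := by
      intro x y hx hy
      have hny := hu.nonneg y (by simp; linarith)
      by_cases hxK : x ∈ zeroSet R u
      · rw [hxK.2]
        have : 0 ≤ 5 * ‖x - y‖ := by positivity
        linarith
      have hseg : ∀ w ∈ segment ℝ x y, ‖w‖ < R / 4 := by
        intro w hw
        have := (convex_ball (0 : ℂ) (R / 4)).segment_subset (by simpa using hx)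
          (by simpa using hy) hw
        simpa using this
      -- parametrize the segment up to the first zero
      set A : Set ℝ := {s ∈ Icc (0 : ℝ) 1 | x + s * (y - x) ∈ zeroSet R u} with hA
      have hcx : Continuous fun s : ℝ => x + s * (y - x) := by fun_prop
      have hAcl : IsClosed A := isClosed_Icc.inter ((hu.isClosed_zeroSet hR).preimage hcx)
      have hmem : ∀ s ∈ Icc (0 : ℝ) 1, x + s * (y - x) ∈ segment ℝ x y := by
        intro s hs
        rw [segment_eq_image']
        exact ⟨s, hs, by simp⟩
      have hinc : ∀ b ∈ Icc (0 : ℝ) 1, (∀ s ∈ Ico 0 b, s ∉ A) →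
          u x - u (x + b * (y - x)) ≤ 5 * ‖x - y‖ := by
        intro b hb hbA
        have h1 : ∀ s ∈ Icc 0 b, ContinuousWithinAt (fun s : ℝ => u (x + s * (y - x))) (Icc 0 b) s := by
          intro s hs
          have h8 : ContinuousAt u (x + s * (y - x)) := hu.continuousAt (by
            have := hseg _ (hmem s ⟨hs.1, hs.2.trans hb.2⟩)
            linarith)
          exact (ContinuousAt.comp (f := fun s : ℝ => x + s * (y - x)) h8
            hcx.continuousAt).continuousWithinAt
        have h2 : ∀ s ∈ Ico 0 b, HasDerivWithinAt (fun s : ℝ => u (x + s * (y - x)))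
            (fderiv ℝ u (x + s * (y - x)) (y - x)) (Ici s) s := by
          intro s hs
          have hs1 : s ∈ Icc (0 : ℝ) 1 := ⟨hs.1, hs.2.le.trans hb.2⟩
          have hz := hseg _ (hmem s hs1)
          have hd : DifferentiableAt ℝ u (x + s * (y - x)) := HarmonicAt.hasFDerivAt
            (hu.harmonicAt (hu.mem_posSet_of_notMem_zeroSet hR (by linarith)
              fun h => hbA s hs ⟨hs1, h⟩))
          have h8 : HasDerivAt (fun s : ℝ => x + s * (y - x)) (y - x) s := by
            simpa using ((hasDerivAt_id s).ofReal_comp.mul_const (y - x)).const_add x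
          exact (hd.hasFDerivAt.comp_hasDerivAt s h8).hasDerivWithinAt
        have h3 : ∀ s ∈ Ico 0 b, ‖fderiv ℝ u (x + s * (y - x)) (y - x)‖ ≤ 5 * ‖x - y‖ := by
          intro s hs
          have hs1 : s ∈ Icc (0 : ℝ) 1 := ⟨hs.1, hs.2.le.trans hb.2⟩
          have hg := hu.norm_cgrad_le_five hR h0 (hseg _ (hmem s hs1)) fun h => hbA s hs ⟨hs1, h⟩
          rw [fderiv_eq_re_cgrad_mul]
          refine (abs_re_le_norm _).trans ?_
          rw [norm_mul, norm_sub_rev y x]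
          gcongr
        have h4 := norm_image_sub_le_of_norm_deriv_right_le_segment h1 h2 h3 b ⟨hb.1, le_rfl⟩
        simp only [ofReal_zero, zero_mul, add_zero, sub_zero] at h4
        have h5 := (abs_le.1 h4).1
        have h6 : 5 * ‖x - y‖ * b ≤ 5 * ‖x - y‖ * 1 := by gcongr; exact hb.2
        linarith
      rcases A.eq_empty_or_nonempty with hAe | hAne
      · have := hinc 1 ⟨zero_le_one, le_rfl⟩ (by simp [hAe])
        simpa using this
      · have hbA := hAcl.csInf_mem hAne ⟨0, fun s hs => hs.1.1⟩
        have h1 := hinc (sInf A) hbA.1 fun s hs hsA =>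
          (csInf_le ⟨0, fun s hs => hs.1.1⟩ hsA).not_gt hs.2
        rw [hbA.2.2] at h1
        linarith
    intro x y hx hy
    rw [abs_le]
    have h1 := key x y hx hy
    have h2 := key y x hy hx
    rw [norm_sub_rev] at h2
    exact ⟨by linarith, h1⟩

end IsClassicalSolution
end

noncomputable section
open InnerProductSpace (HarmonicAt HarmonicOnNhd)
open scoped ComplexConjugate

/-- Along a sequence of pairs on growing disks the gradient bound improves to `1 + o(1)`. -/
lemma Base.eventually_norm_cgrad_le {ι : Type*} {l : Ultrafilter ι} {U : ι → ℂ → ℝ}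
    {K : ι → Set ℂ} (hB : ∀ ρ, ∀ᶠ n in (l : Filter ι), Base ρ (U n) (K n))
    (h0 : ∀ n, (0 : ℂ) ∈ K n) (ρ : ℝ) {ε : ℝ} (hε : 0 < ε) :
    ∀ᶠ n in (l : Filter ι), ∀ z, ‖z‖ < ρ → z ∉ K n → ‖cgrad (U n) z‖ ≤ 1 + ε := by
  by_contra hcon
  rw [← Ultrafilter.eventually_not] at hcon
  have h1 : ∀ᶠ n in (l : Filter ι), ∃ z, ‖z‖ < ρ ∧ z ∉ K n ∧ 1 + ε < ‖cgrad (U n) z‖ := by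
    filter_upwards [hcon] with n hn
    push Not at hn
    exact hn
  obtain ⟨z, hz⟩ := h1.choice
  have h2 : ∀ᶠ n in (l : Filter ι), ∃ m : ℂ, m ≠ 0 ∧ ‖m‖ ≤ ρ ∧
      (∃ k ∈ affK (z n) m (K n), ‖k‖ = 1) ∧ ∀ k ∈ affK (z n) m (K n), 1 ≤ ‖k‖ := by
    filter_upwards [hz, hB 0] with n hn hb
    obtain ⟨k, hk, hk1, hk2⟩ := exists_norm_eq_infDist hb.closed ⟨0, h0 n⟩ (z n)
    set d := infDist (z n) (K n)
    have hd0 : 0 < d := (hb.closed.notMem_iff_infDist_pos ⟨0, h0 n⟩).1 hn.2.1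
    have hd0' : (d : ℂ) ≠ 0 := by exact_mod_cast hd0.ne'
    have hnd : ‖(d : ℂ)‖ = d := by rw [norm_real, Real.norm_of_nonneg hd0.le]
    refine ⟨d, hd0', ?_, ⟨(k - z n) / d, ?_, ?_⟩, fun x hx => ?_⟩
    · rw [hnd]
      have := hk2 0 (h0 n)
      rw [zero_sub, norm_neg] at this
      linarith [hn.1]
    · change z n + d * ((k - z n) / d) ∈ K n
      rwa [mul_div_cancel₀ _ hd0', add_sub_cancel]
    · rw [norm_div, hk1, hnd, div_self hd0.ne']
    · have := hk2 _ hx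
      rw [add_sub_cancel_left, norm_mul, hnd] at this
      exact (le_mul_iff_one_le_right hd0).1 this
  obtain ⟨m, hm⟩ := h2.choice
  have hB' : ∀ r, ∀ᶠ n in (l : Filter ι), Base r (affU (z n) (m n) (U n))
      (affK (z n) (m n) (K n)) := by
    intro r
    filter_upwards [hz, hm, hB (ρ + ρ * |r|)] with n h1 h2 h3
    refine h3.aff h2.1 ?_
    have h4 : ‖m n‖ * r ≤ ‖m n‖ * |r| := by gcongr; exact le_abs_self r
    have h5 : ‖m n‖ * |r| ≤ ρ * |r| := by gcongr; exact h2.2.1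
    linarith [h1.1]
  have hbd : ∀ x, ∀ᶠ n in (l : Filter ι), ‖affU (z n) (m n) (U n) x‖ ≤ 5 * (‖x‖ + 1) := by
    intro x
    filter_upwards [hB' (‖x‖ + 2), hm] with n h1 h2
    obtain ⟨k, hk, hk1⟩ := h2.2.2.1
    have h3 := h1.lip x k (by linarith) (by rw [hk1]; linarith [norm_nonneg x])
    rw [h1.zero k hk (by rw [hk1]; linarith [norm_nonneg x]), sub_zero] at h3
    rw [Real.norm_eq_abs]
    have := norm_sub_le x k
    rw [hk1] at this
    linarith
  choose U' _ hU' using fun x => exists_tendsto_of_bounded (hbd x)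
  have hG : GBase U' (limK l fun n => affK (z n) (m n) (K n)) := fun r => Base.lim hB' hU' r
  have hn0 : (0 : ℂ) ∉ limK l fun n => affK (z n) (m n) (K n) := by
    intro h
    obtain ⟨n, ⟨k, hk, hk1⟩, hn⟩ := ((h 1 one_pos).and hm).exists
    rw [sub_zero] at hk1
    exact (hn.2.2.2 k hk).not_gt hk1
  have hlim := (Base.lim_harmonic hB' hU' hn0).2.norm
  have hge : 1 + ε ≤ ‖cgrad U' 0‖ := by
    refine ge_of_tendsto hlim ?_
    filter_upwards [hz, hm, hB ρ] with n h1 h2 h3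
    have hh : HarmonicAt (U n) (z n + m n * 0) := by simpa using h3.harm _ h1.1 h1.2.1
    have hmn : ‖m n‖ ≠ 0 := norm_ne_zero_iff.2 h2.1
    rw [(harmonicAt_aff hh).2, norm_mul, norm_div, norm_real, norm_norm, div_self hmn, mul_one,
      mul_zero, add_zero]
    exact h1.2.2.le
  linarith [hG.norm_cgrad_le_one hn0]

namespace IsClassicalSolution

variable {R : ℝ} {u : ℂ → ℝ}

/-- Near the free boundary the gradient has norm close to one. -/
lemma exists_abs_norm_cgrad_sub_one_lt (hu : IsClassicalSolution (ball 0 R) u) {ρ : ℝ} (hρ : ρ < R)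
    {δ : ℝ} (hδ : 0 < δ) :
    ∃ ε > 0, ∀ z, ‖z‖ ≤ ρ → 0 < u z → u z < ε → |‖cgrad u z‖ - 1| < δ := by
  by_contra hcon
  push Not at hcon
  choose z hz1 hz2 hz3 hz4 using fun n : ℕ => hcon (1 / ((n : ℝ) + 1)) (by positivity)
  obtain ⟨a, ha, φ, hφ, hlim⟩ := (isCompact_closedBall (0 : ℂ) ρ).tendsto_subseq
    (x := z) fun n => by simpa using hz1 n
  have haR : ‖a‖ < R := by simp at ha; linarith
  have hin : ∀ n, z n ∈ posSet (ball 0 R) u := fun n =>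
    ⟨by simp; linarith [hz1 n], hz2 n⟩
  have hua : u a = 0 := by
    have h1 : Tendsto (fun n => u (z (φ n))) atTop (𝓝 (u a)) :=
      (hu.continuousAt haR).tendsto.comp hlim
    refine tendsto_nhds_unique h1 ?_
    refine squeeze_zero (fun n => (hz2 _).le) (fun n => (hz3 (φ n)).le) ?_
    exact tendsto_one_div_add_atTop_nhds_zero_nat.comp hφ.tendsto_atTop
  have hcl : a ∈ closure (posSet (ball 0 R) u) :=
    mem_closure_of_tendsto hlim (Eventually.of_forall fun n => hin _)
  have hF := hu.mem_FB (by simpa using haR) hua hcl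
  have h2 : Tendsto (fun n => ‖grad2 u (z (φ n))‖) atTop (𝓝 1) :=
    (hu.grad_one a hF).comp (tendsto_nhdsWithin_iff.2 ⟨hlim, Eventually.of_forall fun n => hin _⟩)
  have h3 := (h2.sub_const 1).abs
  rw [sub_self, abs_zero] at h3
  obtain ⟨n, hn⟩ := (h3.eventually (gt_mem_nhds hδ)).exists
  rw [norm_grad2_eq] at hn
  exact (hz4 (φ n)).not_gt hn

/-- The zero set has no compact relatively open piece. -/
lemma false_of_isCompact (hu : IsClassicalSolution (ball 0 R) u)
    (hnc : ∀ z ∈ FB (ball 0 R) u, ¬ IsCompact (connectedComponentIn (FB (ball 0 R) u) z))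
    {Q O : Set ℂ} (hQ : Q.Nonempty) (hQc : IsCompact Q) (hO : IsOpen O) (hOR : O ⊆ ball 0 R)
    (hQO : ∀ z, z ∈ Q ↔ z ∈ O ∧ u z = 0) : False := by
  have hQu : Q ≠ univ := fun h => noncompact_univ ℂ (h ▸ hQc)
  obtain ⟨a, ha⟩ := hQ
  obtain ⟨b, hb⟩ := (ne_univ_iff_exists_notMem Q).1 hQu
  obtain ⟨y, -, hy⟩ := exists_frontier_mem_segment ha hb
  have hyQ : y ∈ Q := hQc.isClosed.frontier_subset hy
  obtain ⟨hyO, hy0⟩ := (hQO y).1 hyQ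
  have hyD : y ∈ closure (posSet (ball 0 R) u) := by
    rw [mem_closure_iff_nhds]
    intro t ht
    have h1 : y ∈ closure Qᶜ := by
      rw [frontier_eq_closure_inter_closure] at hy
      exact hy.2
    obtain ⟨w, hw, hwQ⟩ := mem_closure_iff_nhds.1 h1 (t ∩ O) (inter_mem ht (hO.mem_nhds hyO))
    refine ⟨w, hw.1, ?_⟩
    by_contra hwD
    exact hwQ ((hQO w).2 ⟨hw.2, hu.eq_zero_of_notMem_posSet (hOR hw.2) hwD⟩)
  have hyF := hu.mem_FB (hOR hyO) hy0 hyD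
  set C := connectedComponentIn (FB (ball 0 R) u) y
  have hCp : IsPreconnected C := isPreconnected_connectedComponentIn
  have hyC : y ∈ C := mem_connectedComponentIn hyF
  have hCF : C ⊆ FB (ball 0 R) u := connectedComponentIn_subset _ _
  have hCQ : C ⊆ Q := by
    intro w hw
    by_contra hwQ
    obtain ⟨x, hx, hxO, hxQ⟩ := hCp O Qᶜ hO hQc.isClosed.isOpen_compl
      (fun x _ => by
        by_cases hxQ : x ∈ Q
        · exact Or.inl ((hQO x).1 hxQ).1
        · exact Or.inr hxQ) ⟨y, hyC, hyO⟩ ⟨w, hw, hwQ⟩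
    exact hxQ ((hQO x).2 ⟨hxO, hu.eq_zero_of_mem_FB (hCF hx)⟩)
  have hcc : closure C ⊆ C := by
    refine hCp.closure.subset_connectedComponentIn (subset_closure hyC) fun w hw => ⟨?_, ?_⟩
    · exact hOR ((hQO w).1 (hQc.isClosed.closure_subset_iff.2 hCQ hw)).1
    · exact isClosed_frontier.closure_subset_iff.2 (fun x hx => (hCF hx).2) hw
  exact hnc y hyF (hQc.of_isClosed_subset (isClosed_of_closure_subset hcc) hCQ)

/-- Level pieces of a function locally constant on the zero set reach every circle. -/
lemma exists_reach (hu : IsClassicalSolution (ball 0 R) u)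
    (hnc : ∀ z ∈ FB (ball 0 R) u, ¬ IsCompact (connectedComponentIn (FB (ball 0 R) u) z))
    {α : Type*} {c : ℂ → α} {R' : ℝ} (hR' : R' ≤ R)
    (hc : ∀ z, ‖z‖ < R' → u z = 0 → ∀ᶠ w in 𝓝 z, u w = 0 → c w = c z)
    {x : ℂ} {ρ : ℝ} (hx : u x = 0) (hρ : 0 < ρ) (hxR : ‖x‖ + ρ < R') :
    ∃ y, u y = 0 ∧ ‖y - x‖ = ρ ∧ c y = c x := by
  by_contra! hcon
  have hin : ∀ z, ‖z - x‖ ≤ ρ → ‖z‖ < R' := fun z hz => (norm_le_of_norm_sub_le hz).trans_lt hxR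
  set Q : Set ℂ := {z | ‖z - x‖ ≤ ρ ∧ u z = 0 ∧ c z = c x} with hQ
  set O : Set ℂ := interior {z | ‖z - x‖ < ρ ∧ (u z = 0 → c z = c x)} with hO
  have hOs : O ⊆ {z | ‖z - x‖ < ρ ∧ (u z = 0 → c z = c x)} := interior_subset
  have hQlt : ∀ z ∈ Q, ‖z - x‖ < ρ := fun z hz =>
    lt_of_le_of_ne hz.1 fun h => hcon z hz.2.1 h hz.2.2
  have hQcl : IsClosed Q := by
    refine isClosed_of_closure_subset fun z hz => ?_
    have h1 : ‖z - x‖ ≤ ρ := by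
      have : IsClosed {z : ℂ | ‖z - x‖ ≤ ρ} := isClosed_le (by fun_prop) continuous_const
      exact this.closure_subset_iff.2 (fun w hw => hw.1) hz
    have hzR := hin z h1
    have h2 : u z = 0 := by
      by_contra hne
      have := (hu.continuousAt (hzR.trans_le hR')).eventually_ne hne
      obtain ⟨w, hw, hwQ⟩ := mem_closure_iff_nhds.1 hz _ this
      exact hw hwQ.2.1
    obtain ⟨w, hw, hwQ⟩ := mem_closure_iff_nhds.1 hz _ (hc z hzR h2)
    exact ⟨h1, h2, (hw hwQ.2.1).symm.trans hwQ.2.2⟩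
  have hQc : IsCompact Q := by
    refine (isCompact_closedBall x ρ).of_isClosed_subset hQcl fun z hz => ?_
    rw [mem_closedBall, dist_eq_norm]; exact hz.1
  refine hu.false_of_isCompact hnc (Q := Q) (O := O) ⟨x, by simp [hρ.le], hx, rfl⟩ hQc
    isOpen_interior (fun z hz => ?_) fun z => ⟨fun hz => ⟨?_, hz.2.1⟩, fun hz => ?_⟩
  · have := hin z (hOs hz).1.le
    simp; linarith
  · rw [hO, mem_interior_iff_mem_nhds]
    have h1 : ∀ᶠ w in 𝓝 z, ‖w - x‖ < ρ :=
      (isOpen_lt (by fun_prop) continuous_const).mem_nhds (hQlt z hz)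
    filter_upwards [h1, hc z (hin z hz.1) hz.2.1] with w hw1 hw2
    exact ⟨hw1, fun h => (hw2 h).trans hz.2.2⟩
  · exact ⟨(hOs hz.1).1.le, hz.2, (hOs hz.1).2 hz.2⟩

end IsClassicalSolution
end

noncomputable section
open InnerProductSpace (HarmonicAt HarmonicOnNhd)
open scoped ComplexConjugate

/-- Twice the Cauchy–Riemann operator. -/
def dbar (F : ℂ → ℂ) (z : ℂ) : ℂ := fderiv ℝ F z 1 + I * fderiv ℝ F z I

lemma dbar_of_eventually_eq_zero {F : ℂ → ℂ} {z : ℂ} (h : F =ᶠ[𝓝 z] 0) : dbar F z = 0 := by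
  simp [dbar, h.fderiv_eq]

lemma dbar_mul {F G : ℂ → ℂ} {z : ℂ} (hF : DifferentiableAt ℝ F z) (hG : DifferentiableAt ℝ G z) :
    dbar (fun w => F w * G w) z = dbar F z * G z + F z * dbar G z := by
  simp only [dbar]
  rw [fderiv_fun_mul hF hG]
  simp
  ring

lemma dbar_ofReal {f : ℂ → ℝ} {z : ℂ} (hf : DifferentiableAt ℝ f z) :
    dbar (fun w => (f w : ℂ)) z = conj (cgrad f z) := by
  have h : HasFDerivAt (fun w => (f w : ℂ)) (ofRealCLM.comp (fderiv ℝ f z)) z :=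
    ofRealCLM.hasFDerivAt.comp z hf.hasFDerivAt
  simp [dbar, h.fderiv, cgrad]

lemma dbar_of_differentiableAt {h : ℂ → ℂ} {z : ℂ} (hh : DifferentiableAt ℂ h z) :
    dbar h z = 0 := by
  have h1 : HasFDerivAt h ((ContinuousLinearMap.toSpanSingleton ℂ (deriv h z)).restrictScalars ℝ) z :=
    hh.hasDerivAt.hasFDerivAt.restrictScalars ℝ
  rw [dbar, h1.fderiv]
  simp [← mul_assoc]

lemma integral_fderiv_apply_eq_zero {F : ℂ → ℂ} (hF : ContDiff ℝ 1 F) (hc : HasCompactSupport F)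
    (v : ℂ) : ∫ z, fderiv ℝ F z v = 0 := by
  have hcont : Continuous fun z => fderiv ℝ F z v :=
    (hF.continuous_fderiv (by norm_num)).clm_apply continuous_const
  have hcs : HasCompactSupport fun z => fderiv ℝ F z v := hc.fderiv_apply ℝ v
  have h := integral_mul_fderiv_eq_neg_fderiv_mul_of_integrable (μ := (volume : Measure ℂ))
    (f := fun _ : ℂ => (1 : ℂ)) (g := F) (v := v) (by simp)
    (by simpa using hcont.integrable_of_hasCompactSupport hcs)
    (by simpa using hF.continuous.integrable_of_hasCompactSupport hc)
    (fun x _ => by fun_prop) (fun x _ => hF.differentiable (by norm_num) x)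
  simpa using h

lemma continuous_dbar {F : ℂ → ℂ} (hF : ContDiff ℝ 1 F) : Continuous (dbar F) := by
  have h := hF.continuous_fderiv (by norm_num)
  exact (h.clm_apply continuous_const).add (continuous_const.mul (h.clm_apply continuous_const))

lemma tsupport_dbar_subset (F : ℂ → ℂ) : tsupport (dbar F) ⊆ tsupport F := by
  refine closure_minimal (fun z hz => ?_) isClosed_closure
  by_contra h
  exact hz (dbar_of_eventually_eq_zero (notMem_tsupport_iff_eventuallyEq.1 h))

lemma integral_dbar_eq_zero {F : ℂ → ℂ} (hF : ContDiff ℝ 1 F) (hc : HasCompactSupport F) :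
    ∫ z, dbar F z = 0 := by
  have hi : ∀ v, Integrable fun z => fderiv ℝ F z v := fun v =>
    ((hF.continuous_fderiv (by norm_num)).clm_apply
      continuous_const).integrable_of_hasCompactSupport (hc.fderiv_apply ℝ v)
  simp only [dbar]
  rw [integral_add (hi 1) ((hi I).const_mul I), integral_const_mul,
    integral_fderiv_apply_eq_zero hF hc, integral_fderiv_apply_eq_zero hF hc]
  simp

/-- A smooth cutoff of the half-line vanishing up to `s` and equal to one from `2 s` on. -/
def cut (s t : ℝ) : ℝ := Real.smoothTransition ((t - s) / s)

section cut
variable {s t : ℝ}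

lemma contDiff_cut (s : ℝ) : ContDiff ℝ 1 (cut s) :=
  (Real.smoothTransition.contDiff (n := 1)).comp (by fun_prop)

lemma cut_of_le (hs : 0 < s) (h : t ≤ s) : cut s t = 0 :=
  Real.smoothTransition.zero_of_nonpos (div_nonpos_of_nonpos_of_nonneg (by linarith) hs.le)

lemma cut_of_ge (hs : 0 < s) (h : 2 * s ≤ t) : cut s t = 1 :=
  Real.smoothTransition.one_of_one_le (by rw [le_div_iff₀ hs]; linarith)

lemma cut_nonneg (s t : ℝ) : 0 ≤ cut s t := Real.smoothTransition.nonneg _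
lemma cut_le_one (s t : ℝ) : cut s t ≤ 1 := Real.smoothTransition.le_one _

lemma monotone_cut (hs : 0 < s) : Monotone (cut s) := fun a b h =>
  Real.smoothTransition.monotone (by gcongr)

lemma deriv_cut_nonneg (hs : 0 < s) (t : ℝ) : 0 ≤ deriv (cut s) t := (monotone_cut hs).deriv_nonneg

lemma continuous_deriv_cut (s : ℝ) : Continuous (deriv (cut s)) :=
  (contDiff_cut s).continuous_deriv (by norm_num)

lemma deriv_cut_of_le (hs : 0 < s) (h : t ≤ s) : deriv (cut s) t = 0 :=
  IsLocalMin.deriv_eq_zero (Eventually.of_forall fun x => by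
    rw [cut_of_le hs h]; exact cut_nonneg s x)

lemma deriv_cut_of_ge (hs : 0 < s) (h : 2 * s ≤ t) : deriv (cut s) t = 0 :=
  IsLocalMax.deriv_eq_zero (Eventually.of_forall fun x => by
    rw [cut_of_ge hs h]; exact cut_le_one s x)

/-- The primitive of `cut s` vanishing at the origin. -/
def cutInt (s t : ℝ) : ℝ := ∫ x in (0 : ℝ)..t, cut s x

lemma deriv_cutInt (s : ℝ) : deriv (cutInt s) = cut s := by
  funext t
  exact (contDiff_cut s).continuous.deriv_integral _ 0 t

lemma contDiff_cutInt (s : ℝ) : ContDiff ℝ 1 (cutInt s) := by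
  rw [contDiff_one_iff_deriv]
  refine ⟨fun t => ?_, by rw [deriv_cutInt]; exact (contDiff_cut s).continuous⟩
  exact ((contDiff_cut s).continuous.integral_hasStrictDerivAt 0 t).hasDerivAt.differentiableAt

lemma cutInt_of_le (hs : 0 < s) (h : t ≤ s) : cutInt s t = 0 := by
  refine intervalIntegral.integral_zero_ae (Eventually.of_forall fun x hx => cut_of_le hs ?_)
  rcases le_total 0 t with h0 | h0
  · rw [uIoc_of_le h0] at hx; exact hx.2.trans h
  · rw [uIoc_of_ge h0] at hx; exact hx.2.trans hs.le

lemma cutInt_nonneg (ht : 0 ≤ t) : 0 ≤ cutInt s t :=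
  intervalIntegral.integral_nonneg ht fun x _ => cut_nonneg s x

lemma cutInt_le (ht : 0 ≤ t) : cutInt s t ≤ t := by
  have h := intervalIntegral.integral_mono_on (μ := volume) ht
    ((contDiff_cut s).continuous.intervalIntegrable 0 t)
    ((continuous_const (y := (1 : ℝ))).intervalIntegrable 0 t) (fun x _ => cut_le_one s x)
  simpa [cutInt] using h

end cut

namespace IsClassicalSolution

variable {R : ℝ} {u : ℂ → ℝ}

lemma contDiff_mul_of_eq_zero (hu : IsClassicalSolution (ball 0 R) u) {n : WithTop ℕ∞} {η : ℂ → ℂ}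
    (hη : ContDiff ℝ n η) (hηs : tsupport η ⊆ ball 0 R) {s : ℝ} (hs : 0 < s) {f : ℂ → ℂ}
    (hf : ∀ z ∈ posSet (ball 0 R) u, ContDiffAt ℝ n f z)
    (hf0 : ∀ z ∈ ball 0 R, u z < s → f z = 0) : ContDiff ℝ n fun z => η z * f z := by
  rw [contDiff_iff_contDiffAt]
  intro z
  have hzero : (∀ᶠ w in 𝓝 z, η w * f w = 0) → ContDiffAt ℝ n (fun z => η z * f z) z := fun h =>
    contDiffAt_const (c := (0 : ℂ)) |>.congr_of_eventuallyEq h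
  by_cases hz : z ∈ tsupport η
  · by_cases hzD : z ∈ posSet (ball 0 R) u
    · exact hη.contDiffAt.mul (hf z hzD)
    · apply hzero
      have hzb := hηs hz
      have h0 := hu.eq_zero_of_notMem_posSet hzb hzD
      have hlt : ∀ᶠ w in 𝓝 z, u w < s :=
        (hu.continuousAt (by simpa using hzb)).eventually (gt_mem_nhds (by rw [h0]; exact hs))
      filter_upwards [hlt, isOpen_ball.mem_nhds hzb] with w hw hwb
      rw [hf0 w hwb hw, mul_zero]
  · apply hzero
    filter_upwards [notMem_tsupport_iff_eventuallyEq.1 hz] with w hw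
    simp [hw]

lemma continuous_mul_of_eq_zero (hu : IsClassicalSolution (ball 0 R) u) {η : ℂ → ℂ}
    (hη : Continuous η) (hηs : tsupport η ⊆ ball 0 R) {s : ℝ}
    (hs : 0 < s) {f : ℂ → ℂ} (hf : ∀ z ∈ posSet (ball 0 R) u, ContinuousAt f z)
    (hf0 : ∀ z ∈ ball 0 R, u z < s → f z = 0) : Continuous fun z => η z * f z := by
  have h : ContDiff ℝ 0 fun z => η z * f z := by
    refine hu.contDiff_mul_of_eq_zero (contDiff_zero.2 hη) hηs hs (fun z hz => ?_) hf0
    rw [contDiffAt_zero]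
    refine ⟨posSet (ball 0 R) u, hu.isOpen_posSet.mem_nhds hz, fun w hw =>
      (hf w hw).continuousWithinAt⟩
  exact h.continuous

lemma integrable_mul_of_eq_zero (hu : IsClassicalSolution (ball 0 R) u) {η : ℂ → ℂ}
    (hη : Continuous η) (hηc : HasCompactSupport η) (hηs : tsupport η ⊆ ball 0 R) {s : ℝ}
    (hs : 0 < s) {f : ℂ → ℂ} (hf : ∀ z ∈ posSet (ball 0 R) u, ContinuousAt f z)
    (hf0 : ∀ z ∈ ball 0 R, u z < s → f z = 0) : Integrable fun z => η z * f z :=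
  (hu.continuous_mul_of_eq_zero hη hηs hs hf hf0).integrable_of_hasCompactSupport hηc.mul_right

lemma differentiableAt_cgrad (hu : IsClassicalSolution (ball 0 R) u) {z : ℂ}
    (hz : z ∈ posSet (ball 0 R) u) : DifferentiableAt ℂ (cgrad u) z :=
  HarmonicAt.differentiableAt_cgrad (hu.harmonicAt hz)

lemma contDiffAt_of_differentiableAt (hu : IsClassicalSolution (ball 0 R) u) {h : ℂ → ℂ}
    (hh : ∀ z ∈ posSet (ball 0 R) u, DifferentiableAt ℂ h z) {z : ℂ}
    (hz : z ∈ posSet (ball 0 R) u) : ContDiffAt ℝ 1 h z := by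
  have hd : DifferentiableOn ℂ h (posSet (ball 0 R) u) := fun w hw =>
    (hh w hw).differentiableWithinAt
  exact ((hd.analyticAt (hu.isOpen_posSet.mem_nhds hz)).contDiffAt (n := 1)).restrict_scalars ℝ

lemma contDiffAt_comp (hu : IsClassicalSolution (ball 0 R) u) {ψ : ℝ → ℝ} (hψ : ContDiff ℝ 1 ψ)
    {z : ℂ} (hz : z ∈ posSet (ball 0 R) u) : ContDiffAt ℝ 1 (fun w => ψ (u w)) z :=
  hψ.contDiffAt.comp z ((hu.harmonicAt hz).1.of_le (by norm_num))

lemma cgrad_comp (hu : IsClassicalSolution (ball 0 R) u) {ψ : ℝ → ℝ} (hψ : ContDiff ℝ 1 ψ)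
    {z : ℂ} (hz : z ∈ posSet (ball 0 R) u) :
    cgrad (fun w => ψ (u w)) z = deriv ψ (u z) * cgrad u z := by
  have h : HasFDerivAt (fun w => ψ (u w)) (deriv ψ (u z) • fderiv ℝ u z) z :=
    (hψ.differentiable (by norm_num) _).hasDerivAt.comp_hasFDerivAt z
      (HarmonicAt.hasFDerivAt (hu.harmonicAt hz)).hasFDerivAt
  simp [cgrad, h.fderiv]
  ring

/-- Integration by parts for truncations of `u` against holomorphic functions on the positive
phase. -/
lemma integral_dbar_cutoff (hu : IsClassicalSolution (ball 0 R) u) {η : ℂ → ℂ}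
    (hη : ContDiff ℝ 1 η) (hηc : HasCompactSupport η) (hηs : tsupport η ⊆ ball 0 R)
    {s : ℝ} (hs : 0 < s) {ψ : ℝ → ℝ} (hψ : ContDiff ℝ 1 ψ) (hψ0 : ∀ t ≤ s, ψ t = 0) {h : ℂ → ℂ}
    (hh : ∀ z ∈ posSet (ball 0 R) u, DifferentiableAt ℂ h z) :
    Integrable (fun z => dbar η z * (ψ (u z) * h z)) ∧
    Integrable (fun z => η z * (deriv ψ (u z) * conj (cgrad u z) * h z)) ∧
    (∫ z, dbar η z * (ψ (u z) * h z)) +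
      ∫ z, η z * (deriv ψ (u z) * conj (cgrad u z) * h z) = 0 := by
  have hψ' : ∀ t, t < s → deriv ψ t = 0 := by
    intro t ht
    have : ψ =ᶠ[𝓝 t] fun _ => 0 := by
      filter_upwards [gt_mem_nhds ht] with x hx using hψ0 x hx.le
    rw [this.deriv_eq]; simp
  have hψc : Continuous (deriv ψ) := hψ.continuous_deriv (by norm_num)
  have huc : ∀ z ∈ posSet (ball 0 R) u, ContinuousAt u z := fun z hz =>
    hu.continuousAt (by simpa using hz.1)
  have i1 : Integrable (fun z => dbar η z * (ψ (u z) * h z)) := by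
    refine hu.integrable_mul_of_eq_zero (continuous_dbar hη)
      (hηc.of_isClosed_subset isClosed_closure (tsupport_dbar_subset η))
      ((tsupport_dbar_subset η).trans hηs) hs (fun z hz => ?_)
      (fun z _ hz => by simp [hψ0 _ hz.le])
    refine ContinuousAt.mul ?_ (hh z hz).continuousAt
    exact continuous_ofReal.continuousAt.comp (hψ.continuous.continuousAt.comp (huc z hz))
  have i2 : Integrable (fun z => η z * (deriv ψ (u z) * conj (cgrad u z) * h z)) := by
    refine hu.integrable_mul_of_eq_zero hη.continuous hηc hηs hs (fun z hz => ?_)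
      (fun z _ hz => by simp [hψ' _ hz])
    refine ContinuousAt.mul (ContinuousAt.mul ?_ ?_) (hh z hz).continuousAt
    · exact continuous_ofReal.continuousAt.comp (hψc.continuousAt.comp (huc z hz))
    · exact continuous_conj.continuousAt.comp (hu.differentiableAt_cgrad hz).continuousAt
  refine ⟨i1, i2, ?_⟩
  have hF : ∀ z ∈ posSet (ball 0 R) u, ContDiffAt ℝ 1 (fun z => (ψ (u z) : ℂ)) z := fun z hz =>
    ofRealCLM.contDiff.contDiffAt.comp z (hu.contDiffAt_comp hψ hz)
  have hcd : ContDiff ℝ 1 fun z => η z * (ψ (u z) * h z) :=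
    hu.contDiff_mul_of_eq_zero hη hηs hs
      (fun z hz => (hF z hz).mul (hu.contDiffAt_of_differentiableAt hh hz))
      (fun z _ hz => by simp [hψ0 _ hz.le])
  have key := integral_dbar_eq_zero hcd hηc.mul_right
  rw [← integral_add i1 i2, ← key]
  congr 1
  funext z
  by_cases hz : z ∈ tsupport η
  · have hzb := hηs hz
    by_cases hzD : z ∈ posSet (ball 0 R) u
    · have d1 : DifferentiableAt ℝ η z := hη.differentiable (by norm_num) z
      have d2 : DifferentiableAt ℝ (fun z => (ψ (u z) : ℂ)) z :=
        (hF z hzD).differentiableAt (by norm_num)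
      have d3 : DifferentiableAt ℝ h z := (hh z hzD).restrictScalars ℝ
      rw [dbar_mul (G := fun z => ψ (u z) * h z) d1 (d2.mul d3), dbar_mul d2 d3, dbar_of_differentiableAt (hh z hzD),
        dbar_ofReal ((hu.contDiffAt_comp hψ hzD).differentiableAt (by norm_num)),
        hu.cgrad_comp hψ hzD, map_mul, conj_ofReal]
      ring
    · have h0 := hu.eq_zero_of_notMem_posSet hzb hzD
      have hlt : ∀ᶠ w in 𝓝 z, u w < s :=
        (hu.continuousAt (by simpa using hzb)).eventually (gt_mem_nhds (by rw [h0]; exact hs))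
      rw [dbar_of_eventually_eq_zero (F := fun z => η z * (ψ (u z) * h z)) (by
        filter_upwards [hlt] with w hw
        simp [hψ0 _ hw.le]), h0, hψ0 0 hs.le, hψ' 0 hs]
      simp
  · have hev := notMem_tsupport_iff_eventuallyEq.1 hz
    rw [dbar_of_eventually_eq_zero (F := fun z => η z * (ψ (u z) * h z)) (by
      filter_upwards [hev] with w hw
      simp [hw]), dbar_of_eventually_eq_zero hev, hev.eq_of_nhds]
    simp

end IsClassicalSolution
end

noncomputable section
open InnerProductSpace (HarmonicAt HarmonicOnNhd)
open scoped ComplexConjugate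

lemma continuous_cgrad {η : ℂ → ℝ} (hη : ContDiff ℝ 1 η) : Continuous (cgrad η) := by
  have h := hη.continuous_fderiv (by norm_num)
  have h1 : ∀ v : ℂ, Continuous fun z => ((fderiv ℝ η z v : ℝ) : ℂ) := fun v =>
    continuous_ofReal.comp (h.clm_apply continuous_const)
  exact (h1 1).sub (continuous_const.mul (h1 I))

lemma cgrad_eq_zero_of_notMem_tsupport {η : ℂ → ℝ} {z : ℂ} (hz : z ∉ tsupport η) :
    cgrad η z = 0 := by
  simp [cgrad, (notMem_tsupport_iff_eventuallyEq.1 hz).fderiv_eq]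

lemma hasCompactSupport_cgrad {η : ℂ → ℝ} (hηc : HasCompactSupport η) :
    HasCompactSupport (cgrad η) := by
  refine HasCompactSupport.intro hηc fun z hz => cgrad_eq_zero_of_notMem_tsupport hz

lemma tsupport_ofReal (η : ℂ → ℝ) : tsupport (fun z => (η z : ℂ)) = tsupport η := by
  simp [tsupport, Function.support]

lemma dbar_ofReal_eq {η : ℂ → ℝ} (hη : ContDiff ℝ 1 η) :
    dbar (fun z => (η z : ℂ)) = fun z => conj (cgrad η z) :=
  funext fun z => dbar_ofReal (hη.differentiable (by norm_num) z)

namespace IsClassicalSolution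

variable {R : ℝ} {u : ℂ → ℝ} {η : ℂ → ℝ}

lemma notMem_zeroSet {z : ℂ} (hz : z ∈ posSet (ball 0 R) u) : z ∉ zeroSet R u :=
  fun h => hz.2.ne' h.2

/-- The truncated mass identity. -/
lemma integral_mass (hu : IsClassicalSolution (ball 0 R) u) (hη : ContDiff ℝ 1 η)
    (hηc : HasCompactSupport η) (hηs : tsupport η ⊆ ball 0 R) {s : ℝ} (hs : 0 < s) :
    Integrable (fun z => η z * (deriv (cut s) (u z) * ‖cgrad u z‖ ^ 2)) ∧
    Integrable (fun z => conj (cgrad η z) * (cut s (u z) * cgrad u z)) ∧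
    ((∫ z, η z * (deriv (cut s) (u z) * ‖cgrad u z‖ ^ 2) : ℝ) : ℂ) =
      -∫ z, conj (cgrad η z) * (cut s (u z) * cgrad u z) := by
  obtain ⟨i1, i2, h⟩ := hu.integral_dbar_cutoff (η := fun z => (η z : ℂ))
    (ofRealCLM.contDiff.comp hη) (by rw [HasCompactSupport, tsupport_ofReal]; exact hηc)
    (by rwa [tsupport_ofReal]) hs (contDiff_cut s) (fun t ht => cut_of_le hs ht)
    (h := cgrad u) (fun z hz => hu.differentiableAt_cgrad hz)
  rw [dbar_ofReal_eq hη] at i1 h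
  have he : (fun z => (η z : ℂ) * (deriv (cut s) (u z) * conj (cgrad u z) * cgrad u z)) =
      fun z => ((η z * (deriv (cut s) (u z) * ‖cgrad u z‖ ^ 2) : ℝ) : ℂ) := by
    funext z
    rw [mul_assoc, mul_comm (conj _), mul_conj, normSq_eq_norm_sq]
    push_cast
    ring
  rw [he] at i2 h
  refine ⟨?_, i1, ?_⟩
  · have := i2.re
    simpa only [RCLike.re_to_complex, ofReal_re] using this
  · rw [integral_complex_ofReal] at h
    exact eq_neg_of_add_eq_zero_right h

lemma integral_mass_le (hR : 0 < R) (hu : IsClassicalSolution (ball 0 R) u)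
    (h0 : (0 : ℂ) ∈ FB (ball 0 R) u) (hη : ContDiff ℝ 1 η)
    (hηc : HasCompactSupport η) (hηs : tsupport η ⊆ ball 0 (R / 4)) {s : ℝ} (hs : 0 < s) :
    ∫ z, η z * (deriv (cut s) (u z) * ‖cgrad u z‖ ^ 2) ≤ ∫ z, ‖cgrad η z‖ * 5 := by
  have hηs' : tsupport η ⊆ ball 0 R := hηs.trans (ball_subset_ball (by linarith))
  obtain ⟨-, i1, h⟩ := hu.integral_mass hη hηc hηs' hs
  have h2 := congrArg norm h
  rw [norm_neg, norm_real] at h2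
  refine (le_abs_self _).trans ((Real.norm_eq_abs _).symm.le.trans ?_)
  rw [h2]
  have i2 : Integrable fun z => ‖cgrad η z‖ * 5 :=
    ((continuous_cgrad hη).integrable_of_hasCompactSupport
      (hasCompactSupport_cgrad hηc)).norm.mul_const 5
  refine norm_integral_le_of_norm_le i2 (Eventually.of_forall fun z => ?_)
  rw [norm_mul, RCLike.norm_conj]
  by_cases hz : z ∈ tsupport η
  · gcongr
    have hzb := hηs hz
    rw [norm_mul, norm_real, Real.norm_of_nonneg (cut_nonneg _ _)]
    by_cases hzD : z ∈ posSet (ball 0 R) u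
    · have := hu.norm_cgrad_le_five hR h0 (by simpa using hzb) (notMem_zeroSet hzD)
      exact (mul_le_mul (cut_le_one _ _) this (norm_nonneg _) zero_le_one).trans (by norm_num)
    · rw [hu.eq_zero_of_notMem_posSet (hηs' hz) hzD, cut_of_le hs hs.le]
      norm_num
  · simp [cgrad_eq_zero_of_notMem_tsupport hz]

/-- Weak closedness of the form `-g² 1_{u>0} dz + 1_{u=0} dz̄`, where `g` is the complex gradient. -/
theorem integral_weak (hR : 0 < R) (hu : IsClassicalSolution (ball 0 R) u)
    (h0 : (0 : ℂ) ∈ FB (ball 0 R) u) (hη : ContDiff ℝ 1 η) (hη0 : ∀ z, 0 ≤ η z)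
    (hηc : HasCompactSupport η) (hηs : tsupport η ⊆ ball 0 (R / 4)) :
    ∫ z, (posSet (ball 0 R) u).indicator
      (fun z => cgrad u z ^ 2 * conj (cgrad η z) - cgrad η z) z = 0 := by
  have hηs' : tsupport η ⊆ ball 0 R := hηs.trans (ball_subset_ball (by linarith))
  have hγi : Integrable (cgrad η) :=
    (continuous_cgrad hη).integrable_of_hasCompactSupport (hasCompactSupport_cgrad hηc)
  set C : ℝ := ∫ z, ‖cgrad η z‖ * 5 with hC
  set s : ℕ → ℝ := fun n => 1 / ((n : ℝ) + 1) with hs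
  have hs0 : ∀ n, 0 < s n := fun n => by simp only [hs]; positivity
  have hst : Tendsto s atTop (𝓝 0) := tendsto_one_div_add_atTop_nhds_zero_nat
  set F : ℕ → ℂ → ℂ := fun n z =>
    cut (s n) (u z) * (cgrad u z ^ 2 * conj (cgrad η z) - cgrad η z) with hF
  -- the truncated identity
  have hid : ∀ n, Integrable (F n) ∧ ‖∫ z, F n z‖ =
      ‖∫ z, η z * (deriv (cut (s n)) (u z) * (cgrad u z * ((‖cgrad u z‖ ^ 2 - 1 : ℝ) : ℂ)))‖ := by
    intro n
    have hηC : ContDiff ℝ 1 fun z => (η z : ℂ) := ofRealCLM.contDiff.comp hη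
    have hηcc : HasCompactSupport fun z => (η z : ℂ) := by
      rw [HasCompactSupport, tsupport_ofReal]; exact hηc
    have hηsC : tsupport (fun z => (η z : ℂ)) ⊆ ball 0 R := by rwa [tsupport_ofReal]
    obtain ⟨i1, i2, e1⟩ := hu.integral_dbar_cutoff hηC hηcc hηsC (hs0 n) (contDiff_cut (s n))
      (fun t ht => cut_of_le (hs0 n) ht) (h := fun z => cgrad u z ^ 2)
      (fun z hz => (hu.differentiableAt_cgrad hz).pow 2)
    obtain ⟨j1, j2, e2⟩ := hu.integral_dbar_cutoff hηC hηcc hηsC (hs0 n) (contDiff_cut (s n))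
      (fun t ht => cut_of_le (hs0 n) ht) (h := fun _ => 1)
      (fun z hz => differentiableAt_const _)
    rw [dbar_ofReal_eq hη] at i1 e1 j1 e2
    have hconjI : ∀ {f : ℂ → ℂ}, Integrable f → Integrable fun z => conj (f z) := fun hf =>
      (LinearIsometryEquiv.integrable_comp_iff conjLIE).2 hf
    have e3 := congrArg conj e2
    rw [map_add, ← integral_conj, ← integral_conj, map_zero] at e3
    have hFe : F n = fun z => conj (cgrad η z) * (cut (s n) (u z) * cgrad u z ^ 2) -
        conj (conj (cgrad η z) * (cut (s n) (u z) * 1)) := by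
      funext z
      simp [hF]
      ring
    have hGe : (fun z => η z * (deriv (cut (s n)) (u z) *
        (cgrad u z * ((‖cgrad u z‖ ^ 2 - 1 : ℝ) : ℂ)))) = fun z =>
        (η z : ℂ) * (deriv (cut (s n)) (u z) * conj (cgrad u z) * cgrad u z ^ 2) -
        conj ((η z : ℂ) * (deriv (cut (s n)) (u z) * conj (cgrad u z) * 1)) := by
      funext z
      have : ((‖cgrad u z‖ ^ 2 : ℝ) : ℂ) = cgrad u z * conj (cgrad u z) := by
        rw [mul_conj, normSq_eq_norm_sq]
      rw [ofReal_sub, this]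
      simp
      ring
    refine ⟨by rw [hFe]; exact i1.sub (hconjI j1), ?_⟩
    rw [hGe, hFe, integral_sub i1 (hconjI j1), integral_sub i2 (hconjI j2), ← norm_neg]
    congr 1
    linear_combination e3 - e1
  -- the right-hand side is small
  have hsmall : ∀ δ : ℝ, 0 < δ → δ < 1 / 2 → ∀ᶠ n in atTop, ‖∫ z, F n z‖ ≤ 5 * δ * C := by
    intro δ hδ hδ2
    obtain ⟨ε, hε, hnear⟩ := hu.exists_abs_norm_cgrad_sub_one_lt (ρ := R / 4) (by linarith) hδ
    filter_upwards [hst.eventually (gt_mem_nhds (show (0 : ℝ) < ε / 2 by positivity))] with n hn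
    rw [(hid n).2]
    obtain ⟨m1, -, -⟩ := hu.integral_mass hη hηc hηs' (hs0 n)
    calc _ ≤ ∫ z, 5 * δ * (η z * (deriv (cut (s n)) (u z) * ‖cgrad u z‖ ^ 2)) := by
          refine norm_integral_le_of_norm_le (m1.const_mul _) (Eventually.of_forall fun z => ?_)
          rw [norm_mul, norm_mul, norm_mul, norm_real, norm_real, norm_real,
            Real.norm_of_nonneg (hη0 z), Real.norm_of_nonneg (deriv_cut_nonneg (hs0 n) _)]
          by_cases hz : z ∈ tsupport η
          · by_cases hd : deriv (cut (s n)) (u z) = 0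
            · simp [hd]
            have hu1 : s n < u z := not_le.1 fun h => hd (deriv_cut_of_le (hs0 n) h)
            have hu2 : u z < 2 * s n := not_le.1 fun h => hd (deriv_cut_of_ge (hs0 n) h)
            have hzR : ‖z‖ ≤ R / 4 := by simpa using (ball_subset_closedBall (hηs hz))
            have hg := abs_lt.1 (hnear z hzR ((hs0 n).trans hu1) (by linarith))
            set x := ‖cgrad u z‖
            have hx : x * ‖x ^ 2 - 1‖ ≤ 5 * δ * x ^ 2 := by
              have h1 : ‖x ^ 2 - 1‖ ≤ 5 * δ * x := by
                rw [Real.norm_eq_abs, abs_le]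
                constructor <;> nlinarith
              have hx0 : 0 ≤ x := norm_nonneg _
              nlinarith
            have hη0z := hη0 z
            have hd0 := deriv_cut_nonneg (hs0 n) (u z)
            calc _ ≤ η z * (deriv (cut (s n)) (u z) * (5 * δ * x ^ 2)) := by gcongr
              _ = _ := by ring
          · have : η z = 0 := image_eq_zero_of_notMem_tsupport hz
            simp [this]
      _ = 5 * δ * ∫ z, η z * (deriv (cut (s n)) (u z) * ‖cgrad u z‖ ^ 2) := integral_const_mul _ _
      _ ≤ 5 * δ * C := by
          gcongr
          exact hu.integral_mass_le hR h0 hη hηc hηs (hs0 n)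
  -- passage to the limit
  have hlim : Tendsto (fun n => ∫ z, F n z) atTop (𝓝 (∫ z, (posSet (ball 0 R) u).indicator
      (fun z => cgrad u z ^ 2 * conj (cgrad η z) - cgrad η z) z)) := by
    refine tendsto_integral_of_dominated_convergence (fun z => 26 * ‖cgrad η z‖)
      (fun n => (hid n).1.aestronglyMeasurable) (hγi.norm.const_mul 26)
      (fun n => Eventually.of_forall fun z => ?_) (Eventually.of_forall fun z => ?_)
    · by_cases hz : z ∈ tsupport η
      · by_cases hzD : z ∈ posSet (ball 0 R) u
        · have hg := hu.norm_cgrad_le_five hR h0 (by simpa using hηs hz) (notMem_zeroSet hzD)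
          simp only [hF]
          rw [norm_mul, norm_real, Real.norm_of_nonneg (cut_nonneg _ _)]
          calc _ ≤ 1 * (‖cgrad u z ^ 2 * conj (cgrad η z)‖ + ‖cgrad η z‖) := by
                gcongr
                · exact cut_le_one _ _
                · exact norm_sub_le _ _
            _ ≤ 1 * (5 ^ 2 * ‖cgrad η z‖ + ‖cgrad η z‖) := by
                rw [norm_mul, norm_pow, RCLike.norm_conj]
                gcongr
            _ = _ := by ring
        · simp only [hF]
          rw [hu.eq_zero_of_notMem_posSet (hηs' hz) hzD, cut_of_le (hs0 n) (hs0 n).le]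
          simp
      · simp [hF, cgrad_eq_zero_of_notMem_tsupport hz]
    · by_cases hz : z ∈ tsupport η
      · refine tendsto_const_nhds.congr' ?_
        by_cases hzD : z ∈ posSet (ball 0 R) u
        · filter_upwards [hst.eventually (gt_mem_nhds (show (0 : ℝ) < u z / 2 by
            have := hzD.2; positivity))] with n hn
          simp only [hF]
          rw [indicator_of_mem hzD, cut_of_ge (hs0 n) (by linarith)]
          simp
        · refine Eventually.of_forall fun n => ?_
          simp only [hF]
          rw [indicator_of_notMem hzD, hu.eq_zero_of_notMem_posSet (hηs' hz) hzD,
            cut_of_le (hs0 n) (hs0 n).le]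
          simp
      · simp [hF, cgrad_eq_zero_of_notMem_tsupport hz, indicator]
  have hle : ∀ δ : ℝ, 0 < δ → δ < 1 / 2 → ‖∫ z, (posSet (ball 0 R) u).indicator
      (fun z => cgrad u z ^ 2 * conj (cgrad η z) - cgrad η z) z‖ ≤ 5 * δ * C :=
    fun δ hδ hδ2 => le_of_tendsto hlim.norm (hsmall δ hδ hδ2)
  have hlim2 : Tendsto (fun δ : ℝ => 5 * δ * C) (𝓝[>] 0) (𝓝 0) := by
    have hc : Continuous fun δ : ℝ => 5 * δ * C := by fun_prop
    have := hc.tendsto 0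
    simp only [mul_zero, zero_mul] at this
    exact this.mono_left nhdsWithin_le_nhds
  rw [← norm_le_zero_iff]
  refine ge_of_tendsto hlim2 ?_
  filter_upwards [Ioo_mem_nhdsGT (show (0 : ℝ) < 1 / 2 by norm_num)] with δ hδ
  exact hle δ hδ.1 hδ.2

end IsClassicalSolution
end

noncomputable section
open InnerProductSpace (HarmonicAt HarmonicOnNhd)
open scoped ComplexConjugate

lemma contDiff_cgrad {η : ℂ → ℝ} (hη : ContDiff ℝ 2 η) : ContDiff ℝ 1 (cgrad η) := by
  have h := hη.fderiv_right (m := 1) (by norm_num)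
  have h1 : ∀ v : ℂ, ContDiff ℝ 1 fun z => ((fderiv ℝ η z v : ℝ) : ℂ) := fun v =>
    ofRealCLM.contDiff.comp (h.clm_apply contDiff_const)
  exact (h1 1).sub (contDiff_const.mul (h1 I))

/-- Cutoffs adapted to disks with scale invariant bounds on the Laplacian. -/
lemma exists_cutoff : ∃ C > 0, ∀ (x : ℂ) (r : ℝ), 0 < r → ∃ η : ℂ → ℝ, ContDiff ℝ 2 η ∧
    (∀ z, 0 ≤ η z) ∧ (∀ z, ‖z - x‖ ≤ r / 2 → η z = 1) ∧ tsupport η ⊆ closedBall x r ∧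
    ∀ z, ‖dbar (cgrad η) z‖ ≤ C / r ^ 2 := by
  let b : ContDiffBump (0 : ℂ) := ⟨1 / 2, 1, by norm_num, by norm_num⟩
  have hb : ContDiff ℝ 2 b := b.contDiff
  have hcs : HasCompactSupport (dbar (cgrad b)) :=
    (hasCompactSupport_cgrad b.hasCompactSupport).of_isClosed_subset isClosed_closure
      (tsupport_dbar_subset _)
  obtain ⟨C, hC⟩ := hcs.exists_bound_of_continuous (continuous_dbar (contDiff_cgrad hb))
  refine ⟨|C| + 1, by positivity, fun x r hr => ?_⟩
  have hA : ∀ z, HasFDerivAt (fun z : ℂ => r⁻¹ • (z - x)) (r⁻¹ • ContinuousLinearMap.id ℝ ℂ) z :=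
    fun z => ((hasFDerivAt_id z).sub_const x).const_smul r⁻¹
  have hnorm : ∀ z : ℂ, ‖r⁻¹ • (z - x)‖ = ‖z - x‖ / r := fun z => by
    rw [norm_smul, norm_inv, Real.norm_of_nonneg hr.le]; ring
  have hcg : cgrad (fun z => b (r⁻¹ • (z - x))) = fun z => r⁻¹ • cgrad b (r⁻¹ • (z - x)) := by
    funext z
    have h := (hb.differentiable (by norm_num) (r⁻¹ • (z - x))).hasFDerivAt.comp z (hA z)
    have h' : HasFDerivAt (fun z => b (r⁻¹ • (z - x))) _ z := h
    simp only [cgrad, h'.fderiv]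
    simp
    ring
  refine ⟨fun z => b (r⁻¹ • (z - x)), hb.comp (by fun_prop), fun z => b.nonneg, fun z hz => ?_, ?_,
    fun z => ?_⟩
  · refine b.one_of_mem_closedBall ?_
    rw [mem_closedBall_zero_iff, hnorm, div_le_iff₀ hr]
    change _ ≤ 1 / 2 * r
    linarith
  · refine closure_minimal (fun z hz => ?_) isClosed_closedBall
    have h1 : r⁻¹ • (z - x) ∈ Function.support b := hz
    rw [b.support_eq, mem_ball_zero_iff, hnorm, div_lt_iff₀ hr] at h1
    change _ < 1 * r at h1
    rw [mem_closedBall, dist_eq_norm]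
    linarith
  · have h := ((contDiff_cgrad hb).differentiable (by norm_num)
      (r⁻¹ • (z - x))).hasFDerivAt.comp z (hA z)
    have h' : HasFDerivAt (fun z => r⁻¹ • cgrad b (r⁻¹ • (z - x))) _ z := h.const_smul r⁻¹
    have he : dbar (fun z => r⁻¹ • cgrad b (r⁻¹ • (z - x))) z =
        (r⁻¹ * r⁻¹) • dbar (cgrad b) (r⁻¹ • (z - x)) := by
      rw [dbar, h'.fderiv]
      simp [dbar]
      ring
    rw [hcg, he, norm_smul, Real.norm_of_nonneg (by positivity)]
    have h2 := hC (r⁻¹ • (z - x))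
    calc r⁻¹ * r⁻¹ * ‖dbar (cgrad b) (r⁻¹ • (z - x))‖ ≤ r⁻¹ * r⁻¹ * (|C| + 1) := by
          gcongr
          linarith [le_abs_self C]
      _ = _ := by field_simp

namespace IsClassicalSolution

variable {R : ℝ} {u : ℂ → ℝ} {η : ℂ → ℝ}

/-- The mass on a disk is controlled by the maximum of `u`. -/
lemma integral_mass_le_of_le (hu : IsClassicalSolution (ball 0 R) u) (hη : ContDiff ℝ 2 η) {x : ℂ}
    {r B M s : ℝ} (hr : 0 < r) (hxr : ‖x‖ + r < R) (hηs : tsupport η ⊆ closedBall x r)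
    (hB : ∀ z, ‖dbar (cgrad η) z‖ ≤ B) (hM : ∀ z ∈ closedBall x r, u z ≤ M) (hs : 0 < s) :
    ∫ z, η z * (deriv (cut s) (u z) * ‖cgrad u z‖ ^ 2) ≤ B * M * (Real.pi * r ^ 2) := by
  have hB0 : 0 ≤ B := (norm_nonneg _).trans (hB 0)
  have hin : closedBall x r ⊆ ball 0 R := by
    intro z hz
    rw [mem_closedBall, dist_eq_norm] at hz
    rw [mem_ball_zero_iff]
    exact (norm_le_of_norm_sub_le hz).trans_lt hxr
  have hηc : HasCompactSupport η :=
    (isCompact_closedBall x r).of_isClosed_subset isClosed_closure hηs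
  have hγs : tsupport (cgrad η) ⊆ tsupport η :=
    closure_minimal (fun z hz => by
      by_contra h
      exact hz (cgrad_eq_zero_of_notMem_tsupport h)) isClosed_closure
  obtain ⟨-, -, e1⟩ := hu.integral_mass (hη.of_le (by norm_num)) hηc (hηs.trans hin) hs
  obtain ⟨i1, i2, e2⟩ := hu.integral_dbar_cutoff (contDiff_cgrad hη) (hasCompactSupport_cgrad hηc)
    (hγs.trans (hηs.trans hin)) hs (contDiff_cutInt s) (fun t ht => cutInt_of_le hs ht)
    (h := fun _ => 1) (fun z hz => differentiableAt_const _)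
  rw [deriv_cutInt] at e2
  have e3 := congrArg conj e1
  rw [conj_ofReal, map_neg, ← integral_conj] at e3
  have e4 : (fun z => conj (conj (cgrad η z) * (cut s (u z) * cgrad u z))) =
      fun z => cgrad η z * (cut s (u z) * conj (cgrad u z) * 1) := by
    funext z; simp
  rw [e4] at e3
  have e5 := e3.trans (neg_eq_of_add_eq_zero_left e2)
  have e6 := congrArg norm e5
  rw [norm_real] at e6
  refine (le_abs_self _).trans ((Real.norm_eq_abs _).symm.le.trans ?_)
  rw [e6, ← setIntegral_eq_integral_of_forall_compl_eq_zero (s := closedBall x r)]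
  · have hvol : volume (closedBall x r) < ⊤ := measure_closedBall_lt_top
    refine (norm_setIntegral_le_of_norm_le_const (C := B * M) hvol fun z hz => ?_).trans ?_
    · rw [mul_one, norm_mul, norm_real, Real.norm_of_nonneg (cutInt_nonneg (hu.nonneg z (hin hz)))]
      exact mul_le_mul (hB z) ((cutInt_le (hu.nonneg z (hin hz))).trans (hM z hz))
        (cutInt_nonneg (hu.nonneg z (hin hz))) hB0
    · rw [Measure.real, Complex.volume_closedBall]
      simp [hr.le, mul_comm]
  · intro z hz
    rw [image_eq_zero_of_notMem_tsupport fun h => hz (hηs (hγs (tsupport_dbar_subset _ h))), zero_mul]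

/-- Some point of each circle around a free boundary point exceeds the values inside. -/
lemma exists_le_on_sphere (hu : IsClassicalSolution (ball 0 R) u) {x y : ℂ} {t : ℝ}
    (hxt : ‖x‖ + t < R) (hy : ‖y - x‖ < t) : ∃ w, ‖w - x‖ = t ∧ u y ≤ u w := by
  have ht : 0 < t := (norm_nonneg _).trans_lt hy
  have hin : ∀ z, ‖z - x‖ ≤ t → z ∈ ball 0 R := fun z hz => by
    rw [mem_ball_zero_iff]; exact (norm_le_of_norm_sub_le hz).trans_lt hxt
  have hne : (sphere x t).Nonempty := NormedSpace.sphere_nonempty.2 ht.le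
  obtain ⟨w, hw, hmax⟩ := (isCompact_sphere x t).exists_isMaxOn hne
    (hu.contOn.mono fun z hz => hin z (by rw [mem_sphere, dist_eq_norm] at hz; exact hz.le))
  have hwt : ‖w - x‖ = t := by rwa [mem_sphere, dist_eq_norm] at hw
  have hw0 := hu.nonneg w (hin w hwt.le)
  refine ⟨w, hwt, ?_⟩
  by_cases hyD : y ∈ posSet (ball 0 R) u
  · have hcl : closure (posSet (ball 0 R) u ∩ ball x t) ⊆ closedBall x t :=
      (closure_mono inter_subset_right).trans closure_ball_subset_closedBall
    have hin' : ∀ z ∈ closedBall x t, z ∈ ball 0 R := fun z hz =>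
      hin z (by rwa [mem_closedBall, dist_eq_norm] at hz)
    have ho := hu.isOpen_posSet.inter (isOpen_ball (x := x) (ε := t))
    refine le_of_forall_frontier_le_of_harmonic (h := u) ho (isBounded_ball.subset inter_subset_right)
      (hu.contOn.mono fun z hz => hin' z (hcl hz)) (fun z hz => hu.harmonicAt hz.1) (fun z hz => ?_)
      ⟨hyD, by rwa [mem_ball, dist_eq_norm]⟩
    have hzc := hcl hz.1
    by_cases hzD : z ∈ posSet (ball 0 R) u
    · have hzn : z ∉ ball x t := fun h => hz.2 (by rw [ho.interior_eq]; exact ⟨hzD, h⟩)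
      exact hmax (le_antisymm hzc (not_lt.1 hzn))
    · rw [hu.eq_zero_of_notMem_posSet (hin' z hzc) hzD]
      exact hw0
  · rw [hu.eq_zero_of_notMem_posSet (hin y hy.le) hyD]
    exact hw0

/-- Total variation of the truncation along a circle meeting both phases. -/
lemma one_le_lintegral_circle (hu : IsClassicalSolution (ball 0 R) u) {x : ℂ} {t s : ℝ}
    (ht : 0 < t) (hxt : ‖x‖ + t < R) (hs : 0 < s) {y w : ℂ} (hy : ‖y - x‖ = t) (hy0 : u y = 0)
    (hw : ‖w - x‖ = t) (hw0 : 2 * s ≤ u w) :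
    1 ≤ ∫⁻ θ in Ioo (-Real.pi) Real.pi, ENNReal.ofReal
      (t * (deriv (cut s) (u (x + Complex.polarCoord.symm (t, θ))) *
        ‖cgrad u (x + Complex.polarCoord.symm (t, θ))‖)) := by
  set p : ℝ → ℂ := fun θ => x + t * cexp (θ * I) with hp
  have hpe : ∀ θ : ℝ, x + Complex.polarCoord.symm (t, θ) = p θ := by
    intro θ
    rw [Complex.polarCoord_symm_apply]
    simp [hp, exp_mul_I]
  simp only [hpe]
  have hpx : ∀ θ, ‖p θ - x‖ = t := fun θ => by
    simp [hp, norm_exp_ofReal_mul_I, abs_of_pos ht]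
  have hin : ∀ θ, p θ ∈ ball 0 R := fun θ => by
    rw [mem_ball_zero_iff]; exact (norm_le_of_norm_sub_le (hpx θ).le).trans_lt hxt
  have hpc : Continuous p := by fun_prop
  have hpd : ∀ θ : ℝ, HasDerivAt p (t * (cexp (θ * I) * I)) θ := by
    intro θ
    have h1 : HasDerivAt (fun θ : ℝ => (θ : ℂ) * I) I θ := by
      simpa using (hasDerivAt_id θ).ofReal_comp.mul_const I
    exact (h1.cexp.const_mul (t : ℂ)).const_add x
  set k : ℝ → ℝ := fun θ => deriv (cut s) (u (p θ)) *
    (cgrad u (p θ) * (t * (cexp (θ * I) * I))).re with hk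
  have hzero : ∀ θ, p θ ∉ posSet (ball 0 R) u → ∀ᶠ τ in 𝓝 θ, u (p τ) < s := by
    intro θ hθ
    have h1 : ContinuousAt u (p θ) := hu.continuousAt (by simpa using hin θ)
    have h2 : ContinuousAt (fun τ => u (p τ)) θ := ContinuousAt.comp h1 hpc.continuousAt
    exact h2.eventually (gt_mem_nhds (by
      change u (p θ) < s
      rw [hu.eq_zero_of_notMem_posSet (hin θ) hθ]; exact hs))
  have hder : ∀ θ, HasDerivAt (fun θ => cut s (u (p θ))) (k θ) θ := by
    intro θ
    by_cases hθ : p θ ∈ posSet (ball 0 R) u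
    · have h1 := (HarmonicAt.hasFDerivAt (hu.harmonicAt hθ)).hasFDerivAt.comp_hasDerivAt θ (hpd θ)
      rw [fderiv_eq_re_cgrad_mul] at h1
      exact (((contDiff_cut s).differentiable (by norm_num) _).hasDerivAt).comp θ h1
    · have h1 := hzero θ hθ
      have h2 : k θ = 0 := by
        simp [hk, deriv_cut_of_le hs h1.self_of_nhds.le]
      rw [h2]
      refine (hasDerivAt_const θ (0 : ℝ)).congr_of_eventuallyEq ?_
      filter_upwards [h1] with τ hτ using cut_of_le hs hτ.le
  have hkc : Continuous k := by
    rw [continuous_iff_continuousAt]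
    intro θ
    by_cases hθ : p θ ∈ posSet (ball 0 R) u
    · have h1 : ContinuousAt u (p θ) := hu.continuousAt (by simpa using hin θ)
      have h2 : ContinuousAt (fun τ => u (p τ)) θ := ContinuousAt.comp h1 hpc.continuousAt
      have h3 : ContinuousAt (fun τ => cgrad u (p τ)) θ :=
        ContinuousAt.comp (hu.differentiableAt_cgrad hθ).continuousAt hpc.continuousAt
      refine ContinuousAt.mul ?_ ?_
      · exact ContinuousAt.comp (continuous_deriv_cut s).continuousAt h2
      · exact continuous_re.continuousAt.comp (h3.mul (by fun_prop))
    · refine (continuousAt_const (y := (0 : ℝ))).congr ?_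
      filter_upwards [hzero θ hθ] with τ hτ
      simp [hk, deriv_cut_of_le hs hτ.le]
  have hang : ∀ y, ‖y - x‖ = t → p (y - x).arg = y := by
    intro y hy
    simp only [hp]
    rw [← hy, norm_mul_exp_arg_mul_I]; ring
  have hftc : ∫ θ in (y - x).arg..(w - x).arg, k θ = 1 := by
    rw [intervalIntegral.integral_eq_sub_of_hasDerivAt (fun θ _ => hder θ)
      (hkc.intervalIntegrable _ _), hang y hy, hang w hw, hy0, cut_of_le hs hs.le, cut_of_ge hs hw0]
    norm_num
  have hsub : uIoc (y - x).arg (w - x).arg ⊆ Ioc (-Real.pi) Real.pi := by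
    intro θ hθ
    rw [uIoc, mem_Ioc] at hθ
    have h1 := neg_pi_lt_arg (y - x)
    have h2 := neg_pi_lt_arg (w - x)
    have h3 := arg_le_pi (y - x)
    have h4 := arg_le_pi (w - x)
    exact ⟨(lt_min h1 h2).trans hθ.1, hθ.2.trans (max_le h3 h4)⟩
  have hlin : (1 : ENNReal) ≤ ∫⁻ θ in uIoc (y - x).arg (w - x).arg, ‖k θ‖ₑ := by
    have h1 := intervalIntegral.norm_integral_eq_norm_integral_uIoc
      (f := k) (a := (y - x).arg) (b := (w - x).arg) (μ := volume)
    rw [hftc, norm_one] at h1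
    have h2 := enorm_integral_le_lintegral_enorm (μ := volume.restrict (uIoc (y - x).arg (w - x).arg)) k
    have h3 : ‖∫ θ in uIoc (y - x).arg (w - x).arg, k θ‖ₑ = 1 := by
      rw [← ofReal_norm, ← h1, ENNReal.ofReal_one]
    rwa [h3] at h2
  refine hlin.trans ((lintegral_mono_set hsub).trans ?_)
  rw [Measure.restrict_congr_set (Ioo_ae_eq_Ioc (μ := volume)).symm]
  refine lintegral_mono fun θ => ?_
  rw [← ofReal_norm]
  refine ENNReal.ofReal_le_ofReal ?_
  simp only [hk]
  rw [norm_mul, Real.norm_of_nonneg (deriv_cut_nonneg hs _)]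
  have h5 : ‖(cgrad u (p θ) * (t * (cexp (θ * I) * I))).re‖ ≤ ‖cgrad u (p θ)‖ * t := by
    refine (abs_re_le_norm _).trans ?_
    rw [norm_mul, norm_mul, norm_mul, norm_exp_ofReal_mul_I, norm_I, norm_real,
      Real.norm_of_nonneg ht.le]
    simp
  calc _ ≤ deriv (cut s) (u (p θ)) * (‖cgrad u (p θ)‖ * t) := by
        gcongr
        exact deriv_cut_nonneg hs _
    _ = _ := by ring

/-- The mass on a disk centred on the free boundary is at least proportional to the radius. -/
lemma exists_le_integral_mass (hu : IsClassicalSolution (ball 0 R) u)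
    (hnc : ∀ z ∈ FB (ball 0 R) u, ¬ IsCompact (connectedComponentIn (FB (ball 0 R) u) z))
    (hη : ContDiff ℝ 2 η) (hη0 : ∀ z, 0 ≤ η z) {x : ℂ} {r : ℝ} (hr : 0 < r) (hxr : ‖x‖ + r < R)
    (hη1 : ∀ z, ‖z - x‖ ≤ r / 2 → η z = 1) (hηs : tsupport η ⊆ closedBall x r)
    (hx0 : u x = 0) (hxD : x ∈ closure (posSet (ball 0 R) u)) :
    ∃ s > 0, r / 8 ≤ ∫ z, η z * (deriv (cut s) (u z) * ‖cgrad u z‖ ^ 2) := by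
  obtain ⟨ε, hε, hnear⟩ := hu.exists_abs_norm_cgrad_sub_one_lt (ρ := ‖x‖ + r) hxr
    (show (0 : ℝ) < 1 / 2 by norm_num)
  obtain ⟨y, hyD, hyx⟩ := Metric.mem_closure_iff.1 hxD (r / 4) (by positivity)
  rw [dist_comm, dist_eq_norm] at hyx
  have hy0 : 0 < u y := hyD.2
  set s := min (u y) ε / 2 with hs
  have hs0 : 0 < s := by have := lt_min hy0 hε; positivity
  have hsy : 2 * s ≤ u y := by rw [hs]; linarith [min_le_left (u y) ε]
  have hsε : 2 * s ≤ ε := by rw [hs]; linarith [min_le_right (u y) ε]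
  refine ⟨s, hs0, ?_⟩
  have hin : closedBall x r ⊆ ball 0 R := by
    intro z hz
    rw [mem_closedBall, dist_eq_norm] at hz
    rw [mem_ball_zero_iff]
    exact (norm_le_of_norm_sub_le hz).trans_lt hxr
  have hηc : HasCompactSupport η :=
    (isCompact_closedBall x r).of_isClosed_subset isClosed_closure hηs
  obtain ⟨i1, -, -⟩ := hu.integral_mass (hη.of_le (by norm_num)) hηc (hηs.trans hin) hs0
  set f : ℂ → ℝ := fun z => η z * (deriv (cut s) (u z) * ‖cgrad u z‖ ^ 2) with hf
  have hf0 : ∀ z, 0 ≤ f z := fun z =>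
    mul_nonneg (hη0 z) (mul_nonneg (deriv_cut_nonneg hs0 _) (by positivity))
  have hfc : Continuous f := by
    have h1 : Continuous fun z => (η z : ℂ) *
        ((deriv (cut s) (u z) * ‖cgrad u z‖ ^ 2 : ℝ) : ℂ) := by
      refine hu.continuous_mul_of_eq_zero (η := fun z => (η z : ℂ))
        (continuous_ofReal.comp hη.continuous)
        (by rw [tsupport_ofReal]; exact hηs.trans hin) hs0 (fun z hz => ?_)
        (fun z _ hz => by simp [deriv_cut_of_le hs0 hz.le])
      refine continuous_ofReal.continuousAt.comp (ContinuousAt.mul ?_ ?_)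
      · exact (continuous_deriv_cut s).continuousAt.comp (hu.continuousAt (by simpa using hz.1))
      · exact (hu.differentiableAt_cgrad hz).continuousAt.norm.pow 2
    have h2 := continuous_re.comp h1
    refine h2.congr fun z => ?_
    rw [Function.comp_apply, ← ofReal_mul, ofReal_re]
  have hmeas : Measurable fun q : ℝ × ℝ =>
      ENNReal.ofReal q.1 * ENNReal.ofReal (f (x + Complex.polarCoord.symm q)) := by
    have h1 : Continuous fun q : ℝ × ℝ => f (x + Complex.polarCoord.symm q) := by
      simp only [Complex.polarCoord_symm_apply]
      refine hfc.comp ?_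
      fun_prop
    exact (measurable_fst.ennreal_ofReal).mul h1.measurable.ennreal_ofReal
  have hcirc : ∀ t ∈ Ioo (r / 4) (r / 2), ENNReal.ofReal (1 / 2) ≤
      ∫⁻ θ in Ioo (-Real.pi) Real.pi,
        ENNReal.ofReal t * ENNReal.ofReal (f (x + Complex.polarCoord.symm (t, θ))) := by
    intro t ht
    have ht0 : 0 < t := by linarith [ht.1]
    have hxt : ‖x‖ + t < R := by linarith [ht.2]
    obtain ⟨w, hw, hwu⟩ := hu.exists_le_on_sphere (y := y) hxt (hyx.trans ht.1)
    obtain ⟨y', hy'0, hy', -⟩ := hu.exists_reach hnc (c := fun _ => (0 : ℝ)) le_rfl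
      (fun _ _ _ => Eventually.of_forall fun _ _ => rfl) hx0 ht0 hxt
    have h1 := hu.one_le_lintegral_circle ht0 hxt hs0 hy' hy'0 hw (hsy.trans hwu)
    calc ENNReal.ofReal (1 / 2) = ENNReal.ofReal (1 / 2) * 1 := (mul_one _).symm
      _ ≤ _ := mul_le_mul_right h1 _
      _ = _ := (lintegral_const_mul' _ _ ENNReal.ofReal_ne_top).symm
      _ ≤ _ := by
        refine lintegral_mono fun θ => ?_
        rw [← ENNReal.ofReal_mul (by norm_num), ← ENNReal.ofReal_mul ht0.le]
        refine ENNReal.ofReal_le_ofReal ?_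
        set z := x + Complex.polarCoord.symm (t, θ) with hz
        have hzx : ‖z - x‖ = t := by
          rw [hz, add_sub_cancel_left, Complex.norm_polarCoord_symm, abs_of_pos ht0]
        simp only [hf]
        rw [hη1 z (by rw [hzx]; exact ht.2.le), one_mul]
        by_cases hd : deriv (cut s) (u z) = 0
        · simp [hd]
        have hu1 : s < u z := not_le.1 fun h => hd (deriv_cut_of_le hs0 h)
        have hu2 : u z < 2 * s := not_le.1 fun h => hd (deriv_cut_of_ge hs0 h)
        have hzR : ‖z‖ ≤ ‖x‖ + r := (norm_le_of_norm_sub_le hzx.le).trans (by linarith [ht.2])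
        have hg := (abs_lt.1 (hnear z hzR (hs0.trans hu1) (hu2.trans_le hsε))).1
        have hd0 := deriv_cut_nonneg hs0 (u z)
        calc 1 / 2 * (t * (deriv (cut s) (u z) * ‖cgrad u z‖))
            = t * (deriv (cut s) (u z) * (1 / 2 * ‖cgrad u z‖)) := by ring
          _ ≤ t * (deriv (cut s) (u z) * (‖cgrad u z‖ * ‖cgrad u z‖)) := by
              gcongr; linarith
          _ = _ := by ring
  have hmain : ENNReal.ofReal (r / 8) ≤ ENNReal.ofReal (∫ z, f z) := by
    rw [ofReal_integral_eq_lintegral_ofReal i1 (Eventually.of_forall hf0),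
      ← lintegral_add_left_eq_self _ x, ← Complex.lintegral_comp_polarCoord_symm]
    have hsub : Ioo (r / 4) (r / 2) ×ˢ Ioo (-Real.pi) Real.pi ⊆ polarCoord.target := by
      rintro ⟨a, b⟩ ⟨h1, h2⟩
      exact ⟨(show 0 < r / 4 by positivity).trans h1.1, h2⟩
    refine le_trans ?_ (lintegral_mono_set hsub)
    simp only [smul_eq_mul]
    rw [Measure.volume_eq_prod, ← Measure.prod_restrict, lintegral_prod _ hmeas.aemeasurable]
    calc ENNReal.ofReal (r / 8)
        = ∫⁻ _ in Ioo (r / 4) (r / 2), ENNReal.ofReal (1 / 2) := by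
          rw [setLIntegral_const, Real.volume_Ioo, ← ENNReal.ofReal_mul (by norm_num)]
          congr 1; ring
      _ ≤ _ := setLIntegral_mono' measurableSet_Ioo hcirc
  exact (ENNReal.ofReal_le_ofReal_iff (integral_nonneg hf0)).1 hmain

/-- Linear growth away from the free boundary, with a universal constant. -/
theorem exists_nondegenerate : ∃ c > 0, ∀ (R : ℝ) (u : ℂ → ℝ), IsClassicalSolution (ball 0 R) u →
    (∀ z ∈ FB (ball 0 R) u, ¬ IsCompact (connectedComponentIn (FB (ball 0 R) u) z)) →
    ∀ (x : ℂ) (r : ℝ), 0 < r → ‖x‖ + r < R → u x = 0 → x ∈ closure (posSet (ball 0 R) u) →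
      ∃ y, ‖y - x‖ ≤ r ∧ c * r ≤ u y := by
  obtain ⟨C, hC, hcut⟩ := exists_cutoff
  refine ⟨1 / (8 * C * Real.pi), by positivity, fun R u hu hnc x r hr hxr hx0 hxD => ?_⟩
  obtain ⟨η, hη, hη0, hη1, hηs, hηB⟩ := hcut x r hr
  obtain ⟨s, hs, hle⟩ := hu.exists_le_integral_mass hnc hη hη0 hr hxr hη1 hηs hx0 hxD
  obtain ⟨y, hy, hmax⟩ := (isCompact_closedBall x r).exists_isMaxOn ⟨x, mem_closedBall_self hr.le⟩
    (hu.contOn.mono fun z hz => by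
      rw [mem_closedBall, dist_eq_norm] at hz
      rw [mem_ball_zero_iff]
      exact (norm_le_of_norm_sub_le hz).trans_lt hxr)
  refine ⟨y, by rwa [mem_closedBall, dist_eq_norm] at hy, ?_⟩
  have h1 := hle.trans (hu.integral_mass_le_of_le hη hr hxr hηs hηB (fun z hz => hmax hz) hs)
  have h2 : C / r ^ 2 * u y * (Real.pi * r ^ 2) = u y * (C * Real.pi) := by field_simp
  rw [h2] at h1
  rw [div_mul_eq_mul_div, one_mul, div_le_iff₀ (by positivity)]
  linarith

end IsClassicalSolution
end

noncomputable section
open InnerProductSpace (HarmonicAt HarmonicOnNhd)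
open scoped ComplexConjugate

open scoped Convolution
open ContinuousLinearMap (lsmul)

/-- Mollification of a field of linear maps. -/
def mollify (φ : ContDiffBump (0 : ℂ)) (Ω : ℂ → ℂ →L[ℝ] ℂ) : ℂ → ℂ →L[ℝ] ℂ :=
  φ.normed volume ⋆[lsmul ℝ ℝ, volume] Ω

lemma hasFDerivAt_mollify (φ : ContDiffBump (0 : ℂ)) {Ω : ℂ → ℂ →L[ℝ] ℂ} (hΩ : Integrable Ω)
    (z : ℂ) : ∃ ω' : ℂ →L[ℝ] ℂ →L[ℝ] ℂ, HasFDerivAt (mollify φ Ω) ω' z ∧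
      ∀ x, ω' x = ∫ w, fderiv ℝ (φ.normed volume) (z - w) x • Ω w := by
  have hφ : ContDiff ℝ 1 (φ.normed (volume : Measure ℂ)) := φ.contDiff_normed
  have hφc := φ.hasCompactSupport_normed (μ := (volume : Measure ℂ))
  have h := hφc.hasFDerivAt_convolution_right (lsmul ℝ ℝ (E := ℂ →L[ℝ] ℂ)).flip
    hΩ.locallyIntegrable hφ z
  rw [convolution_flip] at h
  refine ⟨_, h, fun x => ?_⟩
  rw [convolution_precompR_apply _ hΩ.locallyIntegrable (hφc.fderiv ℝ)
    (hφ.continuous_fderiv (by norm_num))]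
  rfl

lemma norm_mollify_sub_le (φ : ContDiffBump (0 : ℂ)) {Ω : ℂ → ℂ →L[ℝ] ℂ} (hΩ : Integrable Ω)
    {z : ℂ} {T : ℂ →L[ℝ] ℂ} {ε : ℝ} (hε : 0 ≤ ε) (h : ∀ w ∈ ball z φ.rOut, ‖Ω w - T‖ ≤ ε) :
    ‖mollify φ Ω z - T‖ ≤ ε := by
  rw [← dist_eq_norm]
  exact dist_convolution_le hε φ.support_normed_eq.subset φ.nonneg_normed φ.integral_normed
    hΩ.aestronglyMeasurable fun w hw => by rw [dist_eq_norm]; exact h w hw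

/-- Weakly closed integrable forms on a disk have Lipschitz primitives. -/
theorem exists_primitive {Ω : ℂ → ℂ →L[ℝ] ℂ} (hΩ : Integrable Ω) {r M : ℝ} (hr : 0 < r)
    (hM : ∀ w, ‖Ω w‖ ≤ M)
    (hcl : ∀ η : ℂ → ℝ, ContDiff ℝ 1 η → (∀ z, 0 ≤ η z) → HasCompactSupport η →
      tsupport η ⊆ ball 0 r →
      ∀ x y, ∫ w, fderiv ℝ η w x • Ω w y = ∫ w, fderiv ℝ η w y • Ω w x) :
    ∃ S : ℂ → ℂ, S 0 = 0 ∧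
      (∀ ρ ≤ r / 2, ∀ L, (∀ w, ‖w‖ < ρ → ‖Ω w‖ ≤ L) →
        ∀ x y, ‖x‖ < ρ → ‖y‖ < ρ → ‖S x - S y‖ ≤ L * ‖x - y‖) ∧
      (∀ z δ, 0 < δ → ball z δ ⊆ ball 0 (r / 2) → ContinuousOn Ω (ball z δ) →
        ∀ P : ℂ → ℂ, (∀ w ∈ ball z δ, HasFDerivAt P (Ω w) w) →
        ∀ x ∈ ball z (δ / 2), S x - P x = S z - P z) := by
  set φ : ℕ → ContDiffBump (0 : ℂ) := fun n =>
    ⟨r / (4 * ((n : ℝ) + 2)), r / (2 * ((n : ℝ) + 2)), by positivity, by gcongr; norm_num⟩ with hφ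
  have hφr : ∀ n, (φ n).rOut = r / (2 * ((n : ℝ) + 2)) := fun n => rfl
  have hφlt : ∀ n, (φ n).rOut < r / 2 := fun n => by
    rw [hφr]
    have : (0 : ℝ) ≤ n := n.cast_nonneg
    gcongr
    linarith
  have hφt : Tendsto (fun n => (φ n).rOut) atTop (𝓝 0) := by
    simp only [hφr]
    refine tendsto_const_nhds.div_atTop ?_
    refine Tendsto.const_mul_atTop (by norm_num) ?_
    exact tendsto_atTop_add_const_right _ _ tendsto_natCast_atTop_atTop
  -- primitives of the mollified forms
  have hprim : ∀ n, ∃ f : ℂ → ℂ, ∀ a ∈ ball (0 : ℂ) (r / 2), HasFDerivAt f (mollify (φ n) Ω a) a := by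
    intro n
    refine (convex_ball (0 : ℂ) (r / 2)).exists_forall_hasFDerivAt_of_fderiv_symmetric isOpen_ball
      (fun z _ => ?_) fun z hz x y => ?_
    · obtain ⟨ω', h, -⟩ := hasFDerivAt_mollify (φ n) hΩ z
      exact h.differentiableAt.differentiableWithinAt
    · obtain ⟨ω', h, hω'⟩ := hasFDerivAt_mollify (φ n) hΩ z
      set N := (φ n).normed (volume : Measure ℂ) with hN
      have hNd : ContDiff ℝ 1 N := (φ n).contDiff_normed
      have hNc : HasCompactSupport N := (φ n).hasCompactSupport_normed
      set η : ℂ → ℝ := fun w => N (z - w) with hη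
      have hηd : ContDiff ℝ 1 η := hNd.comp (by fun_prop)
      have hηf : ∀ w v, fderiv ℝ η w v = -fderiv ℝ N (z - w) v := by
        intro w v
        have h1 : HasFDerivAt (fun w => z - w) (-ContinuousLinearMap.id ℝ ℂ) w :=
          (hasFDerivAt_id w).const_sub z
        have h2 : HasFDerivAt η _ w :=
          (hNd.differentiable (by norm_num) (z - w)).hasFDerivAt.comp w h1
        rw [h2.fderiv]
        simp
      have hηs : tsupport η ⊆ closedBall z (φ n).rOut := by
        refine closure_minimal (fun w hw => ?_) isClosed_closedBall
        have h1 : z - w ∈ Function.support N := hw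
        rw [hN, (φ n).support_normed_eq, mem_ball_zero_iff] at h1
        rw [mem_closedBall, dist_eq_norm, norm_sub_rev]
        exact h1.le
      have hηc : HasCompactSupport η :=
        (isCompact_closedBall _ _).of_isClosed_subset isClosed_closure hηs
      have key := hcl η hηd (fun w => (φ n).nonneg_normed _) hηc (fun w hw => by
        have h1 := hηs hw
        rw [mem_closedBall, dist_eq_norm] at h1
        rw [mem_ball_zero_iff] at hz ⊢
        linarith [norm_le_of_norm_sub_le h1, hφlt n]) x y
      have h_int : ∀ x, Integrable fun w => fderiv ℝ N (z - w) x • Ω w := by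
        intro x
        have hc : Continuous fun w => fderiv ℝ N (z - w) x :=
          ((hNd.continuous_fderiv (by norm_num)).comp (by fun_prop)).clm_apply continuous_const
        obtain ⟨B, hB⟩ := (hNc.fderiv_apply ℝ x).exists_bound_of_continuous
          ((hNd.continuous_fderiv (by norm_num)).clm_apply continuous_const)
        exact hΩ.bdd_smul B hc.aestronglyMeasurable (Eventually.of_forall fun w => hB (z - w))
      rw [h.fderiv, hω', hω', ContinuousLinearMap.integral_apply (h_int x),
        ContinuousLinearMap.integral_apply (h_int y)]
      simp only [hηf, neg_smul, integral_neg, neg_inj] at key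
      exact key
  choose f hf using hprim
  have hM0 : 0 ≤ M := (norm_nonneg _).trans (hM 0)
  have hLip : ∀ n ρ L, ρ ≤ r / 2 → 0 ≤ L → (∀ w, ‖w‖ < ρ + (φ n).rOut → ‖Ω w‖ ≤ L) →
      ∀ x y, ‖x‖ < ρ → ‖y‖ < ρ → ‖f n x - f n y‖ ≤ L * ‖x - y‖ := by
    intro n ρ L hρ hL hΩL x y hx hy
    refine (convex_ball (0 : ℂ) ρ).norm_image_sub_le_of_norm_hasFDerivWithin_le
      (f' := fun z => mollify (φ n) Ω z) (fun z hz => ?_) (fun z hz => ?_)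
      (by simpa using hy) (by simpa using hx)
    · exact (hf n z (ball_subset_ball hρ hz)).hasFDerivWithinAt
    · have h1 := norm_mollify_sub_le (φ n) hΩ (z := z) (T := 0) hL fun w hw => by
        rw [sub_zero]
        refine hΩL w ?_
        rw [mem_ball, dist_eq_norm] at hw
        rw [mem_ball_zero_iff] at hz
        linarith [norm_le_of_norm_sub_le hw.le, norm_le_of_norm_sub_le (le_refl ‖w - z‖)]
      simpa using h1
  set l : Ultrafilter ℕ := hyperfilter ℕ with hl
  have hlt : (l : Filter ℕ) ≤ atTop := by rw [hl, ← Nat.cofinite_eq_atTop]; exact hyperfilter_le_cofinite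
  have hbd : ∀ x, ∀ᶠ n in (l : Filter ℕ),
      ‖if ‖x‖ < r / 2 then f n x - f n 0 else 0‖ ≤ M * ‖x‖ := by
    intro x
    refine Eventually.of_forall fun n => ?_
    split_ifs with h
    · simpa using hLip n (r / 2) M le_rfl hM0 (fun w _ => hM w) x 0 h (by simpa using hr)
    · rw [norm_zero]; positivity
  choose S hS1 hS2 using fun x => exists_tendsto_of_bounded (hbd x)
  have hS : ∀ x, ‖x‖ < r / 2 → Tendsto (fun n => f n x - f n 0) l (𝓝 (S x)) := by
    intro x hx
    have := hS2 x
    simpa only [hx, if_true] using this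
  have hdiff : ∀ x y, ‖x‖ < r / 2 → ‖y‖ < r / 2 →
      Tendsto (fun n => f n x - f n y) l (𝓝 (S x - S y)) := by
    intro x y hx hy
    have := (hS x hx).sub (hS y hy)
    simpa using this
  have hout := hφt.mono_left hlt
  refine ⟨S, by simpa using hS1 0, fun ρ hρ L hL x y hx hy => ?_, fun z δ hδ hzb hΩc P hP x hx => ?_⟩
  · have hL0 : 0 ≤ L := (norm_nonneg _).trans (hL x hx)
    refine le_of_tendsto (hdiff x y (hx.trans_le hρ) (hy.trans_le hρ)).norm ?_
    obtain ⟨ρ₁, h1, h2⟩ := exists_between (max_lt hx hy)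
    filter_upwards [hout.eventually (gt_mem_nhds (sub_pos.2 h2))] with n hn
    exact hLip n ρ₁ L (h2.le.trans hρ) hL0 (fun w hw => hL w (by linarith)) x y
      ((le_max_left _ _).trans_lt h1) ((le_max_right _ _).trans_lt h1)
  · have hzz : z ∈ ball z (δ / 2) := mem_ball_self (by positivity)
    have hsub : ball z (δ / 2) ⊆ ball z δ := ball_subset_ball (by linarith)
    have hin : ∀ w ∈ ball z δ, ‖w‖ < r / 2 := fun w hw => by simpa using hzb hw
    have key : ∀ ε > 0, ‖(S x - S z) - (P x - P z)‖ ≤ ε * ‖x - z‖ := by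
      intro ε hε
      have hK : IsCompact (closedBall z (3 * δ / 4)) := isCompact_closedBall _ _
      have hKs : closedBall z (3 * δ / 4) ⊆ ball z δ := closedBall_subset_ball (by linarith)
      have huc := hK.uniformContinuousOn_of_continuous (hΩc.mono hKs)
      rw [Metric.uniformContinuousOn_iff] at huc
      obtain ⟨τ, hτ, huc⟩ := huc ε hε
      refine le_of_tendsto ((hdiff x z (hin x (hsub hx)) (hin z (hsub hzz))).sub_const
        (P x - P z)).norm ?_
      filter_upwards [hout.eventually (gt_mem_nhds (lt_min hτ (show 0 < δ / 4 by positivity)))]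
        with n hn
      have hn1 := hn.trans_le (min_le_left _ _)
      have hn2 := hn.trans_le (min_le_right _ _)
      have h3 := (convex_ball z (δ / 2)).norm_image_sub_le_of_norm_hasFDerivWithin_le
        (f := fun w => f n w - P w) (f' := fun w => mollify (φ n) Ω w - Ω w) (C := ε)
        (fun w hw => ((hf n w (hzb (hsub hw))).sub (hP w (hsub hw))).hasFDerivWithinAt)
        (fun w hw => norm_mollify_sub_le (φ n) hΩ hε.le fun v hv => ?_) hzz hx
      · have h4 : f n x - f n z - (P x - P z) = f n x - P x - (f n z - P z) := by ring
        rw [h4]; exact h3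
      · rw [← dist_eq_norm]
        rw [mem_ball] at hw hv
        refine (huc v ?_ w ?_ (hv.trans hn1)).le
        · rw [mem_closedBall]
          linarith [dist_triangle v w z]
        · rw [mem_closedBall]; linarith
    have hlim : Tendsto (fun ε : ℝ => ε * ‖x - z‖) (𝓝[>] 0) (𝓝 0) := by
      have hc : Continuous fun ε : ℝ => ε * ‖x - z‖ := by fun_prop
      have := hc.tendsto 0
      simp only [zero_mul] at this
      exact this.mono_left nhdsWithin_le_nhds
    have h0 := ge_of_tendsto hlim (by
      filter_upwards [self_mem_nhdsWithin] with ε hε using key ε hε)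
    rw [norm_le_zero_iff] at h0
    linear_combination h0

end

noncomputable section
open InnerProductSpace (HarmonicAt HarmonicOnNhd)
open scoped ComplexConjugate

/-- The linear map `v ↦ a v + b v̄`. -/
def conjForm (a b : ℂ) : ℂ →L[ℝ] ℂ :=
  a • ContinuousLinearMap.id ℝ ℂ + b • (conjCLE : ℂ →L[ℝ] ℂ)

@[simp] lemma conjForm_apply (a b v : ℂ) : conjForm a b v = a * v + b * conj v := by
  simp [conjForm]

/-- The form `-g² 1_{u>0} dz + 1_{u=0} dz̄` on the disk of radius `R / 4`. -/
def solForm (R : ℝ) (u : ℂ → ℝ) (w : ℂ) : ℂ →L[ℝ] ℂ :=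
  conjForm ((posSet (ball 0 R) u ∩ ball 0 (R / 4)).indicator (fun z => -cgrad u z ^ 2) w)
    ((ball 0 (R / 4) \ posSet (ball 0 R) u).indicator (fun _ => 1) w)

namespace IsClassicalSolution

variable {R : ℝ} {u : ℂ → ℝ}

lemma solForm_of_mem {w : ℂ} (hw : w ∈ posSet (ball 0 R) u) (hwR : ‖w‖ < R / 4) :
    solForm R u w = conjForm (-cgrad u w ^ 2) 0 := by
  have h1 : w ∈ posSet (ball 0 R) u ∩ ball 0 (R / 4) := ⟨hw, by simpa using hwR⟩
  rw [solForm, indicator_of_mem h1, indicator_of_notMem fun h => h.2 hw]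

lemma solForm_of_zero {w : ℂ} (hw : u w = 0) (hwR : ‖w‖ < R / 4) :
    solForm R u w = conjForm 0 1 := by
  have hwn : w ∉ posSet (ball 0 R) u := fun h => h.2.ne' hw
  have h1 : w ∈ ball (0 : ℂ) (R / 4) \ posSet (ball 0 R) u := ⟨by simpa using hwR, hwn⟩
  rw [solForm, indicator_of_notMem fun h => hwn h.1, indicator_of_mem h1]

lemma norm_solForm_le (hR : 0 < R) (hu : IsClassicalSolution (ball 0 R) u) {w : ℂ} {L : ℝ}
    (hL : 1 ≤ L) (h : w ∈ posSet (ball 0 R) u → ‖w‖ < R / 4 → ‖cgrad u w‖ ^ 2 ≤ L) :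
    ‖solForm R u w‖ ≤ L := by
  refine ContinuousLinearMap.opNorm_le_bound _ (by linarith) fun v => ?_
  by_cases hwR : ‖w‖ < R / 4
  · by_cases hw : w ∈ posSet (ball 0 R) u
    · rw [solForm_of_mem hw hwR, conjForm_apply, zero_mul, add_zero, norm_mul, norm_neg, norm_pow]
      gcongr
      exact h hw hwR
    · have hw0 := hu.eq_zero_of_notMem_posSet (by simp; linarith) hw
      rw [solForm_of_zero hw0 hwR, conjForm_apply, zero_mul, zero_add, one_mul, RCLike.norm_conj]
      exact le_mul_of_one_le_left (norm_nonneg _) hL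
  · have hwb : w ∉ ball (0 : ℂ) (R / 4) := by simpa using hwR
    rw [solForm, indicator_of_notMem fun h => hwb h.2, indicator_of_notMem fun h => hwb h.1]
    simp
    positivity

lemma integrable_solForm_coeff (hR : 0 < R) (hu : IsClassicalSolution (ball 0 R) u)
    (h0 : (0 : ℂ) ∈ FB (ball 0 R) u) :
    Integrable ((posSet (ball 0 R) u ∩ ball 0 (R / 4)).indicator fun z => -cgrad u z ^ 2) ∧
    Integrable ((ball 0 (R / 4) \ posSet (ball 0 R) u).indicator fun _ => (1 : ℂ)) := by
  have hE : IsOpen (posSet (ball 0 R) u ∩ ball 0 (R / 4)) := hu.isOpen_posSet.inter isOpen_ball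
  have hfin : volume (ball (0 : ℂ) (R / 4)) < ⊤ := measure_ball_lt_top
  constructor
  · refine IntegrableOn.integrable_indicator ?_ hE.measurableSet
    refine IntegrableOn.of_bound ((measure_mono inter_subset_right).trans_lt hfin) ?_ 25 ?_
    · refine ContinuousOn.aestronglyMeasurable (fun z hz => ?_) hE.measurableSet
      exact ((hu.differentiableAt_cgrad hz.1).continuousAt.pow 2).neg.continuousWithinAt
    · refine (ae_restrict_iff' hE.measurableSet).2 (Eventually.of_forall fun z hz => ?_)
      have := hu.norm_cgrad_le_five hR h0 (by simpa using hz.2) (notMem_zeroSet hz.1)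
      rw [norm_neg, norm_pow]
      calc ‖cgrad u z‖ ^ 2 ≤ 5 ^ 2 := by gcongr
        _ = 25 := by norm_num
  · refine IntegrableOn.integrable_indicator ?_
      (isOpen_ball.measurableSet.diff hu.isOpen_posSet.measurableSet)
    exact integrableOn_const ((measure_mono sdiff_subset).trans_lt hfin).ne

lemma integrable_solForm (hR : 0 < R) (hu : IsClassicalSolution (ball 0 R) u)
    (h0 : (0 : ℂ) ∈ FB (ball 0 R) u) : Integrable (solForm R u) := by
  obtain ⟨h1, h2⟩ := hu.integrable_solForm_coeff hR h0
  have h3 := (h1.smul_const (ContinuousLinearMap.id ℝ ℂ)).add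
    (h2.smul_const (conjCLE : ℂ →L[ℝ] ℂ))
  exact h3

lemma solForm_closed (hR : 0 < R) (hu : IsClassicalSolution (ball 0 R) u)
    (h0 : (0 : ℂ) ∈ FB (ball 0 R) u) {η : ℂ → ℝ} (hη : ContDiff ℝ 1 η) (hη0 : ∀ z, 0 ≤ η z)
    (hηc : HasCompactSupport η) (hηs : tsupport η ⊆ ball 0 (R / 4)) (x y : ℂ) :
    ∫ w, fderiv ℝ η w x • solForm R u w y = ∫ w, fderiv ℝ η w y • solForm R u w x := by
  obtain ⟨ia, ib⟩ := hu.integrable_solForm_coeff hR h0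
  set a : ℂ → ℂ := (posSet (ball 0 R) u ∩ ball 0 (R / 4)).indicator fun z => -cgrad u z ^ 2 with ha
  set b : ℂ → ℂ := (ball 0 (R / 4) \ posSet (ball 0 R) u).indicator fun _ => (1 : ℂ) with hb
  have hγc := continuous_cgrad hη
  have hγs := hasCompactSupport_cgrad hηc
  obtain ⟨B, hB⟩ := hγs.exists_bound_of_continuous hγc
  have iγ : Integrable (cgrad η) := hγc.integrable_of_hasCompactSupport hγs
  have iω : Integrable fun w => conj (cgrad η w) * a w - cgrad η w * b w := by
    refine Integrable.sub (ia.bdd_mul (c := B) (continuous_conj.comp hγc).aestronglyMeasurable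
      (Eventually.of_forall fun w => ?_)) (ib.bdd_mul hγc.aestronglyMeasurable
      (Eventually.of_forall hB))
    rw [RCLike.norm_conj]
    exact hB w
  have hpt : ∀ w, conj (cgrad η w) * a w - cgrad η w * b w = -(posSet (ball 0 R) u).indicator
      (fun z => cgrad u z ^ 2 * conj (cgrad η z) - cgrad η z) w - cgrad η w := by
    intro w
    by_cases hw : w ∈ tsupport η
    · have hwb := hηs hw
      by_cases hwD : w ∈ posSet (ball 0 R) u
      · have hwE : w ∈ posSet (ball 0 R) u ∩ ball 0 (R / 4) := ⟨hwD, hwb⟩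
        have h1 : a w = -cgrad u w ^ 2 := indicator_of_mem hwE _
        have h2 : b w = 0 := indicator_of_notMem (fun h => h.2 hwD) _
        rw [h1, h2, indicator_of_mem hwD]
        ring
      · have h1 : a w = 0 := indicator_of_notMem (fun h => hwD h.1) _
        have hwE : w ∈ ball (0 : ℂ) (R / 4) \ posSet (ball 0 R) u := ⟨hwb, hwD⟩
        have h2 : b w = 1 := indicator_of_mem hwE _
        rw [h1, h2, indicator_of_notMem hwD]
        ring
    · simp [cgrad_eq_zero_of_notMem_tsupport hw, indicator]
  have hγ0 : ∫ w, cgrad η w = 0 := by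
    have h1 := integral_dbar_eq_zero (F := fun z => (η z : ℂ)) (ofRealCLM.contDiff.comp hη)
      (by rw [HasCompactSupport, tsupport_ofReal]; exact hηc)
    rw [dbar_ofReal_eq hη, integral_conj] at h1
    simpa using h1
  have hω0 : ∫ w, (conj (cgrad η w) * a w - cgrad η w * b w) = 0 := by
    have iD : Integrable fun w => (posSet (ball 0 R) u).indicator
        (fun z => cgrad u z ^ 2 * conj (cgrad η z) - cgrad η z) w := by
      refine ((iω.add iγ).neg).congr (Eventually.of_forall fun w => ?_)
      simp [hpt w]
    simp only [hpt]
    rw [integral_sub (f := fun w => -(posSet (ball 0 R) u).indicator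
      (fun z => cgrad u z ^ 2 * conj (cgrad η z) - cgrad η z) w) iD.neg iγ, integral_neg, hu.integral_weak hR h0 hη hη0 hηc hηs, hγ0]
    simp
  have iF : ∀ x y, Integrable fun w => fderiv ℝ η w x • solForm R u w y := by
    intro x y
    have hc : Continuous fun w => fderiv ℝ η w x :=
      (hη.continuous_fderiv (by norm_num)).clm_apply continuous_const
    obtain ⟨C, hC⟩ := (hηc.fderiv_apply ℝ x).exists_bound_of_continuous hc
    exact ((hu.integrable_solForm hR h0).apply_continuousLinearMap y).bdd_smul C
      hc.aestronglyMeasurable (Eventually.of_forall hC)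
  rw [← sub_eq_zero, ← integral_sub (iF x y) (iF y x)]
  have hpt2 : ∀ w, fderiv ℝ η w x • solForm R u w y - fderiv ℝ η w y • solForm R u w x =
      (((x.re * y.im - x.im * y.re : ℝ) : ℂ) * I) *
        (conj (cgrad η w) * a w - cgrad η w * b w) := by
    intro w
    rw [fderiv_eq_re_cgrad_mul, fderiv_eq_re_cgrad_mul]
    change _ • conjForm (a w) (b w) y - _ • conjForm (a w) (b w) x = _
    rw [conjForm_apply, conjForm_apply]
    apply Complex.ext
    · simp
      ring
    · simp
      ring
  simp only [hpt2]
  rw [integral_const_mul, hω0, mul_zero]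

/-- The primitive of `-g² dz` on the positive phase, extended by `z̄ + const` over the zero phase. -/
theorem exists_primitive_solForm (hR : 0 < R) (hu : IsClassicalSolution (ball 0 R) u)
    (h0 : (0 : ℂ) ∈ FB (ball 0 R) u) :
    ∃ S : ℂ → ℂ, S 0 = 0 ∧
      (∀ ρ ≤ R / 8, ∀ L, 1 ≤ L → (∀ z, ‖z‖ < ρ → z ∉ zeroSet R u → ‖cgrad u z‖ ^ 2 ≤ L) →
        ∀ x y, ‖x‖ < ρ → ‖y‖ < ρ → ‖S x - S y‖ ≤ L * ‖x - y‖) ∧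
      (∀ z, ‖z‖ < R / 8 → z ∈ posSet (ball 0 R) u → HasDerivAt S (-(cgrad u z) ^ 2) z) ∧
      (∀ z δ, 0 < δ → ball z δ ⊆ ball 0 (R / 8) → (∀ w ∈ ball z δ, u w = 0) →
        ∀ x ∈ ball z (δ / 2), S x - conj x = S z - conj z) := by
  obtain ⟨S, hS0, hSL, hSP⟩ := exists_primitive (hu.integrable_solForm hR h0) (r := R / 4) (M := 25)
    (by positivity) (fun w => hu.norm_solForm_le hR (by norm_num) fun hw hwR => by
      have := hu.norm_cgrad_le_five hR h0 hwR (notMem_zeroSet hw)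
      calc ‖cgrad u w‖ ^ 2 ≤ 5 ^ 2 := by gcongr
        _ = 25 := by norm_num)
    (fun η h1 h2 h3 h4 => hu.solForm_closed hR h0 h1 h2 h3 h4)
  have hr : R / 4 / 2 = R / 8 := by ring
  rw [hr] at hSL hSP
  refine ⟨S, hS0, fun ρ hρ L hL hg => hSL ρ hρ L fun w hw => hu.norm_solForm_le hR hL
    fun hwD _ => hg w hw (notMem_zeroSet hwD), fun z hz hzD => ?_, fun z δ hδ hzb hzero => ?_⟩
  · have hev : ∀ᶠ w in 𝓝 z, w ∈ posSet (ball 0 R) u ∧ w ∈ ball (0 : ℂ) (R / 8) :=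
      (hu.isOpen_posSet.mem_nhds hzD |> fun h => Filter.Eventually.and h
        (isOpen_ball.mem_nhds (by simpa using hz)))
    obtain ⟨δ, hδ, hball⟩ := Metric.eventually_nhds_iff_ball.1 hev
    have hd : DifferentiableOn ℂ (fun w => -cgrad u w ^ 2) (ball z δ) := fun w hw =>
      ((hu.differentiableAt_cgrad (hball w hw).1).pow 2).neg.differentiableWithinAt
    obtain ⟨P, hP⟩ := hd.isExactOn_ball
    have hform : ∀ w ∈ ball z δ, solForm R u w = conjForm (-cgrad u w ^ 2) 0 := fun w hw =>
      solForm_of_mem (hball w hw).1 (by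
        have := (hball w hw).2
        rw [mem_ball_zero_iff] at this
        linarith)
    have key := hSP z δ hδ (fun w hw => (hball w hw).2) (by
      refine ContinuousOn.congr (f := fun w => (-cgrad u w ^ 2) • ContinuousLinearMap.id ℝ ℂ +
        (0 : ℂ) • (conjCLE : ℂ →L[ℝ] ℂ)) ?_ fun w hw => hform w hw
      exact (hd.continuousOn.smul continuousOn_const).add continuousOn_const) P (fun w hw => by
      have h1 : HasFDerivAt P ((ContinuousLinearMap.toSpanSingleton ℂ
        (-cgrad u w ^ 2)).restrictScalars ℝ) w := (hP w hw).hasFDerivAt.restrictScalars ℝ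
      have h2 : solForm R u w = (ContinuousLinearMap.toSpanSingleton ℂ
        (-cgrad u w ^ 2)).restrictScalars ℝ := by
        rw [hform w hw]
        ext
        simp [mul_comm]
      rw [h2]; exact h1)
    have h3 := (hP z (mem_ball_self hδ)).add_const (S z - P z)
    refine h3.congr_of_eventuallyEq ?_
    filter_upwards [isOpen_ball.mem_nhds (mem_ball_self (half_pos hδ))] with w hw
    have := key w hw
    linear_combination this
  · have hform : ∀ w ∈ ball z δ, solForm R u w = conjForm 0 1 := fun w hw =>
      solForm_of_zero (hzero w hw) (by
        have := hzb hw
        rw [mem_ball_zero_iff] at this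
        linarith)
    refine hSP z δ hδ hzb (continuousOn_const.congr hform) (fun w => conj w) fun w hw => ?_
    have h1 : HasFDerivAt (fun w : ℂ => conj w) (conjCLE : ℂ →L[ℝ] ℂ) w := conjCLE.hasFDerivAt
    have h2 : solForm R u w = (conjCLE : ℂ →L[ℝ] ℂ) := by
      rw [hform w hw]
      ext
      simp
    rw [h2]; exact h1

/-- A continuous function locally constant in the interior of the zero phase is locally constant on
the whole zero phase. -/
lemma eventually_eq_of_eq_zero (hu : IsClassicalSolution (ball 0 R) u) {c : ℂ → ℂ} {r : ℝ}
    (hrR : r ≤ R) (hc : ∀ z, ‖z‖ < r → ContinuousAt c z)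
    (hloc : ∀ z, ‖z‖ < r → (∀ᶠ w in 𝓝 z, u w = 0) → ∀ᶠ w in 𝓝 z, c w = c z) {z : ℂ}
    (hz : ‖z‖ < r) (hz0 : u z = 0) : ∀ᶠ w in 𝓝 z, u w = 0 → c w = c z := by
  have hzb : z ∈ ball (0 : ℂ) R := by simp; linarith
  by_cases hcl : z ∈ closure (posSet (ball 0 R) u)
  · obtain ⟨V, hVo, hzV, hVR, φ, hφ, hφ0, -, hφu, -⟩ := hu.fb_manifold z (hu.mem_FB hzb hz0 hcl)
    have hiff : ∀ w ∈ V, (u w = 0 ↔ φ w ≤ 0) := by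
      intro w hw
      have := Set.ext_iff.1 hφu w
      simpa [hw] using this
    have hφd : ∀ w ∈ V, ContDiffAt ℝ (⊤ : ℕ∞) φ w := fun w hw => hφ.contDiffAt (hVo.mem_nhds hw)
    obtain ⟨e, he1, he⟩ : ∃ e : ℂ, ‖e‖ = 1 ∧ 0 < fderiv ℝ φ z e := by
      obtain ⟨v, hv⟩ : ∃ v, fderiv ℝ φ z v ≠ 0 := by
        by_contra! h
        exact hφ0 z hzV (ContinuousLinearMap.ext h)
      have hv0 : v ≠ 0 := fun h => hv (by rw [h, map_zero])
      have hvn : 0 < ‖v‖ := norm_pos_iff.2 hv0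
      rcases lt_or_gt_of_ne hv with h | h
      · refine ⟨-(‖v‖⁻¹ • v), by rw [norm_neg, norm_smul, norm_inv, norm_norm, inv_mul_cancel₀ hvn.ne'],
          ?_⟩
        rw [map_neg, map_smul, smul_eq_mul]
        have := mul_pos (inv_pos.2 hvn) (neg_pos.2 h)
        linarith
      · refine ⟨‖v‖⁻¹ • v, by rw [norm_smul, norm_inv, norm_norm, inv_mul_cancel₀ hvn.ne'], ?_⟩
        rw [map_smul, smul_eq_mul]
        exact mul_pos (inv_pos.2 hvn) h
    have hfc : ContinuousAt (fun w => fderiv ℝ φ w e) z :=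
      (((hφd z hzV).fderiv_right (m := 0) (by norm_num)).continuousAt).clm_apply continuousAt_const
    have hev : ∀ᶠ w in 𝓝 z, w ∈ V ∧ ‖w‖ < r ∧ 0 < fderiv ℝ φ w e := by
      refine Filter.Eventually.and (hVo.mem_nhds hzV) (Filter.Eventually.and ?_ ?_)
      · exact (continuous_norm.tendsto z).eventually (gt_mem_nhds hz)
      · exact hfc.eventually (lt_mem_nhds he)
    obtain ⟨σ, hσ, hball⟩ := Metric.eventually_nhds_iff_ball.1 hev
    set τ₀ := σ / 2 with hτ₀
    have hτ0 : 0 < τ₀ := by positivity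
    have hmem : ∀ w, ‖w - z‖ < τ₀ → ∀ τ : ℝ, 0 ≤ τ → τ ≤ τ₀ → w - τ * e ∈ ball z σ := by
      intro w hw τ h1 h2
      rw [mem_ball, dist_eq_norm]
      calc ‖w - τ * e - z‖ = ‖(w - z) - τ * e‖ := by ring_nf
        _ ≤ ‖w - z‖ + ‖(τ : ℂ) * e‖ := norm_sub_le _ _
        _ = ‖w - z‖ + τ := by rw [norm_mul, he1, mul_one, norm_real, Real.norm_of_nonneg h1]
        _ < σ := by linarith
    have hdec : ∀ w, ‖w - z‖ < τ₀ → φ w ≤ 0 → ∀ τ : ℝ, 0 < τ → τ ≤ τ₀ → φ (w - τ * e) < 0 := by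
      intro w hw hφw τ h1 h2
      have hder : ∀ t ∈ Icc 0 τ, HasDerivAt (fun t : ℝ => φ (w - t * e))
          (fderiv ℝ φ (w - t * e) (-e)) t := by
        intro t ht
        have hV := (hball _ (hmem w hw t ht.1 (ht.2.trans h2))).1
        have h3 : HasDerivAt (fun t : ℝ => w - t * e) (-e) t := by
          simpa using ((hasDerivAt_id t).ofReal_comp.mul_const e).const_sub w
        exact ((hφd _ hV).differentiableAt (by simp)).hasFDerivAt.comp_hasDerivAt t h3
      obtain ⟨t, ht, hslope⟩ := exists_hasDerivAt_eq_slope (fun t : ℝ => φ (w - t * e)) _ h1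
        (fun t ht => (hder t ht).continuousAt.continuousWithinAt)
        (fun t ht => hder t ⟨ht.1.le, ht.2.le⟩)
      have hpos := (hball _ (hmem w hw t ht.1.le (ht.2.le.trans h2))).2.2
      rw [map_neg, sub_zero] at hslope
      have h4 : φ (w - τ * e) - φ w = -fderiv ℝ φ (w - t * e) e * τ := by
        rw [hslope]
        simp
        field_simp
      have h5 := mul_pos hpos h1
      linarith
    have h_int : ∀ w ∈ ball z σ, φ w < 0 → ∀ᶠ v in 𝓝 w, u v = 0 := by
      intro w hw hφw
      have hV := (hball w hw).1
      filter_upwards [hVo.mem_nhds hV, (hφd w hV).continuousAt.eventually (gt_mem_nhds hφw)]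
        with v hv1 hv2
      exact (hiff v hv1).2 hv2.le
    have hshift : ∀ w, ‖w - z‖ < τ₀ → u w = 0 → c w = c (w - τ₀ * e) := by
      intro w hw hw0
      have hwσ : w ∈ ball z σ := by simpa using hmem w hw 0 le_rfl hτ0.le
      have hφw := (hiff w (hball w hwσ).1).1 hw0
      set A : Set ℂ := (fun τ : ℝ => w - τ * e) '' Ioc 0 τ₀ with hA
      have hcont : Continuous fun τ : ℝ => w - τ * e := by fun_prop
      have hAp : IsPreconnected A := isPreconnected_Ioc.image _ hcont.continuousOn
      have hconst : ∀ τ ∈ Ioc 0 τ₀, c (w - τ * e) = c (w - τ₀ * e) := by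
        intro τ hτ
        refine hAp.eq_of_eventually_eq ?_ ⟨τ, hτ, rfl⟩ ⟨τ₀, ⟨hτ0, le_rfl⟩, rfl⟩
        rintro _ ⟨t, ht, rfl⟩
        have hm := hmem w hw t ht.1.le ht.2
        exact hloc _ (hball _ hm).2.1 (h_int _ hm (hdec w hw hφw t ht.1 ht.2))
      have h1 : Tendsto (fun τ : ℝ => c (w - τ * e)) (𝓝[>] 0) (𝓝 (c w)) := by
        have h2 := hcont.tendsto 0
        simp only [ofReal_zero, zero_mul, sub_zero] at h2
        exact (hc w (hball w hwσ).2.1).tendsto.comp (h2.mono_left nhdsWithin_le_nhds)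
      refine tendsto_nhds_unique h1 (tendsto_const_nhds.congr' ?_)
      filter_upwards [Ioc_mem_nhdsGT hτ0] with τ hτ using (hconst τ hτ).symm
    have hzz : ‖z - z‖ < τ₀ := by simpa using hτ0
    have hm := hmem z hzz τ₀ hτ0.le le_rfl
    have h1 := hloc _ (hball _ hm).2.1
      (h_int _ hm (hdec z hzz ((hiff z hzV).1 hz0) τ₀ hτ0 le_rfl))
    have h2 : Tendsto (fun w : ℂ => w - τ₀ * e) (𝓝 z) (𝓝 (z - τ₀ * e)) :=
      (continuous_id.sub continuous_const).tendsto z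
    filter_upwards [h2.eventually h1, ball_mem_nhds z hτ0] with w hw1 hw2 hw0
    rw [mem_ball, dist_eq_norm] at hw2
    rw [hshift w hw2 hw0, hshift z hzz hz0, hw1]
  · have h1 : ∀ᶠ w in 𝓝 z, u w = 0 := by
      filter_upwards [isOpen_ball.mem_nhds hzb, isClosed_closure.isOpen_compl.mem_nhds hcl]
        with w hw1 hw2
      exact hu.eq_zero_of_notMem_posSet hw1 fun h => hw2 (subset_closure h)
    exact (hloc z hz h1).mono fun w hw _ => hw

end IsClassicalSolution
end

noncomputable section
open InnerProductSpace (HarmonicAt HarmonicOnNhd)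
open scoped ComplexConjugate

theorem IsClassicalSolution.exists_full : ∃ c > 0, ∀ (R : ℝ) (u : ℂ → ℝ), 0 < R →
    IsClassicalSolution (ball 0 R) u → (0 : ℂ) ∈ FB (ball 0 R) u →
    (∀ z ∈ FB (ball 0 R) u, ¬ IsCompact (connectedComponentIn (FB (ball 0 R) u) z)) →
    ∃ S : ℂ → ℂ, S 0 = 0 ∧ ∀ ρ ≤ R / 8, ∀ L, 1 ≤ L →
      (∀ z, ‖z‖ < ρ → z ∉ zeroSet R u → ‖cgrad u z‖ ^ 2 ≤ L) → Full ρ c L u S (zeroSet R u) := by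
  obtain ⟨c, hc, hnd⟩ := IsClassicalSolution.exists_nondegenerate
  refine ⟨c, hc, fun R u hR hu h0 hnc => ?_⟩
  obtain ⟨S, hS0, hSL, hSD, hSZ⟩ := hu.exists_primitive_solForm hR h0
  have hcl := hu.isClosed_zeroSet hR
  have hS5 : ∀ x y, ‖x‖ < R / 8 → ‖y‖ < R / 8 → ‖S x - S y‖ ≤ 25 * ‖x - y‖ :=
    hSL (R / 8) le_rfl 25 (by norm_num) fun z hz hzK => by
      have := hu.norm_cgrad_le_five hR h0 (by linarith) hzK
      calc ‖cgrad u z‖ ^ 2 ≤ 5 ^ 2 := by gcongr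
        _ = 25 := by norm_num
  have hloc : ∀ z, ‖z‖ < R / 8 → (∀ᶠ w in 𝓝 z, u w = 0) →
      ∀ᶠ w in 𝓝 z, S w - conj w = S z - conj z := by
    intro z hz hev
    obtain ⟨δ, hδ, hball⟩ := Metric.eventually_nhds_iff_ball.1
      (hev.and (isOpen_ball.mem_nhds (show z ∈ ball (0 : ℂ) (R / 8) by simpa using hz)))
    filter_upwards [ball_mem_nhds z (half_pos hδ)] with w hw
    exact hSZ z δ hδ (fun w hw => (hball w hw).2) (fun w hw => (hball w hw).1) w hw
  have hcst : ∀ z, ‖z‖ < R / 8 → u z = 0 →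
      ∀ᶠ w in 𝓝 z, u w = 0 → S w - conj w = S z - conj z := by
    intro z hz hz0
    refine hu.eventually_eq_of_eq_zero (c := fun w => S w - conj w) (r := R / 8) (by linarith)
      (fun z hz => ?_) hloc hz hz0
    refine ContinuousAt.sub ?_ continuous_conj.continuousAt
    have hlip : LipschitzOnWith 25 S (ball 0 (R / 8)) :=
      LipschitzOnWith.of_dist_le_mul fun x hx y hy => by
        rw [dist_eq_norm, dist_eq_norm]
        exact hS5 x y (by simpa using hx) (by simpa using hy)
    exact hlip.continuousOn.continuousAt (isOpen_ball.mem_nhds (by simpa using hz))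
  refine ⟨S, hS0, fun ρ hρ L hL hg => ?_⟩
  refine { (hu.base hR h0).mono (show ρ ≤ R / 4 by linarith) with
    slip := hSL ρ hρ L hL hg
    sder := fun z hz hzK => hSD z (by linarith)
      (hu.mem_posSet_of_notMem_zeroSet hR (by linarith) hzK)
    reach := ?_
    nd := ?_
    loc := ?_ }
  · intro x hx r hr hxr
    obtain ⟨y, hy0, hyx, hyS⟩ := hu.exists_reach hnc (c := fun w => S w - conj w)
      (show R / 8 ≤ R by linarith) hcst hx.2 hr (by linarith)
    refine ⟨y, ⟨?_, hy0⟩, hyx, hyS⟩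
    rw [mem_closedBall_zero_iff]
    linarith [norm_le_of_norm_sub_le hyx.le]
  · intro x hx r hr hxr
    have hxK := hcl.frontier_subset hx
    refine hnd R u hu hnc x r hr (by linarith) hxK.2 ?_
    rw [mem_closure_iff_nhds]
    intro t ht
    have h1 : x ∈ closure (zeroSet R u)ᶜ := by
      rw [frontier_eq_closure_inter_closure] at hx
      exact hx.2
    have h2 : ball (0 : ℂ) (R / 2) ∈ 𝓝 x := isOpen_ball.mem_nhds (by
      rw [mem_ball_zero_iff]; linarith)
    obtain ⟨w, hw, hwK⟩ := mem_closure_iff_nhds.1 h1 (t ∩ ball 0 (R / 2)) (inter_mem ht h2)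
    refine ⟨w, hw.1, hu.mem_posSet_of_notMem_zeroSet hR ?_ hwK⟩
    have := hw.2
    rw [mem_ball_zero_iff] at this
    exact this.le
  · intro z hz hzρ
    refine hloc z (by linarith) ?_
    filter_upwards [mem_interior_iff_mem_nhds.1 hz] with w hw using hw.2

end

/-- the three possible outcomes for a blow-down `V` of a global limit `U`
of classical solutions. -/
theorem blowdown_outcomes (R : ℕ → ℝ) (hRpos : ∀ k, 0 < R k)
    (hR : Filter.Tendsto R atTop atTop)
    (u : ℕ → ℂ → ℝ)
    (hsol : ∀ k, IsClassicalSolution (Metric.ball 0 (R k)) (u k))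
    (h0 : ∀ k, (0 : ℂ) ∈ FB (Metric.ball 0 (R k)) (u k))
    (hnc : ∀ k, ∀ z ∈ FB (Metric.ball 0 (R k)) (u k),
      ¬ IsCompact (connectedComponentIn (FB (Metric.ball 0 (R k)) (u k)) z))
    (U : ℂ → ℝ)
    (hU : TendstoLocallyUniformly u U atTop)
    (R' : ℕ → ℝ) (hR'pos : ∀ j, 0 < R' j) (hR' : Filter.Tendsto R' atTop atTop)
    (V : ℂ → ℝ)
    (hV : TendstoLocallyUniformly
      (fun j z => (R' j)⁻¹ * U (((R' j : ℝ) : ℂ) * z)) V atTop) :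
    ∃ T₁ T₂ : ℂ → ℂ, Isometry T₁ ∧ Isometry T₂ ∧
      ((V ∘ T₁ = Pfun ∧ U ∘ T₂ = Pfun) ∨
       (∃ s : ℝ, 0 < s ∧ s ≤ 1 ∧ V ∘ T₁ = Wfun s ∧
         ((∃ a : ℝ, 0 < a ∧ U ∘ T₂ = TPfun a) ∨ U ∘ T₂ = Wfun 1)) ∨
       (∃ s : ℝ, 0 < s ∧ s ≤ 1 ∧ V ∘ T₁ = Wfun s ∧
         ∃ a : ℝ, 0 < a ∧ U ∘ T₂ = hairpin a)) := by
  obtain ⟨c, hc, hfull⟩ := IsClassicalSolution.exists_full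
  choose S hS0 hS using fun k => hfull (R k) (u k) (hRpos k) (hsol k) (h0 k) (hnc k)
  set l : Ultrafilter ℕ := hyperfilter ℕ with hl
  have hlt : (l : Filter ℕ) ≤ atTop := by
    rw [hl, ← Nat.cofinite_eq_atTop]; exact hyperfilter_le_cofinite
  have hbig : ∀ ρ, ∀ᶠ k in (l : Filter ℕ), ρ ≤ R k / 8 := by
    intro ρ
    filter_upwards [hlt (hR.eventually_ge_atTop (8 * ρ))] with k hk
    linarith
  set K : ℕ → Set ℂ := fun k => zeroSet (R k) (u k) with hK
  have h0K : ∀ k, (0 : ℂ) ∈ K k := fun k =>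
    ⟨by simpa using (half_pos (hRpos k)).le, (hsol k).eq_zero_of_mem_FB (h0 k)⟩
  have hB : ∀ ρ, ∀ᶠ k in (l : Filter ℕ), Base ρ (u k) (K k) := by
    intro ρ
    filter_upwards [hbig ρ] with k hk
    exact ((hsol k).base (hRpos k) (h0 k)).mono (by linarith [hRpos k])
  have hF : ∀ ρ, ∀ ε > 0, ∀ᶠ k in (l : Filter ℕ), Full ρ c (1 + ε) (u k) (S k) (K k) := by
    intro ρ ε hε
    set ε' := min 1 (ε / 3) with hε'
    have hε'0 : 0 < ε' := lt_min one_pos (by positivity)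
    have h1 : ε' ≤ 1 := min_le_left _ _
    have h2 : ε' ≤ ε / 3 := min_le_right _ _
    filter_upwards [hbig ρ, Base.eventually_norm_cgrad_le hB h0K ρ hε'0] with k hk hg
    refine hS k ρ hk (1 + ε) (by linarith) fun z hz hzK => ?_
    have h3 := hg z hz hzK
    calc ‖cgrad (u k) z‖ ^ 2 ≤ (1 + ε') ^ 2 := by gcongr
      _ ≤ 1 + ε := by nlinarith
  have hUt : ∀ x, Tendsto (fun k => u k x) l (𝓝 (U x)) := fun x =>
    ((tendstoLocallyUniformlyOn_univ.2 hU).tendsto_at (mem_univ x)).mono_left hlt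
  have hSb : ∀ x, ∀ᶠ k in (l : Filter ℕ), ‖S k x‖ ≤ 2 * ‖x‖ := by
    intro x
    filter_upwards [hF (‖x‖ + 1) 1 one_pos] with k hk
    have := hk.slip x 0 (by linarith) (by rw [norm_zero]; positivity)
    rw [hS0, sub_zero, sub_zero] at this
    linarith
  choose S' _ hS' using fun x => exists_tendsto_of_bounded (hSb x)
  have hG : Glob c U S' (limK l K) := Full.lim hc hF hUt hS'
  have hne : (0 : ℂ) ∈ limK l K :=
    mem_limK_of_tendsto (x := fun _ => 0) (Eventually.of_forall h0K) tendsto_const_nhds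
  have hnu : limK l K ≠ univ := by
    intro huniv
    have h1 : ∀ᶠ k in (l : Filter ℕ), ∃ y, ‖y‖ ≤ 1 ∧ c ≤ u k y := by
      filter_upwards [hF 2 1 one_pos] with k hk
      have hfr : (0 : ℂ) ∈ frontier (K k) := by
        refine ⟨subset_closure (h0K k), fun h_int => ?_⟩
        obtain ⟨w, hw, hwD⟩ := mem_closure_iff_nhds.1 (h0 k).2.1 _
          (mem_interior_iff_mem_nhds.1 h_int)
        exact hwD.2.ne' hw.2
      obtain ⟨y, hy1, hy2⟩ := hk.nd 0 hfr 1 one_pos (by norm_num)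
      exact ⟨y, by simpa using hy1, by simpa using hy2⟩
    obtain ⟨y, hy⟩ := h1.choice
    obtain ⟨a, -, ha⟩ := exists_tendsto_of_bounded (hy.mono fun k hk => hk.1)
    have h2 : c ≤ U a := ge_of_tendsto (Base.tendsto_diag hB hUt ha) (hy.mono fun k hk => hk.2)
    have h3 : U a = 0 := (hG (‖a‖ + 1)).zero a (huniv ▸ mem_univ a) (by linarith)
    linarith
  exact hG.outcomes hc ⟨0, hne⟩ hnu hR' fun z =>
    (tendstoLocallyUniformlyOn_univ.2 hV).tendsto_at (mem_univ z)
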